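/- Suppose Conditions D, M_r with r = 6 + 2a₀, and S hold (a₀ as in Condition D). Then, as n → ∞, the MSE-optimal block length ℓ_n^{opt} and the minimizer ℓ_n⁰ = C₀ n^{1/3} of the asymptotic MSE approximation f_n satisfy |ℓ_n^{opt} − ℓ_n⁰|/ℓ_n⁰ = O(n^{-1/3}). -/

import Mathlib

open MeasureTheory ProbabilityTheory Filter
open scoped Classical

noncomputable section

namespace BlockLength

variable {Ω : Type*} [MeasurableSpace Ω] {d : ℕ}

/-- σ-algebra generated by the coordinates `X i`, `i ∈ S`. -/
def sigmaOf (X : ℤ → Ω → Fin d → ℝ) (S : Set ℤ) : MeasurableSpace Ω :=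
  ⨆ i ∈ S, MeasurableSpace.comap (X i) inferInstance

/-- Strong mixing (α-mixing) coefficient of the process `X`. -/
def alphaMix (μ : Measure Ω) (X : ℤ → Ω → Fin d → ℝ) (k : ℕ) : ℝ :=
  sSup { x | ∃ A B : Set Ω,
    MeasurableSet[sigmaOf X {i | i ≤ 0}] A ∧
    MeasurableSet[sigmaOf X {i | (k : ℤ) ≤ i}] B ∧
    x = |(μ (A ∩ B)).toReal - (μ A).toReal * (μ B).toReal| }

/-- Strict stationarity of the process `X`. -/
def IsStationary (μ : Measure Ω) (X : ℤ → Ω → Fin d → ℝ) : Prop :=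
  ∀ k : ℤ, Measure.map (fun ω => fun i : ℤ => X (i + k) ω) μ =
    Measure.map (fun ω => fun i : ℤ => X i ω) μ

/-- Condition (D): `H` is three times continuously differentiable with
third derivatives of polynomial growth of order `a₀`. -/
def CondD (H : (Fin d → ℝ) → ℝ) (a₀ : ℕ) : Prop :=
  ContDiff ℝ 3 H ∧ ∃ C : ℝ, 0 < C ∧ ∀ x : Fin d → ℝ,
    ‖iteratedFDeriv ℝ 3 H x‖ ≤ C * (1 + ‖x‖ ^ a₀)

/-- Condition (M_r): moment and strong-mixing conditions. -/
def CondM (μ : Measure Ω) (X : ℤ → Ω → Fin d → ℝ) (r : ℕ) : Prop :=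
  ∃ δ : ℝ, 0 < δ ∧
    Integrable (fun ω => ‖X 1 ω‖ ^ ((2 * r : ℝ) + δ)) μ ∧
    Summable (fun k : ℕ => (k : ℝ) ^ (2 * r - 1) *
      alphaMix μ X k ^ (δ / ((2 * r : ℝ) + δ)))

/-- The mean vector `μ = E X₁`. -/
def meanVec (μ : Measure Ω) (X : ℤ → Ω → Fin d → ℝ) : Fin d → ℝ :=
  fun j => ∫ ω, X 1 ω j ∂μ

/-- Centered linearization `Y_i = ∇'(X_i − μ)`, where `∇ = ∂H(μ)/∂x`. -/
def Ylin (μ : Measure Ω) (X : ℤ → Ω → Fin d → ℝ) (H : (Fin d → ℝ) → ℝ)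
    (i : ℤ) (ω : Ω) : ℝ :=
  fderiv ℝ H (meanVec μ X) (fun j => X i ω j - meanVec μ X j)

/-- Autocovariance `r(k) = Cov(∇'X₀, ∇'X_k)`. -/
def rcov (μ : Measure Ω) (X : ℤ → Ω → Fin d → ℝ) (H : (Fin d → ℝ) → ℝ)
    (k : ℤ) : ℝ :=
  ∫ ω, Ylin μ X H 0 ω * Ylin μ X H k ω ∂μ -
    (∫ ω, Ylin μ X H 0 ω ∂μ) * ∫ ω, Ylin μ X H k ω ∂μ

/-- `B₀ = Σ_k |k| r(k)`. -/
def B0 (μ : Measure Ω) (X : ℤ → Ω → Fin d → ℝ) (H : (Fin d → ℝ) → ℝ) : ℝ :=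
  ∑' k : ℤ, |(k : ℝ)| * rcov μ X H k

/-- `σ_∞² = Σ_k r(k)`. -/
def sigInfSq (μ : Measure Ω) (X : ℤ → Ω → Fin d → ℝ) (H : (Fin d → ℝ) → ℝ) : ℝ :=
  ∑' k : ℤ, rcov μ X H k

/-- `V₀ = (4/3) σ_∞⁴`. -/
def V0 (μ : Measure Ω) (X : ℤ → Ω → Fin d → ℝ) (H : (Fin d → ℝ) → ℝ) : ℝ :=
  (4 / 3) * sigInfSq μ X H ^ 2

/-- `C₀ = (2B₀²/V₀)^{1/3}`. -/
def C0 (μ : Measure Ω) (X : ℤ → Ω → Fin d → ℝ) (H : (Fin d → ℝ) → ℝ) : ℝ :=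
  (2 * B0 μ X H ^ 2 / V0 μ X H) ^ ((1 : ℝ) / 3)

/-- Condition (S): `B₀ ≠ 0` and `V₀ > 0`. -/
def CondS (μ : Measure Ω) (X : ℤ → Ω → Fin d → ℝ) (H : (Fin d → ℝ) → ℝ) : Prop :=
  B0 μ X H ≠ 0 ∧ 0 < V0 μ X H

/-- Sample mean `X̄_n` of `X₁,…,X_n`. -/
def sampleMean (X : ℤ → Ω → Fin d → ℝ) (n : ℕ) (ω : Ω) : Fin d → ℝ :=
  fun j => (∑ i ∈ Finset.range n, X ((i : ℤ) + 1) ω j) / n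

/-- `σ_∞² = lim_n n · Var(H(X̄_n))`, identifying the target variance with `Σ_k r(k)`. -/
def SigLimit (μ : Measure Ω) (X : ℤ → Ω → Fin d → ℝ) (H : (Fin d → ℝ) → ℝ) : Prop :=
  Tendsto (fun n : ℕ => (n : ℝ) * variance (fun ω => H (sampleMean X n ω)) μ)
    atTop (nhds (sigInfSq μ X H))

/-- MBB variance estimator obtained by resampling `k` blocks of length `ℓ`
(i.i.d. uniformly over the block-start offsets in `S`) from the data
`X_s, X_{s+1}, …`; the bootstrap variance is written out as the exact average
over all `|S|^k` equally likely block-index tuples. -/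
def mbbVarOn (X : ℤ → Ω → Fin d → ℝ) (H : (Fin d → ℝ) → ℝ)
    (s : ℤ) (ℓ k : ℕ) (S : Finset ℕ) (ω : Ω) : ℝ :=
  let bm : ℕ → Fin d → ℝ := fun i j =>
    (∑ t ∈ Finset.range ℓ, X (s + (i : ℤ) + (t : ℤ)) ω j) / ℓ
  let θ : (Fin k → ↥S) → ℝ := fun f => H (fun j => (∑ a, bm (f a : ℕ) j) / k)
  (ℓ * k : ℝ) *
    ((∑ f : Fin k → ↥S, θ f ^ 2) / (S.card : ℝ) ^ k -
      ((∑ f : Fin k → ↥S, θ f) / (S.card : ℝ) ^ k) ^ 2)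

/-- MBB variance estimator with block length `ℓ` based on the sample
`X_s, …, X_{s+m-1}` (all `m − ℓ + 1` overlapping blocks, `⌊m/ℓ⌋` resampled blocks). -/
def mbbVar (X : ℤ → Ω → Fin d → ℝ) (H : (Fin d → ℝ) → ℝ)
    (s : ℤ) (m ℓ : ℕ) (ω : Ω) : ℝ :=
  mbbVarOn X H s ℓ (m / ℓ) (Finset.range (m - ℓ + 1)) ω

/-- `σ̂_n²(ℓ)`: MBB variance estimator from `X₁,…,X_n`. -/
def sigmaHat (X : ℤ → Ω → Fin d → ℝ) (H : (Fin d → ℝ) → ℝ)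
    (n ℓ : ℕ) (ω : Ω) : ℝ :=
  mbbVar X H 1 n ℓ ω

/-- `MSE_n(ℓ) = E(σ̂_n²(ℓ) − σ_∞²)²`. -/
def MSEfun (μ : Measure Ω) (X : ℤ → Ω → Fin d → ℝ) (H : (Fin d → ℝ) → ℝ)
    (n ℓ : ℕ) : ℝ :=
  ∫ ω, (sigmaHat X H n ℓ ω - sigInfSq μ X H) ^ 2 ∂μ

/-- `f_n(ℓ) = B₀²/ℓ² + V₀ ℓ/n`. -/
def fapprox (μ : Measure Ω) (X : ℤ → Ω → Fin d → ℝ) (H : (Fin d → ℝ) → ℝ)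
    (n ℓ : ℕ) : ℝ :=
  B0 μ X H ^ 2 / (ℓ : ℝ) ^ 2 + V0 μ X H * ℓ / n

/-- The block set `J_n = {ℓ ∈ ℕ : K⁻¹ n^{1/3} ≤ ℓ ≤ K n^{1/3}}` (with `ℓ ≤ n`). -/
def Jset (K : ℝ) (n : ℕ) : Finset ℕ :=
  (Finset.Icc 1 n).filter fun ℓ =>
    K⁻¹ * (n : ℝ) ^ ((1 : ℝ) / 3) ≤ (ℓ : ℝ) ∧ (ℓ : ℝ) ≤ K * (n : ℝ) ^ ((1 : ℝ) / 3)

/-- `b` minimizes `g` over the finite block set `S`. -/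
def IsArgminOn (g : ℕ → ℝ) (S : Finset ℕ) (b : ℕ) : Prop :=
  b ∈ S ∧ ∀ c ∈ S, g b ≤ g c

/-- `Z_n = O_p(a_n)`: `Z_n/a_n` is bounded in probability. -/
def IsBigOp (μ : Measure Ω) (Z : ℕ → Ω → ℝ) (a : ℕ → ℝ) : Prop :=
  ∀ ε : ℝ, 0 < ε → ∃ C : ℝ, 0 < C ∧
    ∀ᶠ n in atTop, (μ {ω | C * |a n| < |Z n ω|}).toReal ≤ ε

/-- Convergence in probability to a constant `c`. -/
def TendstoInProb (μ : Measure Ω) (Z : ℕ → Ω → ℝ) (c : ℝ) : Prop :=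
  ∀ ε : ℝ, 0 < ε →
    Tendsto (fun n => (μ {ω | ε < |Z n ω - c|}).toReal) atTop (nhds 0)

/-- Oracle subsampling MSE `MŜE_m^∞(b)`. -/
def MSEhatInf (μ : Measure Ω) (X : ℤ → Ω → Fin d → ℝ) (H : (Fin d → ℝ) → ℝ)
    (n m b : ℕ) (ω : Ω) : ℝ :=
  (∑ i ∈ Finset.range (n - m + 1),
    (mbbVar X H ((i : ℤ) + 1) m b ω - sigInfSq μ X H) ^ 2) / ((n - m + 1 : ℕ) : ℝ)

/-- HHJ subsampling MSE `MŜE_m(b)` with pilot block length `ℓpil`. -/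
def MSEhatPilot (X : ℤ → Ω → Fin d → ℝ) (H : (Fin d → ℝ) → ℝ)
    (n m b ℓpil : ℕ) (ω : Ω) : ℝ :=
  (∑ i ∈ Finset.range (n - m + 1),
    (mbbVar X H ((i : ℤ) + 1) m b ω - sigmaHat X H n ℓpil ω) ^ 2) / ((n - m + 1 : ℕ) : ℝ)

/-- `i`-th block-deleted JAB point value (`i` 0-based), deleting `m` consecutive blocks
from the `n − ℓ + 1` MBB blocks of length `ℓ`. -/
def jabPoint (X : ℤ → Ω → Fin d → ℝ) (H : (Fin d → ℝ) → ℝ)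
    (n ℓ m i : ℕ) (ω : Ω) : ℝ :=
  mbbVarOn X H 1 ℓ (n / ℓ) (Finset.range (n - ℓ + 1) \ Finset.Ico i (i + m)) ω

/-- JAB variance estimator `VÂR` of the MBB variance estimator `σ̂_n²(ℓ)`. -/
def jabVar (X : ℤ → Ω → Fin d → ℝ) (H : (Fin d → ℝ) → ℝ)
    (n ℓ m : ℕ) (ω : Ω) : ℝ :=
  (↑m / ((((n - ℓ + 1) - m : ℕ) : ℝ) * (((n - ℓ + 1) - m + 1 : ℕ) : ℝ))) *
    ∑ i ∈ Finset.range ((n - ℓ + 1) - m + 1),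
      (((((n - ℓ + 1 : ℕ) : ℝ) * sigmaHat X H n ℓ ω -
          (((n - ℓ + 1) - m : ℕ) : ℝ) * jabPoint X H n ℓ m i ω) / m) -
        sigmaHat X H n ℓ ω) ^ 2

/-- `V̂₀ = (n/ℓ₁) VÂR`. -/
def V0hat (X : ℤ → Ω → Fin d → ℝ) (H : (Fin d → ℝ) → ℝ)
    (n ℓ₁ m : ℕ) (ω : Ω) : ℝ :=
  ((n : ℝ) / (ℓ₁ : ℝ)) * jabVar X H n ℓ₁ m ω

/-- `B̂₀ = ℓ₂ · BIÂS = 2 ℓ₂ (σ̂_n²(ℓ₂) − σ̂_n²(2ℓ₂))`. -/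
def B0hat (X : ℤ → Ω → Fin d → ℝ) (H : (Fin d → ℝ) → ℝ)
    (n ℓ₂ : ℕ) (ω : Ω) : ℝ :=
  (ℓ₂ : ℝ) * (2 * (sigmaHat X H n ℓ₂ ω - sigmaHat X H n (2 * ℓ₂) ω))

/-- The NPPI block length estimator `ℓ̂_{n,NPPI}^{opt} = (2B̂₀²/V̂₀)^{1/3} n^{1/3}`. -/
def nppiEst (X : ℤ → Ω → Fin d → ℝ) (H : (Fin d → ℝ) → ℝ)
    (n ℓ₁ ℓ₂ m : ℕ) (ω : Ω) : ℝ :=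
  (2 * B0hat X H n ℓ₂ ω ^ 2 / V0hat X H n ℓ₁ m ω) ^ ((1 : ℝ) / 3) *
    (n : ℝ) ^ ((1 : ℝ) / 3)

/-- The flat-top lag window `λ`. -/
def flatTop (t : ℝ) : ℝ :=
  if |t| ≤ 1 / 2 then 1 else if |t| ≤ 1 then 2 * (1 - |t|) else 0

/-- `Ŷ_i = ∇̂'(X_i − X̄_n)` with `∇̂ = ∂H(X̄_n)/∂x`. -/
def YhatPW (X : ℤ → Ω → Fin d → ℝ) (H : (Fin d → ℝ) → ℝ)
    (n : ℕ) (i : ℤ) (ω : Ω) : ℝ :=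
  fderiv ℝ H (sampleMean X n ω) (fun j => X i ω j - sampleMean X n ω j)

/-- `∇̂' r̂(k) ∇̂ = n⁻¹ Σ_{i=1}^{n-k} Ŷ_i Ŷ_{i+k}` for `k ≥ 0`. -/
def rhatQuad (X : ℤ → Ω → Fin d → ℝ) (H : (Fin d → ℝ) → ℝ)
    (n k : ℕ) (ω : Ω) : ℝ :=
  (∑ i ∈ Finset.range (n - k),
    YhatPW X H n ((i : ℤ) + 1) ω * YhatPW X H n ((i : ℤ) + 1 + (k : ℤ)) ω) / n

/-- `B̂ = Σ_{k=-2M}^{2M} λ(k/(2M)) |k| ∇̂'r̂(k)∇̂`. -/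
def BhatPW (X : ℤ → Ω → Fin d → ℝ) (H : (Fin d → ℝ) → ℝ)
    (n Mb : ℕ) (ω : Ω) : ℝ :=
  ∑ k ∈ Finset.Icc (-(2 * Mb : ℤ)) (2 * Mb : ℤ),
    flatTop ((k : ℝ) / (2 * Mb)) * |(k : ℝ)| * rhatQuad X H n k.natAbs ω

/-- `Ŝ = Σ_{k=-2M}^{2M} λ(k/(2M)) ∇̂'r̂(k)∇̂`. -/
def ShatPW (X : ℤ → Ω → Fin d → ℝ) (H : (Fin d → ℝ) → ℝ)
    (n Mb : ℕ) (ω : Ω) : ℝ :=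
  ∑ k ∈ Finset.Icc (-(2 * Mb : ℤ)) (2 * Mb : ℤ),
    flatTop ((k : ℝ) / (2 * Mb)) * rhatQuad X H n k.natAbs ω

/-- The Politis–White block length estimator `ℓ̂_{n,PW}^{opt}`. -/
def pwEst (X : ℤ → Ω → Fin d → ℝ) (H : (Fin d → ℝ) → ℝ)
    (n Mb : ℕ) (ω : Ω) : ℝ :=
  (2 * BhatPW X H n Mb ω ^ 2 / ((4 / 3) * ShatPW X H n Mb ω ^ 4)) ^ ((1 : ℝ) / 3) *
    (n : ℝ) ^ ((1 : ℝ) / 3)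

/-- `Δ_m^∞(b)`: difference of the centered oracle subsampling MSE at `b_m^{opt}` and `b`. -/
def DeltaInf (μ : Measure Ω) (X : ℤ → Ω → Fin d → ℝ) (H : (Fin d → ℝ) → ℝ)
    (bopt n m b : ℕ) (ω : Ω) : ℝ :=
  (MSEhatInf μ X H n m bopt ω - ∫ ω', MSEhatInf μ X H n m bopt ω' ∂μ) -
    (MSEhatInf μ X H n m b ω - ∫ ω', MSEhatInf μ X H n m b ω' ∂μ)

/-- `Ω_{3,m}(b)`. -/
def Omega3 (μ : Measure Ω) (X : ℤ → Ω → Fin d → ℝ) (H : (Fin d → ℝ) → ℝ)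
    (bopt ℓpil n m b : ℕ) (ω : Ω) : ℝ :=
  2 * (sigmaHat X H n ℓpil ω - sigInfSq μ X H) / ((n - m + 1 : ℕ) : ℝ) *
    ∑ i ∈ Finset.range (n - m + 1),
      ((mbbVar X H ((i : ℤ) + 1) m b ω - mbbVar X H ((i : ℤ) + 1) m bopt ω) -
        ∫ ω', (mbbVar X H ((i : ℤ) + 1) m b ω' - mbbVar X H ((i : ℤ) + 1) m bopt ω') ∂μ)

/-- `Ω_{1,m}(b) = Ω_{3,m}(b) − E Ω_{3,m}(b)`. -/
def Omega1 (μ : Measure Ω) (X : ℤ → Ω → Fin d → ℝ) (H : (Fin d → ℝ) → ℝ)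
    (bopt ℓpil n m b : ℕ) (ω : Ω) : ℝ :=
  Omega3 μ X H bopt ℓpil n m b ω - ∫ ω', Omega3 μ X H bopt ℓpil n m b ω' ∂μ

/-- `Ω_{2,m}(b) = 2[σ̂_n²(ℓ̃) − Eσ̂_n²(ℓ̃)] · E[σ̂²_{1,m}(b_m^{opt}) − σ̂²_{1,m}(b)]`. -/
def Omega2 (μ : Measure Ω) (X : ℤ → Ω → Fin d → ℝ) (H : (Fin d → ℝ) → ℝ)
    (bopt ℓpil n m b : ℕ) (ω : Ω) : ℝ :=
  2 * (sigmaHat X H n ℓpil ω - ∫ ω', sigmaHat X H n ℓpil ω' ∂μ) *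
    ∫ ω', (mbbVar X H 1 m bopt ω' - mbbVar X H 1 m b ω') ∂μ

/-- `J_m^{opt}(C) = {b ∈ J_m : |b_m^{opt} − b| ≤ C m^{1/3}}`. -/
def JmOpt (K : ℝ) (bopt m : ℕ) (C : ℝ) : Finset ℕ :=
  (Jset K m).filter fun b => |(bopt : ℝ) - (b : ℝ)| ≤ C * (m : ℝ) ^ ((1 : ℝ) / 3)

/-- `Ȳ_k = k⁻¹ Σ_{i=1}^k Y_i`. -/
def Ybar (μ : Measure Ω) (X : ℤ → Ω → Fin d → ℝ) (H : (Fin d → ℝ) → ℝ)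
    (k : ℕ) (ω : Ω) : ℝ :=
  (∑ i ∈ Finset.range k, Ylin μ X H ((i : ℤ) + 1) ω) / k


section Covariance

variable {α : Type*} {m m' m₀ : MeasurableSpace α} {μ : Measure α}

lemma abs_cov_le_of_forall_measurableSet [IsProbabilityMeasure μ] (hm : m ≤ m₀) {ξ η : α → ℝ} {T c : ℝ}
    (hT : 0 ≤ T) (hξ : Measurable[m] ξ) (hξT : ∀ ω, |ξ ω| ≤ T) (hη : Integrable η μ)
    (hc : ∀ A, MeasurableSet[m] A → |∫ ω in A, η ω ∂μ - μ.real A * ∫ ω, η ω ∂μ| ≤ c) :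
    |∫ ω, ξ ω * η ω ∂μ - (∫ ω, ξ ω ∂μ) * ∫ ω, η ω ∂μ| ≤ 2 * T * c := by
  set e := ∫ ω, η ω ∂μ with he
  have hξ0 : Measurable ξ := hξ.mono hm le_rfl
  have hξi : Integrable ξ μ := Integrable.of_bound hξ0.aestronglyMeasurable T
    (ae_of_all _ fun ω => by simpa using hξT ω)
  have hηe : Integrable (fun ω => η ω - e) μ := hη.sub (integrable_const _)
  have hb : ∀ g : α → ℝ, Integrable g μ → Integrable (fun ω => ξ ω * g ω) μ := fun g hg =>
    hg.bdd_mul hξ0.aestronglyMeasurable (ae_of_all _ fun ω => by simpa using hξT ω)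
  set h := μ[fun ω => η ω - e | m] with hh
  have hhi : Integrable h μ := integrable_condExp
  have hhm : Measurable[m] h := stronglyMeasurable_condExp.measurable
  have h1 : ∫ ω, ξ ω * η ω ∂μ - (∫ ω, ξ ω ∂μ) * e = ∫ ω, ξ ω * h ω ∂μ := by
    have e1 : ∫ ω, ξ ω * (η ω - e) ∂μ = ∫ ω, ξ ω * η ω ∂μ - (∫ ω, ξ ω ∂μ) * e := by
      simp_rw [mul_sub]
      rw [integral_sub (hb _ hη) (hξi.mul_const _), integral_mul_const]
    rw [← e1]
    have e2 : μ[fun ω => ξ ω * (η ω - e) | m] =ᵐ[μ] fun ω => ξ ω * h ω :=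
      condExp_mul_of_stronglyMeasurable_left (f := ξ) (g := fun ω => η ω - e)
        hξ.stronglyMeasurable (hb _ hηe) hηe
    rw [← integral_condExp hm, integral_congr_ae e2]
  rw [h1]
  have hA : MeasurableSet[m] {ω | 0 ≤ h ω} := hhm measurableSet_Ici
  have hA0 := hm _ hA
  have h3 : ∫ ω in {ω | 0 ≤ h ω}, h ω ∂μ = ∫ ω in {ω | 0 ≤ h ω}, η ω ∂μ - μ.real {ω | 0 ≤ h ω} * e := by
    have t := setIntegral_condExp hm hηe hA
    rw [← hh] at t
    rw [t, integral_sub hη.integrableOn (integrable_const _).integrableOn]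
    simp
  have h4 : ∫ ω, h ω ∂μ = 0 := by
    rw [hh, integral_condExp hm, integral_sub hη (integrable_const _)]
    simp [he]
  have h5 : ∫ ω, |h ω| ∂μ = 2 * ∫ ω in {ω | 0 ≤ h ω}, h ω ∂μ := by
    have e1 := integral_add_compl hA0 hhi.abs
    have e2 := integral_add_compl hA0 hhi
    have e3 : ∫ ω in {ω | 0 ≤ h ω}, |h ω| ∂μ = ∫ ω in {ω | 0 ≤ h ω}, h ω ∂μ :=
      setIntegral_congr_fun hA0 fun ω hω => abs_of_nonneg hω
    have e4 : ∫ ω in {ω | 0 ≤ h ω}ᶜ, |h ω| ∂μ = - ∫ ω in {ω | 0 ≤ h ω}ᶜ, h ω ∂μ := by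
      rw [← integral_neg]
      exact setIntegral_congr_fun hA0.compl fun ω hω => abs_of_neg (not_le.1 hω)
    linarith
  calc |∫ ω, ξ ω * h ω ∂μ| ≤ ∫ ω, |ξ ω * h ω| ∂μ := abs_integral_le_integral_abs
    _ ≤ ∫ ω, T * |h ω| ∂μ := by
        refine integral_mono (hb _ hhi).abs (hhi.abs.const_mul _) fun ω => ?_
        simp only [abs_mul]
        exact mul_le_mul_of_nonneg_right (hξT ω) (abs_nonneg _)
    _ = 2 * T * ∫ ω in {ω | 0 ≤ h ω}, h ω ∂μ := by rw [integral_const_mul, h5]; ring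
    _ ≤ 2 * T * c := by
        refine mul_le_mul_of_nonneg_left ?_ (by positivity)
        rw [h3]; exact (le_abs_self _).trans (hc _ hA)

lemma abs_cov_le_of_bounded [IsProbabilityMeasure μ] (hm : m ≤ m₀) (hm' : m' ≤ m₀) {a : ℝ}
    (ha : ∀ A B, MeasurableSet[m] A → MeasurableSet[m'] B →
      |μ.real (A ∩ B) - μ.real A * μ.real B| ≤ a)
    {ξ η : α → ℝ} {T T' : ℝ} (hT : 0 ≤ T) (hT' : 0 ≤ T')
    (hξ : Measurable[m] ξ) (hη : Measurable[m'] η)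
    (hξT : ∀ ω, |ξ ω| ≤ T) (hηT : ∀ ω, |η ω| ≤ T') :
    |∫ ω, ξ ω * η ω ∂μ - (∫ ω, ξ ω ∂μ) * ∫ ω, η ω ∂μ| ≤ 4 * a * (T * T') := by
  have hη0 : Measurable η := hη.mono hm' le_rfl
  have hηi : Integrable η μ := Integrable.of_bound hη0.aestronglyMeasurable T'
    (ae_of_all _ fun ω => by simpa using hηT ω)
  have := abs_cov_le_of_forall_measurableSet hm hT hξ hξT hηi (c := 2 * T' * a) ?_
  · calc _ ≤ _ := this
      _ = _ := by ring
  intro A hA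
  have hA0 := hm _ hA
  have h2 := abs_cov_le_of_forall_measurableSet hm' hT' hη hηT
    (η := A.indicator fun _ => (1 : ℝ)) (c := a)
    ((integrable_const (μ := μ) (1 : ℝ)).indicator hA0) ?_
  · have e1 : ∫ ω, η ω * A.indicator (fun _ => (1 : ℝ)) ω ∂μ = ∫ ω in A, η ω ∂μ := by
      rw [← integral_indicator hA0]
      refine integral_congr_ae (ae_of_all _ fun ω => ?_)
      by_cases h : ω ∈ A <;> simp [h]
    have e2 : ∫ ω, A.indicator (fun _ => (1 : ℝ)) ω ∂μ = μ.real A := by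
      rw [integral_indicator hA0]; simp
    rw [e1, e2, mul_comm (∫ ω, η ω ∂μ)] at h2
    exact h2
  · intro B hB
    have hB0 := hm' _ hB
    have e2 : ∫ ω, A.indicator (fun _ => (1 : ℝ)) ω ∂μ = μ.real A := by
      rw [integral_indicator hA0]; simp
    have e3 : ∫ ω in B, A.indicator (fun _ => (1 : ℝ)) ω ∂μ = μ.real (A ∩ B) := by
      rw [setIntegral_indicator hA0]; simp [Set.inter_comm]
    rw [e2, e3, mul_comm]
    exact ha A B hA hB

lemma mul_le_rpow_add_rpow {p q u v : ℝ} (hp : 1 ≤ p) (hq : 1 ≤ q) (hpq : p⁻¹ + q⁻¹ ≤ 1)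
    (hu : 0 ≤ u) (hv : 0 ≤ v) (h : 1 ≤ u ∨ 1 ≤ v) : u * v ≤ u ^ p + v ^ q := by
  have hup : 0 ≤ u ^ p := Real.rpow_nonneg hu _
  have hvq : 0 ≤ v ^ q := Real.rpow_nonneg hv _
  rcases le_total v 1 with hv1 | hv1
  · rcases le_total u 1 with hu1 | hu1
    · rcases h with h | h
      · have : u = 1 := le_antisymm hu1 h
        subst this; simp only [Real.one_rpow]; nlinarith
      · have : v = 1 := le_antisymm hv1 h
        subst this; simp only [Real.one_rpow]; nlinarith
    · have := Real.self_le_rpow_of_one_le hu1 hp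
      nlinarith
  · rcases le_total u 1 with hu1 | hu1
    · have := Real.self_le_rpow_of_one_le hv1 hq
      nlinarith
    · have h1 : u = (u ^ p) ^ p⁻¹ := by
        rw [← Real.rpow_mul hu, mul_inv_cancel₀ (by linarith), Real.rpow_one]
      have h2 : v = (v ^ q) ^ q⁻¹ := by
        rw [← Real.rpow_mul hv, mul_inv_cancel₀ (by linarith), Real.rpow_one]
      set M := u ^ p + v ^ q with hM
      have hM1 : 1 ≤ M := by
        have := Real.one_le_rpow hu1 (by linarith : 0 ≤ p)
        linarith
      calc u * v = (u ^ p) ^ p⁻¹ * (v ^ q) ^ q⁻¹ := by rw [← h1, ← h2]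
        _ ≤ M ^ p⁻¹ * M ^ q⁻¹ := by
            gcongr
            · linarith
            · linarith
        _ = M ^ (p⁻¹ + q⁻¹) := (Real.rpow_add (by linarith) _ _).symm
        _ ≤ M ^ (1 : ℝ) := Real.rpow_le_rpow_of_exponent_le hM1 hpq
        _ = M := Real.rpow_one _

lemma abs_mul_le_rpow {p q x y : ℝ} (hp : 1 ≤ p) (hq : 1 ≤ q) (hpq : p⁻¹ + q⁻¹ ≤ 1) :
    |x * y| ≤ 1 + |x| ^ p + |y| ^ q := by
  have hx := Real.rpow_nonneg (abs_nonneg x) p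
  have hy := Real.rpow_nonneg (abs_nonneg y) q
  rw [abs_mul]
  by_cases h : 1 ≤ |x| ∨ 1 ≤ |y|
  · have := mul_le_rpow_add_rpow hp hq hpq (abs_nonneg x) (abs_nonneg y) h
    linarith
  · push Not at h
    nlinarith [abs_nonneg x, abs_nonneg y]

/-- Multiplying out the truncation levels `a ^ (-1/p)` and `a ^ (-1/q)`. -/
lemma abs_mul_le_of_level {p q x y a : ℝ} (ha : 0 < a) (hp : 1 ≤ p) (hq : 1 ≤ q)
    (hpq : p⁻¹ + q⁻¹ ≤ 1) (h : a ^ (-p⁻¹) ≤ |x| ∨ a ^ (-q⁻¹) ≤ |y|) :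
    |x * y| ≤ a ^ (1 - p⁻¹ - q⁻¹) * (|x| ^ p + |y| ^ q) := by
  have hT : 0 < a ^ (-p⁻¹) := Real.rpow_pos_of_pos ha _
  have hT' : 0 < a ^ (-q⁻¹) := Real.rpow_pos_of_pos ha _
  have key := mul_le_rpow_add_rpow hp hq hpq (u := |x| / a ^ (-p⁻¹)) (v := |y| / a ^ (-q⁻¹))
    (by positivity) (by positivity) (by
      rcases h with h | h
      · left; rwa [one_le_div hT]
      · right; rwa [one_le_div hT'])
  have e1 : (|x| / a ^ (-p⁻¹)) ^ p = a * |x| ^ p := by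
    rw [Real.div_rpow (abs_nonneg _) hT.le, ← Real.rpow_mul ha.le]
    have : -p⁻¹ * p = -1 := by field_simp
    rw [this, Real.rpow_neg_one, div_inv_eq_mul, mul_comm]
  have e2 : (|y| / a ^ (-q⁻¹)) ^ q = a * |y| ^ q := by
    rw [Real.div_rpow (abs_nonneg _) hT'.le, ← Real.rpow_mul ha.le]
    have : -q⁻¹ * q = -1 := by field_simp
    rw [this, Real.rpow_neg_one, div_inv_eq_mul, mul_comm]
  rw [e1, e2, div_mul_div_comm, div_le_iff₀ (by positivity), ← abs_mul] at key
  calc |x * y| ≤ _ := key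
    _ = (a * (a ^ (-p⁻¹) * a ^ (-q⁻¹))) * (|x| ^ p + |y| ^ q) := by ring
    _ = _ := by
      congr 1
      rw [← Real.rpow_add ha]
      nth_rewrite 1 [← Real.rpow_one a]
      rw [← Real.rpow_add ha]
      congr 1; ring

lemma integrable_of_integrable_rpow [IsFiniteMeasure μ] {ξ : α → ℝ} {p : ℝ} (hp : 1 ≤ p)
    (hξ : AEStronglyMeasurable ξ μ) (h : Integrable (fun ω => |ξ ω| ^ p) μ) : Integrable ξ μ := by
  refine ((integrable_const (1 : ℝ)).add h).mono' hξ (ae_of_all _ fun ω => ?_)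
  simp only [Real.norm_eq_abs, Pi.add_apply]
  have := Real.rpow_nonneg (abs_nonneg (ξ ω)) p
  rcases le_total (|ξ ω|) 1 with h1 | h1
  · linarith
  · linarith [Real.self_le_rpow_of_one_le h1 hp]

lemma integrable_mul_of_integrable_rpow [IsFiniteMeasure μ] {ξ η : α → ℝ} {p q : ℝ} (hp : 1 ≤ p)
    (hq : 1 ≤ q) (hpq : p⁻¹ + q⁻¹ ≤ 1)
    (hξ : AEStronglyMeasurable ξ μ) (hη : AEStronglyMeasurable η μ)
    (h : Integrable (fun ω => |ξ ω| ^ p) μ) (h' : Integrable (fun ω => |η ω| ^ q) μ) :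
    Integrable (fun ω => ξ ω * η ω) μ := by
  refine (((integrable_const (1 : ℝ)).add h).add h').mono' (hξ.mul hη) (ae_of_all _ fun ω => ?_)
  simpa using abs_mul_le_rpow hp hq hpq (x := ξ ω) (y := η ω)

/-- Davydov's covariance inequality. -/
theorem davydov [IsProbabilityMeasure μ] (hm : m ≤ m₀) (hm' : m' ≤ m₀) {a : ℝ} (ha0 : 0 < a)
    (ha : ∀ A B, MeasurableSet[m] A → MeasurableSet[m'] B →
      |μ.real (A ∩ B) - μ.real A * μ.real B| ≤ a)
    {ξ η : α → ℝ} {p q M M' : ℝ} (hp : 1 ≤ p) (hq : 1 ≤ q) (hpq : p⁻¹ + q⁻¹ ≤ 1)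
    (hξ : Measurable[m] ξ) (hη : Measurable[m'] η)
    (hξp : Integrable (fun ω => |ξ ω| ^ p) μ) (hηq : Integrable (fun ω => |η ω| ^ q) μ)
    (hM : ∫ ω, |ξ ω| ^ p ∂μ ≤ M) (hM' : ∫ ω, |η ω| ^ q ∂μ ≤ M') :
    |∫ ω, ξ ω * η ω ∂μ - (∫ ω, ξ ω ∂μ) * ∫ ω, η ω ∂μ| ≤
      (4 + 2 * (M + M')) * a ^ (1 - p⁻¹ - q⁻¹) := by
  set T := a ^ (-p⁻¹) with hTdef
  set T' := a ^ (-q⁻¹) with hTdef'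
  have hT : 0 < T := Real.rpow_pos_of_pos ha0 _
  have hT' : 0 < T' := Real.rpow_pos_of_pos ha0 _
  have hTT : a * (T * T') = a ^ (1 - p⁻¹ - q⁻¹) := by
    rw [hTdef, hTdef', ← Real.rpow_add ha0]
    nth_rewrite 1 [← Real.rpow_one a]
    rw [← Real.rpow_add ha0]
    congr 1; ring
  have hξ0 : Measurable ξ := hξ.mono hm le_rfl
  have hη0 : Measurable η := hη.mono hm' le_rfl
  set tr : ℝ → ℝ → ℝ := fun t x => if |x| ≤ t then x else 0 with htr
  have htrm : ∀ t, Measurable (tr t) := fun t =>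
    Measurable.ite (measurableSet_le measurable_id.abs measurable_const) measurable_id
      measurable_const
  have htrb : ∀ t x, 0 ≤ t → |tr t x| ≤ t := by
    intro t x ht; simp only [htr]; split_ifs with h
    · exact h
    · simpa using ht
  have hb := abs_cov_le_of_bounded hm hm' ha hT.le hT'.le (ξ := fun ω => tr T (ξ ω))
    (η := fun ω => tr T' (η ω)) ((htrm T).comp hξ) ((htrm T').comp hη)
    (fun ω => htrb _ _ hT.le) (fun ω => htrb _ _ hT'.le)
  have hdiff : ∀ x y, |x * y - tr T x * tr T' y| ≤
      a ^ (1 - p⁻¹ - q⁻¹) * (|x| ^ p + |y| ^ q) := by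
    intro x y
    have h0 : 0 ≤ a ^ (1 - p⁻¹ - q⁻¹) * (|x| ^ p + |y| ^ q) := by positivity
    simp only [htr]
    split_ifs with h1 h2 h2
    · simpa using h0
    · simpa using abs_mul_le_of_level ha0 hp hq hpq (Or.inr (not_le.1 h2).le)
    · simpa using abs_mul_le_of_level ha0 hp hq hpq (Or.inl (not_le.1 h1).le)
    · simpa using abs_mul_le_of_level ha0 hp hq hpq (Or.inl (not_le.1 h1).le)
  have hξi := integrable_of_integrable_rpow hp hξ0.aestronglyMeasurable hξp
  have hηi := integrable_of_integrable_rpow hq hη0.aestronglyMeasurable hηq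
  have hξη := integrable_mul_of_integrable_rpow hp hq hpq hξ0.aestronglyMeasurable
    hη0.aestronglyMeasurable hξp hηq
  have hmT : Measurable fun ω => tr T (ξ ω) := (htrm T).comp hξ0
  have hmT' : Measurable fun ω => tr T' (η ω) := (htrm T').comp hη0
  have hTi : Integrable (fun ω => tr T (ξ ω)) μ := Integrable.of_bound hmT.aestronglyMeasurable T
    (ae_of_all _ fun ω => by simpa using htrb _ _ hT.le)
  have hTi' : Integrable (fun ω => tr T' (η ω)) μ :=
    Integrable.of_bound hmT'.aestronglyMeasurable T'
      (ae_of_all _ fun ω => by simpa using htrb _ _ hT'.le)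
  have hTTi : Integrable (fun ω => tr T (ξ ω) * tr T' (η ω)) μ :=
    hTi'.bdd_mul hmT.aestronglyMeasurable (ae_of_all _ fun ω => by simpa using htrb _ _ hT.le)
  have hd1 : |∫ ω, ξ ω * η ω ∂μ - ∫ ω, tr T (ξ ω) * tr T' (η ω) ∂μ| ≤
      a ^ (1 - p⁻¹ - q⁻¹) * (M + M') := by
    rw [← integral_sub hξη hTTi]
    calc _ ≤ ∫ ω, |ξ ω * η ω - tr T (ξ ω) * tr T' (η ω)| ∂μ := abs_integral_le_integral_abs
      _ ≤ ∫ ω, a ^ (1 - p⁻¹ - q⁻¹) * (|ξ ω| ^ p + |η ω| ^ q) ∂μ :=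
          integral_mono (hξη.sub hTTi).abs ((hξp.add hηq).const_mul _) fun ω => hdiff _ _
      _ ≤ _ := by
          rw [integral_const_mul, integral_add hξp hηq]
          gcongr
  have hd2 : |(∫ ω, ξ ω ∂μ) * ∫ ω, η ω ∂μ - (∫ ω, tr T (ξ ω) ∂μ) * ∫ ω, tr T' (η ω) ∂μ| ≤
      a ^ (1 - p⁻¹ - q⁻¹) * (M + M') := by
    have i1 : Integrable (fun z : α × α => |ξ z.1| ^ p) (μ.prod μ) := hξp.comp_fst μ
    have i2 : Integrable (fun z : α × α => |η z.2| ^ q) (μ.prod μ) := hηq.comp_snd μ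
    have i3 := hξi.mul_prod hηi
    have i4 := hTi.mul_prod hTi'
    rw [← integral_prod_mul, ← integral_prod_mul, ← integral_sub i3 i4]
    calc _ ≤ ∫ z : α × α, |ξ z.1 * η z.2 - tr T (ξ z.1) * tr T' (η z.2)| ∂(μ.prod μ) :=
          abs_integral_le_integral_abs
      _ ≤ ∫ z : α × α, a ^ (1 - p⁻¹ - q⁻¹) * (|ξ z.1| ^ p + |η z.2| ^ q) ∂(μ.prod μ) :=
          integral_mono (i3.sub i4).abs ((i1.add i2).const_mul _) fun ω => hdiff _ _
      _ ≤ _ := by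
          rw [integral_const_mul, integral_add i1 i2,
            integral_fun_fst (μ := μ) (ν := μ) (fun ω => |ξ ω| ^ p),
            integral_fun_snd (μ := μ) (ν := μ) (fun ω => |η ω| ^ q)]
          simp only [probReal_univ, one_smul]
          gcongr
  have hb' : 4 * a * (T * T') = 4 * a ^ (1 - p⁻¹ - q⁻¹) := by rw [← hTT]; ring
  rw [hb'] at hb
  rw [abs_le] at *
  constructor <;> nlinarith [hb.1, hb.2, hd1.1, hd1.2, hd2.1, hd2.2]

end Covariance


section Mixing

variable {μ : Measure Ω} {X : ℤ → Ω → Fin d → ℝ}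

/-- Quantitative strong mixing for `X`: events separated by a time gap `k` are dependent
at most by `C * (1 + k) ^ (-β)`. -/
def Mix (μ : Measure Ω) (X : ℤ → Ω → Fin d → ℝ) (C β : ℝ) : Prop :=
  ∀ (S T : Set ℤ) (s : ℤ) (k : ℕ), (∀ i ∈ S, i ≤ s) → (∀ j ∈ T, s + k ≤ j) → ∀ A B : Set Ω,
    MeasurableSet[sigmaOf X S] A → MeasurableSet[sigmaOf X T] B →
    |μ.real (A ∩ B) - μ.real A * μ.real B| ≤ C * (1 + (k : ℝ)) ^ (-β)

lemma sigmaOf_mono {S T : Set ℤ} (h : S ⊆ T) : sigmaOf X S ≤ sigmaOf X T :=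
  biSup_mono h

lemma sigmaOf_le (hX : ∀ i, Measurable (X i)) (S : Set ℤ) :
    sigmaOf X S ≤ (inferInstance : MeasurableSpace Ω) :=
  iSup₂_le fun i _ => (hX i).comap_le

lemma comap_le_sigmaOf {S : Set ℤ} {i : ℤ} (h : i ∈ S) :
    MeasurableSpace.comap (X i) inferInstance ≤ sigmaOf X S :=
  le_iSup₂ (f := fun i (_ : i ∈ S) => MeasurableSpace.comap (X i) inferInstance) i h

lemma sigmaOf_eq_comap (S : Set ℤ) :
    sigmaOf X S = MeasurableSpace.comap (fun ω i => X i ω)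
      (⨆ i ∈ S, MeasurableSpace.comap (fun x : ℤ → Fin d → ℝ => x i) inferInstance) := by
  simp only [sigmaOf, MeasurableSpace.comap_iSup, MeasurableSpace.comap_comp]
  rfl

lemma abs_measureReal_inter_sub_le_one [IsProbabilityMeasure μ] (A B : Set Ω) :
    |μ.real (A ∩ B) - μ.real A * μ.real B| ≤ 1 := by
  have h1 : μ.real (A ∩ B) ≤ 1 := measureReal_le_one
  have h2 : μ.real A ≤ 1 := measureReal_le_one
  have h3 : μ.real B ≤ 1 := measureReal_le_one
  have h4 : 0 ≤ μ.real (A ∩ B) := measureReal_nonneg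
  have h5 : 0 ≤ μ.real A := measureReal_nonneg
  have h6 : 0 ≤ μ.real B := measureReal_nonneg
  rw [abs_le]; constructor <;> nlinarith

lemma abs_measure_sub_le_alphaMix [IsProbabilityMeasure μ] {k : ℕ} {A B : Set Ω}
    (hA : MeasurableSet[sigmaOf X {i | i ≤ 0}] A)
    (hB : MeasurableSet[sigmaOf X {i | (k : ℤ) ≤ i}] B) :
    |μ.real (A ∩ B) - μ.real A * μ.real B| ≤ alphaMix μ X k := by
  refine le_csSup ⟨1, ?_⟩ ⟨A, B, hA, hB, rfl⟩
  rintro x ⟨A, B, -, -, rfl⟩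
  exact abs_measureReal_inter_sub_le_one A B

lemma alphaMix_nonneg [IsProbabilityMeasure μ] (k : ℕ) : 0 ≤ alphaMix μ X k :=
  (abs_nonneg _).trans (abs_measure_sub_le_alphaMix (A := ∅) (B := ∅)
    (MeasurableSpace.measurableSet_empty _) (MeasurableSpace.measurableSet_empty _))

lemma alphaMix_le_one [IsProbabilityMeasure μ] (k : ℕ) : alphaMix μ X k ≤ 1 := by
  refine csSup_le ⟨_, ∅, ∅, MeasurableSpace.measurableSet_empty _, MeasurableSpace.measurableSet_empty _, rfl⟩ ?_
  rintro x ⟨A, B, -, -, rfl⟩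
  exact abs_measureReal_inter_sub_le_one A B

lemma IsStationary.abs_measure_sub_le_alphaMix [IsProbabilityMeasure μ] (hs : IsStationary μ X)
    (hX : ∀ i, Measurable (X i)) {S T : Set ℤ} {s : ℤ} {k : ℕ}
    (hS : ∀ i ∈ S, i ≤ s) (hT : ∀ j ∈ T, s + k ≤ j) {A B : Set Ω}
    (hA : MeasurableSet[sigmaOf X S] A) (hB : MeasurableSet[sigmaOf X T] B) :
    |μ.real (A ∩ B) - μ.real A * μ.real B| ≤ alphaMix μ X k := by
  replace hA := sigmaOf_mono (T := {i | i ≤ s}) hS A hA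
  replace hB := sigmaOf_mono (T := {i | s + k ≤ i}) hT B hB
  rw [sigmaOf_eq_comap] at hA hB
  obtain ⟨A', hA', rfl⟩ := hA
  obtain ⟨B', hB', rfl⟩ := hB
  have hle : ∀ U : Set ℤ, (⨆ i ∈ U, MeasurableSpace.comap
      (fun x : ℤ → Fin d → ℝ => x i) inferInstance) ≤ MeasurableSpace.pi := fun U =>
    iSup₂_le fun i _ => (measurable_pi_apply i).comap_le
  have hP : Measurable fun ω => fun i : ℤ => X i ω := measurable_pi_lambda _ fun i => hX i
  have hP' : Measurable fun ω => fun i : ℤ => X (i + -s) ω := measurable_pi_lambda _ fun i => hX _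
  have key : ∀ D, MeasurableSet D → μ.real ((fun ω => fun i : ℤ => X i ω) ⁻¹' D) =
      μ.real ((fun ω => fun i : ℤ => X (i + -s) ω) ⁻¹' D) := by
    intro D hD
    rw [← map_measureReal_apply hP hD, ← map_measureReal_apply hP' hD, hs]
  have hshift : ∀ (U V : Set ℤ), (∀ i ∈ U, i + -s ∈ V) → ∀ D,
      MeasurableSet[⨆ i ∈ U, MeasurableSpace.comap
      (fun x : ℤ → Fin d → ℝ => x i) inferInstance] D →
      MeasurableSet[sigmaOf X V] ((fun ω => fun i : ℤ => X (i + -s) ω) ⁻¹' D) := by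
    intro U V hUV D hD
    have h1 : MeasurableSet[MeasurableSpace.comap (fun ω => fun i : ℤ => X (i + -s) ω)
      (⨆ i ∈ U, MeasurableSpace.comap (fun x : ℤ → Fin d → ℝ => x i) inferInstance)]
      ((fun ω => fun i : ℤ => X (i + -s) ω) ⁻¹' D) := ⟨D, hD, rfl⟩
    refine (?_ : _ ≤ sigmaOf X V) _ h1
    simp only [MeasurableSpace.comap_iSup, MeasurableSpace.comap_comp]
    exact iSup₂_le fun i hi => comap_le_sigmaOf (hUV i hi)
  rw [← Set.preimage_inter, key _ ((hle _ _ hA').inter (hle _ _ hB')), key _ (hle _ _ hA'),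
    key _ (hle _ _ hB'), Set.preimage_inter]
  refine BlockLength.abs_measure_sub_le_alphaMix (hshift _ _ ?_ _ hA') (hshift _ _ ?_ _ hB')
  · intro i hi; simp only [Set.mem_ofPred_eq] at *; omega
  · intro i hi; simp only [Set.mem_ofPred_eq] at *; omega

/-- Polynomial mixing rate extracted from the summability part of the moment-mixing condition. -/
lemma exists_mix [IsProbabilityMeasure μ] (hs : IsStationary μ X) (hX : ∀ i, Measurable (X i))
    {r : ℕ} {δ : ℝ} (hδ : 0 < δ)
    (hsum : Summable (fun k : ℕ => (k : ℝ) ^ (2 * r - 1) *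
      alphaMix μ X k ^ (δ / ((2 * r : ℝ) + δ)))) :
    ∃ C, 1 ≤ C ∧ Mix μ X C (((2 * r - 1 : ℕ) : ℝ) * ((2 * r : ℝ) + δ) / δ) := by
  set q : ℝ := 2 * r + δ with hq
  have hqpos : 0 < q := by positivity
  obtain ⟨M, hM⟩ := hsum.tendsto_atTop_zero.bddAbove_range
  have hM' : ∀ k : ℕ, (k : ℝ) ^ (2 * r - 1) * alphaMix μ X k ^ (δ / q) ≤ max M 1 := fun k =>
    (hM ⟨k, rfl⟩).trans (le_max_left _ _)
  set M' := max M 1 with hM'def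
  have hM1 : 1 ≤ M' := le_max_right _ _
  set e := 2 * r - 1 with he
  have hc1 : 1 ≤ (2 : ℝ) ^ e * M' := by
    have : (1 : ℝ) ≤ 2 ^ e := one_le_pow₀ (by norm_num)
    nlinarith
  refine ⟨((2 : ℝ) ^ e * M') ^ (q / δ), Real.one_le_rpow hc1 (by positivity), ?_⟩
  intro S T s k hS hT A B hA hB
  refine (hs.abs_measure_sub_le_alphaMix hX hS hT hA hB).trans ?_
  have ha0 : 0 ≤ alphaMix μ X k := alphaMix_nonneg k
  have ha1 : alphaMix μ X k ≤ 1 := alphaMix_le_one k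
  have h1 : (1 + (k : ℝ)) ^ e * alphaMix μ X k ^ (δ / q) ≤ 2 ^ e * M' := by
    rcases Nat.eq_zero_or_pos k with rfl | hk
    · have : alphaMix μ X 0 ^ (δ / q) ≤ 1 := Real.rpow_le_one ha0 ha1 (by positivity)
      simpa using this.trans hc1
    · have hk1 : (1 : ℝ) ≤ k := by exact_mod_cast hk
      calc (1 + (k : ℝ)) ^ e * alphaMix μ X k ^ (δ / q)
          ≤ (2 * k) ^ e * alphaMix μ X k ^ (δ / q) := by
            gcongr; linarith
        _ = 2 ^ e * ((k : ℝ) ^ e * alphaMix μ X k ^ (δ / q)) := by rw [mul_pow]; ring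
        _ ≤ _ := by gcongr; exact hM' k
  have hk0 : (0 : ℝ) < 1 + k := by positivity
  calc alphaMix μ X k = (alphaMix μ X k ^ (δ / q)) ^ (q / δ) := by
        rw [← Real.rpow_mul ha0, div_mul_div_cancel₀ hqpos.ne', div_self hδ.ne', Real.rpow_one]
    _ ≤ (2 ^ e * M' * ((1 + (k : ℝ)) ^ e)⁻¹) ^ (q / δ) := by
        refine Real.rpow_le_rpow (by positivity) ?_ (by positivity)
        rw [← div_eq_mul_inv, le_div_iff₀ (by positivity)]
        linarith
    _ = _ := by
        rw [Real.mul_rpow (by positivity) (by positivity)]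
        congr 1
        rw [← Real.rpow_natCast, ← Real.rpow_neg hk0.le, ← Real.rpow_mul hk0.le]
        congr 1; ring

/-- A process adapted to `X`, centered, with bounded absolute moments of order `q`. -/
structure Adm (μ : Measure Ω) (X : ℤ → Ω → Fin d → ℝ) (q M : ℝ) (x : ℤ → Ω → ℝ) : Prop where
  meas : ∀ a, Measurable[MeasurableSpace.comap (X a) inferInstance] (x a)
  int : ∀ a, Integrable (fun ω => |x a ω| ^ q) μ
  bound : ∀ a, ∫ ω, |x a ω| ^ q ∂μ ≤ M
  mean : ∀ a, ∫ ω, x a ω ∂μ = 0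

lemma Adm.measurable_sigmaOf {q M : ℝ} {x : ℤ → Ω → ℝ} (hx : Adm μ X q M x) {S : Set ℤ} {a : ℤ}
    (ha : a ∈ S) : Measurable[sigmaOf X S] (x a) :=
  (hx.meas a).mono (comap_le_sigmaOf ha) le_rfl

lemma Adm.measurable {q M : ℝ} {x : ℤ → Ω → ℝ} (hx : Adm μ X q M x)
    (hX : ∀ i, Measurable (X i)) (a : ℤ) : Measurable (x a) :=
  (hx.meas a).mono (hX a).comap_le le_rfl

/-- Davydov's inequality for functionals of separated stretches of the process. -/
lemma Mix.abs_cov_le [IsProbabilityMeasure μ] (hX : ∀ i, Measurable (X i)) {C β : ℝ} (hC : 0 < C)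
    (h : Mix μ X C β) {S T : Set ℤ} {s : ℤ} {k : ℕ} (hS : ∀ i ∈ S, i ≤ s)
    (hT : ∀ j ∈ T, s + k ≤ j) {ξ η : Ω → ℝ} {p q M M' : ℝ} (hp : 1 ≤ p) (hq : 1 ≤ q)
    (hpq : p⁻¹ + q⁻¹ ≤ 1)
    (hξ : Measurable[sigmaOf X S] ξ) (hη : Measurable[sigmaOf X T] η)
    (hξp : Integrable (fun ω => |ξ ω| ^ p) μ) (hηq : Integrable (fun ω => |η ω| ^ q) μ)
    (hM : ∫ ω, |ξ ω| ^ p ∂μ ≤ M) (hM' : ∫ ω, |η ω| ^ q ∂μ ≤ M') :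
    |∫ ω, ξ ω * η ω ∂μ - (∫ ω, ξ ω ∂μ) * ∫ ω, η ω ∂μ| ≤
      (4 + 2 * (M + M')) * (C * (1 + (k : ℝ)) ^ (-β)) ^ (1 - p⁻¹ - q⁻¹) :=
  davydov (sigmaOf_le hX S) (sigmaOf_le hX T) (by positivity)
    (fun A B hA hB => h S T s k hS hT A B hA hB) hp hq hpq hξ hη hξp hηq hM hM'

end Mixing

section MomentCore

lemma abs_add_pow_sub_pow_le {s y Λ t : ℝ} (hΛ : 1 ≤ Λ) (hs : |s| ≤ Λ * t) (hy : |y| ≤ t) (N : ℕ) :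
    |(s + y) ^ (N + 1) - s ^ (N + 1)| ≤ (N + 1) * 2 ^ N * Λ ^ N * t ^ (N + 1) := by
  have ht : 0 ≤ t := (abs_nonneg y).trans hy
  have h1 := abs_pow_sub_pow_le (s + y) s (N + 1)
  have hm : max |s + y| |s| ≤ 2 * Λ * t := by
    refine max_le ((abs_add_le _ _).trans ?_) ?_ <;> nlinarith
  calc _ ≤ _ := h1
    _ ≤ t * ((N + 1 : ℕ) : ℝ) * (2 * Λ * t) ^ N := by
        simp only [add_sub_cancel_left, Nat.add_sub_cancel]
        gcongr
    _ = _ := by push_cast; ring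

lemma abs_add_pow_sub_taylor_le {s y Λ t : ℝ} (hΛ : 1 ≤ Λ) (hs : |s| ≤ Λ * t) (hy : |y| ≤ t)
    (N : ℕ) : |(s + y) ^ (N + 2) - s ^ (N + 2) - (N + 2) * s ^ (N + 1) * y| ≤
      (N + 2) ^ 2 * 2 ^ (N + 2) * Λ ^ N * t ^ (N + 2) := by
  have ht : 0 ≤ t := (abs_nonneg y).trans hy
  have hΛ0 : 0 ≤ Λ := by linarith
  induction N with
  | zero =>
    have : (s + y) ^ 2 - s ^ 2 - ((0 : ℕ) + 2) * s ^ (0 + 1) * y = y ^ 2 := by push_cast; ring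
    rw [this, abs_of_nonneg (sq_nonneg _)]
    have : y ^ 2 ≤ t ^ 2 := by rw [← sq_abs]; gcongr
    norm_num
    nlinarith [sq_nonneg t]
  | succ N ih =>
    have e : (s + y) ^ (N + 1 + 2) - s ^ (N + 1 + 2) - ((N + 1 : ℕ) + 2) * s ^ (N + 1 + 1) * y =
        s * ((s + y) ^ (N + 2) - s ^ (N + 2) - (N + 2) * s ^ (N + 1) * y) +
          y * ((s + y) ^ (N + 1 + 1) - s ^ (N + 1 + 1)) := by push_cast; ring
    have h2 := abs_add_pow_sub_pow_le hΛ hs hy (N + 1)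
    have hΛ1 : Λ ^ (N + 1) = Λ ^ N * Λ := pow_succ _ _
    rw [e]
    calc _ ≤ |s| * |(s + y) ^ (N + 2) - s ^ (N + 2) - (N + 2) * s ^ (N + 1) * y| +
          |y| * |(s + y) ^ (N + 1 + 1) - s ^ (N + 1 + 1)| := by
          rw [← abs_mul, ← abs_mul]; exact abs_add_le _ _
      _ ≤ (Λ * t) * ((N + 2) ^ 2 * 2 ^ (N + 2) * Λ ^ N * t ^ (N + 2)) +
          t * (((N + 1 : ℕ) + 1) * 2 ^ (N + 1) * Λ ^ (N + 1) * t ^ (N + 1 + 1)) := by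
          gcongr
      _ = ((N + 2) ^ 2 * 2 ^ (N + 2) + (N + 2) * 2 ^ (N + 1)) * (Λ ^ (N + 1) * t ^ (N + 3)) := by
          push_cast; ring
      _ ≤ (((N + 1 : ℕ) + 2) ^ 2 * 2 ^ (N + 1 + 2)) * (Λ ^ (N + 1) * t ^ (N + 3)) := by
          gcongr
          push_cast
          have : (0 : ℝ) < 2 ^ N := by positivity
          have hN : (0 : ℝ) ≤ N := by positivity
          simp only [pow_succ]
          nlinarith [mul_nonneg this.le hN, mul_nonneg (mul_nonneg this.le hN) hN]
      _ = _ := by ring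

variable {α : Type*} [MeasurableSpace α] {ν : Measure α}

lemma max_pow_le {a b : ℝ} (ha : 0 ≤ a) (hb : 0 ≤ b) (n : ℕ) : max a b ^ n ≤ a ^ n + b ^ n := by
  rcases max_choice a b with h | h <;> rw [h]
  · have := pow_nonneg hb n; linarith
  · have := pow_nonneg ha n; linarith

lemma integral_add_mul_add_mul {f g h : α → ℝ} (hf : Integrable f ν) (hg : Integrable g ν)
    (hh : Integrable h ν) (a b l : ℝ) :
    ∫ ω, (f ω + a * g ω + b * (f ω / l + h ω)) ∂ν =
      ∫ ω, f ω ∂ν + a * ∫ ω, g ω ∂ν + b * ((∫ ω, f ω ∂ν) / l + ∫ ω, h ω ∂ν) := by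
  have h1 : Integrable (fun ω => f ω / l + h ω) ν := (hf.div_const l).add hh
  have h2 := hg.const_mul a
  rw [integral_add (f := fun ω => f ω + a * g ω) (hf.add h2) (h1.const_mul b), integral_add hf h2,
    integral_const_mul, integral_const_mul, integral_add (hf.div_const l) hh, integral_div]

/-- Inductive moment bound for partial sums `S j = ∑ i < j, ξ i` whose conditional drift
`E[S j ^ (p - 1) ξ j]` is controlled. -/
theorem moment_core [IsProbabilityMeasure ν] {ξ : ℕ → α → ℝ} {N n : ℕ} {D M : ℝ} (hD : 0 ≤ D)
    (hS : ∀ j ≤ n, MemLp (fun ω => ∑ i ∈ Finset.range j, ξ i ω) (N + 2 : ℕ) ν)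
    (hξ : ∀ j < n, MemLp (ξ j) (N + 2 : ℕ) ν) (hN : Even N)
    (hM : ∀ j < n, ∫ ω, ξ j ω ^ (N + 2) ∂ν ≤ M)
    (hdrift : ∀ Λ : ℝ, 1 ≤ Λ → (∀ j ≤ n, ∫ ω, (∑ i ∈ Finset.range j, ξ i ω) ^ (N + 2) ∂ν ≤
      Λ ^ (N + 2)) → ∀ j < n,
        ∫ ω, (∑ i ∈ Finset.range j, ξ i ω) ^ (N + 1) * ξ j ω ∂ν ≤ D * Λ ^ N)
    (hM0 : 0 ≤ M) (hn : 1 ≤ n) :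
    ∫ ω, (∑ i ∈ Finset.range n, ξ i ω) ^ (N + 2) ∂ν ≤
      (n * ((N + 2) * D + (N + 2) ^ 2 * 2 ^ (N + 2) * (1 + M))) ^ (N / 2 + 1) := by
  obtain ⟨m, rfl⟩ := hN
  set p := m + m + 2 with hp
  have hpe : Even p := ⟨m + 1, by omega⟩
  set S : ℕ → α → ℝ := fun j ω => ∑ i ∈ Finset.range j, ξ i ω with hSdef
  have hint : ∀ {f : α → ℝ}, MemLp f p ν → Integrable (fun ω => f ω ^ p) ν := by
    intro f hf
    have := hf.integrable_norm_pow (by omega : p ≠ 0)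
    refine this.congr (ae_of_all _ fun ω => ?_)
    simp [hpe.pow_abs]
  have hne : (Finset.range (n + 1)).Nonempty := ⟨0, by simp⟩
  set E : ℕ → ℝ := fun j => ∫ ω, S j ω ^ p ∂ν with hE
  set B := max 1 ((Finset.range (n + 1)).sup' hne E) with hB
  set Λ := B ^ ((p : ℝ)⁻¹) with hΛdef
  have hB1 : 1 ≤ B := le_max_left _ _
  have hΛ1 : 1 ≤ Λ := Real.one_le_rpow hB1 (by positivity)
  have hΛp : Λ ^ p = B := Real.rpow_inv_natCast_pow (by linarith) (by omega)
  have hEB : ∀ j ≤ n, E j ≤ Λ ^ p := fun j hj => by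
    rw [hΛp]
    exact (Finset.le_sup' E (by simp; omega)).trans (le_max_right _ _)
  set c : ℝ := (p : ℝ) ^ 2 * 2 ^ p * (1 + M) with hc
  have hstep : ∀ j < n, E (j + 1) ≤ E j + (p * D + c) * Λ ^ (m + m) := by
    intro j hj
    have hd := hdrift Λ hΛ1 hEB j hj
    set t : α → ℝ := fun ω => max (|S j ω| / Λ) |ξ j ω| with ht
    have hΛ0 : 0 < Λ := by linarith
    have htp : ∀ ω, t ω ^ p ≤ S j ω ^ p / Λ ^ p + ξ j ω ^ p := fun ω => by
      refine (max_pow_le (by positivity) (abs_nonneg _) p).trans_eq ?_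
      rw [div_pow, hpe.pow_abs, hpe.pow_abs]
    have hpt : ∀ ω, S (j + 1) ω ^ p ≤ S j ω ^ p + p * (S j ω ^ (m + m + 1) * ξ j ω) +
        p ^ 2 * 2 ^ p * Λ ^ (m + m) * (S j ω ^ p / Λ ^ p + ξ j ω ^ p) := by
      intro ω
      have h1 := abs_add_pow_sub_taylor_le (s := S j ω) (y := ξ j ω) (t := t ω) hΛ1
        (by
          have : |S j ω| / Λ ≤ t ω := le_max_left _ _
          rwa [div_le_iff₀' hΛ0] at this) (le_max_right _ _) (m + m)
      have h2 : S (j + 1) ω = S j ω + ξ j ω := Finset.sum_range_succ _ _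
      rw [h2]
      have h3 := (le_abs_self _).trans h1
      have h4 : (p : ℝ) ^ 2 * 2 ^ p * Λ ^ (m + m) * t ω ^ p ≤
        p ^ 2 * 2 ^ p * Λ ^ (m + m) * (S j ω ^ p / Λ ^ p + ξ j ω ^ p) := by
        gcongr; exact htp ω
      have hpc : ((m + m : ℕ) : ℝ) + 2 = p := by rw [hp]; push_cast; ring
      rw [hpc] at h3
      linarith
    have i1 := hint (hS j hj.le)
    have i2 := hint (hξ j hj)
    have i3 : Integrable (fun ω => S j ω ^ (m + m + 1) * ξ j ω) ν := by
      refine (i1.add i2).mono' (((hS j hj.le).1.pow _).mul (hξ j hj).1) (ae_of_all _ fun ω => ?_)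
      rw [norm_mul, norm_pow, Real.norm_eq_abs, Real.norm_eq_abs]
      calc |S j ω| ^ (m + m + 1) * |ξ j ω| ≤ max |S j ω| |ξ j ω| ^ (m + m + 1) *
            max |S j ω| |ξ j ω| := by
            gcongr
            · exact le_max_left _ _
            · exact le_max_right _ _
        _ = max |S j ω| |ξ j ω| ^ p := by rw [hp]; ring
        _ ≤ _ := (max_pow_le (abs_nonneg _) (abs_nonneg _) p).trans_eq (by
            rw [hpe.pow_abs, hpe.pow_abs]; rfl)
    have hcalc : E (j + 1) ≤ E j + p * ∫ ω, S j ω ^ (m + m + 1) * ξ j ω ∂ν +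
        p ^ 2 * 2 ^ p * Λ ^ (m + m) * (E j / Λ ^ p + ∫ ω, ξ j ω ^ p ∂ν) := by
      have i4 := (i1.add (i3.const_mul (p : ℝ))).add
        (((i1.div_const (Λ ^ p)).add i2).const_mul (p ^ 2 * 2 ^ p * Λ ^ (m + m)))
      refine (integral_mono (hint (hS (j + 1) hj)) i4 hpt).trans_eq ?_
      exact integral_add_mul_add_mul i1 i3 i2 _ _ _
    have hEj : E j / Λ ^ p ≤ 1 := by
      rw [div_le_one (by positivity)]; exact hEB j hj.le
    have hM' := hM j hj
    calc E (j + 1) ≤ _ := hcalc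
      _ ≤ E j + p * (D * Λ ^ (m + m)) + p ^ 2 * 2 ^ p * Λ ^ (m + m) * (1 + M) := by gcongr
      _ = _ := by rw [hc]; ring
  have hc0 : 1 ≤ c := by
    have h1 : (1 : ℝ) ≤ p := by exact_mod_cast (by omega : 1 ≤ p)
    have h2 : (1 : ℝ) ≤ (p : ℝ) ^ 2 := one_le_pow₀ h1
    have h3 : (1 : ℝ) ≤ 2 ^ p := one_le_pow₀ (by norm_num)
    rw [hc]
    have h4 : 1 ≤ (p : ℝ) ^ 2 * 2 ^ p := by nlinarith
    nlinarith
  set G := (p : ℝ) * D + c with hG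
  have hG1 : 1 ≤ G := by
    have : 0 ≤ (p : ℝ) * D := by positivity
    linarith
  have hsum : ∀ j ≤ n, E j ≤ j * (G * Λ ^ (m + m)) := by
    intro j
    induction j with
    | zero => intro _; simp [hE, hSdef, hp]
    | succ j ih =>
      intro hj
      have h1 := hstep j (by omega)
      have h2 := ih (by omega)
      push_cast
      linarith
  have hn1 : (1 : ℝ) ≤ n := by exact_mod_cast hn
  have hGΛ : 1 ≤ G * Λ ^ (m + m) := by
    have : 1 ≤ Λ ^ (m + m) := one_le_pow₀ hΛ1
    nlinarith
  have hBle : Λ ^ p ≤ n * (G * Λ ^ (m + m)) := by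
    rw [hΛp, hB]
    refine max_le (by nlinarith) (Finset.sup'_le _ _ fun j hj => ?_)
    have hjn : j ≤ n := by simp at hj; omega
    refine (hsum j hjn).trans ?_
    gcongr
  have hΛ2 : Λ ^ 2 ≤ n * G := by
    have h0 : 0 < Λ ^ (m + m) := by positivity
    have : Λ ^ 2 * Λ ^ (m + m) ≤ n * G * Λ ^ (m + m) := by
      calc Λ ^ 2 * Λ ^ (m + m) = Λ ^ p := by rw [hp]; ring
        _ ≤ _ := hBle
        _ = _ := by ring
    exact le_of_mul_le_mul_right this h0
  have hfin : E n ≤ (n * G) ^ (m + 1) := by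
    calc E n ≤ Λ ^ p := hEB n le_rfl
      _ = (Λ ^ 2) ^ (m + 1) := by rw [← pow_mul, hp]; ring_nf
      _ ≤ _ := by gcongr
  have e1 : (m + m) / 2 + 1 = m + 1 := by omega
  rw [e1]
  convert hfin using 3
  rw [hG, hc, hp]; push_cast; ring

end MomentCore

section AdmMoment

variable {μ : Measure Ω} {X : ℤ → Ω → Fin d → ℝ}

lemma Adm.memLp [IsProbabilityMeasure μ] {q M : ℝ} {x : ℤ → Ω → ℝ} (hx : Adm μ X q M x)
    (hX : ∀ i, Measurable (X i)) {p : ℕ} (hp : (p : ℝ) ≤ q) (hq : 0 < q) (a : ℤ) :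
    MemLp (x a) p μ := by
  have h1 : MemLp (x a) (ENNReal.ofReal q) μ := by
    rw [← integrable_norm_rpow_iff (hx.measurable hX a).aestronglyMeasurable
      (by simpa using hq) ENNReal.ofReal_ne_top, ENNReal.toReal_ofReal hq.le]
    exact hx.int a
  refine h1.mono_exponent ?_
  rw [← ENNReal.ofReal_natCast]
  exact ENNReal.ofReal_le_ofReal hp

lemma abs_rpow_le_one_add {x p q : ℝ} (h0 : 0 ≤ p) (h : p ≤ q) : |x| ^ p ≤ 1 + |x| ^ q := by
  have hx := Real.rpow_nonneg (abs_nonneg x) q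
  rcases le_total |x| 1 with h1 | h1
  · have := Real.rpow_le_one (abs_nonneg x) h1 h0
    linarith
  · have := Real.rpow_le_rpow_of_exponent_le h1 h
    linarith

lemma Adm.integral_rpow_le [IsProbabilityMeasure μ] {q M : ℝ} {x : ℤ → Ω → ℝ}
    (hx : Adm μ X q M x) {p : ℝ} (h0 : 0 ≤ p) (hp : p ≤ q) (a : ℤ) :
    ∫ ω, |x a ω| ^ p ∂μ ≤ 1 + M := by
  calc ∫ ω, |x a ω| ^ p ∂μ ≤ ∫ ω, (1 + |x a ω| ^ q) ∂μ := by
        refine integral_mono_of_nonneg (ae_of_all _ fun ω => by positivity)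
          ((integrable_const _).add (hx.int a)) (ae_of_all _ fun ω => abs_rpow_le_one_add h0 hp)
    _ = 1 + ∫ ω, |x a ω| ^ q ∂μ := by
        rw [integral_add (integrable_const _) (hx.int a)]; simp
    _ ≤ _ := by gcongr; exact hx.bound a

lemma integrable_abs_pow_of_memLp {ν : Measure Ω} {f : Ω → ℝ} {p : ℕ} (hf : MemLp f p ν)
    (hp : p ≠ 0) : Integrable (fun ω => |f ω| ^ p) ν :=
  hf.integrable_norm_pow hp

/-- Moment bound for partial sums of an adapted process. -/
theorem Adm.exists_moment_bound [IsProbabilityMeasure μ] (hX : ∀ i, Measurable (X i))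
    {C β q M : ℝ} (hC : 1 ≤ C) (hmix : Mix μ X C β) (hM : 0 ≤ M) {N : ℕ} (hN : Even N)
    (hq : (N : ℝ) + 2 ≤ q) :
    ∃ K : ℝ, 1 ≤ K ∧ ∀ x, Adm μ X q M x → ∀ (s : ℤ) (n : ℕ), 1 ≤ n →
      ∫ ω, (∑ i ∈ Finset.range n, x (s + i) ω) ^ (N + 2) ∂μ ≤
        (n * (K * (1 + ∑ k ∈ Finset.range n,
          (1 + (k : ℝ)) ^ (-(β * (((N : ℝ) + 2)⁻¹ - q⁻¹)))))) ^ (N / 2 + 1) := by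
  have hN0 : (0 : ℝ) ≤ N := by positivity
  have hq0 : 0 < q := by linarith
  set e : ℝ := ((N : ℝ) + 2)⁻¹ - q⁻¹ with he
  have he0 : 0 ≤ e := by
    rw [he, sub_nonneg]; exact inv_anti₀ (by positivity) hq
  set c0 : ℝ := (N + 1) * 2 ^ N with hc0
  have hc0' : 0 < c0 := by positivity
  set D0 : ℝ := c0 * ((4 + 2 * ((2 + M) + M)) * C ^ e) with hD0
  have hCe : 0 < C ^ e := Real.rpow_pos_of_pos (by linarith) _
  have hD00 : 0 ≤ D0 := by positivity
  set c1 : ℝ := (N + 2) ^ 2 * 2 ^ (N + 2) * (1 + (1 + M)) with hc1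
  have hc1' : 1 ≤ c1 := by
    have h3 : (1 : ℝ) ≤ 2 ^ (N + 2) := one_le_pow₀ (by norm_num)
    have h2 : (1 : ℝ) ≤ (N + 2) ^ 2 := one_le_pow₀ (by linarith)
    have h4 : (1 : ℝ) ≤ (N + 2) ^ 2 * 2 ^ (N + 2) := by nlinarith
    rw [hc1]; nlinarith
  refine ⟨(N + 2) * D0 + c1, by nlinarith [mul_nonneg (by positivity : (0 : ℝ) ≤ N + 2) hD00], ?_⟩
  intro x hx s n hn
  set L : ℝ := ∑ k ∈ Finset.range n, (1 + (k : ℝ)) ^ (-(β * e)) with hL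
  have hL0 : 0 ≤ L := Finset.sum_nonneg fun k _ => by positivity
  have hpq : ((N + 2 : ℕ) : ℝ) ≤ q := by push_cast; linarith
  have hLp : ∀ a, MemLp (x a) (N + 2 : ℕ) μ := fun a => hx.memLp hX hpq hq0 a
  have hS : ∀ j, MemLp (fun ω => ∑ i ∈ Finset.range j, x (s + i) ω) (N + 2 : ℕ) μ := fun j =>
    memLp_finsetSum _ fun i _ => hLp _
  have hpe : Even (N + 2) := hN.add even_two
  have hxp : ∀ a, ∫ ω, x a ω ^ (N + 2) ∂μ ≤ 1 + M := fun a => by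
    have := hx.integral_rpow_le (p := (N + 2 : ℕ)) (by positivity) hpq a
    simpa only [Real.rpow_natCast, hpe.pow_abs] using this
  refine (moment_core (D := D0 * L) (M := 1 + M) (ξ := fun i => x (s + i)) (by positivity)
    (fun j _ => hS j) (fun j _ => hLp _) hN (fun j _ => hxp _) ?_ (by linarith) hn).trans ?_
  swap
  · gcongr
    have : 0 ≤ (N + 2) * D0 + c1 * L := by positivity
    nlinarith
  intro Λ hΛ hE j hj
  have hΛ0 : 0 < Λ := by linarith
  set S : ℕ → Ω → ℝ := fun j ω => ∑ i ∈ Finset.range j, x (s + i) ω with hSdef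
  have hterm : ∀ i < j, Integrable (fun ω => (S (i + 1) ω ^ (N + 1) - S i ω ^ (N + 1)) *
      x (s + j) ω) μ ∧ ∫ ω, (S (i + 1) ω ^ (N + 1) - S i ω ^ (N + 1)) * x (s + j) ω ∂μ ≤
      D0 * (1 + ((j - i : ℕ) : ℝ)) ^ (-(β * e)) * Λ ^ N := by
    intro i hi
    have hi1 := integrable_abs_pow_of_memLp (hS i) (by omega)
    have hi2 := integrable_abs_pow_of_memLp (hLp (s + i)) (by omega)
    set ξ : Ω → ℝ := fun ω => (S (i + 1) ω ^ (N + 1) - S i ω ^ (N + 1)) / (c0 * Λ ^ N) with hξ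
    set P : ℝ := ((N : ℝ) + 2) / (N + 1) with hP
    have hξb : ∀ ω, |ξ ω| ^ P ≤ |S i ω| ^ (N + 2) / Λ ^ (N + 2) + |x (s + i) ω| ^ (N + 2) := by
      intro ω
      set t := max (|S i ω| / Λ) |x (s + i) ω| with ht
      have ht0 : 0 ≤ t := (abs_nonneg _).trans (le_max_right _ _)
      have h1 := abs_add_pow_sub_pow_le (s := S i ω) (y := x (s + i) ω) (t := t) hΛ
        (by
          have : |S i ω| / Λ ≤ t := le_max_left _ _
          rwa [div_le_iff₀' hΛ0] at this) (le_max_right _ _) N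
      have h2 : S (i + 1) ω = S i ω + x (s + i) ω := Finset.sum_range_succ _ _
      have h3 : |ξ ω| ≤ t ^ (N + 1) := by
        rw [hξ]; simp only
        rw [abs_div, abs_of_pos (by positivity : 0 < c0 * Λ ^ N), div_le_iff₀ (by positivity), h2]
        linarith
      calc |ξ ω| ^ P ≤ (t ^ (N + 1)) ^ P := Real.rpow_le_rpow (abs_nonneg _) h3 (by positivity)
        _ = t ^ (N + 2) := by
          rw [← Real.rpow_natCast, ← Real.rpow_mul ht0, ← Real.rpow_natCast]
          congr 1; rw [hP]; push_cast; field_simp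
        _ ≤ (|S i ω| / Λ) ^ (N + 2) + |x (s + i) ω| ^ (N + 2) :=
          max_pow_le (by positivity) (abs_nonneg _) _
        _ = _ := by rw [div_pow]
    have hSm : ∀ k ≤ j, Measurable[sigmaOf X {a | a < s + k}] (S k) := fun k _ =>
      Finset.measurable_sum _ fun a ha => hx.measurable_sigmaOf (by
        simp only [Finset.mem_range] at ha
        simp only [Set.mem_ofPred_eq]; omega)
    have hξm : Measurable[sigmaOf X {a | a < s + (i + 1 : ℕ)}] ξ := by
      have m1 := hSm (i + 1) (by omega)
      have m2 := (hSm i (by omega)).mono (sigmaOf_mono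
        (T := {a | a < s + (i + 1 : ℕ)}) (by
          intro a ha; simp only [Set.mem_ofPred_eq] at *; push_cast; omega)) le_rfl
      exact ((m1.pow_const _).sub (m2.pow_const _)).div_const _
    have hξ0 : Measurable ξ := hξm.mono (sigmaOf_le hX _) le_rfl
    have hdom : Integrable (fun ω => |S i ω| ^ (N + 2) / Λ ^ (N + 2) +
        |x (s + i) ω| ^ (N + 2)) μ := (hi1.div_const _).add hi2
    have hξi : Integrable (fun ω => |ξ ω| ^ P) μ := by
      refine hdom.mono' (hξ0.abs.pow_const P).aestronglyMeasurable (ae_of_all _ fun ω => ?_)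
      rw [Real.norm_eq_abs, abs_of_nonneg (by positivity)]
      exact hξb ω
    have hξM : ∫ ω, |ξ ω| ^ P ∂μ ≤ 2 + M := by
      refine (integral_mono hξi hdom hξb).trans ?_
      rw [integral_add (hi1.div_const _) hi2, integral_div]
      simp only [hpe.pow_abs]
      have h1 : (∫ ω, S i ω ^ (N + 2) ∂μ) / Λ ^ (N + 2) ≤ 1 := by
        rw [div_le_one (by positivity)]; exact hE i (by omega)
      have h2 := hxp (s + i)
      linarith
    have hP1 : 1 ≤ P := by rw [hP, le_div_iff₀ (by positivity)]; linarith
    have hPinv : P⁻¹ = 1 - ((N : ℝ) + 2)⁻¹ := by rw [hP]; field_simp; ring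
    have hPq : P⁻¹ + q⁻¹ ≤ 1 := by rw [hPinv]; linarith
    have hq1 : 1 ≤ q := by linarith
    have hcov := hmix.abs_cov_le hX (by linarith) (S := {a | a < s + (i + 1 : ℕ)})
      (T := {s + (j : ℤ)}) (s := s + i) (k := j - i)
      (by intro a ha; simp only [Set.mem_ofPred_eq] at ha; push_cast at ha; omega)
      (by intro a ha; simp only [Set.mem_singleton_iff] at ha; subst ha; omega) hP1 hq1 hPq hξm
      (hx.measurable_sigmaOf (Set.mem_singleton _)) hξi (hx.int _) hξM (hx.bound _)
    rw [hx.mean, mul_zero, sub_zero] at hcov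
    have hint := integrable_mul_of_integrable_rpow hP1 hq1 hPq hξ0.aestronglyMeasurable
      (hx.measurable hX (s + j)).aestronglyMeasurable hξi (hx.int _)
    have hfe : (fun ω => (S (i + 1) ω ^ (N + 1) - S i ω ^ (N + 1)) * x (s + j) ω) =
        fun ω => (c0 * Λ ^ N) * (ξ ω * x (s + j) ω) := by
      funext ω
      have : (c0 * Λ ^ N) ≠ 0 := by positivity
      simp only [hξ]; field_simp
    rw [hfe]
    refine ⟨hint.const_mul _, ?_⟩
    rw [integral_const_mul]
    have e1 : 1 - P⁻¹ - q⁻¹ = e := by rw [hPinv, he]; ring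
    rw [e1, Real.mul_rpow (by linarith) (by positivity), ← Real.rpow_mul (by positivity),
      neg_mul] at hcov
    calc _ ≤ c0 * Λ ^ N * ((4 + 2 * ((2 + M) + M)) * (C ^ e *
          (1 + ((j - i : ℕ) : ℝ)) ^ (-(β * e)))) := by
          gcongr; exact (le_abs_self _).trans hcov
      _ = _ := by rw [hD0]; ring
  have hsplit : ∀ ω, S j ω ^ (N + 1) * x (s + j) ω =
      ∑ i ∈ Finset.range j, (S (i + 1) ω ^ (N + 1) - S i ω ^ (N + 1)) * x (s + j) ω := by
    intro ω
    rw [← Finset.sum_mul, Finset.sum_range_sub (fun i => S i ω ^ (N + 1))]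
    simp [hSdef]
  change ∫ ω, S j ω ^ (N + 1) * x (s + j) ω ∂μ ≤ _
  simp_rw [hsplit]
  rw [integral_finsetSum _ fun i hi => (hterm i (Finset.mem_range.1 hi)).1]
  calc _ ≤ ∑ i ∈ Finset.range j, D0 * (1 + ((j - i : ℕ) : ℝ)) ^ (-(β * e)) * Λ ^ N :=
        Finset.sum_le_sum fun i hi => (hterm i (Finset.mem_range.1 hi)).2
    _ = D0 * (∑ i ∈ Finset.range j, (1 + ((j - i : ℕ) : ℝ)) ^ (-(β * e))) * Λ ^ N := by
        rw [Finset.mul_sum, Finset.sum_mul]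
    _ ≤ D0 * L * Λ ^ N := by
        gcongr
        rw [← Finset.sum_range_reflect]
        calc _ ≤ ∑ k ∈ (Finset.range j).image (fun i : ℕ => i + 1),
              (1 + (k : ℝ)) ^ (-(β * e)) := by
              rw [Finset.sum_image (fun a _ b _ h => Nat.succ_injective h)]
              refine (Finset.sum_congr rfl fun k hk => ?_).le
              have : j - (j - 1 - k) = k + 1 := by have := Finset.mem_range.1 hk; omega
              rw [this]
          _ ≤ L := by
              refine Finset.sum_le_sum_of_subset_of_nonneg ?_ fun k _ _ => by positivity
              intro k hk
              simp only [Finset.mem_image, Finset.mem_range] at hk ⊢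
              omega

end AdmMoment

section Regular

/-- Standing assumptions: a stationary process with `q > 2 r ≥ 12` moments and a polynomial
strong mixing rate. -/
structure Regular (μ : Measure Ω) (X : ℤ → Ω → Fin d → ℝ) (r : ℕ) (q C : ℝ) : Prop where
  meas : ∀ i, Measurable (X i)
  stat : IsStationary μ X
  mix : Mix μ X C (((2 * r - 1 : ℕ) : ℝ) * q / (q - 2 * r))
  one_le : 1 ≤ C
  six_le : 6 ≤ r
  lt : (2 * r : ℝ) < q
  int : Integrable (fun ω => ‖X 1 ω‖ ^ q) μ

variable {μ : Measure Ω} {X : ℤ → Ω → Fin d → ℝ} {r : ℕ} {q C : ℝ}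

lemma CondM.exists_regular [IsProbabilityMeasure μ] (hX : ∀ i, Measurable (X i))
    (hs : IsStationary μ X) (hr : 6 ≤ r) (h : CondM μ X r) :
    ∃ q C, Regular μ X r q C := by
  obtain ⟨δ, hδ, hint, hsum⟩ := h
  obtain ⟨C, hC, hmix⟩ := exists_mix hs hX hδ hsum
  refine ⟨2 * r + δ, C, hX, hs, ?_, hC, hr, by linarith, hint⟩
  simpa using hmix

lemma Regular.cast_six_le (h : Regular μ X r q C) : (6 : ℝ) ≤ r := by exact_mod_cast h.six_le

lemma Regular.lt_q (h : Regular μ X r q C) : 12 < q := by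
  linarith [h.cast_six_le, h.lt]

lemma Regular.cast_two_mul_sub_one (h : Regular μ X r q C) :
    ((2 * r - 1 : ℕ) : ℝ) = 2 * r - 1 := by
  have := h.six_le
  rw [Nat.cast_sub (by omega)]; push_cast; ring

lemma Regular.rate_ge (h : Regular μ X r q C) :
    11 ≤ ((2 * r - 1 : ℕ) : ℝ) * q / (q - 2 * r) := by
  rw [h.cast_two_mul_sub_one]
  have h1 := h.cast_six_le
  have h2 := h.lt
  rw [le_div_iff₀ (by linarith)]
  nlinarith

lemma summable_one_add_rpow {γ : ℝ} (hγ : 1 < γ) :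
    Summable fun k : ℕ => (1 + (k : ℝ)) ^ (-γ) := by
  have h1 := (summable_nat_add_iff 1).2 (Real.summable_nat_rpow.2 (neg_lt_neg hγ))
  refine h1.congr fun k => ?_
  push_cast; rw [add_comm]

/-- Sharp moment bounds of even order at most ten. -/
lemma Regular.exists_moment_le [IsProbabilityMeasure μ] (h : Regular μ X r q C) {M : ℝ}
    (hM : 0 ≤ M) {N : ℕ} (hN : Even N) (hN8 : N ≤ 8) :
    ∃ K : ℝ, 1 ≤ K ∧ ∀ x, Adm μ X q M x → ∀ (s : ℤ) (n : ℕ),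
      ∫ ω, (∑ i ∈ Finset.range n, x (s + i) ω) ^ (N + 2) ∂μ ≤ K * (n : ℝ) ^ (N / 2 + 1) := by
  have h12 := h.lt_q
  have h6 := h.cast_six_le
  have hNr : (N : ℝ) ≤ 8 := by exact_mod_cast hN8
  have hN0 : (0 : ℝ) ≤ N := by positivity
  obtain ⟨K, hK, hb⟩ := Adm.exists_moment_bound h.meas h.one_le h.mix hM hN (q := q) (by linarith)
  set β := ((2 * r - 1 : ℕ) : ℝ) * q / (q - 2 * r) with hβ
  set γ := β * (((N : ℝ) + 2)⁻¹ - q⁻¹) with hγ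
  have hγ1 : 1 < γ := by
    have h2 := h.lt
    have h3 : (11 : ℝ) / 10 ≤ γ := by
      have e1 : γ = (2 * r - 1) * ((q - (N + 2)) / ((q - 2 * r) * (N + 2))) := by
        rw [hγ, hβ, h.cast_two_mul_sub_one]
        have : q - 2 * r ≠ 0 := by linarith
        have : (N : ℝ) + 2 ≠ 0 := by positivity
        have : q ≠ 0 := by linarith
        field_simp
      have e2 : 1 / 10 ≤ (q - (N + 2)) / ((q - 2 * r) * (N + 2)) := by
        rw [div_le_div_iff₀ (by norm_num) (by apply mul_pos <;> linarith)]
        nlinarith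
      rw [e1]; nlinarith
    linarith
  set T := ∑' k : ℕ, (1 + (k : ℝ)) ^ (-γ) with hT
  have hT0 : 0 ≤ T := tsum_nonneg fun k => by positivity
  refine ⟨(K * (1 + T)) ^ (N / 2 + 1), one_le_pow₀ (by nlinarith), fun x hx s n => ?_⟩
  rcases Nat.eq_zero_or_pos n with rfl | hn
  · simp
  refine (hb x hx s n hn).trans ?_
  rw [← mul_pow, mul_comm (n : ℝ)]
  have := (summable_one_add_rpow hγ1).sum_le_tsum (Finset.range n) fun k _ => by positivity
  have h0 : 0 ≤ ∑ k ∈ Finset.range n, (1 + (k : ℝ)) ^ (-γ) :=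
    Finset.sum_nonneg fun k _ => by positivity
  gcongr

/-- A cruder moment bound of the full order `2 r`. -/
lemma Regular.exists_moment_top_le [IsProbabilityMeasure μ] (h : Regular μ X r q C) {M : ℝ}
    (hM : 0 ≤ M) :
    ∃ K : ℝ, 1 ≤ K ∧ ∀ x, Adm μ X q M x → ∀ (s : ℤ) (n : ℕ),
      ∫ ω, (∑ i ∈ Finset.range n, x (s + i) ω) ^ (2 * r) ∂μ ≤ K * (n : ℝ) ^ (r + 1) := by
  have h12 := h.lt_q
  have h6 := h.cast_six_le
  have h6' := h.six_le
  have hlt := h.lt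
  obtain ⟨N, hN⟩ : ∃ N, 2 * r = N + 2 := ⟨2 * r - 2, by omega⟩
  have hNe : Even N := ⟨r - 1, by omega⟩
  have hN2 : N / 2 + 1 = r := by omega
  have hNr : (N : ℝ) + 2 = 2 * r := by exact_mod_cast hN.symm
  obtain ⟨K, hK, hb⟩ := Adm.exists_moment_bound h.meas h.one_le h.mix hM hNe (q := q)
    (by linarith)
  set γ := ((2 * r - 1 : ℕ) : ℝ) * q / (q - 2 * r) * (((N : ℝ) + 2)⁻¹ - q⁻¹) with hγ
  have hγ1 : γ = 1 - 1 / (2 * r) := by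
    rw [hγ, hNr, h.cast_two_mul_sub_one]
    have : q - 2 * r ≠ 0 := by linarith
    have : (r : ℝ) ≠ 0 := by linarith
    have : q ≠ 0 := by linarith
    field_simp
  set η : ℝ := 1 + 1 / (2 * r) with hη
  have hη1 : 1 < η := by
    have : (0 : ℝ) < 1 / (2 * r) := by positivity
    linarith
  set T := ∑' k : ℕ, (1 + (k : ℝ)) ^ (-η) with hT
  have hT0 : 0 ≤ T := tsum_nonneg fun k => by positivity
  refine ⟨(K * (1 + T)) ^ r, one_le_pow₀ (by nlinarith), fun x hx s n => ?_⟩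
  rcases Nat.eq_zero_or_pos n with rfl | hn
  · simp [show r ≠ 0 by omega]
  have hn1 : (1 : ℝ) ≤ n := by exact_mod_cast hn
  have hsum : ∑ k ∈ Finset.range n, (1 + (k : ℝ)) ^ (-γ) ≤ T * (n : ℝ) ^ ((r : ℝ)⁻¹) := by
    calc _ ≤ ∑ k ∈ Finset.range n, (1 + (k : ℝ)) ^ (-η) * (n : ℝ) ^ ((r : ℝ)⁻¹) := by
          refine Finset.sum_le_sum fun k hk => ?_
          have hk0 : (0 : ℝ) < 1 + k := by positivity
          have e1 : -γ = -η + (r : ℝ)⁻¹ := by rw [hγ1, hη]; field_simp; ring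
          rw [e1, Real.rpow_add hk0]
          gcongr
          have : k + 1 ≤ n := Finset.mem_range.1 hk
          have : ((k + 1 : ℕ) : ℝ) ≤ n := by exact_mod_cast this
          push_cast at this; linarith
      _ ≤ _ := by
          rw [← Finset.sum_mul]
          gcongr
          exact (summable_one_add_rpow hη1).sum_le_tsum _ fun k _ => by positivity
  have hnr : 1 ≤ (n : ℝ) ^ ((r : ℝ)⁻¹) := Real.one_le_rpow hn1 (by positivity)
  have h0 : 0 ≤ ∑ k ∈ Finset.range n, (1 + (k : ℝ)) ^ (-γ) :=
    Finset.sum_nonneg fun k _ => by positivity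
  have hmain := hb x hx s n hn
  rw [hN2, ← hN] at hmain
  calc _ ≤ _ := hmain
    _ ≤ (n * (K * ((1 + T) * (n : ℝ) ^ ((r : ℝ)⁻¹)))) ^ r := by
        gcongr
        nlinarith
    _ = (K * (1 + T)) ^ r * ((n : ℝ) ^ r * ((n : ℝ) ^ ((r : ℝ)⁻¹)) ^ r) := by
        simp only [mul_pow]; ring
    _ = _ := by
        rw [Real.rpow_inv_natCast_pow (by positivity) (by omega)]; ring

end Regular

section Separation

variable {μ : Measure Ω} {X : ℤ → Ω → Fin d → ℝ} {r : ℕ} {q C : ℝ}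

lemma Regular.abs_cov_le [IsProbabilityMeasure μ] (h : Regular μ X r q C) {S T : Set ℤ} {s : ℤ}
    {k : ℕ} (hS : ∀ i ∈ S, i ≤ s) (hT : ∀ j ∈ T, s + k ≤ j) {ξ η : Ω → ℝ} {p p' M M' : ℝ} {m : ℕ}
    (hp : 1 ≤ p) (hp' : 1 ≤ p') (hm : (m : ℝ) ≤ 11 * (1 - p⁻¹ - p'⁻¹))
    (hξ : Measurable[sigmaOf X S] ξ) (hη : Measurable[sigmaOf X T] η)
    (hξp : Integrable (fun ω => |ξ ω| ^ p) μ) (hηq : Integrable (fun ω => |η ω| ^ p') μ)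
    (hM : ∫ ω, |ξ ω| ^ p ∂μ ≤ M) (hM' : ∫ ω, |η ω| ^ p' ∂μ ≤ M') :
    |∫ ω, ξ ω * η ω ∂μ - (∫ ω, ξ ω ∂μ) * ∫ ω, η ω ∂μ| ≤
      (4 + 2 * (M + M')) * C / (1 + (k : ℝ)) ^ m := by
  have hm0 : (0 : ℝ) ≤ m := by positivity
  have hMM : 0 ≤ M := le_trans (integral_nonneg fun ω => by positivity) hM
  have hMM' : 0 ≤ M' := le_trans (integral_nonneg fun ω => by positivity) hM'
  have hC := h.one_le
  have hk : (1 : ℝ) ≤ 1 + k := by simp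
  have hpi : 0 < p⁻¹ := by positivity
  have hpi' : 0 < p'⁻¹ := by positivity
  refine (h.mix.abs_cov_le h.meas (by linarith) hS hT hp hp' (by linarith) hξ hη hξp hηq
    hM hM').trans ?_
  rw [mul_div_assoc (4 + 2 * (M + M')) C]
  have h4 : 0 ≤ 4 + 2 * (M + M') := by positivity
  refine mul_le_mul_of_nonneg_left ?_ h4
  set β := ((2 * r - 1 : ℕ) : ℝ) * q / (q - 2 * r)
  rw [Real.mul_rpow (by linarith) (by positivity), ← Real.rpow_mul (by positivity), div_eq_mul_inv]
  refine mul_le_mul ?_ ?_ (by positivity) (by linarith)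
  · calc C ^ (1 - p⁻¹ - p'⁻¹) ≤ C ^ (1 : ℝ) := Real.rpow_le_rpow_of_exponent_le hC (by linarith)
      _ = C := Real.rpow_one _
  · rw [← Real.rpow_natCast, ← Real.rpow_neg (by positivity)]
    refine Real.rpow_le_rpow_of_exponent_le hk ?_
    have := h.rate_ge
    nlinarith

/-- A family of centered functionals, the `i`-th depending on the stretch `X i, …, X (i + w)`. -/
structure Blk (μ : Measure Ω) (X : ℤ → Ω → Fin d → ℝ) (w : ℕ) (P M : ℝ) (c : ℤ → Ω → ℝ) :
    Prop where
  meas : ∀ i, Measurable[sigmaOf X (Set.Icc i (i + w))] (c i)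
  int : ∀ i, Integrable (fun ω => |c i ω| ^ P) μ
  bound : ∀ i, ∫ ω, |c i ω| ^ P ∂μ ≤ M
  mean : ∀ i, ∫ ω, c i ω ∂μ = 0

lemma Adm.blk [IsProbabilityMeasure μ] (hX : ∀ i, Measurable (X i)) {M P : ℝ} {x : ℤ → Ω → ℝ}
    (hx : Adm μ X q M x) (h0 : 0 ≤ P) (hP : P ≤ q) : Blk μ X 0 P (1 + M) x where
  meas a := hx.measurable_sigmaOf (by simp)
  int a := by
    refine ((integrable_const (1 : ℝ)).add (hx.int a)).mono'
      ((hx.measurable hX a).abs.pow_const P).aestronglyMeasurable (ae_of_all _ fun ω => ?_)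
    rw [Real.norm_eq_abs, abs_of_nonneg (by positivity)]
    exact abs_rpow_le_one_add h0 hP
  bound a := hx.integral_rpow_le h0 hP a
  mean := hx.mean

section

variable {w : ℕ} {P M M' : ℝ} {c c' c'' : ℤ → Ω → ℝ}

lemma Blk.measurable (hc : Blk μ X w P M c) (hX : ∀ i, Measurable (X i)) (i : ℤ) :
    Measurable (c i) := (hc.meas i).mono (sigmaOf_le hX _) le_rfl

lemma Blk.measurable_sigmaOf (hc : Blk μ X w P M c) {S : Set ℤ} {i : ℤ}
    (h : Set.Icc i (i + w) ⊆ S) : Measurable[sigmaOf X S] (c i) :=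
  (hc.meas i).mono (sigmaOf_mono h) le_rfl

lemma Blk.nonneg (hc : Blk μ X w P M c) : 0 ≤ M :=
  le_trans (integral_nonneg fun ω => by positivity) (hc.bound 0)

lemma abs_mul_rpow_half_le {x y P : ℝ} (hP : 0 ≤ P) :
    |x * y| ^ (P / 2) ≤ |x| ^ P + |y| ^ P := by
  rw [abs_mul]
  have h1 : |x| * |y| ≤ (max |x| |y|) ^ (2 : ℝ) := by
    rw [Real.rpow_two, sq]
    gcongr
    · exact le_max_left _ _
    · exact le_max_right _ _
  have hm : 0 ≤ max |x| |y| := (abs_nonneg _).trans (le_max_left _ _)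
  calc (|x| * |y|) ^ (P / 2) ≤ ((max |x| |y|) ^ (2 : ℝ)) ^ (P / 2) :=
        Real.rpow_le_rpow (by positivity) h1 (by positivity)
    _ = (max |x| |y|) ^ P := by rw [← Real.rpow_mul hm]; congr 1; ring
    _ ≤ _ := by
        have hx := Real.rpow_nonneg (abs_nonneg x) P
        have hy := Real.rpow_nonneg (abs_nonneg y) P
        rcases max_choice |x| |y| with h | h <;> rw [h] <;> linarith

lemma integrable_abs_mul_rpow_half {f g : Ω → ℝ} (hP : 0 ≤ P) (hf : Measurable f)
    (hg : Measurable g) (hf' : Integrable (fun ω => |f ω| ^ P) μ)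
    (hg' : Integrable (fun ω => |g ω| ^ P) μ) :
    Integrable (fun ω => |f ω * g ω| ^ (P / 2)) μ := by
  refine (hf'.add hg').mono' ((hf.mul hg).abs.pow_const _).aestronglyMeasurable
    (ae_of_all _ fun ω => ?_)
  rw [Real.norm_eq_abs, abs_of_nonneg (by positivity)]
  exact abs_mul_rpow_half_le hP

lemma integral_abs_mul_rpow_half_le {f g : Ω → ℝ} (hP : 0 ≤ P) (hf : Measurable f)
    (hg : Measurable g) (hf' : Integrable (fun ω => |f ω| ^ P) μ)
    (hg' : Integrable (fun ω => |g ω| ^ P) μ) (hM : ∫ ω, |f ω| ^ P ∂μ ≤ M)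
    (hM' : ∫ ω, |g ω| ^ P ∂μ ≤ M') :
    ∫ ω, |f ω * g ω| ^ (P / 2) ∂μ ≤ M + M' := by
  refine (integral_mono (integrable_abs_mul_rpow_half hP hf hg hf' hg') (hf'.add hg')
    fun ω => abs_mul_rpow_half_le hP).trans ?_
  simp only [Pi.add_apply]
  rw [integral_add hf' hg']
  linarith

lemma abs_integral_mul_le [IsProbabilityMeasure μ] {f g : Ω → ℝ} {p p' : ℝ} (hp : 1 ≤ p)
    (hp' : 1 ≤ p') (hpp : p⁻¹ + p'⁻¹ ≤ 1) (hf' : Integrable (fun ω => |f ω| ^ p) μ)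
    (hg' : Integrable (fun ω => |g ω| ^ p') μ) (hM : ∫ ω, |f ω| ^ p ∂μ ≤ M)
    (hM' : ∫ ω, |g ω| ^ p' ∂μ ≤ M') : |∫ ω, f ω * g ω ∂μ| ≤ 1 + M + M' := by
  have hi : Integrable (fun ω => 1 + |f ω| ^ p) μ := (integrable_const (1 : ℝ)).add hf'
  calc _ ≤ ∫ ω, |f ω * g ω| ∂μ := abs_integral_le_integral_abs
    _ ≤ ∫ ω, (1 + |f ω| ^ p + |g ω| ^ p') ∂μ :=
      integral_mono_of_nonneg (ae_of_all _ fun ω => abs_nonneg _)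
        (hi.add hg')
        (ae_of_all _ fun ω => abs_mul_le_rpow hp hp' hpp)
    _ ≤ _ := by
      rw [integral_add hi hg', integral_add (integrable_const _) hf']
      simp only [integral_const, probReal_univ, one_smul]
      gcongr

/-- Covariance of two separated block functionals. -/
lemma Regular.pair_le [IsProbabilityMeasure μ] (h : Regular μ X r q C) (hc : Blk μ X w P M c)
    (hc' : Blk μ X w P M c') {m : ℕ} (hP : 2 ≤ P) (hm : (m : ℝ) ≤ 11 * (1 - 2 / P)) {i j : ℤ}
    {t : ℕ} (ht : t = 0 ∨ i + w + t ≤ j ∨ j + w + t ≤ i) :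
    |∫ ω, c i ω * c' j ω ∂μ| ≤ (4 + 4 * M) * C / (1 + (t : ℝ)) ^ m := by
  have hM := hc.nonneg
  have hP1 : 1 ≤ P := by linarith
  have hC := h.one_le
  have hm' : (m : ℝ) ≤ 11 * (1 - P⁻¹ - P⁻¹) := by
    have : 2 / P = P⁻¹ + P⁻¹ := by ring
    linarith
  have e0 : (4 + 2 * (M + M)) * C / (1 + (t : ℝ)) ^ m = (4 + 4 * M) * C / (1 + (t : ℝ)) ^ m := by
    ring
  rcases ht with rfl | ht | ht
  · have := abs_integral_mul_le hP1 hP1 (by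
      rw [← two_mul, ← div_eq_mul_inv, div_le_one (by linarith)]; exact hP) (hc.int i) (hc'.int j)
      (hc.bound i) (hc'.bound j)
    simp only [Nat.cast_zero, add_zero, one_pow, div_one]
    nlinarith
  · have := h.abs_cov_le (S := Set.Icc i (i + w)) (T := Set.Icc j (j + w)) (s := i + w) (k := t)
      (fun a ha => ha.2) (fun a ha => ht.trans ha.1) hP1 hP1 hm' (hc.meas i) (hc'.meas j)
      (hc.int i) (hc'.int j) (hc.bound i) (hc'.bound j)
    rw [hc.mean, zero_mul, sub_zero, e0] at this
    exact this
  · have := h.abs_cov_le (S := Set.Icc j (j + w)) (T := Set.Icc i (i + w)) (s := j + w) (k := t)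
      (fun a ha => ha.2) (fun a ha => ht.trans ha.1) hP1 hP1 hm' (hc'.meas j) (hc.meas i)
      (hc'.int j) (hc.int i) (hc'.bound j) (hc.bound i)
    rw [hc.mean, mul_zero, sub_zero, e0] at this
    simp_rw [mul_comm (c i _)]
    exact this

/-- Mean of a product of three block functionals one of which is separated from the rest. -/
lemma Regular.isolated_le [IsProbabilityMeasure μ] (h : Regular μ X r q C) (hc : Blk μ X w P M c)
    (hc' : Blk μ X w P M c') (hc'' : Blk μ X w P M c'') {m : ℕ} (hP : 3 ≤ P)
    (hm : (m : ℝ) ≤ 11 * (1 - 3 / P)) {i j k : ℤ}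
    {t : ℕ} (ht : t = 0 ∨ (i + w + t ≤ j ∧ i + w + t ≤ k) ∨ (j + w + t ≤ i ∧ k + w + t ≤ i)) :
    |∫ ω, c i ω * (c' j ω * c'' k ω) ∂μ| ≤ (4 + 6 * M) * C / (1 + (t : ℝ)) ^ m := by
  have hM := hc.nonneg
  have hP0 : 0 ≤ P := by linarith
  have hP1 : 1 ≤ P := by linarith
  have hP2 : 1 ≤ P / 2 := by linarith
  have hC := h.one_le
  have hP3 : P⁻¹ + (P / 2)⁻¹ = 3 / P := by field_simp; ring
  have hm' : (m : ℝ) ≤ 11 * (1 - P⁻¹ - (P / 2)⁻¹) := by linarith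
  have hm'' : (m : ℝ) ≤ 11 * (1 - (P / 2)⁻¹ - P⁻¹) := by linarith
  have e0 : (4 + 2 * (M + (M + M))) * C / (1 + (t : ℝ)) ^ m =
    (4 + 6 * M) * C / (1 + (t : ℝ)) ^ m := by ring
  have e1 : (4 + 2 * ((M + M) + M)) * C / (1 + (t : ℝ)) ^ m =
    (4 + 6 * M) * C / (1 + (t : ℝ)) ^ m := by ring
  have hi := integrable_abs_mul_rpow_half (μ := μ) hP0 (hc'.measurable h.meas j)
    (hc''.measurable h.meas k) (hc'.int j) (hc''.int k)
  have hb := integral_abs_mul_rpow_half_le (μ := μ) hP0 (hc'.measurable h.meas j)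
    (hc''.measurable h.meas k) (hc'.int j) (hc''.int k) (hc'.bound j) (hc''.bound k)
  have hmul : ∀ S : Set ℤ, Set.Icc j (j + w) ⊆ S → Set.Icc k (k + w) ⊆ S →
      Measurable[sigmaOf X S] fun ω => c' j ω * c'' k ω := fun S h1 h2 =>
    (hc'.measurable_sigmaOf h1).mul (hc''.measurable_sigmaOf h2)
  rcases ht with rfl | ht | ht
  · have := abs_integral_mul_le hP1 hP2 (by
      rw [hP3, div_le_one (by linarith)]; exact hP) (hc.int i) hi (hc.bound i) hb
    simp only [Nat.cast_zero, add_zero, one_pow, div_one]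
    nlinarith
  · have := h.abs_cov_le (S := Set.Icc i (i + w)) (T := {a | i + w + t ≤ a}) (s := i + w) (k := t)
      (fun a ha => ha.2) (fun a ha => ha) hP1 hP2 hm' (hc.meas i)
      (hmul _ (fun a ha => ht.1.trans ha.1) (fun a ha => ht.2.trans ha.1))
      (hc.int i) hi (hc.bound i) hb
    rw [hc.mean, zero_mul, sub_zero, e0] at this
    exact this
  · have := h.abs_cov_le (S := {a | a + t ≤ i}) (T := Set.Icc i (i + w)) (s := i - t) (k := t)
      (fun a ha => by simp only [Set.mem_ofPred_eq] at ha; omega)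
      (fun a ha => by have := ha.1; omega) hP2 hP1 hm''
      (hmul _ (fun a ha => by have := ha.2; simp only [Set.mem_ofPred_eq]; omega)
        (fun a ha => by have := ha.2; simp only [Set.mem_ofPred_eq]; omega)) (hc.meas i)
      hi (hc.int i) hb (hc.bound i)
    rw [hc.mean, mul_zero, sub_zero, e1] at this
    simp_rw [mul_comm (c i _)]
    exact this

/-- Mean of a product of three block functionals in terms of the spread of the blocks. -/
lemma Regular.triple_le [IsProbabilityMeasure μ] (h : Regular μ X r q C) (hc : Blk μ X w P M c)
    (hc' : Blk μ X w P M c') (hc'' : Blk μ X w P M c'') {m : ℕ} (hP : 3 ≤ P)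
    (hm : (m : ℝ) ≤ 11 * (1 - 3 / P)) {i j k : ℤ}
    {t : ℕ} (ht : t = 0 ∨ 2 * (w + t : ℤ) ≤ |i - j| ∨ 2 * (w + t : ℤ) ≤ |i - k| ∨
      2 * (w + t : ℤ) ≤ |j - k|) :
    |∫ ω, c i ω * c' j ω * c'' k ω ∂μ| ≤ (4 + 6 * M) * C / (1 + (t : ℝ)) ^ m := by
  have key : (t = 0 ∨ (i + w + t ≤ j ∧ i + w + t ≤ k) ∨ (j + w + t ≤ i ∧ k + w + t ≤ i)) ∨
      (t = 0 ∨ (j + w + t ≤ i ∧ j + w + t ≤ k) ∨ (i + w + t ≤ j ∧ k + w + t ≤ j)) ∨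
      (t = 0 ∨ (k + w + t ≤ i ∧ k + w + t ≤ j) ∨ (i + w + t ≤ k ∧ j + w + t ≤ k)) := by
    rcases abs_cases (i - j) with ⟨h1, _⟩ | ⟨h1, _⟩ <;>
    rcases abs_cases (i - k) with ⟨h2, _⟩ | ⟨h2, _⟩ <;>
    rcases abs_cases (j - k) with ⟨h3, _⟩ | ⟨h3, _⟩ <;> omega
  rcases key with ht | ht | ht
  · simpa only [mul_assoc] using h.isolated_le hc hc' hc'' hP hm ht
  · have := h.isolated_le hc' hc hc'' hP hm ht
    simpa only [mul_assoc, mul_left_comm] using this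
  · have := h.isolated_le hc'' hc hc' hP hm ht
    simpa only [mul_comm (c'' k _)] using this

end

end Separation

section Cumulants

variable {μ : Measure Ω} {X : ℤ → Ω → Fin d → ℝ} {r : ℕ} {q C M : ℝ}

lemma abs_mul_mul_rpow_third_le {x y z P : ℝ} (hP : 0 ≤ P) :
    |x * (y * z)| ^ (P / 3) ≤ |x| ^ P + |y| ^ P + |z| ^ P := by
  rw [abs_mul, abs_mul]
  set m := max |x| (max |y| |z|) with hmdef
  have hx : |x| ≤ m := le_max_left _ _
  have hy : |y| ≤ m := (le_max_left _ _).trans (le_max_right _ _)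
  have hz : |z| ≤ m := (le_max_right _ _).trans (le_max_right _ _)
  have hm : 0 ≤ m := (abs_nonneg _).trans hx
  have h1 : |x| * (|y| * |z|) ≤ m ^ (3 : ℝ) := by
    have : m ^ (3 : ℝ) = m * (m * m) := by
      rw [show (3 : ℝ) = ((3 : ℕ) : ℝ) by norm_num, Real.rpow_natCast]; ring
    rw [this]
    gcongr
  have hx' := Real.rpow_nonneg (abs_nonneg x) P
  have hy' := Real.rpow_nonneg (abs_nonneg y) P
  have hz' := Real.rpow_nonneg (abs_nonneg z) P
  calc (|x| * (|y| * |z|)) ^ (P / 3) ≤ (m ^ (3 : ℝ)) ^ (P / 3) :=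
        Real.rpow_le_rpow (by positivity) h1 (by positivity)
    _ = m ^ P := by rw [← Real.rpow_mul hm]; congr 1; ring
    _ ≤ _ := by
        rcases max_choice |x| (max |y| |z|) with h | h
        · rw [hmdef, h]; linarith
        · rcases max_choice |y| |z| with h' | h' <;> rw [hmdef, h, h'] <;> linarith

lemma one_add_pow_le_of_le_three_mul {D t : ℕ} (h : D ≤ 3 * t + 2) :
    (1 + (D : ℝ)) ^ 7 ≤ 3 ^ 7 * (1 + (t : ℝ)) ^ 7 := by
  rw [← mul_pow]
  have : (D : ℝ) ≤ 3 * t + 2 := by exact_mod_cast h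
  gcongr
  linarith

lemma div_one_add_pow_le {K : ℝ} (hK : 0 ≤ K) {D t : ℕ} (h : D ≤ 3 * t + 2) :
    K / (1 + (t : ℝ)) ^ 7 ≤ 3 ^ 7 * K / (1 + (D : ℝ)) ^ 7 := by
  rw [div_le_div_iff₀ (by positivity) (by positivity)]
  have := one_add_pow_le_of_le_three_mul h
  nlinarith

lemma Regular.twelve_le [IsProbabilityMeasure μ] (h : Regular μ X r q C) : (12 : ℝ) ≤ q :=
  h.lt_q.le

lemma Regular.exists_cov_le [IsProbabilityMeasure μ] (h : Regular μ X r q C) (M : ℝ) :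
    ∃ K, 1 ≤ K ∧ ∀ x y : ℤ → Ω → ℝ, Adm μ X q M x → Adm μ X q M y → ∀ i j : ℤ, ∀ D : ℕ,
      D ≤ |i - j| → |∫ ω, x i ω * y j ω ∂μ| ≤ K / (1 + (D : ℝ)) ^ 7 := by
  refine ⟨max 1 ((4 + 4 * (1 + M)) * C), le_max_left _ _, fun x y hx hy i j D hD => ?_⟩
  refine (h.pair_le (hx.blk h.meas (P := 12) (by norm_num) h.twelve_le)
    (hy.blk h.meas (P := 12) (by norm_num) h.twelve_le) (m := 7) (t := D) (by norm_num)
    (by norm_num) ?_).trans ?_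
  · rcases abs_cases (i - j) with ⟨h1, _⟩ | ⟨h1, _⟩ <;> omega
  · gcongr
    exact le_max_right _ _

lemma Regular.exists_third_moment_le [IsProbabilityMeasure μ] (h : Regular μ X r q C) (M : ℝ) :
    ∃ K, 1 ≤ K ∧ ∀ x y z : ℤ → Ω → ℝ, Adm μ X q M x → Adm μ X q M y → Adm μ X q M z →
      ∀ i j k : ℤ, ∀ D : ℕ, ((D : ℤ) ≤ |i - j| ∨ (D : ℤ) ≤ |i - k| ∨ (D : ℤ) ≤ |j - k|) →
      |∫ ω, x i ω * y j ω * z k ω ∂μ| ≤ K / (1 + (D : ℝ)) ^ 7 := by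
  refine ⟨max 1 (3 ^ 7 * ((4 + 6 * (1 + M)) * C)), le_max_left _ _,
    fun x y z hx hy hz i j k D hD => ?_⟩
  have hb := fun {x} (hx : Adm μ X q M x) => hx.blk h.meas (P := 12) (by norm_num) h.twelve_le
  have hC := h.one_le
  refine (h.triple_le (hb hx) (hb hy) (hb hz) (m := 7) (t := D / 2) (by norm_num)
    (by norm_num) ?_).trans ((div_one_add_pow_le (D := D) ?_ (by omega)).trans ?_)
  · omega
  · have := (hb hx).nonneg
    positivity
  · gcongr
    exact le_max_right _ _

/-- The fourth joint cumulant of centered variables `x i, x j, x k, x l`. -/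
def cum4 (μ : Measure Ω) (x : ℤ → Ω → ℝ) (i j k l : ℤ) : ℝ :=
  ∫ ω, x i ω * x j ω * (x k ω * x l ω) ∂μ
    - (∫ ω, x i ω * x j ω ∂μ) * (∫ ω, x k ω * x l ω ∂μ)
    - (∫ ω, x i ω * x k ω ∂μ) * (∫ ω, x j ω * x l ω ∂μ)
    - (∫ ω, x i ω * x l ω ∂μ) * (∫ ω, x j ω * x k ω ∂μ)

lemma cum4_swap12 (x : ℤ → Ω → ℝ) (i j k l : ℤ) : cum4 μ x i j k l = cum4 μ x j i k l := by
  unfold cum4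
  simp_rw [mul_comm (x i _) (x j _)]
  ring

lemma cum4_swap34 (x : ℤ → Ω → ℝ) (i j k l : ℤ) : cum4 μ x i j k l = cum4 μ x i j l k := by
  unfold cum4
  simp_rw [mul_comm (x k _) (x l _)]
  ring

lemma cum4_swap23 (x : ℤ → Ω → ℝ) (i j k l : ℤ) : cum4 μ x i j k l = cum4 μ x i k j l := by
  unfold cum4
  simp_rw [mul_mul_mul_comm (x i _) (x j _), mul_comm (x k _) (x j _)]
  ring

lemma sort_four {P : ℤ → ℤ → ℤ → ℤ → Prop} (s12 : ∀ a b c d, P a b c d → P b a c d)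
    (s23 : ∀ a b c d, P a b c d → P a c b d) (s34 : ∀ a b c d, P a b c d → P a b d c)
    (h : ∀ a b c d, a ≤ b → b ≤ c → c ≤ d → P a b c d) (a b c d : ℤ) : P a b c d := by
  have hB : ∀ a b c d, a ≤ b → b ≤ c → P a b c d := by
    intro a b c d hab hbc
    rcases le_total c d with h1 | h1
    · exact h _ _ _ _ hab hbc h1
    refine s34 _ _ _ _ ?_
    rcases le_total b d with h2 | h2
    · exact h _ _ _ _ hab h2 h1
    refine s23 _ _ _ _ ?_
    rcases le_total a d with h3 | h3
    · exact h _ _ _ _ h3 h2 hbc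
    exact s12 _ _ _ _ (h _ _ _ _ h3 hab hbc)
  have hC : ∀ a b c d, a ≤ b → P a b c d := by
    intro a b c d hab
    rcases le_total b c with h2 | h2
    · exact hB _ _ _ _ hab h2
    refine s23 _ _ _ _ ?_
    rcases le_total a c with h3 | h3
    · exact hB _ _ _ _ h3 h2
    exact s12 _ _ _ _ (hB _ _ _ _ h3 hab)
  rcases le_total a b with h3 | h3
  · exact hC _ _ _ _ h3
  · exact s12 _ _ _ _ (hC _ _ _ _ h3)

lemma Regular.exists_cum4_sorted_le [IsProbabilityMeasure μ] (h : Regular μ X r q C) (M : ℝ) :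
    ∃ K, 1 ≤ K ∧ ∀ x : ℤ → Ω → ℝ, Adm μ X q M x → ∀ i j k l : ℤ, i ≤ j → j ≤ k → k ≤ l →
      ∀ t : ℕ, (i + t ≤ j ∨ j + t ≤ k ∨ k + t ≤ l) →
      |cum4 μ x i j k l| ≤ K / (1 + (t : ℝ)) ^ 7 := by
  obtain ⟨K₂, hK₂, hcov⟩ := h.exists_cov_le M
  refine ⟨max 1 ((4 + 2 * ((1 + M) + ((1 + M) + (1 + M) + (1 + M)))) * C + 3 * K₂ ^ 2),
    le_max_left _ _, fun x hx i j k l hij hjk hkl t ht => ?_⟩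
  have hC := h.one_le
  have hb := hx.blk h.meas (P := 12) (by norm_num) h.twelve_le
  have hM := hb.nonneg
  have hm := hx.measurable h.meas
  have hbd : ∀ a b : ℤ, |∫ ω, x a ω * x b ω ∂μ| ≤ K₂ := fun a b => by
    simpa using hcov x x hx hx a b 0 (by simp)
  have hfar : ∀ a b : ℤ, a + t ≤ b → |∫ ω, x a ω * x b ω ∂μ| ≤ K₂ / (1 + (t : ℝ)) ^ 7 :=
    fun a b hab => hcov x x hx hx a b t (by rw [abs_sub_comm]; exact le_abs.2 (Or.inl (by omega)))
  have ht1 : 0 ≤ K₂ / (1 + (t : ℝ)) ^ 7 := by positivity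
  have hpr : ∀ a b c e : ℤ, a + t ≤ b ∨ c + t ≤ e →
      |(∫ ω, x a ω * x b ω ∂μ) * ∫ ω, x c ω * x e ω ∂μ| ≤ K₂ ^ 2 / (1 + (t : ℝ)) ^ 7 := by
    intro a b c e hh
    have e1 : K₂ ^ 2 / (1 + (t : ℝ)) ^ 7 = K₂ / (1 + (t : ℝ)) ^ 7 * K₂ := by ring
    rw [abs_mul, e1]
    rcases hh with hh | hh
    · exact mul_le_mul (hfar _ _ hh) (hbd _ _) (abs_nonneg _) ht1
    · rw [mul_comm]
      exact mul_le_mul (hfar _ _ hh) (hbd _ _) (abs_nonneg _) ht1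
  have hpow2 : ∀ a b : ℤ, Integrable (fun ω => |x a ω * x b ω| ^ (6 : ℝ)) μ ∧
      ∫ ω, |x a ω * x b ω| ^ (6 : ℝ) ∂μ ≤ (1 + M) + (1 + M) := fun a b => by
    rw [show (6 : ℝ) = 12 / 2 by norm_num]
    exact ⟨integrable_abs_mul_rpow_half (by norm_num) (hm a) (hm b) (hb.int a) (hb.int b),
      integral_abs_mul_rpow_half_le (by norm_num) (hm a) (hm b) (hb.int a) (hb.int b)
        (hb.bound a) (hb.bound b)⟩
  have hpow3 : ∀ a b c : ℤ, Integrable (fun ω => |x a ω * (x b ω * x c ω)| ^ (4 : ℝ)) μ ∧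
      ∫ ω, |x a ω * (x b ω * x c ω)| ^ (4 : ℝ) ∂μ ≤ (1 + M) + (1 + M) + (1 + M) := by
    intro a b c
    rw [show (4 : ℝ) = 12 / 3 by norm_num]
    have h2 : Integrable (fun ω => |x a ω| ^ (12 : ℝ) + |x b ω| ^ (12 : ℝ)) μ :=
      (hb.int a).add (hb.int b)
    have hi : Integrable (fun ω => |x a ω * (x b ω * x c ω)| ^ ((12 : ℝ) / 3)) μ := by
      refine (h2.add (hb.int c)).mono' (((hm a).mul ((hm b).mul (hm c))).abs.pow_const
        _).aestronglyMeasurable (ae_of_all _ fun ω => ?_)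
      rw [Real.norm_eq_abs, abs_of_nonneg (by positivity)]
      exact abs_mul_mul_rpow_third_le (by norm_num)
    refine ⟨hi, (integral_mono hi (h2.add (hb.int c)) fun ω =>
      abs_mul_mul_rpow_third_le (by norm_num)).trans ?_⟩
    simp only [Pi.add_apply]
    rw [integral_add h2 (hb.int c), integral_add (hb.int a) (hb.int b)]
    linarith [hb.bound a, hb.bound b, hb.bound c]
  have hms : ∀ (a : ℤ) (S : Set ℤ), a ∈ S → Measurable[sigmaOf X S] (x a) := fun a S ha =>
    hx.measurable_sigmaOf ha
  have fin : ∀ E P₁ P₂ P₃ L : ℝ, |E| ≤ L * C / (1 + (t : ℝ)) ^ 7 →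
      L ≤ 4 + 2 * ((1 + M) + ((1 + M) + (1 + M) + (1 + M))) →
      |P₁| ≤ K₂ ^ 2 / (1 + (t : ℝ)) ^ 7 → |P₂| ≤ K₂ ^ 2 / (1 + (t : ℝ)) ^ 7 →
      |P₃| ≤ K₂ ^ 2 / (1 + (t : ℝ)) ^ 7 →
      |E - P₁ - P₂ - P₃| ≤ max 1 ((4 + 2 * ((1 + M) + ((1 + M) + (1 + M) + (1 + M)))) * C +
        3 * K₂ ^ 2) / (1 + (t : ℝ)) ^ 7 := by
    intro E P₁ P₂ P₃ L hE hL h1 h2 h3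
    have h4 : |E - P₁ - P₂ - P₃| ≤ |E| + |P₁| + |P₂| + |P₃| := by
      rw [abs_le]
      constructor <;> linarith [neg_abs_le E, le_abs_self E, neg_abs_le P₁, le_abs_self P₁,
        neg_abs_le P₂, le_abs_self P₂, neg_abs_le P₃, le_abs_self P₃]
    calc _ ≤ _ := h4
      _ ≤ (L * C + 3 * K₂ ^ 2) / (1 + (t : ℝ)) ^ 7 := by
        rw [add_div, mul_div_assoc 3]; linarith
      _ ≤ _ := by
        gcongr
        refine le_max_of_le_right ?_
        gcongr
  rcases ht with ht | ht | ht
  · have := h.abs_cov_le (S := {a | a ≤ i}) (T := {a | i + t ≤ a}) (s := i) (k := t)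
      (fun a ha => ha) (fun a ha => ha) (p := 12) (p' := 4) (m := 7) (by norm_num) (by norm_num)
      (by norm_num) (hms i _ (by simp))
      ((hms j _ (by simp only [Set.mem_ofPred_eq]; omega)).mul
        ((hms k _ (by simp only [Set.mem_ofPred_eq]; omega)).mul
          (hms l _ (by simp only [Set.mem_ofPred_eq]; omega)))) (hb.int i) (hpow3 j k l).1
      (hb.bound i) (hpow3 j k l).2
    rw [hb.mean, zero_mul, sub_zero] at this
    unfold cum4
    simp_rw [mul_assoc (x i _)] at this ⊢
    exact fin _ _ _ _ _ this le_rfl (hpr _ _ _ _ (by omega)) (hpr _ _ _ _ (by omega))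
      (hpr _ _ _ _ (by omega))
  · have := h.abs_cov_le (S := {a | a ≤ j}) (T := {a | j + t ≤ a}) (s := j) (k := t)
      (fun a ha => ha) (fun a ha => ha) (p := 6) (p' := 6) (m := 7) (by norm_num) (by norm_num)
      (by norm_num) ((hms i _ hij).mul (hms j _ (by simp)))
      ((hms k _ (by simp only [Set.mem_ofPred_eq]; omega)).mul
          (hms l _ (by simp only [Set.mem_ofPred_eq]; omega))) (hpow2 i j).1 (hpow2 k l).1
      (hpow2 i j).2 (hpow2 k l).2
    have h0 : |(0 : ℝ)| ≤ K₂ ^ 2 / (1 + (t : ℝ)) ^ 7 := by rw [abs_zero]; positivity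
    have := fin _ 0 _ _ _ this (by linarith) h0 (hpr i k j l (by omega)) (hpr i l j k (by omega))
    rw [sub_zero] at this
    exact this
  · have := h.abs_cov_le (S := {a | a ≤ k}) (T := {a | k + t ≤ a}) (s := k) (k := t)
      (fun a ha => ha) (fun a ha => ha) (p := 4) (p' := 12) (m := 7) (by norm_num) (by norm_num)
      (by norm_num)
      ((hms i _ (by simp only [Set.mem_ofPred_eq]; omega)).mul
        ((hms j _ (by simp only [Set.mem_ofPred_eq]; omega)).mul
          (hms k _ (by simp only [Set.mem_ofPred_eq]; omega))))
      (hms l _ (by simp only [Set.mem_ofPred_eq]; omega)) (hpow3 i j k).1 (hb.int l)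
      (hpow3 i j k).2 (hb.bound l)
    rw [hb.mean, mul_zero, sub_zero] at this
    unfold cum4
    simp only [Pi.mul_apply, mul_assoc] at this
    simp_rw [mul_assoc (x i _)]
    exact fin _ _ _ _ _ this (le_of_eq (by ring)) (hpr _ _ _ _ (by omega)) (hpr _ _ _ _ (by omega))
      (hpr _ _ _ _ (by omega))

lemma Regular.exists_cum4_le [IsProbabilityMeasure μ] (h : Regular μ X r q C) (M : ℝ) :
    ∃ K, 1 ≤ K ∧ ∀ x : ℤ → Ω → ℝ, Adm μ X q M x → ∀ i j k l : ℤ, ∀ D : ℕ,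
      (D ≤ |i - j| ∨ D ≤ |i - k| ∨ D ≤ |i - l| ∨ D ≤ |j - k| ∨ D ≤ |j - l| ∨ D ≤ |k - l|) →
      |cum4 μ x i j k l| ≤ K / (1 + (D : ℝ)) ^ 7 := by
  obtain ⟨K, hK, hs⟩ := h.exists_cum4_sorted_le M
  refine ⟨3 ^ 7 * K, by linarith, fun x hx => ?_⟩
  refine sort_four ?_ ?_ ?_ ?_
  · intro a b c e hh D hD
    rw [cum4_swap12]
    exact hh D (by rw [abs_sub_comm a b]; tauto)
  · intro a b c e hh D hD
    rw [cum4_swap23]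
    exact hh D (by rw [abs_sub_comm b c]; tauto)
  · intro a b c e hh D hD
    rw [cum4_swap34]
    exact hh D (by rw [abs_sub_comm c e]; tauto)
  · intro i j k l hij hjk hkl D hD
    refine (hs x hx i j k l hij hjk hkl (D / 3) ?_).trans
      (div_one_add_pow_le (by linarith) (by omega))
    simp only [le_abs] at hD
    omega

end Cumulants

section LinearFunctionals

/-- Linear functionals of the observations. -/
abbrev LinForm (d : ℕ) := (Fin d → ℝ) →L[ℝ] ℝ

variable {μ : Measure Ω} {X : ℤ → Ω → Fin d → ℝ} {r : ℕ} {q C : ℝ}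

lemma IsStationary.integral_eq (hs : IsStationary μ X) (hX : ∀ i, Measurable (X i))
    {F : (ℤ → Fin d → ℝ) → ℝ} (hF : Measurable F) (k : ℤ) :
    ∫ ω, F (fun i => X (i + k) ω) ∂μ = ∫ ω, F (fun i => X i ω) ∂μ := by
  rw [← integral_map (f := F) (measurable_pi_lambda _ fun i => hX (i + k)).aemeasurable
      hF.aestronglyMeasurable,
    ← integral_map (f := F) (measurable_pi_lambda _ fun i => hX i).aemeasurable
      hF.aestronglyMeasurable, hs k]

lemma IsStationary.integrable_iff (hs : IsStationary μ X) (hX : ∀ i, Measurable (X i))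
    {F : (ℤ → Fin d → ℝ) → ℝ} (hF : Measurable F) (k : ℤ) :
    Integrable (fun ω => F (fun i => X (i + k) ω)) μ ↔
      Integrable (fun ω => F (fun i => X i ω)) μ := by
  have h1 := integrable_map_measure (μ := μ) (g := F)
    (f := fun ω => fun i : ℤ => X (i + k) ω) hF.aestronglyMeasurable
    (measurable_pi_lambda _ fun i => hX (i + k)).aemeasurable
  have h2 := integrable_map_measure (μ := μ) (g := F)
    (f := fun ω => fun i : ℤ => X i ω) hF.aestronglyMeasurable
    (measurable_pi_lambda _ fun i => hX i).aemeasurable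
  rw [hs k] at h1
  exact h1.symm.trans h2

/-- The centered process obtained by applying a linear functional. -/
def lin (μ : Measure Ω) (X : ℤ → Ω → Fin d → ℝ) (φ : LinForm d) (i : ℤ) (ω : Ω) : ℝ :=
  φ (X i ω - meanVec μ X)

lemma Regular.integrable_norm_rpow (h : Regular μ X r q C) (i : ℤ) :
    Integrable (fun ω => ‖X i ω‖ ^ q) μ := by
  have := (h.stat.integrable_iff h.meas (F := fun f => ‖f 1‖ ^ q)
    (by fun_prop) (i - 1)).2 h.int
  simpa using this

lemma Regular.integrable_norm_pow [IsProbabilityMeasure μ] (h : Regular μ X r q C) (i : ℤ) {j : ℕ}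
    (hj : j ≤ 2 * r) : Integrable (fun ω => ‖X i ω‖ ^ j) μ := by
  refine ((integrable_const (1 : ℝ)).add (h.integrable_norm_rpow i)).mono'
    ((h.meas i).norm.pow_const j).aestronglyMeasurable (ae_of_all _ fun ω => ?_)
  rw [Real.norm_eq_abs, abs_of_nonneg (by positivity)]
  have := abs_rpow_le_one_add (x := ‖X i ω‖) (p := (j : ℝ)) (q := q) (by positivity)
    (by have := h.lt; have : (j : ℝ) ≤ 2 * r := by exact_mod_cast hj
        linarith)
  simpa [Real.rpow_natCast] using this

lemma Regular.integrable_coord [IsProbabilityMeasure μ] (h : Regular μ X r q C) (i : ℤ) :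
    Integrable (X i) μ := by
  have := h.six_le
  have h1 := h.integrable_norm_pow i (j := 1) (by omega)
  simp only [pow_one] at h1
  exact (integrable_norm_iff (h.meas i).aestronglyMeasurable).1 h1

lemma Regular.integral_coord [IsProbabilityMeasure μ] (h : Regular μ X r q C) (i : ℤ) :
    ∫ ω, X i ω ∂μ = meanVec μ X := by
  funext j
  have h1 := h.stat.integral_eq h.meas (F := fun f => f 1 j) (by fun_prop) (i - 1)
  have h2 := (ContinuousLinearMap.proj (R := ℝ) (φ := fun _ : Fin d => ℝ) j).integral_comp_comm
    (h.integrable_coord i)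
  simp only [ContinuousLinearMap.proj_apply] at h2
  rw [← h2]
  simpa [meanVec] using h1

lemma Regular.lin_mean [IsProbabilityMeasure μ] (h : Regular μ X r q C)
    (φ : LinForm d) (i : ℤ) : ∫ ω, lin μ X φ i ω ∂μ = 0 := by
  unfold lin
  have hi : Integrable (fun ω => X i ω - meanVec μ X) μ :=
    (h.integrable_coord i).sub (integrable_const _)
  rw [φ.integral_comp_comm hi, integral_sub (h.integrable_coord i) (integrable_const _), h.integral_coord]
  simp

lemma add_rpow_le {x y p : ℝ} (hx : 0 ≤ x) (hy : 0 ≤ y) (hp : 0 ≤ p) :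
    (x + y) ^ p ≤ 2 ^ p * (x ^ p + y ^ p) := by
  have h1 : x + y ≤ 2 * max x y := by
    linarith [le_max_left x y, le_max_right x y]
  calc (x + y) ^ p ≤ (2 * max x y) ^ p := Real.rpow_le_rpow (by positivity) h1 hp
    _ = 2 ^ p * (max x y) ^ p := Real.mul_rpow (by norm_num) (by positivity)
    _ ≤ _ := by
      have h2 := Real.rpow_nonneg hx p
      have h3 := Real.rpow_nonneg hy p
      gcongr
      rcases max_choice x y with hh | hh <;> rw [hh] <;> linarith

lemma Regular.exists_adm_lin [IsProbabilityMeasure μ] (h : Regular μ X r q C) (B : ℝ) :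
    ∃ M, 0 ≤ M ∧ ∀ φ : LinForm d, ‖φ‖ ≤ B → Adm μ X q M (lin μ X φ) := by
  have hq : 0 ≤ q := by linarith [h.lt_q]
  have hi : ∀ i, Integrable (fun ω => ‖X i ω - meanVec μ X‖ ^ q) μ := fun i => by
    refine (((h.integrable_norm_rpow i).add (integrable_const (‖meanVec μ X‖ ^ q))).const_mul
      (2 ^ q)).mono' (((h.meas i).sub measurable_const).norm.pow_const q).aestronglyMeasurable
      (ae_of_all _ fun ω => ?_)
    rw [Real.norm_eq_abs, abs_of_nonneg (by positivity)]
    exact (Real.rpow_le_rpow (norm_nonneg _) (norm_sub_le _ _) hq).trans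
      (add_rpow_le (norm_nonneg _) (norm_nonneg _) hq)
  have hst : ∀ i, ∫ ω, ‖X i ω - meanVec μ X‖ ^ q ∂μ = ∫ ω, ‖X 0 ω - meanVec μ X‖ ^ q ∂μ :=
    fun i => by
      have := h.stat.integral_eq h.meas (F := fun f => ‖f 0 - meanVec μ X‖ ^ q) (by fun_prop) i
      simpa using this
  refine ⟨|B| ^ q * ∫ ω, ‖X 0 ω - meanVec μ X‖ ^ q ∂μ,
    mul_nonneg (by positivity) (integral_nonneg fun ω => by positivity), fun φ hφ => ?_⟩
  have hle : ∀ i ω, |lin μ X φ i ω| ^ q ≤ |B| ^ q * ‖X i ω - meanVec μ X‖ ^ q := fun i ω => by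
    rw [← Real.mul_rpow (abs_nonneg _) (norm_nonneg _)]
    refine Real.rpow_le_rpow (abs_nonneg _) ?_ hq
    refine (φ.le_opNorm _).trans ?_
    gcongr
    exact hφ.trans (le_abs_self B)
  have hm : ∀ i, Measurable[MeasurableSpace.comap (X i) inferInstance] (lin μ X φ i) := fun i =>
    (φ.measurable.comp (measurable_id.sub measurable_const)).comp (comap_measurable (X i))
  have hint : ∀ i, Integrable (fun ω => |lin μ X φ i ω| ^ q) μ := fun i => by
    refine ((hi i).const_mul (|B| ^ q)).mono'
      (((hm i).mono (h.meas i).comap_le le_rfl).abs.pow_const q).aestronglyMeasurable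
      (ae_of_all _ fun ω => ?_)
    rw [Real.norm_eq_abs, abs_of_nonneg (by positivity)]
    exact hle i ω
  refine ⟨hm, hint, fun i => ?_, h.lin_mean φ⟩
  rw [← hst i, ← integral_const_mul]
  exact integral_mono (hint i) ((hi i).const_mul _) (hle i)

/-- Cross-covariance function of two linear functionals of the process. -/
def ccov (μ : Measure Ω) (X : ℤ → Ω → Fin d → ℝ) (φ ψ : LinForm d) (k : ℤ) : ℝ :=
  ∫ ω, lin μ X φ 0 ω * lin μ X ψ k ω ∂μ

lemma Regular.integral_lin_mul_lin (h : Regular μ X r q C) (φ ψ : LinForm d)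
    (a b : ℤ) : ∫ ω, lin μ X φ a ω * lin μ X ψ b ω ∂μ = ccov μ X φ ψ (b - a) := by
  have := h.stat.integral_eq h.meas
    (F := fun f => φ (f 0 - meanVec μ X) * ψ (f (b - a) - meanVec μ X)) (by fun_prop) a
  simpa [ccov, lin] using this

lemma Regular.rcov_eq [IsProbabilityMeasure μ] (h : Regular μ X r q C) (H : (Fin d → ℝ) → ℝ)
    (k : ℤ) : rcov μ X H k =
      ccov μ X (fderiv ℝ H (meanVec μ X)) (fderiv ℝ H (meanVec μ X)) k := by
  have h0 : ∫ ω, Ylin μ X H 0 ω ∂μ = 0 := h.lin_mean (fderiv ℝ H (meanVec μ X)) 0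
  rw [rcov, h0, zero_mul, sub_zero]
  rfl

end LinearFunctionals

section Decay

/-- A summable weight on the integers. -/
def dec (h : ℤ) : ℝ := 1 / (1 + |(h : ℝ)|) ^ 2

/-- The total mass of the weight `dec`. -/
def decSum : ℝ := ∑' h : ℤ, dec h

lemma dec_pos (h : ℤ) : 0 < dec h := by unfold dec; positivity

lemma dec_neg (h : ℤ) : dec (-h) = dec h := by simp [dec]

lemma dec_sub_comm (a b : ℤ) : dec (a - b) = dec (b - a) := by rw [← dec_neg, neg_sub]

lemma summable_dec : Summable dec := by
  have h1 : Summable fun n : ℕ => dec n := by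
    have := summable_one_add_rpow (γ := 2) (by norm_num)
    refine this.congr fun k => ?_
    rw [Real.rpow_neg (by positivity), Real.rpow_two]
    simp [dec]
  refine Summable.of_nat_of_neg h1 ?_
  simpa [dec_neg] using h1

lemma decSum_ge_one : 1 ≤ decSum := by
  have := summable_dec.le_tsum 0 fun j _ => (dec_pos j).le
  simpa [dec, decSum] using this

lemma sum_dec_le (S : Finset ℤ) (a : ℤ) : ∑ b ∈ S, dec (b - a) ≤ decSum := by
  have h1 : Summable fun b : ℤ => dec (b - a) :=
    summable_dec.comp_injective (sub_left_injective)
  calc _ ≤ ∑' b : ℤ, dec (b - a) := h1.sum_le_tsum _ fun j _ => (dec_pos _).le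
    _ = ∑' b : ℤ, dec b := (Equiv.subRight a).tsum_eq (fun b => dec b)
    _ = decSum := rfl

lemma sum_dec_le' (S : Finset ℤ) (a : ℤ) : ∑ b ∈ S, dec (a - b) ≤ decSum := by
  simp_rw [dec_sub_comm a]
  exact sum_dec_le S a

/-- Polynomial decay of a sequence on the integers. -/
def Decays (K : ℝ) (r : ℤ → ℝ) : Prop := ∀ h : ℤ, |r h| * (1 + |(h : ℝ)|) ^ 5 ≤ K * dec h

variable {K : ℝ} {r : ℤ → ℝ}

lemma decays_of_le (h : ∀ a : ℤ, |r a| ≤ K / (1 + |(a : ℝ)|) ^ 7) : Decays K r := fun a => by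
  calc _ ≤ K / (1 + |(a : ℝ)|) ^ 7 * (1 + |(a : ℝ)|) ^ 5 := by gcongr; exact h a
    _ = K * dec a := by
      unfold dec
      have : (1 + |(a : ℝ)|) ≠ 0 := by positivity
      field_simp

lemma Decays.nonneg (h : Decays K r) : 0 ≤ K := by
  have h1 := h 0
  have h2 : 0 ≤ |r 0| * (1 + |((0 : ℤ) : ℝ)|) ^ 5 := by positivity
  have h3 : dec 0 = 1 := by simp [dec]
  rw [h3] at h1
  linarith

lemma Decays.mul_pow_le (h : Decays K r) {j : ℕ} (hj : j ≤ 5) (a : ℤ) :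
    |r a| * (1 + |(a : ℝ)|) ^ j ≤ K * dec a := by
  refine le_trans ?_ (h a)
  gcongr
  linarith [abs_nonneg (a : ℝ)]

lemma Decays.abs_le (h : Decays K r) (a : ℤ) : |r a| ≤ K * dec a := by
  simpa using h.mul_pow_le (j := 0) (by norm_num) a

lemma Decays.sum_abs_le (h : Decays K r) (S : Finset ℤ) (a : ℤ) :
    ∑ b ∈ S, |r (b - a)| ≤ K * decSum := by
  refine (Finset.sum_le_sum fun b _ => h.abs_le (b - a)).trans ?_
  rw [← Finset.mul_sum]
  exact mul_le_mul_of_nonneg_left (sum_dec_le S a) h.nonneg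

lemma abs_tsum_sub_sum_le {g : ℤ → ℝ} {K : ℝ} {j m : ℕ} {S : Finset ℤ} (hK : 0 ≤ K)
    (hg : ∀ a : ℤ, |g a| * (1 + |(a : ℝ)|) ^ j ≤ K * dec a)
    (hS : ∀ a : ℤ, |a| < m → a ∈ S) (hm : 1 ≤ m) :
    |∑' a, g a - ∑ a ∈ S, g a| ≤ K * decSum / (m : ℝ) ^ j := by
  have hm0 : (0 : ℝ) < m := by exact_mod_cast hm
  have hb : ∀ a, |g a| ≤ K * dec a := fun a => by
    refine le_trans ?_ (hg a)
    refine le_mul_of_one_le_right (abs_nonneg _) (one_le_pow₀ ?_)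
    linarith [abs_nonneg (a : ℝ)]
  have hs : Summable g := Summable.of_norm_bounded (summable_dec.mul_left K) hb
  rw [← hs.sum_add_tsum_compl (s := S), add_sub_cancel_left]
  have hsub : Summable fun x : ((S : Set ℤ)ᶜ : Set ℤ) => K / (m : ℝ) ^ j * dec x :=
    (summable_dec.mul_left _).subtype _
  have hle : ∀ x : ((S : Set ℤ)ᶜ : Set ℤ), ‖g x‖ ≤ K / (m : ℝ) ^ j * dec x := fun x => by
    have hx : (m : ℤ) ≤ |(x : ℤ)| := by
      by_contra hlt
      exact x.2 (hS x (not_le.1 hlt))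
    have hx' : (m : ℝ) ≤ 1 + |((x : ℤ) : ℝ)| := by
      have : (m : ℝ) ≤ |((x : ℤ) : ℝ)| := by exact_mod_cast hx
      linarith
    have h1 : |g x| * (m : ℝ) ^ j ≤ K * dec x := by
      refine le_trans ?_ (hg x)
      gcongr
    rw [Real.norm_eq_abs, div_mul_eq_mul_div, le_div_iff₀ (by positivity)]
    exact h1
  refine (tsum_of_norm_bounded hsub.hasSum hle).trans ?_
  have h2 : ∑' x : ((S : Set ℤ)ᶜ : Set ℤ), K / (m : ℝ) ^ j * dec x ≤
      ∑' x : ℤ, K / (m : ℝ) ^ j * dec x :=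
    Summable.tsum_subtype_le (fun x : ℤ => K / (m : ℝ) ^ j * dec x) ((S : Set ℤ)ᶜ) (fun x => by
      have := dec_pos x
      positivity) (summable_dec.mul_left _)
  refine h2.trans (le_of_eq ?_)
  rw [tsum_mul_left, decSum]
  ring

lemma Decays.abs_tsum_le (h : Decays K r) : |∑' a, r a| ≤ K * decSum := by
  refine (tsum_of_norm_bounded (f := r) (summable_dec.mul_left K).hasSum h.abs_le).trans ?_
  rw [tsum_mul_left, decSum]

lemma Decays.abs_window_le (h : Decays K r) {S : Finset ℤ} {a : ℤ} {m : ℕ} (hm : 1 ≤ m)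
    (hS : ∀ b : ℤ, |b - a| < m → b ∈ S) :
    |∑' b, r b - ∑ b ∈ S, r (b - a)| ≤ K * decSum / (m : ℝ) := by
  have e : ∑ b ∈ S, r (b - a) = ∑ b ∈ S.image (fun b => b - a), r b := by
    rw [Finset.sum_image]
    intro x _ y _ hxy
    simpa using hxy
  rw [e]
  have := abs_tsum_sub_sum_le (g := r) (j := 1) (m := m) (S := S.image (fun b => b - a)) h.nonneg
    (fun a => h.mul_pow_le (by norm_num) a)
    (fun b hb => Finset.mem_image.2 ⟨b + a, hS _ (by simpa using hb), by ring⟩) hm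
  simpa using this

end Decay

section Triangle

lemma sum_Icc_symm_succ (f : ℤ → ℝ) (k : ℕ) :
    ∑ x ∈ Finset.Icc (-((k + 1 : ℕ) : ℤ)) ((k + 1 : ℕ) : ℤ), f x =
      ∑ x ∈ Finset.Icc (-(k : ℤ)) k, f x + f (k + 1) + f (-(k + 1)) := by
  have e : Finset.Icc (-((k + 1 : ℕ) : ℤ)) ((k + 1 : ℕ) : ℤ) =
      insert ((k : ℤ) + 1) (insert (-((k : ℤ) + 1)) (Finset.Icc (-(k : ℤ)) k)) := by
    ext x
    simp only [Finset.mem_Icc, Finset.mem_insert]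
    push_cast
    omega
  rw [e, Finset.sum_insert, Finset.sum_insert]
  · ring
  · simp only [Finset.mem_Icc]; omega
  · simp only [Finset.mem_Icc, Finset.mem_insert]; omega

lemma sum_sq_sub_abs (l : ℝ) (k : ℕ) :
    ∑ x ∈ Finset.Icc (-(k : ℤ)) k, (l - |(x : ℝ)|) ^ 2 =
      l ^ 2 + 2 * (k * l ^ 2 - l * k * (k + 1) + k * (k + 1) * (2 * k + 1) / 6) := by
  induction k with
  | zero => simp
  | succ k ih =>
    rw [sum_Icc_symm_succ, ih]
    have h1 : |(((k : ℤ) + 1 : ℤ) : ℝ)| = k + 1 := by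
      push_cast; rw [abs_of_nonneg (by positivity)]
    have h2 : |((-((k : ℤ) + 1) : ℤ) : ℝ)| = k + 1 := by
      rw [Int.cast_neg, abs_neg, h1]
    rw [h1, h2]
    push_cast
    ring

lemma sum_sum_sub (g : ℤ → ℝ) (l : ℕ) :
    ∑ s ∈ Finset.range l, ∑ t ∈ Finset.range l, g ((t : ℤ) - s) =
      ∑ x ∈ Finset.Icc (-(l : ℤ)) l, ((l : ℝ) - |(x : ℝ)|) * g x := by
  induction l with
  | zero => simp
  | succ l ih =>
    have hA : ∀ k : ℕ, ∑ x ∈ Finset.Icc (-(k : ℤ)) k, g x =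
        g 0 + ∑ s ∈ Finset.range k, (g (s + 1) + g (-(s + 1))) := by
      intro k
      induction k with
      | zero => simp
      | succ k ihk => rw [sum_Icc_symm_succ, ihk, Finset.sum_range_succ]; ring
    rw [sum_Icc_symm_succ]
    have h1 : |(((l : ℤ) + 1 : ℤ) : ℝ)| = l + 1 := by
      push_cast; rw [abs_of_nonneg (by positivity)]
    have h2 : |((-((l : ℤ) + 1) : ℤ) : ℝ)| = l + 1 := by
      rw [Int.cast_neg, abs_neg, h1]
    rw [h1, h2]
    push_cast
    have e1 : ∑ x ∈ Finset.Icc (-(l : ℤ)) l, ((l : ℝ) + 1 - |(x : ℝ)|) * g x =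
        ∑ x ∈ Finset.Icc (-(l : ℤ)) l, ((l : ℝ) - |(x : ℝ)|) * g x +
          ∑ x ∈ Finset.Icc (-(l : ℤ)) l, g x := by
      rw [← Finset.sum_add_distrib]
      exact Finset.sum_congr rfl fun x _ => by ring
    rw [e1, ← ih, hA, Finset.sum_range_succ]
    simp_rw [Finset.sum_range_succ]
    rw [Finset.sum_add_distrib, Finset.sum_add_distrib]
    have e2 : ∑ s ∈ Finset.range l, g ((l : ℤ) - s) = ∑ s ∈ Finset.range l, g (s + 1) := by
      rw [← Finset.sum_range_reflect]
      refine Finset.sum_congr rfl fun s hs => ?_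
      have := Finset.mem_range.1 hs
      congr 1; omega
    have e3 : ∑ s ∈ Finset.range l, g ((s : ℤ) - l) = ∑ s ∈ Finset.range l, g (-(s + 1)) := by
      rw [← Finset.sum_range_reflect]
      refine Finset.sum_congr rfl fun s hs => ?_
      have := Finset.mem_range.1 hs
      congr 1; omega
    rw [e2, e3, sub_self]
    ring

end Triangle

section BlockKernel

/-- Number of the `N` overlapping blocks of length `l` containing both `a` and `b`. -/
def cnt (N l : ℕ) (a b : ℤ) : ℤ := max 0 (min (N : ℤ) (min a b) - max 0 (max a b - (l : ℤ)))

/-- The data index set. -/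
def dat (N l : ℕ) : Finset ℤ := Finset.Icc 1 (N + l - 1)

/-- Normalised block kernel. -/
def ker (N l : ℕ) (a b : ℤ) : ℝ := (cnt N l a b : ℝ) / (N * l)

/-- Weights of the average of the block means. -/
def wgt (N l : ℕ) (a : ℤ) : ℝ := ker N l a a

/-- The `i`-th block sum. -/
def bsum (l : ℕ) (x : ℤ → ℝ) (i : ℕ) : ℝ := ∑ t ∈ Finset.range l, x (i + 1 + t)

variable {N l : ℕ}

lemma bsum_eq_sum_dat (x : ℤ → ℝ) {i : ℕ} (hi : i < N) :
    bsum l x i = ∑ a ∈ dat N l, if (i : ℤ) + 1 ≤ a ∧ a ≤ i + l then x a else 0 := by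
  rw [← Finset.sum_filter, bsum]
  refine Finset.sum_bij' (fun t _ => (i : ℤ) + 1 + t) (fun a _ => (a - (i + 1)).toNat) ?_ ?_ ?_ ?_ ?_
  · intro t ht
    have := Finset.mem_range.1 ht
    simp only [dat, Finset.mem_filter, Finset.mem_Icc]
    omega
  · intro a ha
    simp only [dat, Finset.mem_filter, Finset.mem_Icc] at ha
    rw [Finset.mem_range]
    omega
  · intro t _
    omega
  · intro a ha
    simp only [dat, Finset.mem_filter, Finset.mem_Icc] at ha
    omega
  · intro t _
    rfl

lemma sum_indicator_eq_cnt (a b : ℤ) :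
    (∑ i ∈ Finset.range N, if ((i : ℤ) + 1 ≤ a ∧ a ≤ i + l) ∧ ((i : ℤ) + 1 ≤ b ∧ b ≤ i + l)
      then (1 : ℝ) else 0) = cnt N l a b := by
  rw [← Finset.sum_filter, Finset.sum_const, nsmul_eq_mul, mul_one]
  have : ((Finset.range N).filter fun i : ℕ =>
      ((i : ℤ) + 1 ≤ a ∧ a ≤ i + l) ∧ ((i : ℤ) + 1 ≤ b ∧ b ≤ i + l)) =
      Finset.Ico (max 0 (max a b - l)).toNat (min (N : ℤ) (min a b)).toNat := by
    ext i
    simp only [Finset.mem_filter, Finset.mem_range, Finset.mem_Ico]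
    omega
  rw [this, Nat.card_Ico, ← Int.cast_natCast]
  congr 1
  unfold cnt
  omega

/-- The average product of block sums as a bilinear form in the data. -/
lemma sum_bsum_mul (x y : ℤ → ℝ) :
    (∑ i ∈ Finset.range N, bsum l x i * bsum l y i) / (N * l) =
      ∑ a ∈ dat N l, ∑ b ∈ dat N l, ker N l a b * (x a * y b) := by
  have e : ∑ i ∈ Finset.range N, bsum l x i * bsum l y i =
      ∑ a ∈ dat N l, ∑ b ∈ dat N l, (cnt N l a b : ℝ) * (x a * y b) := by
    have h1 : ∀ i ∈ Finset.range N, bsum l x i * bsum l y i =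
        ∑ a ∈ dat N l, ∑ b ∈ dat N l,
          (if ((i : ℤ) + 1 ≤ a ∧ a ≤ i + l) ∧ ((i : ℤ) + 1 ≤ b ∧ b ≤ i + l)
            then (1 : ℝ) else 0) * (x a * y b) := by
      intro i hi
      rw [bsum_eq_sum_dat x (Finset.mem_range.1 hi), bsum_eq_sum_dat y (Finset.mem_range.1 hi),
        Finset.sum_mul_sum]
      refine Finset.sum_congr rfl fun a _ => Finset.sum_congr rfl fun b _ => ?_
      by_cases ha : (i : ℤ) + 1 ≤ a ∧ a ≤ i + l <;> by_cases hb : (i : ℤ) + 1 ≤ b ∧ b ≤ i + l <;>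
        simp only [ha, hb, and_self, and_true, true_and, if_true, if_false, mul_zero, zero_mul,
          one_mul, and_false, false_and]
    rw [Finset.sum_congr rfl h1, Finset.sum_comm]
    refine Finset.sum_congr rfl fun a _ => ?_
    rw [Finset.sum_comm]
    refine Finset.sum_congr rfl fun b _ => ?_
    rw [← Finset.sum_mul, sum_indicator_eq_cnt]
  rw [e, Finset.sum_div]
  refine Finset.sum_congr rfl fun a _ => ?_
  rw [Finset.sum_div]
  refine Finset.sum_congr rfl fun b _ => ?_
  unfold ker
  ring

lemma sum_bsum (x : ℤ → ℝ) :
    (∑ i ∈ Finset.range N, bsum l x i) / (N * l) = ∑ a ∈ dat N l, wgt N l a * x a := by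
  have e : ∑ i ∈ Finset.range N, bsum l x i = ∑ a ∈ dat N l, (cnt N l a a : ℝ) * x a := by
    have h1 : ∀ i ∈ Finset.range N, bsum l x i =
        ∑ a ∈ dat N l, (if ((i : ℤ) + 1 ≤ a ∧ a ≤ i + l) ∧ ((i : ℤ) + 1 ≤ a ∧ a ≤ i + l)
            then (1 : ℝ) else 0) * x a := by
      intro i hi
      rw [bsum_eq_sum_dat x (Finset.mem_range.1 hi)]
      refine Finset.sum_congr rfl fun a _ => ?_
      simp only [and_self, ite_mul, one_mul, zero_mul]
    rw [Finset.sum_congr rfl h1, Finset.sum_comm]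
    refine Finset.sum_congr rfl fun a _ => ?_
    rw [← Finset.sum_mul, sum_indicator_eq_cnt]
  rw [e, Finset.sum_div]
  refine Finset.sum_congr rfl fun a _ => ?_
  unfold wgt ker
  ring

lemma cnt_nonneg (a b : ℤ) : 0 ≤ cnt N l a b := le_max_left _ _

lemma cnt_le (a b : ℤ) : cnt N l a b ≤ l := by unfold cnt; omega

lemma ker_nonneg (a b : ℤ) : 0 ≤ ker N l a b := by
  have : (0 : ℝ) ≤ cnt N l a b := by exact_mod_cast cnt_nonneg a b
  unfold ker
  positivity

lemma ker_le (hl : 1 ≤ l) (hN : 1 ≤ N) (a b : ℤ) : ker N l a b ≤ 1 / N := by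
  have h1 : (cnt N l a b : ℝ) ≤ l := by exact_mod_cast cnt_le a b
  have h2 : (0 : ℝ) < l := by exact_mod_cast hl
  have h3 : (0 : ℝ) < N := by exact_mod_cast hN
  unfold ker
  rw [div_le_div_iff₀ (by positivity) h3]
  nlinarith

lemma abs_ker_le (hl : 1 ≤ l) (hN : 1 ≤ N) (a b : ℤ) : |ker N l a b| ≤ 1 / N := by
  rw [abs_of_nonneg (ker_nonneg a b)]
  exact ker_le hl hN a b

lemma wgt_le (hl : 1 ≤ l) (hN : 1 ≤ N) (a : ℤ) : wgt N l a ≤ 1 / N := ker_le hl hN a a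

lemma abs_wgt_le (hl : 1 ≤ l) (hN : 1 ≤ N) (a : ℤ) : |wgt N l a| ≤ 1 / N :=
  abs_ker_le hl hN a a

lemma abs_ker_sub_le (a b c e : ℤ) :
    |ker N l a b - ker N l c e| ≤ (|((a - c : ℤ) : ℝ)| + |((b - e : ℤ) : ℝ)|) / (N * l) := by
  have h1 : |cnt N l a b - cnt N l c e| ≤ |a - c| + |b - e| := by
    have h2 : ∀ a b c : ℤ, |cnt N l a b - cnt N l c b| ≤ |a - c| := by
      intro a b c
      unfold cnt
      rcases abs_cases (a - c) with ⟨h, _⟩ | ⟨h, _⟩ <;> rw [h, abs_le] <;> omega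
    have h3 : ∀ a b : ℤ, cnt N l a b = cnt N l b a := by
      intro a b
      unfold cnt
      rw [min_comm a, max_comm a]
    have h5 := h2 b c e
    rw [h3 b c, h3 e c] at h5
    exact (abs_sub_le _ (cnt N l c b) _).trans (add_le_add (h2 a b c) h5)
  have h4 : |(cnt N l a b : ℝ) - cnt N l c e| ≤ |((a - c : ℤ) : ℝ)| + |((b - e : ℤ) : ℝ)| := by
    exact_mod_cast h1
  unfold ker
  rw [← sub_div, abs_div, abs_of_nonneg (by positivity : (0 : ℝ) ≤ N * l)]
  gcongr

lemma abs_ker_sub_wgt_le (a b : ℤ) :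
    |ker N l a b - wgt N l a| ≤ |((a - b : ℤ) : ℝ)| / (N * l) := by
  have := abs_ker_sub_le (N := N) (l := l) a b a a
  rw [wgt]
  rw [show (b - a : ℤ) = -(a - b) by ring] at this
  simpa only [sub_self, Int.cast_zero, abs_zero, zero_add, Int.cast_neg, abs_neg] using this

lemma ker_eq_zero {a b : ℤ} (h : a ∉ dat N l ∨ b ∉ dat N l ∨ l ≤ |a - b|) : ker N l a b = 0 := by
  have : cnt N l a b = 0 := by
    simp only [dat, Finset.mem_Icc, le_abs] at h
    unfold cnt
    omega
  rw [ker, this]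
  simp

lemma card_dat (hl : 1 ≤ l) : (dat N l).card = N + l - 1 := by
  rw [dat, Int.card_Icc]
  omega

lemma sum_ker (hl : 1 ≤ l) (hN : 1 ≤ N) :
    ∑ a ∈ dat N l, ∑ b ∈ dat N l, ker N l a b = l := by
  have := sum_bsum_mul (N := N) (l := l) (fun _ => 1) (fun _ => 1)
  have h2 : (0 : ℝ) < l := by exact_mod_cast hl
  have h3 : (0 : ℝ) < N := by exact_mod_cast hN
  simp only [mul_one, bsum, Finset.sum_const, Finset.card_range, nsmul_eq_mul] at this
  rw [← this]
  field_simp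

lemma sum_wgt (hl : 1 ≤ l) (hN : 1 ≤ N) : ∑ a ∈ dat N l, wgt N l a = 1 := by
  have := sum_bsum (N := N) (l := l) (fun _ => 1)
  have h2 : (0 : ℝ) < l := by exact_mod_cast hl
  have h3 : (0 : ℝ) < N := by exact_mod_cast hN
  simp only [mul_one, bsum, Finset.sum_const, Finset.card_range, nsmul_eq_mul] at this
  rw [← this]
  field_simp

lemma sum_abs_wgt_sub_le (hl : 1 ≤ l) (hN : 1 ≤ N) :
    ∑ a ∈ dat N l, |wgt N l a - 1 / ((N + l - 1 : ℕ) : ℝ)| ≤ 2 * l / N := by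
  have h2 : (1 : ℝ) ≤ l := by exact_mod_cast hl
  have h3 : (1 : ℝ) ≤ N := by exact_mod_cast hN
  have hn : ((N + l - 1 : ℕ) : ℝ) = N + l - 1 := by
    rw [Nat.cast_sub (by omega)]; push_cast; ring
  have hn0 : (0 : ℝ) < N + l - 1 := by linarith
  have hc : ((dat N l).card : ℝ) = N + l - 1 := by rw [card_dat hl, hn]
  rw [hn]
  have hpt : ∀ a ∈ dat N l, |wgt N l a - 1 / ((N : ℝ) + l - 1)| ≤
      (1 / N - wgt N l a) + (1 / N - 1 / ((N : ℝ) + l - 1)) := fun a _ => by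
    have h4 : 1 / ((N : ℝ) + l - 1) ≤ 1 / N :=
      one_div_le_one_div_of_le (by linarith) (by linarith)
    have h5 := wgt_le hl hN a
    rw [abs_le]
    constructor <;> linarith
  refine (Finset.sum_le_sum hpt).trans ?_
  rw [Finset.sum_add_distrib, Finset.sum_sub_distrib, sum_wgt hl hN, Finset.sum_const,
    Finset.sum_const, nsmul_eq_mul, nsmul_eq_mul, hc]
  have : ((N : ℝ) + l - 1) * (1 / N) - 1 + ((N : ℝ) + l - 1) * (1 / N - 1 / (N + l - 1)) =
      2 * (l - 1) / N := by
    field_simp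
    ring
  rw [this]
  gcongr
  linarith

lemma sum_ker_sq (hl : 1 ≤ l) (hN : 2 * l ≤ N) :
    |∑ a ∈ dat N l, ∑ b ∈ dat N l, ker N l a b ^ 2 - 2 / 3 * (l : ℝ) / N| ≤
      5 * (1 / (N * l) + (l : ℝ) ^ 2 / (N : ℝ) ^ 2) := by
  have h2 : (1 : ℝ) ≤ l := by exact_mod_cast hl
  have h3 : (2 : ℝ) * l ≤ N := by exact_mod_cast hN
  have h30 : (0 : ℝ) < N := by linarith
  set c : ℝ := (2 * (l : ℝ) ^ 3 + l) / 3 with hc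
  have hcl : c ≤ (l : ℝ) ^ 3 := by
    have : (l : ℝ) ≤ l ^ 3 := le_self_pow₀ h2 (by norm_num)
    rw [hc]; linarith
  have hc0 : 0 ≤ c := by positivity
  have hT : ∀ a : ℤ, ∑ b ∈ Finset.Icc (a - l) (a + l), ((l : ℝ) - |((b - a : ℤ) : ℝ)|) ^ 2 = c := by
    intro a
    have h4 := sum_sq_sub_abs (l : ℝ) l
    have h5 : ∑ b ∈ Finset.Icc (a - l) (a + l), ((l : ℝ) - |((b - a : ℤ) : ℝ)|) ^ 2 =
        ∑ x ∈ Finset.Icc (-(l : ℤ)) l, ((l : ℝ) - |(x : ℝ)|) ^ 2 := by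
      refine Finset.sum_bij' (fun b _ => b - a) (fun x _ => x + a) ?_ ?_ ?_ ?_ fun b _ => rfl <;>
        simp only [Finset.mem_Icc] <;> omega
    rw [h5, h4, hc]
    ring
  have hz : ∀ a b : ℤ, b ∉ Finset.Icc (a - (l : ℤ)) (a + l) → (cnt N l a b : ℝ) ^ 2 = 0 := by
    intro a b hb
    have : cnt N l a b = 0 := by
      simp only [Finset.mem_Icc] at hb
      unfold cnt
      omega
    simp [this]
  have hle : ∀ a : ℤ, ∑ b ∈ dat N l, (cnt N l a b : ℝ) ^ 2 ≤ c := by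
    intro a
    rw [← hT a, ← Finset.sum_subset (Finset.filter_subset (· ∈ Finset.Icc (a - (l : ℤ)) (a + l)) _)
      fun b hb hb' => hz a b fun h => hb' (Finset.mem_filter.2 ⟨hb, h⟩)]
    refine (Finset.sum_le_sum fun b hb => ?_).trans (Finset.sum_le_sum_of_subset_of_nonneg
      (fun b hb => (Finset.mem_filter.1 hb).2) fun b _ _ => sq_nonneg _)
    have h7 : cnt N l a b ≤ l - |b - a| := by
      have := (Finset.mem_filter.1 hb).2
      simp only [Finset.mem_Icc] at this
      unfold cnt
      rcases abs_cases (b - a) with ⟨h, _⟩ | ⟨h, _⟩ <;> rw [h] <;> omega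
    have h8 : (cnt N l a b : ℝ) ≤ l - |((b - a : ℤ) : ℝ)| := by exact_mod_cast h7
    have h9 : (0 : ℝ) ≤ cnt N l a b := by exact_mod_cast cnt_nonneg a b
    gcongr
  have heq : ∀ a ∈ Finset.Icc (2 * l : ℤ) (N - l), ∑ b ∈ dat N l, (cnt N l a b : ℝ) ^ 2 = c := by
    intro a ha
    simp only [Finset.mem_Icc] at ha
    have hsub : Finset.Icc (a - (l : ℤ)) (a + l) ⊆ dat N l := by
      intro b hb
      simp only [dat, Finset.mem_Icc] at hb ⊢
      omega
    rw [← hT a, ← Finset.sum_subset hsub fun b _ => hz a b]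
    refine Finset.sum_congr rfl fun b hb => ?_
    simp only [Finset.mem_Icc] at hb
    congr 1
    have : cnt N l a b = l - |b - a| := by
      unfold cnt
      rcases abs_cases (b - a) with ⟨h, _⟩ | ⟨h, _⟩ <;> rw [h] <;> omega
    rw [this]
    push_cast
    rfl
  have hn : ((N + l - 1 : ℕ) : ℝ) = N + l - 1 := by
    rw [Nat.cast_sub (by omega)]; push_cast; ring
  have hup : ∑ a ∈ dat N l, ∑ b ∈ dat N l, (cnt N l a b : ℝ) ^ 2 ≤ (N + l) * c := by
    refine (Finset.sum_le_sum fun a _ => hle a).trans ?_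
    rw [Finset.sum_const, nsmul_eq_mul, card_dat hl, hn]
    gcongr
    linarith
  have hlow : (N - 3 * l : ℝ) * c ≤ ∑ a ∈ dat N l, ∑ b ∈ dat N l, (cnt N l a b : ℝ) ^ 2 := by
    have hsub : Finset.Icc (2 * l : ℤ) (N - l) ⊆ dat N l := by
      intro b hb
      simp only [dat, Finset.mem_Icc] at hb ⊢
      omega
    refine le_trans ?_ (Finset.sum_le_sum_of_subset_of_nonneg hsub fun a _ _ =>
      Finset.sum_nonneg fun b _ => sq_nonneg _)
    rw [Finset.sum_congr rfl heq, Finset.sum_const, nsmul_eq_mul, Int.card_Icc]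
    gcongr
    have : (N : ℤ) - 3 * l ≤ ((N - l + 1 - 2 * l : ℤ).toNat : ℤ) := by omega
    exact_mod_cast this
  have e : ∑ a ∈ dat N l, ∑ b ∈ dat N l, ker N l a b ^ 2 =
      (∑ a ∈ dat N l, ∑ b ∈ dat N l, (cnt N l a b : ℝ) ^ 2) / (N * l) ^ 2 := by
    simp_rw [ker, div_pow, Finset.sum_div]
  rw [e]
  set S := ∑ a ∈ dat N l, ∑ b ∈ dat N l, (cnt N l a b : ℝ) ^ 2
  have hpos : (0 : ℝ) < (N * l) ^ 2 := by positivity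
  have e2 : S / ((N : ℝ) * l) ^ 2 - 2 / 3 * l / N = (S - 2 / 3 * l ^ 3 * N) / (N * l) ^ 2 := by
    field_simp
  have e3 : 5 * (1 / ((N : ℝ) * l) + (l : ℝ) ^ 2 / (N : ℝ) ^ 2) =
      5 * (N * l + l ^ 4) / (N * l) ^ 2 := by
    field_simp
  rw [e2, e3, abs_div, abs_of_pos hpos]
  gcongr
  have e4 : (2 / 3 * (l : ℝ) ^ 3) = c - l / 3 := by rw [hc]; ring
  have h10 : (l : ℝ) * c ≤ l ^ 4 := by
    calc (l : ℝ) * c ≤ l * l ^ 3 := by gcongr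
      _ = l ^ 4 := by ring
  have h11 : (0 : ℝ) ≤ l * N := by positivity
  rw [e4, abs_le]
  constructor <;> nlinarith

end BlockKernel

section KernelQuadratic

lemma sum_mul_mul_symm {ι : Type*} (P : Finset ι) (w : ι → ℝ) (ρ : ι → ι → ℝ)
    (hρ : ∀ p q, ρ p q = ρ q p) :
    ∑ p ∈ P, ∑ q ∈ P, w p * w q * ρ p q =
      ∑ p ∈ P, w p ^ 2 * ∑ q ∈ P, ρ p q - 1 / 2 * ∑ p ∈ P, ∑ q ∈ P, (w p - w q) ^ 2 * ρ p q := by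
  have h1 : ∑ p ∈ P, ∑ q ∈ P, w q ^ 2 * ρ p q = ∑ p ∈ P, ∑ q ∈ P, w p ^ 2 * ρ p q := by
    rw [Finset.sum_comm]
    refine Finset.sum_congr rfl fun p _ => Finset.sum_congr rfl fun q _ => by rw [hρ]
  have h2 : ∑ p ∈ P, ∑ q ∈ P, (w p - w q) ^ 2 * ρ p q =
      ∑ p ∈ P, ∑ q ∈ P, w p ^ 2 * ρ p q + ∑ p ∈ P, ∑ q ∈ P, w q ^ 2 * ρ p q -
        2 * ∑ p ∈ P, ∑ q ∈ P, w p * w q * ρ p q := by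
    simp only [Finset.mul_sum, ← Finset.sum_add_distrib, ← Finset.sum_sub_distrib]
    refine Finset.sum_congr rfl fun p _ => Finset.sum_congr rfl fun q _ => by ring
  rw [h2, h1]
  simp only [Finset.mul_sum (s := P)]
  simp only [← Finset.mul_sum]
  ring

/-- A window containing the data index set and its neighbourhoods of width `N + l - 1`. -/
def win (N l : ℕ) : Finset ℤ := Finset.Icc (1 - (N + l : ℤ)) (2 * (N + l : ℤ))

variable {N l : ℕ}

lemma dat_subset_win (N l : ℕ) : dat N l ⊆ win N l := by
  intro b hb
  simp only [dat, win, Finset.mem_Icc] at hb ⊢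
  omega

lemma card_supp_le (hl : 1 ≤ l) (hN : l ≤ N) :
    ((((dat N l) ×ˢ (dat N l)).filter fun p => |p.1 - p.2| < (l : ℤ)).card : ℝ) ≤ 4 * N * l := by
  have h1 : ((dat N l) ×ˢ (dat N l)).filter (fun p => |p.1 - p.2| < (l : ℤ)) ⊆
      (dat N l).biUnion fun a => (Finset.Ioo (a - l) (a + l)).image fun b => (a, b) := by
    rintro ⟨a, b⟩ hp
    simp only [Finset.mem_filter, Finset.mem_product, abs_lt] at hp
    simp only [Finset.mem_biUnion, Finset.mem_image, Finset.mem_Ioo, Prod.mk.injEq]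
    exact ⟨a, hp.1.1, b, by omega, rfl, rfl⟩
  have h2 : (((dat N l) ×ˢ (dat N l)).filter fun p => |p.1 - p.2| < (l : ℤ)).card ≤
      (N + l - 1) * (2 * l) := by
    refine (Finset.card_le_card h1).trans (Finset.card_biUnion_le.trans ?_)
    refine (Finset.sum_le_sum (g := fun _ => 2 * l) fun a _ => ?_).trans ?_
    · refine Finset.card_image_le.trans ?_
      rw [Int.card_Ioo]
      omega
    · rw [Finset.sum_const, card_dat hl, smul_eq_mul]
  have h3 : (N + l - 1) * (2 * l) ≤ 4 * N * l := by
    have : N + l - 1 ≤ 2 * N := by omega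
    calc _ ≤ 2 * N * (2 * l) := Nat.mul_le_mul_right _ this
      _ = 4 * N * l := by ring
  exact_mod_cast h2.trans h3

lemma sum_ker_sq_le (hl : 1 ≤ l) (hN : 1 ≤ N) :
    ∑ a ∈ dat N l, ∑ b ∈ dat N l, ker N l a b ^ 2 ≤ l / N := by
  calc _ ≤ ∑ a ∈ dat N l, ∑ b ∈ dat N l, ker N l a b * (1 / N) := by
        refine Finset.sum_le_sum fun a _ => Finset.sum_le_sum fun b _ => ?_
        rw [pow_two]
        exact mul_le_mul_of_nonneg_left (ker_le hl hN a b) (ker_nonneg a b)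
    _ = l / N := by
        simp only [← Finset.sum_mul]
        rw [sum_ker hl hN]
        ring

lemma abs_sum_diff_sq_le {K : ℝ} {r : ℤ → ℝ} (h : Decays K r) (hl : 1 ≤ l) (hN : l ≤ N) :
    |∑ p ∈ win N l ×ˢ win N l, ∑ q ∈ win N l ×ˢ win N l,
      (ker N l p.1 p.2 - ker N l q.1 q.2) ^ 2 * (r (q.1 - p.1) * r (q.2 - p.2))| ≤
      8 * (K * decSum) ^ 2 / (N * l) := by
  have hl0 : (0 : ℝ) < l := by exact_mod_cast hl
  have hN0 : (0 : ℝ) < N := by exact_mod_cast (hl.trans hN)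
  set D := (dat N l) ×ˢ (dat N l) with hD
  set S := D.filter fun p => |p.1 - p.2| < (l : ℤ) with hS
  set P := win N l ×ˢ win N l with hP
  have hSP : S ⊆ P := (Finset.filter_subset _ _).trans
    (Finset.product_subset_product (dat_subset_win N l) (dat_subset_win N l))
  have hz : ∀ p : ℤ × ℤ, p ∉ S → ker N l p.1 p.2 = 0 := fun p hp => ker_eq_zero (by
    by_contra! hc
    exact hp (Finset.mem_filter.2 ⟨Finset.mem_product.2 ⟨hc.1, hc.2.1⟩, hc.2.2⟩))
  have hK := h.nonneg
  have hdS := decSum_ge_one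
  set c : ℝ := K ^ 2 / (N * l) ^ 2 with hc
  obtain ⟨U, hU⟩ : ∃ U : ℤ × ℤ → ℤ × ℤ → ℝ, ∀ p q, U p q =
      c * (dec (q.1 - p.1) * dec (q.2 - p.2)) := ⟨_, fun _ _ => rfl⟩
  have hpt : ∀ p q : ℤ × ℤ, |(ker N l p.1 p.2 - ker N l q.1 q.2) ^ 2 *
      (r (q.1 - p.1) * r (q.2 - p.2))| ≤
      (if p ∈ S then U p q else 0) + if q ∈ S then U p q else 0 := by
    intro p q
    have hnn : 0 ≤ U p q := by
      have := dec_pos (q.1 - p.1)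
      have := dec_pos (q.2 - p.2)
      rw [hU]
      positivity
    by_cases hpq : p ∈ S ∨ q ∈ S
    · have h1 : |(ker N l p.1 p.2 - ker N l q.1 q.2) ^ 2 * (r (q.1 - p.1) * r (q.2 - p.2))| ≤
          U p q := by
        have h2 := abs_ker_sub_le (N := N) (l := l) q.1 q.2 p.1 p.2
        set s : ℝ := |((q.1 - p.1 : ℤ) : ℝ)|
        set t : ℝ := |((q.2 - p.2 : ℤ) : ℝ)|
        have hs : 0 ≤ s := abs_nonneg _
        have ht : 0 ≤ t := abs_nonneg _
        have h3 : s + t ≤ (1 + s) * (1 + t) := by nlinarith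
        rw [abs_mul, abs_mul, abs_pow, abs_sub_comm]
        calc _ ≤ ((1 + s) * (1 + t) / (N * l)) ^ 2 * (|r (q.1 - p.1)| * |r (q.2 - p.2)|) := by
              gcongr
              exact h2.trans (by gcongr)
          _ = (|r (q.1 - p.1)| * (1 + s) ^ 2) * (|r (q.2 - p.2)| * (1 + t) ^ 2) / (N * l) ^ 2 := by
              ring
          _ ≤ (K * dec (q.1 - p.1)) * (K * dec (q.2 - p.2)) / (N * l) ^ 2 := by
              have h5 := h.mul_pow_le (j := 2) (by norm_num) (q.1 - p.1)
              have h6 := h.mul_pow_le (j := 2) (by norm_num) (q.2 - p.2)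
              have h7 : 0 ≤ K * dec (q.1 - p.1) := mul_nonneg hK (dec_pos _).le
              gcongr
          _ = U p q := by rw [hU, hc]; ring
      split_ifs <;> first | linarith | tauto
    · push Not at hpq
      rw [hz p hpq.1, hz q hpq.2, if_neg hpq.1, if_neg hpq.2]
      simp
  have hc0 : 0 ≤ c := by positivity
  have hin : ∀ p : ℤ × ℤ, ∑ q ∈ P, U p q ≤ c * decSum ^ 2 := by
    intro p
    simp only [hU]
    rw [← Finset.mul_sum, hP, Finset.sum_product]
    simp only [← Finset.mul_sum, ← Finset.sum_mul]
    rw [pow_two]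
    have h1 := sum_dec_le (win N l) p.1
    have h2 := sum_dec_le (win N l) p.2
    have h3 : 0 ≤ ∑ b ∈ win N l, dec (b - p.2) := Finset.sum_nonneg fun b _ => (dec_pos _).le
    gcongr
  have hS1 : ∑ p ∈ P, ∑ q ∈ P, (if p ∈ S then U p q else 0) ≤
        S.card * (c * decSum ^ 2) := by
    have : ∀ p ∈ P, (∑ q ∈ P, if p ∈ S then U p q else 0) ≤
        if p ∈ S then c * decSum ^ 2 else 0 := by
      intro p _
      split_ifs with hp
      · exact hin p
      · simp
    refine (Finset.sum_le_sum this).trans ?_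
    rw [← Finset.sum_filter, Finset.sum_const, nsmul_eq_mul]
    have : (P.filter fun p => p ∈ S) ⊆ S := fun p hp => (Finset.mem_filter.1 hp).2
    gcongr
  have hS2 : ∑ p ∈ P, ∑ q ∈ P, (if q ∈ S then U p q else 0) ≤
        S.card * (c * decSum ^ 2) := by
    rw [Finset.sum_comm]
    refine le_trans (le_of_eq ?_) hS1
    refine Finset.sum_congr rfl fun p _ => Finset.sum_congr rfl fun q _ => ?_
    rw [hU, hU, dec_sub_comm p.1, dec_sub_comm p.2]
  have hcard : (S.card : ℝ) ≤ 4 * N * l := card_supp_le hl hN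
  calc _ ≤ ∑ p ∈ P, ∑ q ∈ P, |(ker N l p.1 p.2 - ker N l q.1 q.2) ^ 2 *
      (r (q.1 - p.1) * r (q.2 - p.2))| := (Finset.abs_sum_le_sum_abs _ _).trans
        (Finset.sum_le_sum fun p _ => Finset.abs_sum_le_sum_abs _ _)
    _ ≤ _ := Finset.sum_le_sum fun p _ => Finset.sum_le_sum fun q _ => hpt p q
    _ ≤ S.card * (c * decSum ^ 2) + S.card * (c * decSum ^ 2) := by
        simp only [Finset.sum_add_distrib]
        exact add_le_add hS1 hS2
    _ = 2 * S.card * (c * decSum ^ 2) := by ring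
    _ ≤ 2 * (4 * N * l) * (c * decSum ^ 2) := by gcongr
    _ = 8 * (K * decSum) ^ 2 / (N * l) := by
        rw [hc]
        field_simp
        ring

set_option maxHeartbeats 1000000 in
/-- The Gaussian part of the variance of the averaged squared block sums. -/
lemma abs_ker_quad_le {K : ℝ} {r : ℤ → ℝ} (h : Decays K r) (hs : ∀ a, r (-a) = r a)
    (hl : 1 ≤ l) (hN : 2 * l ≤ N) :
    |∑ a ∈ dat N l, ∑ b ∈ dat N l, ∑ c ∈ dat N l, ∑ e ∈ dat N l,
        ker N l a b * ker N l c e * (r (c - a) * r (e - b)) -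
      2 / 3 * (∑' a, r a) ^ 2 * l / N| ≤
      11 * (K * decSum) ^ 2 * (1 / (N * l) + (l : ℝ) ^ 2 / (N : ℝ) ^ 2) := by
  have hl1 : (1 : ℝ) ≤ l := by exact_mod_cast hl
  have hl0 : (0 : ℝ) < l := by exact_mod_cast hl
  have hN1 : 1 ≤ N := by omega
  have hN0 : (0 : ℝ) < N := by exact_mod_cast hN1
  have hK := h.nonneg
  set T := K * decSum with hT
  have hT0 : 0 ≤ T := mul_nonneg hK (by linarith [decSum_ge_one])
  set s := ∑' a, r a with hsdef
  have hsT : |s| ≤ T := h.abs_tsum_le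
  set P := win N l ×ˢ win N l with hP
  set D := dat N l ×ˢ dat N l with hD
  have hDP : D ⊆ P := Finset.product_subset_product (dat_subset_win N l) (dat_subset_win N l)
  have hz : ∀ p : ℤ × ℤ, p ∉ D → ker N l p.1 p.2 = 0 := fun p hp => ker_eq_zero (by
    by_contra! hc
    exact hp (Finset.mem_product.2 ⟨hc.1, hc.2.1⟩))
  have e1 : ∑ a ∈ dat N l, ∑ b ∈ dat N l, ∑ c ∈ dat N l, ∑ e ∈ dat N l,
        ker N l a b * ker N l c e * (r (c - a) * r (e - b)) =
      ∑ p ∈ P, ∑ q ∈ P, ker N l p.1 p.2 * ker N l q.1 q.2 *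
        (r (q.1 - p.1) * r (q.2 - p.2)) := by
    rw [← Finset.sum_subset hDP (fun p _ hp => by simp [hz p hp]), hD, Finset.sum_product]
    refine Finset.sum_congr rfl fun a _ => Finset.sum_congr rfl fun b _ => ?_
    rw [← Finset.sum_subset hDP (fun p _ hp => by simp [hz p hp]), hD, Finset.sum_product]
  have e2 := sum_mul_mul_symm P (fun p => ker N l p.1 p.2)
    (fun p q => r (q.1 - p.1) * r (q.2 - p.2)) (fun p q => by
      rw [← hs (q.1 - p.1), ← hs (q.2 - p.2), neg_sub, neg_sub])
  have e3 : ∑ p ∈ P, ker N l p.1 p.2 ^ 2 * ∑ q ∈ P, r (q.1 - p.1) * r (q.2 - p.2) =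
      ∑ a ∈ dat N l, ∑ b ∈ dat N l, ker N l a b ^ 2 *
        ((∑ c ∈ win N l, r (c - a)) * ∑ c ∈ win N l, r (c - b)) := by
    rw [← Finset.sum_subset hDP (fun p _ hp => by simp [hz p hp]), hD, Finset.sum_product]
    refine Finset.sum_congr rfl fun a _ => Finset.sum_congr rfl fun b _ => ?_
    rw [hP, Finset.sum_product, Finset.sum_mul_sum]
  have hw : ∀ a ∈ dat N l, |s - ∑ c ∈ win N l, r (c - a)| ≤ T / N := by
    intro a ha
    refine h.abs_window_le hN1 fun b hb => ?_
    simp only [dat, win, Finset.mem_Icc, abs_lt] at ha hb ⊢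
    omega
  have hwT : ∀ a, |∑ c ∈ win N l, r (c - a)| ≤ T := fun a =>
    (Finset.abs_sum_le_sum_abs _ _).trans (h.sum_abs_le _ a)
  have h3 : |∑ a ∈ dat N l, ∑ b ∈ dat N l, ker N l a b ^ 2 *
        ((∑ c ∈ win N l, r (c - a)) * ∑ c ∈ win N l, r (c - b)) -
      ∑ a ∈ dat N l, ∑ b ∈ dat N l, ker N l a b ^ 2 * s ^ 2| ≤
      2 * T ^ 2 * (l / (N : ℝ) ^ 2) := by
    simp only [← Finset.sum_sub_distrib, ← mul_sub]
    calc _ ≤ ∑ a ∈ dat N l, ∑ b ∈ dat N l, ker N l a b ^ 2 * (2 * T ^ 2 / N) := by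
          refine (Finset.abs_sum_le_sum_abs _ _).trans (Finset.sum_le_sum fun a ha =>
            (Finset.abs_sum_le_sum_abs _ _).trans (Finset.sum_le_sum fun b hb => ?_))
          rw [abs_mul, abs_of_nonneg (sq_nonneg (ker N l a b))]
          refine mul_le_mul_of_nonneg_left ?_ (sq_nonneg _)
          set u := ∑ c ∈ win N l, r (c - a)
          set v := ∑ c ∈ win N l, r (c - b)
          have : u * v - s ^ 2 = -(u * (s - v) + s * (s - u)) := by ring
          rw [this, abs_neg]
          calc _ ≤ |u| * |s - v| + |s| * |s - u| := by
                rw [← abs_mul, ← abs_mul]; exact abs_add_le _ _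
            _ ≤ T * (T / N) + T * (T / N) := by
                gcongr
                · exact hwT a
                · exact hw b hb
                · exact hw a ha
            _ = _ := by ring
      _ ≤ l / N * (2 * T ^ 2 / N) := by
          simp only [← Finset.sum_mul]
          exact mul_le_mul_of_nonneg_right (sum_ker_sq_le hl hN1) (by positivity)
      _ = _ := by field_simp
  have h4 := sum_ker_sq hl hN
  have h5 := abs_sum_diff_sq_le h hl (by omega : l ≤ N)
  rw [e1, e2, e3]
  set Q := ∑ a ∈ dat N l, ∑ b ∈ dat N l, ker N l a b ^ 2 *
        ((∑ c ∈ win N l, r (c - a)) * ∑ c ∈ win N l, r (c - b))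
  set R := ∑ p ∈ P, ∑ q ∈ P,
      (ker N l p.1 p.2 - ker N l q.1 q.2) ^ 2 * (r (q.1 - p.1) * r (q.2 - p.2))
  set S2 := ∑ a ∈ dat N l, ∑ b ∈ dat N l, ker N l a b ^ 2 with hS2
  simp only [← Finset.sum_mul] at h3
  rw [← hS2] at h3
  have h6 : (l : ℝ) / N ^ 2 ≤ l ^ 2 / (N : ℝ) ^ 2 := by
    gcongr
    nlinarith
  have h7 : |(S2 - 2 / 3 * (l : ℝ) / N) * s ^ 2| ≤
      5 * (1 / (N * l) + (l : ℝ) ^ 2 / (N : ℝ) ^ 2) * T ^ 2 := by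
    rw [abs_mul, abs_pow]
    gcongr
  have e4 : Q - 1 / 2 * R - 2 / 3 * s ^ 2 * l / N =
      (Q - S2 * s ^ 2) + (S2 - 2 / 3 * (l : ℝ) / N) * s ^ 2 - 1 / 2 * R := by ring
  rw [e4]
  have h8 : 8 * T ^ 2 / ((N : ℝ) * l) = 8 * T ^ 2 * (1 / (N * l)) := by ring
  rw [hT] at h8
  have hT2 : 0 ≤ T ^ 2 := sq_nonneg T
  have h9 : 2 * T ^ 2 * (l / (N : ℝ) ^ 2) ≤ 2 * T ^ 2 * ((l : ℝ) ^ 2 / (N : ℝ) ^ 2) := by gcongr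
  have h10 : 0 ≤ T ^ 2 * (1 / ((N : ℝ) * l)) := by positivity
  have h11 : 0 ≤ T ^ 2 * ((l : ℝ) ^ 2 / (N : ℝ) ^ 2) := by positivity
  rw [h8, ← hT] at h5
  rw [abs_le] at h3 h5 h7 ⊢
  constructor <;> linarith [h3.1, h3.2, h5.1, h5.2, h7.1, h7.2]

end KernelQuadratic

section KernelSums

variable {N l : ℕ}

lemma one_le_natAbs_bound {a b : ℤ} : (((a - b).natAbs : ℕ) : ℝ) = |((a - b : ℤ) : ℝ)| := by
  rw [← Int.cast_natCast, Int.natCast_natAbs, Int.cast_abs]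

/-- Joint cumulant type decay of order seven in the largest distance, three indices. -/
def Decays3 (K : ℝ) (F : ℤ → ℤ → ℤ → ℝ) : Prop := ∀ a b c : ℤ, ∀ D : ℕ,
  (D : ℤ) ≤ |a - b| ∨ (D : ℤ) ≤ |a - c| ∨ (D : ℤ) ≤ |b - c| → |F a b c| ≤ K / (1 + (D : ℝ)) ^ 7

/-- Joint cumulant type decay of order seven in the largest distance, four indices. -/
def Decays4 (K : ℝ) (F : ℤ → ℤ → ℤ → ℤ → ℝ) : Prop := ∀ a b c e : ℤ, ∀ D : ℕ,
  (D : ℤ) ≤ |a - b| ∨ (D : ℤ) ≤ |a - c| ∨ (D : ℤ) ≤ |a - e| ∨ (D : ℤ) ≤ |b - c| ∨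
    (D : ℤ) ≤ |b - e| ∨ (D : ℤ) ≤ |c - e| → |F a b c e| ≤ K / (1 + (D : ℝ)) ^ 7

lemma mul_pow_seven_le {K v u1 u2 u3 : ℝ} (h1 : 0 ≤ u1) (h2 : 0 ≤ u2) (h3 : 0 ≤ u3)
    (hv : 0 ≤ v) (hv1 : v ≤ K / (1 + u1) ^ 7) (hv2 : v ≤ K / (1 + u2) ^ 7)
    (hv3 : v ≤ K / (1 + u3) ^ 7) :
    v * (1 + u1) ≤ K * (1 / (1 + u1) ^ 2 * (1 / (1 + u2) ^ 2 * (1 / (1 + u3) ^ 2))) := by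
  obtain ⟨u, hu, hu1, hu2, hu3, hvu⟩ : ∃ u, 0 ≤ u ∧ u1 ≤ u ∧ u2 ≤ u ∧ u3 ≤ u ∧
      v * (1 + u) ^ 7 ≤ K := by
    have e1 := (le_div_iff₀ (by positivity)).1 hv1
    have e2 := (le_div_iff₀ (by positivity)).1 hv2
    have e3 := (le_div_iff₀ (by positivity)).1 hv3
    rcases le_total u1 u2 with h12 | h12 <;> rcases le_total u2 u3 with h23 | h23 <;>
      rcases le_total u1 u3 with h13 | h13 <;>
      first
      | exact ⟨u1, h1, le_rfl, h12, h13, e1⟩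
      | exact ⟨u2, h2, h12, le_rfl, h23, e2⟩
      | exact ⟨u3, h3, by linarith, by linarith, le_rfl, e3⟩
      | exact ⟨u1, h1, le_rfl, h12, by linarith, e1⟩
  have e : K * (1 / (1 + u1) ^ 2 * (1 / (1 + u2) ^ 2 * (1 / (1 + u3) ^ 2))) =
      K / ((1 + u1) ^ 2 * (1 + u2) ^ 2 * (1 + u3) ^ 2) := by
    field_simp
  rw [e, le_div_iff₀ (by positivity)]
  calc _ = v * ((1 + u1) ^ 3 * (1 + u2) ^ 2 * (1 + u3) ^ 2) := by ring
    _ ≤ v * ((1 + u) ^ 3 * (1 + u) ^ 2 * (1 + u) ^ 2) := by gcongr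
    _ = v * (1 + u) ^ 7 := by ring
    _ ≤ K := hvu

lemma Decays4.base {K : ℝ} {F : ℤ → ℤ → ℤ → ℤ → ℝ} (h : Decays4 K F) (a b c e : ℤ) :
    |F a b c e| * (1 + |((b - a : ℤ) : ℝ)|) ≤ K * (dec (b - a) * (dec (c - a) * dec (e - a))) ∧
    |F a b c e| * (1 + |((e - c : ℤ) : ℝ)|) ≤ K * (dec (e - c) * (dec (a - c) * dec (b - c))) := by
  have h1 := h a b c e (b - a).natAbs (by rw [Int.natCast_natAbs, abs_sub_comm]; simp)
  have h2 := h a b c e (c - a).natAbs (by rw [Int.natCast_natAbs, abs_sub_comm c a]; simp)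
  have h3 := h a b c e (e - a).natAbs (by rw [Int.natCast_natAbs, abs_sub_comm e a]; simp)
  have h4 := h a b c e (e - c).natAbs (by rw [Int.natCast_natAbs, abs_sub_comm e c]; simp)
  have h5 := h a b c e (a - c).natAbs (by rw [Int.natCast_natAbs]; simp)
  have h6 := h a b c e (b - c).natAbs (by rw [Int.natCast_natAbs]; simp)
  rw [one_le_natAbs_bound] at h1 h2 h3 h4 h5 h6
  exact ⟨mul_pow_seven_le (abs_nonneg _) (abs_nonneg _) (abs_nonneg _) (abs_nonneg _) h1 h2 h3,
    mul_pow_seven_le (abs_nonneg _) (abs_nonneg _) (abs_nonneg _) (abs_nonneg _) h4 h5 h6⟩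

lemma Decays3.base {K : ℝ} {F : ℤ → ℤ → ℤ → ℝ} (h : Decays3 K F) (a b c : ℤ) :
    |F a b c| * (1 + |((b - a : ℤ) : ℝ)|) ≤ K * (dec (b - a) * dec (c - a)) ∧
    |F a b c| ≤ K * (dec (a - c) * dec (b - c)) := by
  have h1 := h a b c (b - a).natAbs (by rw [Int.natCast_natAbs, abs_sub_comm]; simp)
  have h2 := h a b c (c - a).natAbs (by rw [Int.natCast_natAbs, abs_sub_comm c a]; simp)
  have h5 := h a b c (a - c).natAbs (by rw [Int.natCast_natAbs]; simp)
  have h6 := h a b c (b - c).natAbs (by rw [Int.natCast_natAbs]; simp)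
  have h0 := h a b c 0 (by simp)
  rw [one_le_natAbs_bound] at h1 h2 h5 h6
  have h0' : |F a b c| ≤ K / (1 + (0 : ℝ)) ^ 7 := by simpa using h0
  have e1 := mul_pow_seven_le (abs_nonneg _) (abs_nonneg _) le_rfl (abs_nonneg _) h1 h2 h0'
  have e2 := mul_pow_seven_le le_rfl (abs_nonneg _) (abs_nonneg _) (abs_nonneg _) h0' h5 h6
  simp only [add_zero, one_pow, div_one, mul_one, one_mul] at e1 e2
  exact ⟨e1, e2⟩

/-- Local modulus of the kernel. -/
def kerMod (N l : ℕ) (a : ℤ) : ℝ := 1 / (N * l) + |wgt N l a - 1 / ((N + l - 1 : ℕ) : ℝ)|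

lemma kerMod_nonneg (a : ℤ) : 0 ≤ kerMod N l a := by unfold kerMod; positivity

lemma abs_ker_sub_inv_le (a b : ℤ) :
    |ker N l a b - 1 / ((N + l - 1 : ℕ) : ℝ)| ≤ (1 + |((b - a : ℤ) : ℝ)|) * kerMod N l a := by
  have h1 := abs_ker_sub_wgt_le (N := N) (l := l) a b
  have h2 := abs_sub_le (ker N l a b) (wgt N l a) (1 / ((N + l - 1 : ℕ) : ℝ))
  have h3 : |((a - b : ℤ) : ℝ)| = |((b - a : ℤ) : ℝ)| := by
    rw [← abs_neg]; push_cast; ring_nf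
  rw [h3] at h1
  unfold kerMod
  have h4 : (0 : ℝ) ≤ 1 / (N * l) := by positivity
  have h5 := abs_nonneg (wgt N l a - 1 / ((N + l - 1 : ℕ) : ℝ))
  have h6 := abs_nonneg ((b - a : ℤ) : ℝ)
  have h7 : |((b - a : ℤ) : ℝ)| / (N * l) = |((b - a : ℤ) : ℝ)| * (1 / (N * l)) := by ring
  rw [h7] at h1
  nlinarith [mul_nonneg h6 h5]

lemma abs_wgt_sub_inv_le (a : ℤ) : |wgt N l a - 1 / ((N + l - 1 : ℕ) : ℝ)| ≤ kerMod N l a := by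
  unfold kerMod
  have h4 : (0 : ℝ) ≤ 1 / (N * l) := by positivity
  linarith

lemma cast_card_le (hl : 1 ≤ l) (hN : l ≤ N) : ((dat N l).card : ℝ) ≤ 2 * N := by
  have : (dat N l).card ≤ 2 * N := by rw [card_dat hl]; omega
  exact_mod_cast this

lemma sum_kerMod_le (hl : 1 ≤ l) (hN : l ≤ N) :
    ∑ a ∈ dat N l, kerMod N l a ≤ 2 * (1 / l + l / N) := by
  have hl0 : (0 : ℝ) < l := by exact_mod_cast hl
  have hN0 : (0 : ℝ) < N := by exact_mod_cast (hl.trans hN)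
  unfold kerMod
  rw [Finset.sum_add_distrib, Finset.sum_const, nsmul_eq_mul]
  have h1 := sum_abs_wgt_sub_le hl (hl.trans hN)
  have h2 : ((dat N l).card : ℝ) * (1 / (N * l)) ≤ 2 * N * (1 / (N * l)) := by
    gcongr
    exact cast_card_le hl hN
  have h3 : 2 * (N : ℝ) * (1 / (N * l)) = 2 * (1 / l) := by field_simp
  have h4 : 2 * (l : ℝ) / N = 2 * (l / N) := by ring
  linarith

lemma inv_card_le (hl : 1 ≤ l) (hN : 1 ≤ N) : 1 / ((N + l - 1 : ℕ) : ℝ) ≤ 1 / N := by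
  have hN0 : (0 : ℝ) < N := by exact_mod_cast hN
  refine one_div_le_one_div_of_le hN0 ?_
  exact_mod_cast (by omega : N ≤ N + l - 1)

lemma sum_dec_dec_le (S : Finset ℤ) (a : ℤ) :
    ∑ b ∈ S, ∑ c ∈ S, dec (b - a) * dec (c - a) ≤ decSum ^ 2 := by
  simp only [← Finset.mul_sum, ← Finset.sum_mul]
  rw [pow_two]
  have h3 : 0 ≤ ∑ b ∈ S, dec (b - a) := Finset.sum_nonneg fun b _ => (dec_pos _).le
  have hd : 0 ≤ decSum := by linarith [decSum_ge_one]
  have := sum_dec_le S a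
  gcongr

lemma sum_dec_dec_dec_le (S : Finset ℤ) (a : ℤ) :
    ∑ b ∈ S, ∑ c ∈ S, ∑ e ∈ S, dec (b - a) * (dec (c - a) * dec (e - a)) ≤ decSum ^ 3 := by
  simp only [← Finset.mul_sum, ← Finset.sum_mul]
  have h3 : 0 ≤ ∑ b ∈ S, dec (b - a) := Finset.sum_nonneg fun b _ => (dec_pos _).le
  have hd : 0 ≤ decSum := by linarith [decSum_ge_one]
  have := sum_dec_le S a
  calc _ ≤ decSum * (decSum * decSum) := by gcongr
    _ = _ := by ring

lemma sum_wgt_mul_le {ι : Type*} {S : Finset ι} {f : ι → ℝ} {T : ℝ}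
    {u : ι → ℝ} (hf : ∀ a ∈ S, f a ≤ T) (hu : ∀ a ∈ S, 0 ≤ u a) :
    ∑ a ∈ S, u a * f a ≤ (∑ a ∈ S, u a) * T := by
  rw [Finset.sum_mul]
  exact Finset.sum_le_sum fun a ha => mul_le_mul_of_nonneg_left (hf a ha) (hu a ha)

/-- Weighted sums of four-index arrays agree with plain averages. -/
lemma Decays4.abs_ker_sum_sub_le {K : ℝ} {F : ℤ → ℤ → ℤ → ℤ → ℝ} (h : Decays4 K F)
    (hK : 0 ≤ K) (hl : 1 ≤ l) (hN : l ≤ N) :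
    |∑ a ∈ dat N l, ∑ b ∈ dat N l, ∑ c ∈ dat N l, ∑ e ∈ dat N l,
        ker N l a b * ker N l c e * F a b c e -
      ∑ a ∈ dat N l, ∑ b ∈ dat N l, ∑ c ∈ dat N l, ∑ e ∈ dat N l,
        (1 / ((N + l - 1 : ℕ) : ℝ)) ^ 2 * F a b c e| ≤
      4 * (K * decSum ^ 3) * (1 / (N * l) + l / (N : ℝ) ^ 2) := by
  have hN1 : 1 ≤ N := hl.trans hN
  have hl0 : (0 : ℝ) < l := by exact_mod_cast hl
  have hN0 : (0 : ℝ) < N := by exact_mod_cast hN1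
  set D := dat N l
  set v : ℝ := 1 / ((N + l - 1 : ℕ) : ℝ) with hv
  have hv0 : 0 ≤ v := by positivity
  have hvN : v ≤ 1 / N := inv_card_le hl hN1
  obtain ⟨U, hU⟩ : ∃ U : ℤ → ℤ → ℤ → ℤ → ℝ, ∀ a b c e, U a b c e =
      1 / N * (kerMod N l a * (K * (dec (b - a) * (dec (c - a) * dec (e - a))))) :=
    ⟨_, fun _ _ _ _ => rfl⟩
  have hpt : ∀ a b c e, |ker N l a b * ker N l c e * F a b c e - v ^ 2 * F a b c e| ≤
      U a b c e + U c e a b := by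
    intro a b c e
    obtain ⟨h1, h2⟩ := h.base a b c e
    have h3 := abs_ker_sub_inv_le (N := N) (l := l) a b
    have h4 := abs_ker_sub_inv_le (N := N) (l := l) c e
    have e1 : ker N l a b * ker N l c e * F a b c e - v ^ 2 * F a b c e =
        ker N l c e * ((ker N l a b - v) * F a b c e) + v * ((ker N l c e - v) * F a b c e) := by
      ring
    have hm1 := kerMod_nonneg (N := N) (l := l) a
    have hm2 := kerMod_nonneg (N := N) (l := l) c
    rw [e1, hU, hU]
    refine (abs_add_le _ _).trans (add_le_add ?_ ?_)
    · rw [abs_mul, abs_mul]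
      refine mul_le_mul (abs_ker_le hl hN1 c e) ?_ (by positivity) (by positivity)
      calc _ ≤ (1 + |((b - a : ℤ) : ℝ)|) * kerMod N l a * |F a b c e| := by gcongr
        _ = kerMod N l a * (|F a b c e| * (1 + |((b - a : ℤ) : ℝ)|)) := by ring
        _ ≤ _ := by gcongr
    · rw [abs_mul, abs_mul, abs_of_nonneg hv0]
      refine mul_le_mul hvN ?_ (by positivity) (by positivity)
      calc _ ≤ (1 + |((e - c : ℤ) : ℝ)|) * kerMod N l c * |F a b c e| := by gcongr
        _ = kerMod N l c * (|F a b c e| * (1 + |((e - c : ℤ) : ℝ)|)) := by ring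
        _ ≤ _ := by gcongr
  have hmain : ∑ a ∈ D, ∑ b ∈ D, ∑ c ∈ D, ∑ e ∈ D, U a b c e ≤
      1 / N * (2 * (1 / l + l / N) * (K * decSum ^ 3)) := by
    simp only [hU, ← Finset.mul_sum]
    gcongr
    have hd := decSum_ge_one
    refine (sum_wgt_mul_le (T := K * decSum ^ 3) (fun a _ => ?_) fun a _ => kerMod_nonneg a).trans ?_
    · have := sum_dec_dec_dec_le D a
      simp only [← Finset.mul_sum] at this
      gcongr
    · gcongr
      exact sum_kerMod_le hl hN
  have hmain2 : ∑ a ∈ D, ∑ b ∈ D, ∑ c ∈ D, ∑ e ∈ D, U c e a b ≤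
      1 / N * (2 * (1 / l + l / N) * (K * decSum ^ 3)) := by
    refine le_trans (le_of_eq ?_) hmain
    calc _ = ∑ a ∈ D, ∑ c ∈ D, ∑ b ∈ D, ∑ e ∈ D, U c e a b :=
          Finset.sum_congr rfl fun a _ => Finset.sum_comm
      _ = ∑ c ∈ D, ∑ a ∈ D, ∑ b ∈ D, ∑ e ∈ D, U c e a b :=
          Finset.sum_comm
      _ = ∑ c ∈ D, ∑ a ∈ D, ∑ e ∈ D, ∑ b ∈ D, U c e a b :=
          Finset.sum_congr rfl fun c _ => Finset.sum_congr rfl fun a _ => Finset.sum_comm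
      _ = _ := Finset.sum_congr rfl fun c _ => Finset.sum_comm
  simp only [← Finset.sum_sub_distrib]
  calc _ ≤ ∑ a ∈ D, ∑ b ∈ D, ∑ c ∈ D, ∑ e ∈ D, (U a b c e + U c e a b) := by
        refine (Finset.abs_sum_le_sum_abs _ _).trans (Finset.sum_le_sum fun a _ =>
          (Finset.abs_sum_le_sum_abs _ _).trans (Finset.sum_le_sum fun b _ =>
          (Finset.abs_sum_le_sum_abs _ _).trans (Finset.sum_le_sum fun c _ =>
          (Finset.abs_sum_le_sum_abs _ _).trans (Finset.sum_le_sum fun e _ => hpt a b c e))))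
    _ ≤ 1 / N * (2 * (1 / l + l / N) * (K * decSum ^ 3)) +
        1 / N * (2 * (1 / l + l / N) * (K * decSum ^ 3)) := by
        simp only [Finset.sum_add_distrib]
        exact add_le_add hmain hmain2
    _ = _ := by field_simp; ring

lemma Decays4.sum_abs_le {K : ℝ} {F : ℤ → ℤ → ℤ → ℤ → ℝ} (h : Decays4 K F) (hK : 0 ≤ K)
    (hl : 1 ≤ l) (hN : l ≤ N) :
    ∑ a ∈ dat N l, ∑ b ∈ dat N l, ∑ c ∈ dat N l, ∑ e ∈ dat N l, |F a b c e| ≤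
      2 * N * (K * decSum ^ 3) := by
  have hd := decSum_ge_one
  calc _ ≤ ∑ a ∈ dat N l, K * decSum ^ 3 := by
        refine Finset.sum_le_sum fun a _ => ?_
        refine le_trans (Finset.sum_le_sum fun b _ => Finset.sum_le_sum fun c _ =>
          Finset.sum_le_sum fun e _ => (le_mul_of_one_le_right (abs_nonneg _)
            (le_add_of_nonneg_right (abs_nonneg _))).trans (h.base a b c e).1) ?_
        simp only [← Finset.mul_sum]
        have := sum_dec_dec_dec_le (dat N l) a
        simp only [← Finset.mul_sum] at this
        gcongr
    _ ≤ _ := by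
        rw [Finset.sum_const, nsmul_eq_mul]
        gcongr
        exact cast_card_le hl hN

/-- Weighted sums of three-index arrays agree with plain averages. -/
lemma Decays3.abs_ker_sum_sub_le {K : ℝ} {F : ℤ → ℤ → ℤ → ℝ} (h : Decays3 K F)
    (hK : 0 ≤ K) (hl : 1 ≤ l) (hN : l ≤ N) :
    |∑ a ∈ dat N l, ∑ b ∈ dat N l, ∑ c ∈ dat N l, ker N l a b * wgt N l c * F a b c -
      ∑ a ∈ dat N l, ∑ b ∈ dat N l, ∑ c ∈ dat N l, (1 / ((N + l - 1 : ℕ) : ℝ)) ^ 2 * F a b c| ≤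
      4 * (K * decSum ^ 2) * (1 / (N * l) + l / (N : ℝ) ^ 2) := by
  have hN1 : 1 ≤ N := hl.trans hN
  have hl0 : (0 : ℝ) < l := by exact_mod_cast hl
  have hN0 : (0 : ℝ) < N := by exact_mod_cast hN1
  set D := dat N l
  set v : ℝ := 1 / ((N + l - 1 : ℕ) : ℝ) with hv
  have hv0 : 0 ≤ v := by positivity
  have hvN : v ≤ 1 / N := inv_card_le hl hN1
  have hd := decSum_ge_one
  obtain ⟨U, hU⟩ : ∃ U : ℤ → ℤ → ℤ → ℝ, ∀ a b c, U a b c =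
      1 / N * (kerMod N l a * (K * (dec (b - a) * dec (c - a)))) :=
    ⟨_, fun _ _ _ => rfl⟩
  have hpt : ∀ a b c, |ker N l a b * wgt N l c * F a b c - v ^ 2 * F a b c| ≤
      U a b c + U c a b := by
    intro a b c
    obtain ⟨h1, h2⟩ := h.base a b c
    have h3 := abs_ker_sub_inv_le (N := N) (l := l) a b
    have h4 := abs_wgt_sub_inv_le (N := N) (l := l) c
    have e1 : ker N l a b * wgt N l c * F a b c - v ^ 2 * F a b c =
        wgt N l c * ((ker N l a b - v) * F a b c) + v * ((wgt N l c - v) * F a b c) := by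
      ring
    have hm1 := kerMod_nonneg (N := N) (l := l) a
    have hm2 := kerMod_nonneg (N := N) (l := l) c
    rw [e1, hU, hU]
    refine (abs_add_le _ _).trans (add_le_add ?_ ?_)
    · rw [abs_mul, abs_mul]
      refine mul_le_mul (abs_wgt_le hl hN1 c) ?_ (by positivity) (by positivity)
      calc _ ≤ (1 + |((b - a : ℤ) : ℝ)|) * kerMod N l a * |F a b c| := by gcongr
        _ = kerMod N l a * (|F a b c| * (1 + |((b - a : ℤ) : ℝ)|)) := by ring
        _ ≤ _ := by gcongr
    · rw [abs_mul, abs_mul, abs_of_nonneg hv0]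
      refine mul_le_mul hvN ?_ (by positivity) (by positivity)
      gcongr
  have hsum : ∀ a, ∑ b ∈ D, ∑ c ∈ D, K * (dec (b - a) * dec (c - a)) ≤ K * decSum ^ 2 := by
    intro a
    have := sum_dec_dec_le D a
    simp only [← Finset.mul_sum] at this ⊢
    gcongr
  have hmain : ∑ a ∈ D, ∑ b ∈ D, ∑ c ∈ D, U a b c ≤
      1 / N * (2 * (1 / l + l / N) * (K * decSum ^ 2)) := by
    have h1 := sum_wgt_mul_le (S := D) (fun a _ => hsum a) fun a _ => kerMod_nonneg (N := N) (l := l) a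
    simp only [hU, ← Finset.mul_sum] at h1 ⊢
    gcongr
    refine h1.trans ?_
    gcongr
    exact sum_kerMod_le hl hN
  have hmain2 : ∑ a ∈ D, ∑ b ∈ D, ∑ c ∈ D, U c a b ≤
      1 / N * (2 * (1 / l + l / N) * (K * decSum ^ 2)) := by
    refine le_trans (le_of_eq ?_) hmain
    calc _ = ∑ a ∈ D, ∑ c ∈ D, ∑ b ∈ D, U c a b :=
          Finset.sum_congr rfl fun a _ => Finset.sum_comm
      _ = _ := Finset.sum_comm
  simp only [← Finset.sum_sub_distrib]
  calc _ ≤ ∑ a ∈ D, ∑ b ∈ D, ∑ c ∈ D, (U a b c + U c a b) := by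
        refine (Finset.abs_sum_le_sum_abs _ _).trans (Finset.sum_le_sum fun a _ =>
          (Finset.abs_sum_le_sum_abs _ _).trans (Finset.sum_le_sum fun b _ =>
          (Finset.abs_sum_le_sum_abs _ _).trans (Finset.sum_le_sum fun c _ => hpt a b c)))
    _ ≤ 1 / N * (2 * (1 / l + l / N) * (K * decSum ^ 2)) +
        1 / N * (2 * (1 / l + l / N) * (K * decSum ^ 2)) := by
        simp only [Finset.sum_add_distrib]
        exact add_le_add hmain hmain2
    _ = _ := by field_simp; ring

lemma Decays3.sum_abs_le {K : ℝ} {F : ℤ → ℤ → ℤ → ℝ} (h : Decays3 K F) (hK : 0 ≤ K)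
    (hl : 1 ≤ l) (hN : l ≤ N) :
    ∑ a ∈ dat N l, ∑ b ∈ dat N l, ∑ c ∈ dat N l, |F a b c| ≤ 2 * N * (K * decSum ^ 2) := by
  have hd := decSum_ge_one
  calc _ ≤ ∑ a ∈ dat N l, K * decSum ^ 2 := by
        refine Finset.sum_le_sum fun a _ => ?_
        refine le_trans (Finset.sum_le_sum fun b _ => Finset.sum_le_sum fun c _ =>
          (le_mul_of_one_le_right (abs_nonneg _)
            (le_add_of_nonneg_right (abs_nonneg _))).trans (h.base a b c).1) ?_
        simp only [← Finset.mul_sum]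
        have := sum_dec_dec_le (dat N l) a
        simp only [← Finset.mul_sum] at this
        gcongr
    _ ≤ _ := by
        rw [Finset.sum_const, nsmul_eq_mul]
        gcongr
        exact cast_card_le hl hN

/-- Weighted sums of covariance arrays agree with plain averages. -/
lemma Decays.abs_wgt_sum_sub_le {K : ℝ} {r : ℤ → ℝ} (h : Decays K r)
    (hl : 1 ≤ l) (hN : l ≤ N) :
    |∑ a ∈ dat N l, ∑ b ∈ dat N l, wgt N l a * wgt N l b * r (b - a) -
      ∑ a ∈ dat N l, ∑ b ∈ dat N l, (1 / ((N + l - 1 : ℕ) : ℝ)) ^ 2 * r (b - a)| ≤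
      4 * (K * decSum) * (l / (N : ℝ) ^ 2) := by
  have hN1 : 1 ≤ N := hl.trans hN
  have hK := h.nonneg
  have hN0 : (0 : ℝ) < N := by exact_mod_cast hN1
  set D := dat N l
  set v : ℝ := 1 / ((N + l - 1 : ℕ) : ℝ) with hv
  have hv0 : 0 ≤ v := by positivity
  have hvN : v ≤ 1 / N := inv_card_le hl hN1
  have hd := decSum_ge_one
  have hpt : ∀ a b, |wgt N l a * wgt N l b * r (b - a) - v ^ 2 * r (b - a)| ≤
      1 / N * (|wgt N l a - v| * (K * dec (b - a))) +
      1 / N * (|wgt N l b - v| * (K * dec (b - a))) := by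
    intro a b
    have h1 := h.abs_le (b - a)
    have e1 : wgt N l a * wgt N l b * r (b - a) - v ^ 2 * r (b - a) =
        wgt N l b * ((wgt N l a - v) * r (b - a)) + v * ((wgt N l b - v) * r (b - a)) := by
      ring
    rw [e1]
    refine (abs_add_le _ _).trans (add_le_add ?_ ?_)
    · rw [abs_mul, abs_mul]
      refine mul_le_mul (abs_wgt_le hl hN1 b) ?_ (by positivity) (by positivity)
      gcongr
    · rw [abs_mul, abs_mul, abs_of_nonneg hv0]
      refine mul_le_mul hvN ?_ (by positivity) (by positivity)
      gcongr
  have hmain : ∀ f : ℤ → ℤ → ℝ, (∀ a b, f a b = dec (b - a) ∨ f a b = dec (a - b)) →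
      ∑ a ∈ D, ∑ b ∈ D, 1 / N * (|wgt N l a - v| * (K * f a b)) ≤
      1 / N * (2 * (l / N) * (K * decSum)) := by
    intro f hf
    have hs : ∀ a ∈ D, K * ∑ b ∈ D, f a b ≤ K * decSum := fun a _ => by
      have : ∑ b ∈ D, f a b ≤ decSum := by
        refine le_trans (Finset.sum_le_sum fun b _ => ?_) (sum_dec_le D a)
        rcases hf a b with h | h
        · rw [h]
        · rw [h, dec_sub_comm]
      gcongr
    have h1 := sum_wgt_mul_le hs fun a _ => abs_nonneg (wgt N l a - v)
    simp only [← Finset.mul_sum]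
    gcongr
    refine h1.trans ?_
    gcongr
    have := sum_abs_wgt_sub_le hl hN1
    rwa [mul_div_assoc] at this
  have hmain2 : ∑ a ∈ D, ∑ b ∈ D, 1 / N * (|wgt N l b - v| * (K * dec (b - a))) ≤
      1 / N * (2 * (l / N) * (K * decSum)) := by
    rw [Finset.sum_comm]
    exact hmain (fun b a => dec (b - a)) fun _ _ => Or.inr rfl
  simp only [← Finset.sum_sub_distrib]
  calc _ ≤ ∑ a ∈ D, ∑ b ∈ D,
      (1 / N * (|wgt N l a - v| * (K * dec (b - a))) +
      1 / N * (|wgt N l b - v| * (K * dec (b - a)))) := by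
        refine (Finset.abs_sum_le_sum_abs _ _).trans (Finset.sum_le_sum fun a _ =>
          (Finset.abs_sum_le_sum_abs _ _).trans (Finset.sum_le_sum fun b _ => hpt a b))
    _ ≤ 1 / N * (2 * (l / N) * (K * decSum)) + 1 / N * (2 * (l / N) * (K * decSum)) := by
        simp only [Finset.sum_add_distrib]
        exact add_le_add (hmain (fun a b => dec (b - a)) fun _ _ => Or.inl rfl) hmain2
    _ = _ := by field_simp; ring

end KernelSums


section Growth

variable {μ : Measure Ω} {X : ℤ → Ω → Fin d → ℝ} {r : ℕ} {q C : ℝ}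

/-- A measurable function of the data growing at most like a polynomial of degree `j` in finitely
many of the observations. -/
structure Growth (X : ℤ → Ω → Fin d → ℝ) (j : ℕ) (f : Ω → ℝ) : Prop where
  meas : Measurable f
  bound : ∃ (S : Finset ℤ) (c : ℝ), 0 ≤ c ∧ ∀ ω, |f ω| ≤ c * (1 + ∑ a ∈ S, ‖X a ω‖) ^ j

variable {f g : Ω → ℝ} {i j : ℕ}

lemma one_le_envelope (S : Finset ℤ) (ω : Ω) : 1 ≤ 1 + ∑ a ∈ S, ‖X a ω‖ :=
  le_add_of_nonneg_right (Finset.sum_nonneg fun _ _ => norm_nonneg _)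

lemma envelope_mono {S T : Finset ℤ} (h : S ⊆ T) (ω : Ω) :
    1 + ∑ a ∈ S, ‖X a ω‖ ≤ 1 + ∑ a ∈ T, ‖X a ω‖ := by
  gcongr

lemma Regular.memLp_envelope [IsProbabilityMeasure μ] (h : Regular μ X r q C) (S : Finset ℤ)
    {p : ℕ} (hp : p = 2 * r) : MemLp (fun ω => 1 + ∑ a ∈ S, ‖X a ω‖) (p : ENNReal) μ := by
  have h6 := h.six_le
  have h0 : (p : ENNReal) ≠ 0 := by
    norm_cast
    omega
  have h1 : ∀ a ∈ S, MemLp (fun ω => ‖X a ω‖) (p : ENNReal) μ := fun a _ => by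
    rw [← integrable_norm_rpow_iff (h.meas a).norm.aestronglyMeasurable h0
      (ENNReal.natCast_ne_top _)]
    simp only [ENNReal.toReal_natCast, Real.rpow_natCast, norm_norm]
    exact h.integrable_norm_pow a hp.le
  have h2 : MemLp (fun ω => ∑ a ∈ S, ‖X a ω‖) (p : ENNReal) μ := memLp_finsetSum _ h1
  have h3 : MemLp (fun _ : Ω => (1 : ℝ)) (p : ENNReal) μ := memLp_const 1
  exact h3.add h2

lemma Regular.integrable_envelope_pow [IsProbabilityMeasure μ] (h : Regular μ X r q C)
    (S : Finset ℤ) (hj : j ≤ 2 * r) : Integrable (fun ω => (1 + ∑ a ∈ S, ‖X a ω‖) ^ j) μ := by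
  obtain ⟨p, hp⟩ : ∃ p, p = 2 * r := ⟨_, rfl⟩
  have hle : (j : ENNReal) ≤ (p : ENNReal) := Nat.cast_le.2 (hp ▸ hj)
  refine ((h.memLp_envelope S hp).mono_exponent hle).integrable_norm_pow'.congr
    (ae_of_all _ fun ω => ?_)
  change ‖_‖ ^ j = _
  rw [Real.norm_eq_abs, abs_of_nonneg (zero_le_one.trans (one_le_envelope S ω))]

namespace Growth

lemma const (j : ℕ) (c : ℝ) : Growth X j (fun _ => c) :=
  ⟨measurable_const, ∅, |c|, abs_nonneg c, fun ω => by simp⟩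

lemma mono (h : Growth X i f) (hij : i ≤ j) : Growth X j f := by
  obtain ⟨S, c, hc, hb⟩ := h.bound
  refine ⟨h.meas, S, c, hc, fun ω => (hb ω).trans ?_⟩
  have := one_le_envelope (X := X) S ω
  gcongr

lemma add (hf : Growth X j f) (hg : Growth X j g) : Growth X j (fun ω => f ω + g ω) := by
  obtain ⟨S, c, hc, hb⟩ := hf.bound
  obtain ⟨T, c', hc', hb'⟩ := hg.bound
  refine ⟨hf.meas.add hg.meas, S ∪ T, c + c', by positivity, fun ω => ?_⟩
  have h1 := envelope_mono (X := X) (Finset.subset_union_left (s₁ := S) (s₂ := T)) ω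
  have h2 := envelope_mono (X := X) (Finset.subset_union_right (s₁ := S) (s₂ := T)) ω
  have h3 := one_le_envelope (X := X) S ω
  have h4 := one_le_envelope (X := X) T ω
  refine (abs_add_le _ _).trans ((add_le_add (hb ω) (hb' ω)).trans ?_)
  rw [add_mul]
  gcongr

lemma mul (hf : Growth X i f) (hg : Growth X j g) : Growth X (i + j) (fun ω => f ω * g ω) := by
  obtain ⟨S, c, hc, hb⟩ := hf.bound
  obtain ⟨T, c', hc', hb'⟩ := hg.bound
  refine ⟨hf.meas.mul hg.meas, S ∪ T, c * c', by positivity, fun ω => ?_⟩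
  have h1 := envelope_mono (X := X) (Finset.subset_union_left (s₁ := S) (s₂ := T)) ω
  have h2 := envelope_mono (X := X) (Finset.subset_union_right (s₁ := S) (s₂ := T)) ω
  have h3 := one_le_envelope (X := X) S ω
  have h4 := one_le_envelope (X := X) T ω
  rw [abs_mul]
  calc |f ω| * |g ω| ≤ (c * (1 + ∑ a ∈ S, ‖X a ω‖) ^ i) * (c' * (1 + ∑ a ∈ T, ‖X a ω‖) ^ j) :=
        mul_le_mul (hb ω) (hb' ω) (abs_nonneg _) (by positivity)
    _ ≤ (c * (1 + ∑ a ∈ S ∪ T, ‖X a ω‖) ^ i) * (c' * (1 + ∑ a ∈ S ∪ T, ‖X a ω‖) ^ j) := by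
        gcongr
    _ = _ := by ring

lemma const_mul (hf : Growth X j f) (c : ℝ) : Growth X j (fun ω => c * f ω) := by
  have := (const (X := X) 0 c).mul hf
  rwa [Nat.zero_add] at this

lemma neg (hf : Growth X j f) : Growth X j (fun ω => -f ω) := by
  simpa using hf.const_mul (-1)

lemma sub (hf : Growth X j f) (hg : Growth X j g) : Growth X j (fun ω => f ω - g ω) := by
  simpa [sub_eq_add_neg] using hf.add hg.neg

lemma pow (hf : Growth X j f) (k : ℕ) : Growth X (j * k) (fun ω => f ω ^ k) := by
  induction k with
  | zero => simpa using const (X := X) 0 1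
  | succ k ih => simpa [pow_succ, mul_add] using ih.mul hf

lemma div_const (hf : Growth X j f) (c : ℝ) : Growth X j (fun ω => f ω / c) := by
  simpa [div_eq_inv_mul] using hf.const_mul c⁻¹

lemma sum {ι : Type*} {s : Finset ι} {f : ι → Ω → ℝ} (h : ∀ i ∈ s, Growth X j (f i)) :
    Growth X j (fun ω => ∑ i ∈ s, f i ω) := by
  induction s using Finset.induction_on with
  | empty => simpa using const (X := X) j 0
  | insert a s ha ih =>
    simp only [Finset.sum_insert ha]
    exact (h a (Finset.mem_insert_self _ _)).add
      (ih fun i hi => h i (Finset.mem_insert_of_mem hi))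

lemma integrable [IsProbabilityMeasure μ] (hf : Growth X j f) (h : Regular μ X r q C)
    (hj : j ≤ 2 * r) : Integrable f μ := by
  obtain ⟨S, c, hc, hb⟩ := hf.bound
  exact ((h.integrable_envelope_pow S hj).const_mul c).mono' hf.meas.aestronglyMeasurable
    (ae_of_all _ hb)

end Growth

lemma Regular.growth_lin (h : Regular μ X r q C) (φ : LinForm d) (a : ℤ) :
    Growth X 1 (lin μ X φ a) := by
  refine ⟨φ.measurable.comp ((h.meas a).sub measurable_const), {a},
    ‖φ‖ * (1 + ‖meanVec μ X‖), by positivity, fun ω => ?_⟩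
  refine (φ.le_opNorm _).trans ?_
  rw [mul_assoc, Finset.sum_singleton, pow_one]
  gcongr
  refine (norm_sub_le _ _).trans ?_
  nlinarith [norm_nonneg (X a ω), norm_nonneg (meanVec μ X)]

lemma integral_mul_sq_le {f g : Ω → ℝ} (hf : Integrable (fun ω => f ω ^ 2) μ)
    (hg : Integrable (fun ω => g ω ^ 2) μ) (hfg : Integrable (fun ω => f ω * g ω) μ) :
    (∫ ω, f ω * g ω ∂μ) ^ 2 ≤ (∫ ω, f ω ^ 2 ∂μ) * ∫ ω, g ω ^ 2 ∂μ := by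
  have key : ∀ t : ℝ, 0 ≤ (∫ ω, f ω ^ 2 ∂μ) * (t * t) + (2 * ∫ ω, f ω * g ω ∂μ) * t +
      ∫ ω, g ω ^ 2 ∂μ := fun t => by
    have h0 : 0 ≤ ∫ ω, (t * f ω + g ω) ^ 2 ∂μ := integral_nonneg fun ω => sq_nonneg _
    have h1 : ∫ ω, (t * f ω + g ω) ^ 2 ∂μ =
        ∫ ω, (t * t * f ω ^ 2 + 2 * t * (f ω * g ω) + g ω ^ 2) ∂μ :=
      integral_congr_ae (ae_of_all _ fun ω => by ring)
    have i1 : Integrable (fun ω => t * t * f ω ^ 2) μ := hf.const_mul _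
    have i2 : Integrable (fun ω => 2 * t * (f ω * g ω)) μ := hfg.const_mul _
    have i3 : Integrable (fun ω => t * t * f ω ^ 2 + 2 * t * (f ω * g ω)) μ := i1.add i2
    rw [h1, integral_add i3 hg, integral_add i1 i2, integral_const_mul, integral_const_mul] at h0
    linarith
  have := discrim_le_zero key
  rw [discrim] at this
  linarith

lemma abs_integral_mul_le_of_sq {f g : Ω → ℝ} {s t : ℝ} (hf : Integrable (fun ω => f ω ^ 2) μ)
    (hg : Integrable (fun ω => g ω ^ 2) μ) (hfg : Integrable (fun ω => f ω * g ω) μ)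
    (hs : 0 ≤ s) (ht : 0 ≤ t) (hfs : ∫ ω, f ω ^ 2 ∂μ ≤ s ^ 2) (hgt : ∫ ω, g ω ^ 2 ∂μ ≤ t ^ 2) :
    |∫ ω, f ω * g ω ∂μ| ≤ s * t := by
  refine abs_le_of_sq_le_sq ((integral_mul_sq_le hf hg hfg).trans ?_) (by positivity)
  rw [mul_pow]
  exact mul_le_mul hfs hgt (integral_nonneg fun ω => sq_nonneg _) (by positivity)

end Growth

section Forms

variable {μ : Measure Ω} {X : ℤ → Ω → Fin d → ℝ} {r : ℕ} {q C : ℝ} {N l : ℕ}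

/-- The quadratic form in the data given by the average of products of normalised block sums. -/
def qf (N l : ℕ) (x y : ℤ → Ω → ℝ) (ω : Ω) : ℝ :=
  ∑ a ∈ dat N l, ∑ b ∈ dat N l, ker N l a b * (x a ω * y b ω)

/-- The average of all block means. -/
def mf (N l : ℕ) (x : ℤ → Ω → ℝ) (ω : Ω) : ℝ := ∑ a ∈ dat N l, wgt N l a * x a ω

lemma qf_eq (x y : ℤ → Ω → ℝ) (ω : Ω) : qf N l x y ω =
    (∑ i ∈ Finset.range N, bsum l (fun a => x a ω) i * bsum l (fun a => y a ω) i) / (N * l) :=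
  (sum_bsum_mul _ _).symm

lemma mf_eq (x : ℤ → Ω → ℝ) (ω : Ω) : mf N l x ω =
    (∑ i ∈ Finset.range N, bsum l (fun a => x a ω) i) / (N * l) :=
  (sum_bsum fun a => x a ω).symm

lemma ker_comm (a b : ℤ) : ker N l a b = ker N l b a := by
  unfold ker cnt
  rw [min_comm a b, max_comm a b]

lemma Regular.growth_qf (h : Regular μ X r q C) (φ ψ : LinForm d) :
    Growth X 2 (qf N l (lin μ X φ) (lin μ X ψ)) :=
  Growth.sum fun a _ => Growth.sum fun b _ =>
    ((h.growth_lin φ a).mul (h.growth_lin ψ b)).const_mul _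

lemma Regular.growth_mf (h : Regular μ X r q C) (φ : LinForm d) :
    Growth X 1 (mf N l (lin μ X φ)) :=
  Growth.sum fun a _ => (h.growth_lin φ a).const_mul _

/-- Third-order moments of linear functionals. -/
def mom3 (μ : Measure Ω) (X : ℤ → Ω → Fin d → ℝ) (φ ψ χ : LinForm d) (a b c : ℤ) : ℝ :=
  ∫ ω, lin μ X φ a ω * lin μ X ψ b ω * lin μ X χ c ω ∂μ

lemma Regular.exists_decay [IsProbabilityMeasure μ] (h : Regular μ X r q C) (B : ℝ) :
    ∃ K, 1 ≤ K ∧ (∀ φ ψ : LinForm d, ‖φ‖ ≤ B → ‖ψ‖ ≤ B → Decays K (ccov μ X φ ψ)) ∧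
      (∀ φ ψ χ : LinForm d, ‖φ‖ ≤ B → ‖ψ‖ ≤ B → ‖χ‖ ≤ B →
        Decays3 K (mom3 μ X φ ψ χ)) ∧
      ∀ φ : LinForm d, ‖φ‖ ≤ B → Decays4 K (cum4 μ (lin μ X φ)) := by
  obtain ⟨M, hM, hA⟩ := h.exists_adm_lin B
  obtain ⟨K₂, h₂, H₂⟩ := h.exists_cov_le M
  obtain ⟨K₃, h₃, H₃⟩ := h.exists_third_moment_le M
  obtain ⟨K₄, h₄, H₄⟩ := h.exists_cum4_le M
  refine ⟨K₂ + K₃ + K₄, by linarith, fun φ ψ hφ hψ => decays_of_le fun a => ?_,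
    fun φ ψ χ hφ hψ hχ a b c D hD => ?_, fun φ hφ a b c e D hD => ?_⟩
  · have := H₂ _ _ (hA φ hφ) (hA ψ hψ) 0 a a.natAbs (by simp)
    refine this.trans ?_
    have e : ((a.natAbs : ℕ) : ℝ) = |(a : ℝ)| := by rw [Nat.cast_natAbs, Int.cast_abs]
    rw [e]
    gcongr
    linarith
  · refine (H₃ _ _ _ (hA φ hφ) (hA ψ hψ) (hA χ hχ) a b c D hD).trans ?_
    gcongr
    linarith
  · refine (H₄ _ (hA φ hφ) a b c e D hD).trans ?_
    gcongr
    linarith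

lemma Regular.ccov_neg (h : Regular μ X r q C) (φ ψ : LinForm d) (a : ℤ) :
    ccov μ X φ ψ (-a) = ccov μ X ψ φ a := by
  have h1 := h.integral_lin_mul_lin φ ψ a 0
  rw [zero_sub] at h1
  rw [← h1, ccov]
  simp only [mul_comm]

variable [IsProbabilityMeasure μ]

lemma Regular.integral_sum_sum (h : Regular μ X r q C) {S T : Finset ℤ} {w : ℤ → ℤ → ℝ} {j : ℕ}
    {f : ℤ → ℤ → Ω → ℝ} (hf : ∀ a b, Growth X j (f a b)) (hj : j ≤ 2 * r) :
    ∫ ω, ∑ a ∈ S, ∑ b ∈ T, w a b * f a b ω ∂μ = ∑ a ∈ S, ∑ b ∈ T, w a b * ∫ ω, f a b ω ∂μ := by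
  rw [integral_finsetSum _ fun a _ =>
    (Growth.sum fun b _ => (hf a b).const_mul (w a b)).integrable h hj]
  refine Finset.sum_congr rfl fun a _ => ?_
  rw [integral_finsetSum _ fun b _ => ((hf a b).const_mul (w a b)).integrable h hj]
  simp only [integral_const_mul]

lemma Regular.two_le (h : Regular μ X r q C) : 2 ≤ 2 * r := by have := h.six_le; omega

lemma Regular.integral_qf_eq_sum (h : Regular μ X r q C) (φ ψ : LinForm d) :
    ∫ ω, qf N l (lin μ X φ) (lin μ X ψ) ω ∂μ =
      ∑ a ∈ dat N l, ∑ b ∈ dat N l, ker N l a b * ccov μ X φ ψ (b - a) := by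
  unfold qf
  rw [h.integral_sum_sum (fun a b => (h.growth_lin φ a).mul (h.growth_lin ψ b)) h.two_le]
  simp only [h.integral_lin_mul_lin]

lemma Regular.integral_bsum_mul (h : Regular μ X r q C) (φ ψ : LinForm d) (i : ℕ) :
    ∫ ω, bsum l (fun a => lin μ X φ a ω) i * bsum l (fun a => lin μ X ψ a ω) i ∂μ =
      ∑ x ∈ Finset.Icc (-(l : ℤ)) l, ((l : ℝ) - |(x : ℝ)|) * ccov μ X φ ψ x := by
  rw [← sum_sum_sub]
  have h0 : ∀ ω, bsum l (fun a => lin μ X φ a ω) i * bsum l (fun a => lin μ X ψ a ω) i =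
      ∑ s ∈ Finset.range l, ∑ t ∈ Finset.range l,
        lin μ X φ (i + 1 + s) ω * lin μ X ψ (i + 1 + t) ω := fun ω => by
    rw [bsum, bsum, Finset.sum_mul_sum]
  simp only [h0]
  rw [integral_finsetSum _ fun s _ => (Growth.sum fun t _ =>
    (h.growth_lin φ _).mul (h.growth_lin ψ _)).integrable h h.two_le]
  refine Finset.sum_congr rfl fun s _ => ?_
  rw [integral_finsetSum _ fun t _ =>
    ((h.growth_lin φ _).mul (h.growth_lin ψ _)).integrable h h.two_le]
  refine Finset.sum_congr rfl fun t _ => ?_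
  rw [h.integral_lin_mul_lin]
  congr 1
  ring

lemma growth_bsum (h : Regular μ X r q C) (φ : LinForm d) (i : ℕ) :
    Growth X 1 (fun ω => bsum l (fun a => lin μ X φ a ω) i) :=
  Growth.sum fun _ _ => h.growth_lin φ _

lemma Regular.integral_qf (h : Regular μ X r q C) (φ ψ : LinForm d)
    (hl : 1 ≤ l) (hN : 1 ≤ N) :
    ∫ ω, qf N l (lin μ X φ) (lin μ X ψ) ω ∂μ =
      ∑ x ∈ Finset.Icc (-(l : ℤ)) l, ccov μ X φ ψ x -
        (∑ x ∈ Finset.Icc (-(l : ℤ)) l, |(x : ℝ)| * ccov μ X φ ψ x) / l := by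
  simp only [qf_eq]
  rw [integral_div, integral_finsetSum _ fun i _ =>
    ((growth_bsum h φ i).mul (growth_bsum h ψ i)).integrable h h.two_le]
  simp only [h.integral_bsum_mul, sub_mul, Finset.sum_sub_distrib, ← Finset.mul_sum,
    Finset.sum_const, Finset.card_range, nsmul_eq_mul]
  have h1 : (l : ℝ) ≠ 0 := by positivity
  have h2 : (N : ℝ) ≠ 0 := by positivity
  field_simp

lemma Regular.abs_integral_qf_sub_le (h : Regular μ X r q C) {φ ψ : LinForm d} {K : ℝ}
    (hK : Decays K (ccov μ X φ ψ)) (hl : 1 ≤ l) (hN : 1 ≤ N) :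
    |∫ ω, qf N l (lin μ X φ) (lin μ X ψ) ω ∂μ -
      (∑' a, ccov μ X φ ψ a - (∑' a : ℤ, |(a : ℝ)| * ccov μ X φ ψ a) / l)| ≤
      2 * (K * decSum) / (l : ℝ) ^ 4 := by
  have hK0 := hK.nonneg
  have hmem : ∀ a : ℤ, |a| < l → a ∈ Finset.Icc (-(l : ℤ)) l := fun a ha => by
    rw [abs_lt] at ha
    simp only [Finset.mem_Icc]
    omega
  have h1 := abs_tsum_sub_sum_le hK0 (fun a => hK.mul_pow_le (j := 4) (by norm_num) a) hmem hl
  have h2 := abs_tsum_sub_sum_le (g := fun a : ℤ => |(a : ℝ)| * ccov μ X φ ψ a) (j := 4) hK0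
    (fun a => by
      refine le_trans ?_ (hK a)
      have := abs_nonneg (a : ℝ)
      have := abs_nonneg (ccov μ X φ ψ a)
      rw [abs_mul, abs_abs, pow_succ _ 4]
      nlinarith [mul_nonneg (abs_nonneg (ccov μ X φ ψ a))
        (pow_nonneg (by positivity : (0 : ℝ) ≤ 1 + |(a : ℝ)|) 4)]) hmem hl
  rw [h.integral_qf φ ψ hl hN]
  have hl1 : (1 : ℝ) ≤ l := by exact_mod_cast hl
  set S := ∑ x ∈ Finset.Icc (-(l : ℤ)) l, ccov μ X φ ψ x
  set T := ∑ x ∈ Finset.Icc (-(l : ℤ)) l, |(x : ℝ)| * ccov μ X φ ψ x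
  set S' := ∑' a, ccov μ X φ ψ a
  set T' := ∑' a : ℤ, |(a : ℝ)| * ccov μ X φ ψ a
  have e : S - T / l - (S' - T' / l) = -(S' - S) + (T' - T) / l := by ring
  have h3 : |(T' - T) / l| ≤ K * decSum / (l : ℝ) ^ 4 := by
    rw [abs_div, abs_of_nonneg (by positivity : (0 : ℝ) ≤ l)]
    exact (div_le_self (abs_nonneg _) hl1).trans h2
  calc _ ≤ |-(S' - S)| + |(T' - T) / l| := by rw [e]; exact abs_add_le _ _
    _ ≤ K * decSum / (l : ℝ) ^ 4 + K * decSum / (l : ℝ) ^ 4 := by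
        rw [abs_neg]
        exact add_le_add h1 h3
    _ = _ := by ring

lemma Regular.abs_integral_qf_sub_tsum_le (h : Regular μ X r q C)
    {φ ψ : LinForm d} {K : ℝ}
    (hK : Decays K (ccov μ X φ ψ)) (hl : 1 ≤ l) (hN : 1 ≤ N) :
    |∫ ω, qf N l (lin μ X φ) (lin μ X ψ) ω ∂μ - ∑' a, ccov μ X φ ψ a| ≤
      3 * (K * decSum) / l := by
  have h1 := h.abs_integral_qf_sub_le hK hl hN
  have hK0 := hK.nonneg
  have hd := decSum_ge_one
  have h2 := abs_tsum_sub_sum_le (g := fun a : ℤ => |(a : ℝ)| * ccov μ X φ ψ a) (j := 0) (m := 1)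
    (S := {0}) hK0
    (fun a => by
      refine le_trans ?_ (hK.mul_pow_le (j := 1) (by norm_num) a)
      have := abs_nonneg (a : ℝ)
      rw [abs_mul, abs_abs, pow_zero, mul_one, pow_one, mul_comm]
      gcongr
      linarith)
    (fun a ha => by
      rw [Nat.cast_one, Int.abs_lt_one_iff] at ha
      simp [ha]) le_rfl
  simp only [Finset.sum_singleton, Int.cast_zero, abs_zero, zero_mul, sub_zero, pow_zero,
    div_one] at h2
  have hl1 : (1 : ℝ) ≤ l := by exact_mod_cast hl
  set T' := ∑' a : ℤ, |(a : ℝ)| * ccov μ X φ ψ a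
  set S' := ∑' a, ccov μ X φ ψ a
  set E := ∫ ω, qf N l (lin μ X φ) (lin μ X ψ) ω ∂μ
  have h3 : |T' / l| ≤ K * decSum / l := by
    rw [abs_div, abs_of_nonneg (by positivity : (0 : ℝ) ≤ l)]
    gcongr
  have h4 : 2 * (K * decSum) / (l : ℝ) ^ 4 ≤ 2 * (K * decSum) / l := by
    have : (l : ℝ) ≤ (l : ℝ) ^ 4 := le_self_pow₀ hl1 (by norm_num)
    gcongr
  calc |E - S'| = |(E - (S' - T' / l)) - T' / l| := by congr 1; ring
    _ ≤ |E - (S' - T' / l)| + |T' / l| := abs_sub _ _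
    _ ≤ 2 * (K * decSum) / l + K * decSum / l := add_le_add (h1.trans h4) h3
    _ = _ := by ring

lemma Regular.integral_mf (h : Regular μ X r q C) (φ : LinForm d) :
    ∫ ω, mf N l (lin μ X φ) ω ∂μ = 0 := by
  unfold mf
  have := h.two_le
  rw [integral_finsetSum _ fun a _ => ((h.growth_lin φ a).const_mul _).integrable h (by omega)]
  simp [integral_const_mul, h.lin_mean]

lemma Regular.integral_mf_mul (h : Regular μ X r q C) (φ ψ : LinForm d) :
    ∫ ω, mf N l (lin μ X φ) ω * mf N l (lin μ X ψ) ω ∂μ =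
      ∑ a ∈ dat N l, ∑ b ∈ dat N l, wgt N l a * wgt N l b * ccov μ X φ ψ (b - a) := by
  have h0 : ∀ ω, mf N l (lin μ X φ) ω * mf N l (lin μ X ψ) ω = ∑ a ∈ dat N l, ∑ b ∈ dat N l,
      wgt N l a * wgt N l b * (lin μ X φ a ω * lin μ X ψ b ω) := fun ω => by
    rw [mf, mf, Finset.sum_mul_sum]
    refine Finset.sum_congr rfl fun a _ => Finset.sum_congr rfl fun b _ => by ring
  simp only [h0]
  rw [h.integral_sum_sum (fun a b => (h.growth_lin φ a).mul (h.growth_lin ψ b)) h.two_le]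
  simp only [h.integral_lin_mul_lin]

lemma Regular.integral_sum_mom3 (h : Regular μ X r q C) {S : Finset ℤ} (w : ℤ → ℤ → ℤ → ℝ)
    (φ ψ χ : LinForm d) :
    ∫ ω, ∑ a ∈ S, ∑ b ∈ S, ∑ c ∈ S,
        w a b c * (lin μ X φ a ω * lin μ X ψ b ω * lin μ X χ c ω) ∂μ =
      ∑ a ∈ S, ∑ b ∈ S, ∑ c ∈ S, w a b c * mom3 μ X φ ψ χ a b c := by
  have h6 := h.six_le
  have g : ∀ a b c, Growth X 3 (fun ω => lin μ X φ a ω * lin μ X ψ b ω * lin μ X χ c ω) :=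
    fun a b c => ((h.growth_lin φ a).mul (h.growth_lin ψ b)).mul (h.growth_lin χ c)
  rw [integral_finsetSum _ fun a _ => (Growth.sum fun b _ => Growth.sum fun c _ =>
    (g a b c).const_mul _).integrable h (by omega)]
  exact Finset.sum_congr rfl fun a _ => h.integral_sum_sum (g a) (by omega)

lemma Regular.integral_qf_mul_mf (h : Regular μ X r q C) (φ ψ χ : LinForm d) :
    ∫ ω, qf N l (lin μ X φ) (lin μ X ψ) ω * mf N l (lin μ X χ) ω ∂μ =
      ∑ a ∈ dat N l, ∑ b ∈ dat N l, ∑ c ∈ dat N l,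
        ker N l a b * wgt N l c * mom3 μ X φ ψ χ a b c := by
  rw [← h.integral_sum_mom3 (fun a b c => ker N l a b * wgt N l c)]
  refine integral_congr_ae (ae_of_all _ fun ω => ?_)
  simp only [qf, mf, Finset.sum_mul]
  simp only [Finset.mul_sum]
  refine Finset.sum_congr rfl fun a _ => Finset.sum_congr rfl fun b _ =>
    Finset.sum_congr rfl fun c _ => by ring

lemma Regular.integral_mf_mul_mul (h : Regular μ X r q C) (φ ψ χ : LinForm d) :
    ∫ ω, mf N l (lin μ X φ) ω * mf N l (lin μ X ψ) ω * mf N l (lin μ X χ) ω ∂μ =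
      ∑ a ∈ dat N l, ∑ b ∈ dat N l, ∑ c ∈ dat N l,
        wgt N l a * wgt N l b * wgt N l c * mom3 μ X φ ψ χ a b c := by
  rw [← h.integral_sum_mom3 (fun a b c => wgt N l a * wgt N l b * wgt N l c)]
  refine integral_congr_ae (ae_of_all _ fun ω => ?_)
  simp only [mf]
  rw [Finset.sum_mul_sum]
  simp only [Finset.sum_mul]
  simp only [Finset.mul_sum]
  refine Finset.sum_congr rfl fun a _ => Finset.sum_congr rfl fun b _ =>
    Finset.sum_congr rfl fun c _ => by ring

lemma Decays3.abs_weighted_sum_le {K W : ℝ} {w F : ℤ → ℤ → ℤ → ℝ} (hd : Decays3 K F)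
    (hK : 0 ≤ K) (hl : 1 ≤ l) (hN : l ≤ N) (hw : ∀ a b c, |w a b c| ≤ W) :
    |∑ a ∈ dat N l, ∑ b ∈ dat N l, ∑ c ∈ dat N l, w a b c * F a b c| ≤
      W * (2 * N * (K * decSum ^ 2)) := by
  have hW : 0 ≤ W := (abs_nonneg _).trans (hw 0 0 0)
  calc _ ≤ ∑ a ∈ dat N l, ∑ b ∈ dat N l, ∑ c ∈ dat N l, W * |F a b c| := by
        refine (Finset.abs_sum_le_sum_abs _ _).trans (Finset.sum_le_sum fun a _ =>
          (Finset.abs_sum_le_sum_abs _ _).trans (Finset.sum_le_sum fun b _ =>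
          (Finset.abs_sum_le_sum_abs _ _).trans (Finset.sum_le_sum fun c _ => ?_)))
        rw [abs_mul]
        exact mul_le_mul_of_nonneg_right (hw a b c) (abs_nonneg _)
    _ ≤ _ := by
        simp only [← Finset.mul_sum]
        gcongr
        exact hd.sum_abs_le hK hl hN

lemma Regular.abs_integral_qf_mul_mf_le (h : Regular μ X r q C) {φ ψ χ : LinForm d}
    {K : ℝ} (hK : 0 ≤ K) (hd : Decays3 K (mom3 μ X φ ψ χ)) (hl : 1 ≤ l) (hN : l ≤ N) :
    |∫ ω, qf N l (lin μ X φ) (lin μ X ψ) ω * mf N l (lin μ X χ) ω ∂μ| ≤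
      2 * (K * decSum ^ 2) / N := by
  rw [h.integral_qf_mul_mf]
  have hN1 : 1 ≤ N := hl.trans hN
  refine (hd.abs_weighted_sum_le hK hl hN (W := 1 / (N : ℝ) * (1 / N)) fun a b c => ?_).trans_eq
    (by field_simp)
  rw [abs_mul]
  exact mul_le_mul (abs_ker_le hl hN1 a b) (abs_wgt_le hl hN1 c) (abs_nonneg _) (by positivity)

lemma Regular.abs_integral_mf_mul_mul_le (h : Regular μ X r q C) {φ ψ χ : LinForm d}
    {K : ℝ} (hK : 0 ≤ K) (hd : Decays3 K (mom3 μ X φ ψ χ)) (hl : 1 ≤ l) (hN : l ≤ N) :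
    |∫ ω, mf N l (lin μ X φ) ω * mf N l (lin μ X ψ) ω * mf N l (lin μ X χ) ω ∂μ| ≤
      2 * (K * decSum ^ 2) / (N : ℝ) ^ 2 := by
  rw [h.integral_mf_mul_mul]
  have hN1 : 1 ≤ N := hl.trans hN
  refine (hd.abs_weighted_sum_le hK hl hN (W := 1 / (N : ℝ) * (1 / N) * (1 / N))
    fun a b c => ?_).trans_eq (by field_simp)
  rw [abs_mul, abs_mul]
  exact mul_le_mul (mul_le_mul (abs_wgt_le hl hN1 a) (abs_wgt_le hl hN1 b) (abs_nonneg _)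
    (by positivity)) (abs_wgt_le hl hN1 c) (abs_nonneg _) (by positivity)

lemma Regular.integral_sum_four (h : Regular μ X r q C) {S : Finset ℤ} {w : ℤ → ℤ → ℤ → ℤ → ℝ}
    {j : ℕ} {f : ℤ → ℤ → ℤ → ℤ → Ω → ℝ} (hf : ∀ a b c e, Growth X j (f a b c e))
    (hj : j ≤ 2 * r) :
    ∫ ω, ∑ a ∈ S, ∑ b ∈ S, ∑ c ∈ S, ∑ e ∈ S, w a b c e * f a b c e ω ∂μ =
      ∑ a ∈ S, ∑ b ∈ S, ∑ c ∈ S, ∑ e ∈ S, w a b c e * ∫ ω, f a b c e ω ∂μ := by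
  have h0 := h.integral_sum_sum (S := S) (T := S) (w := fun _ _ => 1)
    (f := fun a b ω => ∑ c ∈ S, ∑ e ∈ S, w a b c e * f a b c e ω)
    (fun a b => Growth.sum fun c _ => Growth.sum fun e _ => (hf a b c e).const_mul _) hj
  simp only [one_mul] at h0
  rw [h0]
  refine Finset.sum_congr rfl fun a _ => Finset.sum_congr rfl fun b _ => ?_
  exact h.integral_sum_sum (hf a b) hj

lemma Regular.integral_four (h : Regular μ X r q C) (φ : LinForm d) (a b c e : ℤ) :
    ∫ ω, lin μ X φ a ω * lin μ X φ b ω * (lin μ X φ c ω * lin μ X φ e ω) ∂μ =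
      cum4 μ (lin μ X φ) a b c e + ccov μ X φ φ (b - a) * ccov μ X φ φ (e - c) +
        ccov μ X φ φ (c - a) * ccov μ X φ φ (e - b) +
        ccov μ X φ φ (e - a) * ccov μ X φ φ (c - b) := by
  simp only [cum4, h.integral_lin_mul_lin]
  ring

lemma Regular.growth_four (h : Regular μ X r q C) (φ : LinForm d) (a b c e : ℤ) :
    Growth X 4 (fun ω => lin μ X φ a ω * lin μ X φ b ω * (lin μ X φ c ω * lin μ X φ e ω)) :=
  ((h.growth_lin φ a).mul (h.growth_lin φ b)).mul ((h.growth_lin φ c).mul (h.growth_lin φ e))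

lemma sum_four_add {S : Finset ℤ} (f g : ℤ → ℤ → ℤ → ℤ → ℝ) :
    ∑ a ∈ S, ∑ b ∈ S, ∑ c ∈ S, ∑ e ∈ S, (f a b c e + g a b c e) =
      ∑ a ∈ S, ∑ b ∈ S, ∑ c ∈ S, ∑ e ∈ S, f a b c e +
        ∑ a ∈ S, ∑ b ∈ S, ∑ c ∈ S, ∑ e ∈ S, g a b c e := by
  simp only [Finset.sum_add_distrib]

lemma sum_four_prod {S : Finset ℤ} (f g : ℤ → ℤ → ℝ) :
    ∑ a ∈ S, ∑ b ∈ S, ∑ c ∈ S, ∑ e ∈ S, f a b * g c e =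
      (∑ a ∈ S, ∑ b ∈ S, f a b) * ∑ c ∈ S, ∑ e ∈ S, g c e := by
  rw [Finset.sum_mul]
  refine Finset.sum_congr rfl fun a _ => ?_
  rw [Finset.sum_mul]
  refine Finset.sum_congr rfl fun b _ => ?_
  simp only [Finset.mul_sum]

lemma Regular.integral_qf_sq (h : Regular μ X r q C) (φ : LinForm d) :
    ∫ ω, qf N l (lin μ X φ) (lin μ X φ) ω ^ 2 ∂μ =
      (∫ ω, qf N l (lin μ X φ) (lin μ X φ) ω ∂μ) ^ 2 +
      ∑ a ∈ dat N l, ∑ b ∈ dat N l, ∑ c ∈ dat N l, ∑ e ∈ dat N l,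
        ker N l a b * ker N l c e * cum4 μ (lin μ X φ) a b c e +
      2 * ∑ a ∈ dat N l, ∑ b ∈ dat N l, ∑ c ∈ dat N l, ∑ e ∈ dat N l,
        ker N l a b * ker N l c e * (ccov μ X φ φ (c - a) * ccov μ X φ φ (e - b)) := by
  have h0 : ∀ ω, qf N l (lin μ X φ) (lin μ X φ) ω ^ 2 =
      ∑ a ∈ dat N l, ∑ b ∈ dat N l, ∑ c ∈ dat N l, ∑ e ∈ dat N l, ker N l a b * ker N l c e *
        (lin μ X φ a ω * lin μ X φ b ω * (lin μ X φ c ω * lin μ X φ e ω)) := fun ω => by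
    rw [sq, qf, ← sum_four_prod]
    refine Finset.sum_congr rfl fun a _ => Finset.sum_congr rfl fun b _ =>
      Finset.sum_congr rfl fun c _ => Finset.sum_congr rfl fun e _ => by ring
  have h6 := h.six_le
  simp only [h0]
  rw [h.integral_sum_four (h.growth_four φ) (by omega), h.integral_qf_eq_sum, sq, ← sum_four_prod]
  simp only [h.integral_four, mul_add, sum_four_add]
  have e1 : ∑ a ∈ dat N l, ∑ b ∈ dat N l, ∑ c ∈ dat N l, ∑ e ∈ dat N l,
        ker N l a b * ker N l c e * (ccov μ X φ φ (e - a) * ccov μ X φ φ (c - b)) =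
      ∑ a ∈ dat N l, ∑ b ∈ dat N l, ∑ c ∈ dat N l, ∑ e ∈ dat N l,
        ker N l a b * ker N l c e * (ccov μ X φ φ (c - a) * ccov μ X φ φ (e - b)) := by
    refine Finset.sum_congr rfl fun a _ => Finset.sum_congr rfl fun b _ => ?_
    rw [Finset.sum_comm]
    refine Finset.sum_congr rfl fun c _ => Finset.sum_congr rfl fun e _ => ?_
    rw [ker_comm e c]
  have e2 : ∀ a b c e, ker N l a b * ker N l c e * (ccov μ X φ φ (b - a) * ccov μ X φ φ (e - c)) =
      ker N l a b * ccov μ X φ φ (b - a) * (ker N l c e * ccov μ X φ φ (e - c)) :=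
    fun a b c e => by ring
  simp only [e1, e2]
  ring

lemma Regular.abs_var_qf_sub_le (h : Regular μ X r q C) {φ : LinForm d} {K : ℝ}
    (hK : 0 ≤ K) (h2 : Decays K (ccov μ X φ φ)) (h4 : Decays4 K (cum4 μ (lin μ X φ)))
    (hl : 1 ≤ l) (hN : 2 * l ≤ N) :
    |∫ ω, qf N l (lin μ X φ) (lin μ X φ) ω ^ 2 ∂μ -
      (∫ ω, qf N l (lin μ X φ) (lin μ X φ) ω ∂μ) ^ 2 -
      (4 / 3 * (∑' a, ccov μ X φ φ a) ^ 2 * l / N +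
        ∑ a ∈ dat N l, ∑ b ∈ dat N l, ∑ c ∈ dat N l, ∑ e ∈ dat N l,
          (1 / ((N + l - 1 : ℕ) : ℝ)) ^ 2 * cum4 μ (lin μ X φ) a b c e)| ≤
      (22 * (K * decSum) ^ 2 + 4 * (K * decSum ^ 3)) *
        (1 / (N * l) + (l : ℝ) ^ 2 / (N : ℝ) ^ 2) := by
  rw [h.integral_qf_sq]
  have a1 := abs_ker_quad_le h2 (h.ccov_neg φ φ) hl hN
  have a2 := h4.abs_ker_sum_sub_le hK hl (by omega : l ≤ N)
  set Q := ∑ a ∈ dat N l, ∑ b ∈ dat N l, ∑ c ∈ dat N l, ∑ e ∈ dat N l,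
        ker N l a b * ker N l c e * (ccov μ X φ φ (c - a) * ccov μ X φ φ (e - b))
  set F := ∑ a ∈ dat N l, ∑ b ∈ dat N l, ∑ c ∈ dat N l, ∑ e ∈ dat N l,
        ker N l a b * ker N l c e * cum4 μ (lin μ X φ) a b c e
  set F' := ∑ a ∈ dat N l, ∑ b ∈ dat N l, ∑ c ∈ dat N l, ∑ e ∈ dat N l,
          (1 / ((N + l - 1 : ℕ) : ℝ)) ^ 2 * cum4 μ (lin μ X φ) a b c e
  set s := ∑' a, ccov μ X φ φ a
  set A := ∫ ω, qf N l (lin μ X φ) (lin μ X φ) ω ∂μ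
  have hd := decSum_ge_one
  have hl1 : (1 : ℝ) ≤ l := by exact_mod_cast hl
  have a3 : 4 * (K * decSum ^ 3) * (1 / (N * l) + l / (N : ℝ) ^ 2) ≤
      4 * (K * decSum ^ 3) * (1 / (N * l) + (l : ℝ) ^ 2 / (N : ℝ) ^ 2) := by
    have : (l : ℝ) ≤ (l : ℝ) ^ 2 := le_self_pow₀ hl1 (by norm_num)
    have : 0 ≤ decSum := by linarith
    gcongr
  have e : A ^ 2 + F + 2 * Q - A ^ 2 - (4 / 3 * s ^ 2 * l / N + F') =
      2 * (Q - 2 / 3 * s ^ 2 * l / N) + (F - F') := by ring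
  rw [e]
  refine (abs_add_le _ _).trans ?_
  rw [abs_mul, abs_two]
  linarith

lemma Decays.mul_decSum_nonneg {K : ℝ} {ρ : ℤ → ℝ} (h : Decays K ρ) : 0 ≤ K * decSum :=
  mul_nonneg h.nonneg (zero_le_one.trans decSum_ge_one)

lemma Regular.integral_qf_mul_mf_sq (h : Regular μ X r q C) (φ : LinForm d) :
    ∫ ω, qf N l (lin μ X φ) (lin μ X φ) ω * mf N l (lin μ X φ) ω ^ 2 ∂μ =
      (∫ ω, qf N l (lin μ X φ) (lin μ X φ) ω ∂μ) * ∫ ω, mf N l (lin μ X φ) ω ^ 2 ∂μ +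
      ∑ a ∈ dat N l, ∑ b ∈ dat N l, ∑ c ∈ dat N l, ∑ e ∈ dat N l,
        ker N l a b * (wgt N l c * wgt N l e) * (cum4 μ (lin μ X φ) a b c e +
          (ccov μ X φ φ (c - a) * ccov μ X φ φ (e - b) +
            ccov μ X φ φ (e - a) * ccov μ X φ φ (c - b))) := by
  have h0 : ∀ ω, qf N l (lin μ X φ) (lin μ X φ) ω * mf N l (lin μ X φ) ω ^ 2 =
      ∑ a ∈ dat N l, ∑ b ∈ dat N l, ∑ c ∈ dat N l, ∑ e ∈ dat N l,
        ker N l a b * (wgt N l c * wgt N l e) *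
        (lin μ X φ a ω * lin μ X φ b ω * (lin μ X φ c ω * lin μ X φ e ω)) := fun ω => by
    rw [sq, qf, mf, Finset.sum_mul_sum, ← sum_four_prod]
    refine Finset.sum_congr rfl fun a _ => Finset.sum_congr rfl fun b _ =>
      Finset.sum_congr rfl fun c _ => Finset.sum_congr rfl fun e _ => by ring
  have h6 := h.six_le
  have h1 : ∫ ω, mf N l (lin μ X φ) ω ^ 2 ∂μ = _ :=
    (integral_congr_ae (ae_of_all _ fun ω => sq _)).trans (h.integral_mf_mul φ φ)
  simp only [h0]
  rw [h.integral_sum_four (h.growth_four φ) (by omega), h.integral_qf_eq_sum, h1,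
    ← sum_four_prod, ← sum_four_add]
  refine Finset.sum_congr rfl fun a _ => Finset.sum_congr rfl fun b _ =>
      Finset.sum_congr rfl fun c _ => Finset.sum_congr rfl fun e _ => ?_
  rw [h.integral_four]
  ring

lemma Regular.abs_cov_qf_mf_sq_le (h : Regular μ X r q C) {φ : LinForm d} {K : ℝ}
    (hK : 0 ≤ K) (h2 : Decays K (ccov μ X φ φ)) (h4 : Decays4 K (cum4 μ (lin μ X φ)))
    (hl : 1 ≤ l) (hN : l ≤ N) :
    |∫ ω, qf N l (lin μ X φ) (lin μ X φ) ω * mf N l (lin μ X φ) ω ^ 2 ∂μ -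
      (∫ ω, qf N l (lin μ X φ) (lin μ X φ) ω ∂μ) * ∫ ω, mf N l (lin μ X φ) ω ^ 2 ∂μ| ≤
      (2 * (K * decSum ^ 3) + 2 * (K * decSum) ^ 2) * (l / (N : ℝ) ^ 2) := by
  rw [h.integral_qf_mul_mf_sq, add_sub_cancel_left]
  have hN1 : 1 ≤ N := hl.trans hN
  have hN0 : (0 : ℝ) < N := by positivity
  have hl1 : (1 : ℝ) ≤ l := by exact_mod_cast hl
  have hd := decSum_ge_one
  have hd0 : 0 ≤ decSum := by linarith
  have hT := h2.mul_decSum_nonneg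
  have hw : ∀ c e, |wgt N l c * wgt N l e| ≤ 1 / (N : ℝ) ^ 2 := fun c e => by
    rw [abs_mul]
    calc _ ≤ 1 / (N : ℝ) * (1 / N) :=
          mul_le_mul (abs_wgt_le hl hN1 c) (abs_wgt_le hl hN1 e) (abs_nonneg _) (by positivity)
      _ = _ := by ring
  set ρ := ccov μ X φ φ
  set F := cum4 μ (lin μ X φ)
  calc _ ≤ ∑ a ∈ dat N l, ∑ b ∈ dat N l, ∑ c ∈ dat N l, ∑ e ∈ dat N l,
        (1 / (N : ℝ) ^ 3 * |F a b c e| + (ker N l a b * (1 / (N : ℝ) ^ 2) *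
          (|ρ (c - a)| * |ρ (e - b)|) + ker N l a b * (1 / (N : ℝ) ^ 2) *
          (|ρ (e - a)| * |ρ (c - b)|))) := by
        iterate 4 refine (Finset.abs_sum_le_sum_abs _ _).trans (Finset.sum_le_sum fun _ _ => ?_)
        rename_i a _ b _ c _ e _
        have k0 := ker_nonneg (N := N) (l := l) a b
        have k1 := ker_le hl hN1 a b
        have k2 : |ker N l a b * (wgt N l c * wgt N l e)| ≤ ker N l a b * (1 / (N : ℝ) ^ 2) := by
          rw [abs_mul, abs_of_nonneg k0]
          exact mul_le_mul_of_nonneg_left (hw c e) k0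
        have k3 : ker N l a b * (1 / (N : ℝ) ^ 2) ≤ 1 / (N : ℝ) ^ 3 := by
          calc _ ≤ 1 / (N : ℝ) * (1 / (N : ℝ) ^ 2) := by gcongr
            _ = _ := by ring
        rw [abs_mul]
        calc _ ≤ ker N l a b * (1 / (N : ℝ) ^ 2) * (|F a b c e| +
              (|ρ (c - a)| * |ρ (e - b)| + |ρ (e - a)| * |ρ (c - b)|)) := by
              refine mul_le_mul k2 ?_ (abs_nonneg _) (by positivity)
              refine (abs_add_le _ _).trans (add_le_add le_rfl ((abs_add_le _ _).trans ?_))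
              rw [abs_mul, abs_mul]
          _ ≤ _ := by
              rw [mul_add, mul_add]
              gcongr
    _ = 1 / (N : ℝ) ^ 3 * ∑ a ∈ dat N l, ∑ b ∈ dat N l, ∑ c ∈ dat N l, ∑ e ∈ dat N l,
          |F a b c e| + (∑ a ∈ dat N l, ∑ b ∈ dat N l, ker N l a b * (1 / (N : ℝ) ^ 2) *
          ((∑ c ∈ dat N l, |ρ (c - a)|) * ∑ e ∈ dat N l, |ρ (e - b)|) +
          ∑ a ∈ dat N l, ∑ b ∈ dat N l, ker N l a b * (1 / (N : ℝ) ^ 2) *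
          ((∑ c ∈ dat N l, |ρ (c - b)|) * ∑ e ∈ dat N l, |ρ (e - a)|)) := by
        rw [sum_four_add, sum_four_add]
        congr 1
        · simp only [Finset.mul_sum]
        congr 1 <;> refine Finset.sum_congr rfl fun a _ => Finset.sum_congr rfl fun b _ => ?_ <;>
          rw [Finset.sum_mul_sum] <;> simp only [Finset.mul_sum]
        exact Finset.sum_congr rfl fun c _ => Finset.sum_congr rfl fun e _ => by ring
    _ ≤ 1 / (N : ℝ) ^ 3 * (2 * N * (K * decSum ^ 3)) +
        (l * (1 / (N : ℝ) ^ 2) * (K * decSum) ^ 2 + l * (1 / (N : ℝ) ^ 2) * (K * decSum) ^ 2) := by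
        have s1 : ∀ a b, (∑ c ∈ dat N l, |ρ (c - a)|) * ∑ e ∈ dat N l, |ρ (e - b)| ≤
            (K * decSum) ^ 2 := fun a b => by
          rw [sq]
          exact mul_le_mul (h2.sum_abs_le _ a) (h2.sum_abs_le _ b)
            (Finset.sum_nonneg fun _ _ => abs_nonneg _) hT
        have s2 : ∀ f : ℤ → ℤ → ℝ, (∀ a b, f a b ≤ (K * decSum) ^ 2) → ∑ a ∈ dat N l,
            ∑ b ∈ dat N l, ker N l a b * (1 / (N : ℝ) ^ 2) * f a b ≤
            l * (1 / (N : ℝ) ^ 2) * (K * decSum) ^ 2 := fun f hf => by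
          rw [← sum_ker hl hN1]
          simp only [Finset.sum_mul]
          refine Finset.sum_le_sum fun a _ => Finset.sum_le_sum fun b _ => ?_
          have k0 := ker_nonneg (N := N) (l := l) a b
          exact mul_le_mul_of_nonneg_left (hf a b) (by positivity)
        refine add_le_add ?_ (add_le_add (s2 _ s1) (s2 _ fun a b => s1 b a))
        gcongr
        exact h4.sum_abs_le hK hl hN
    _ = (2 * (K * decSum ^ 3)) * (1 / (N : ℝ) ^ 2) + 2 * (K * decSum) ^ 2 * (l / (N : ℝ) ^ 2) := by
        field_simp
        ring
    _ ≤ _ := by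
        rw [add_mul]
        have : 1 / (N : ℝ) ^ 2 ≤ l / (N : ℝ) ^ 2 := by gcongr
        gcongr

lemma mf_eq_average (x : ℤ → Ω → ℝ) (ω : Ω) : mf N l x ω =
    ∑ t ∈ Finset.range l, (1 / (l : ℝ)) *
      ((∑ i ∈ Finset.range N, x ((t + 1 : ℤ) + i) ω) / N) := by
  rw [mf_eq]
  simp only [bsum]
  rw [Finset.sum_comm, Finset.sum_div]
  refine Finset.sum_congr rfl fun t _ => ?_
  rw [one_div_mul_eq_div, div_div]
  congr 1
  refine Finset.sum_congr rfl fun i _ => ?_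
  congr 1
  ring

lemma Regular.integral_mf_pow_le (h : Regular μ X r q C) {φ : LinForm d} {p e : ℕ}
    {K : ℝ} (hp : Even p) (hpr : p ≤ 2 * r) (hl : 1 ≤ l)
    (hK : ∀ (s : ℤ) (n : ℕ),
      ∫ ω, (∑ i ∈ Finset.range n, lin μ X φ (s + i) ω) ^ p ∂μ ≤ K * (n : ℝ) ^ e) :
    ∫ ω, mf N l (lin μ X φ) ω ^ p ∂μ ≤ K * (N : ℝ) ^ e / (N : ℝ) ^ p := by
  have hl0 : (0 : ℝ) < l := by positivity
  have g : ∀ t : ℕ, Growth X (1 * p) (fun ω =>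
      ((∑ i ∈ Finset.range N, lin μ X φ ((t + 1 : ℤ) + i) ω) / N) ^ p) := fun t =>
    (Growth.pow ((Growth.sum fun i _ => h.growth_lin φ _).div_const _) p)
  have gm := (h.growth_mf (N := N) (l := l) φ).pow p
  have hp1 : 1 * p ≤ 2 * r := by omega
  calc ∫ ω, mf N l (lin μ X φ) ω ^ p ∂μ
      ≤ ∫ ω, ∑ t ∈ Finset.range l, (1 / (l : ℝ)) *
        ((∑ i ∈ Finset.range N, lin μ X φ ((t + 1 : ℤ) + i) ω) / N) ^ p ∂μ := by
        refine integral_mono (gm.integrable h hp1)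
          ((Growth.sum fun t _ => (g t).const_mul _).integrable h hp1) fun ω => ?_
        rw [mf_eq_average]
        refine Real.pow_arith_mean_le_arith_mean_pow_of_even _ _ _ (fun _ _ => by positivity) ?_ hp
        rw [Finset.sum_const, Finset.card_range, nsmul_eq_mul]
        field_simp
    _ = ∑ t ∈ Finset.range l, (1 / (l : ℝ)) * ((∫ ω,
        (∑ i ∈ Finset.range N, lin μ X φ ((t + 1 : ℤ) + i) ω) ^ p ∂μ) / (N : ℝ) ^ p) := by
        rw [integral_finsetSum _ fun t _ => ((g t).const_mul _).integrable h hp1]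
        refine Finset.sum_congr rfl fun t _ => ?_
        rw [integral_const_mul]
        simp only [div_pow, integral_div]
    _ ≤ ∑ t ∈ Finset.range l, (1 / (l : ℝ)) * (K * (N : ℝ) ^ e / (N : ℝ) ^ p) := by
        gcongr
        exact hK _ _
    _ = _ := by
        rw [Finset.sum_const, Finset.card_range, nsmul_eq_mul]
        field_simp

lemma Regular.exists_mf_pow_le (h : Regular μ X r q C) (B : ℝ) :
    ∃ K : ℝ, 1 ≤ K ∧ ∀ φ : LinForm d, ‖φ‖ ≤ B → ∀ N l : ℕ, 1 ≤ l → 1 ≤ N →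
      (∀ j, 1 ≤ j → j ≤ 5 → ∫ ω, mf N l (lin μ X φ) ω ^ (2 * j) ∂μ ≤ K / (N : ℝ) ^ j) ∧
      ∫ ω, mf N l (lin μ X φ) ω ^ (2 * r) ∂μ ≤ K / (N : ℝ) ^ 4 := by
  obtain ⟨M, hM, hA⟩ := h.exists_adm_lin B
  obtain ⟨K0, h0, H0⟩ := h.exists_moment_le hM (N := 0) (by decide) (by norm_num)
  obtain ⟨K2, h2, H2⟩ := h.exists_moment_le hM (N := 2) (by decide) (by norm_num)
  obtain ⟨K4, h4, H4⟩ := h.exists_moment_le hM (N := 4) (by decide) (by norm_num)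
  obtain ⟨K6, h6, H6⟩ := h.exists_moment_le hM (N := 6) (by decide) (by norm_num)
  obtain ⟨K8, h8, H8⟩ := h.exists_moment_le hM (N := 8) (by decide) (by norm_num)
  obtain ⟨K, h1, H1⟩ := h.exists_moment_top_le hM
  have hr := h.six_le
  refine ⟨K0 + K2 + K4 + K6 + K8 + K, by linarith, fun φ hφ N l hl hN => ⟨fun j hj hj5 => ?_, ?_⟩⟩
  · have hN0 : (0 : ℝ) < N := by positivity
    have key : ∀ K' : ℝ, K' ≤ K0 + K2 + K4 + K6 + K8 + K → (∀ (s : ℤ) (n : ℕ),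
        ∫ ω, (∑ i ∈ Finset.range n, lin μ X φ (s + i) ω) ^ (2 * j) ∂μ ≤ K' * (n : ℝ) ^ j) →
        ∫ ω, mf N l (lin μ X φ) ω ^ (2 * j) ∂μ ≤
          (K0 + K2 + K4 + K6 + K8 + K) / (N : ℝ) ^ j := fun K' hK' H => by
      refine (h.integral_mf_pow_le (even_two_mul j) (by omega) hl H).trans ?_
      have e : K' * (N : ℝ) ^ j / (N : ℝ) ^ (2 * j) = K' / (N : ℝ) ^ j := by
        rw [two_mul, pow_add]
        field_simp
      rw [e]
      gcongr
    have hx := hA φ hφ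
    interval_cases j
    · exact key K0 (by linarith) (H0 _ hx)
    · exact key K2 (by linarith) (H2 _ hx)
    · exact key K4 (by linarith) (H4 _ hx)
    · exact key K6 (by linarith) (H6 _ hx)
    · exact key K8 (by linarith) (H8 _ hx)
  · have hN1 : (1 : ℝ) ≤ N := by exact_mod_cast hN
    refine (h.integral_mf_pow_le (even_two_mul r) le_rfl hl (H1 _ (hA φ hφ))).trans ?_
    have e : (N : ℝ) ^ (2 * r) = (N : ℝ) ^ (r + 1) * (N : ℝ) ^ (r - 1) := by
      rw [← pow_add]
      congr 1
      omega
    rw [e, mul_comm, mul_div_mul_left _ _ (by positivity)]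
    have : (N : ℝ) ^ 4 ≤ (N : ℝ) ^ (r - 1) := pow_le_pow_right₀ hN1 (by omega)
    gcongr
    linarith

end Forms

section BlockSums

/-- Weight controlling the dependence between blocks of width `w` at distance `h`. -/
def gap (w h : ℕ) : ℝ := 1 / (1 + ((h / 2 - w : ℕ) : ℝ)) ^ 2

lemma gap_nonneg (w h : ℕ) : 0 ≤ gap w h := by unfold gap; positivity

lemma gap_le (w : ℕ) (x : ℤ) : gap w x.natAbs ≤
    (if x ∈ Finset.Ioo (-(2 * w : ℤ)) (2 * w) then 1 else 0) +
      4 * (dec (x - 2 * w) + dec (x + 2 * w)) := by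
  have h1 := (dec_pos (x - 2 * w)).le
  have h2 := (dec_pos (x + 2 * w)).le
  have key : ∀ y : ℤ, |y| ≤ 2 * ((x.natAbs / 2 - w : ℕ) : ℤ) + 1 →
      gap w x.natAbs ≤ 4 * dec y := fun y hy => by
    have h3 : |(y : ℝ)| ≤ 2 * ((x.natAbs / 2 - w : ℕ) : ℝ) + 1 := by exact_mod_cast hy
    unfold gap dec
    rw [mul_one_div, div_le_div_iff₀ (by positivity) (by positivity)]
    have h4 : 1 + |(y : ℝ)| ≤ 2 * (1 + ((x.natAbs / 2 - w : ℕ) : ℝ)) := by linarith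
    calc 1 * (1 + |(y : ℝ)|) ^ 2 ≤ (2 * (1 + ((x.natAbs / 2 - w : ℕ) : ℝ))) ^ 2 := by
          rw [one_mul]
          gcongr
      _ = _ := by ring
  by_cases hx : x ∈ Finset.Ioo (-(2 * w : ℤ)) (2 * w)
  · rw [if_pos hx]
    have : gap w x.natAbs ≤ 1 := by
      unfold gap
      rw [div_le_one (by positivity)]
      exact one_le_pow₀ (by linarith [Nat.cast_nonneg (α := ℝ) (x.natAbs / 2 - w)])
    linarith
  · rw [if_neg hx]
    simp only [Finset.mem_Ioo, not_and_or, not_lt] at hx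
    rcases hx with hx | hx
    · have := key (x + 2 * w) (by rw [abs_le]; omega)
      linarith
    · have := key (x - 2 * w) (by rw [abs_le]; omega)
      linarith

/-- Constant in the summation bound for `gap`. -/
def gapSum : ℝ := 4 + 8 * decSum

lemma gapSum_nonneg : 0 ≤ gapSum := by
  have := decSum_ge_one
  unfold gapSum
  linarith

lemma sum_gap_le {w : ℕ} (hw : 1 ≤ w) (N : ℕ) (i : ℤ) :
    ∑ j ∈ Finset.range N, gap w (i - j : ℤ).natAbs ≤ gapSum * w := by
  set S : Finset ℤ := (Finset.range N).map Nat.castEmbedding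
  have e : ∑ j ∈ Finset.range N, gap w (i - j : ℤ).natAbs = ∑ z ∈ S, gap w (i - z).natAbs := by
    rw [Finset.sum_map]
    rfl
  rw [e]
  have hw1 : (1 : ℝ) ≤ w := by exact_mod_cast hw
  have hd := decSum_ge_one
  have h1 : ∑ z ∈ S, (if i - z ∈ Finset.Ioo (-(2 * w : ℤ)) (2 * w) then (1 : ℝ) else 0) ≤ 4 * w := by
    rw [Finset.sum_boole]
    have h2 : (S.filter fun z => i - z ∈ Finset.Ioo (-(2 * w : ℤ)) (2 * w)).card ≤ 4 * w := by
      refine (Finset.card_le_card (t := Finset.Ioo (i - 2 * w) (i + 2 * w)) fun z hz => ?_).trans ?_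
      · simp only [Finset.mem_filter, Finset.mem_Ioo] at hz ⊢
        omega
      · rw [Int.card_Ioo]
        omega
    exact_mod_cast h2
  have h3 : ∑ z ∈ S, dec (i - z - 2 * w) ≤ decSum := by
    have := sum_dec_le' S (i - 2 * w)
    refine (Finset.sum_congr rfl fun z _ => ?_).trans_le this
    congr 1
    ring
  have h4 : ∑ z ∈ S, dec (i - z + 2 * w) ≤ decSum := by
    have := sum_dec_le' S (i + 2 * w)
    refine (Finset.sum_congr rfl fun z _ => ?_).trans_le this
    congr 1
    ring
  refine (Finset.sum_le_sum fun z _ => gap_le w (i - z)).trans ?_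
  rw [Finset.sum_add_distrib, ← Finset.mul_sum, Finset.sum_add_distrib]
  unfold gapSum
  nlinarith

variable {μ : Measure Ω} {X : ℤ → Ω → Fin d → ℝ} {r : ℕ} {q C : ℝ} {N w : ℕ} {M : ℝ}
  {c c' c'' : ℤ → Ω → ℝ}
variable [IsProbabilityMeasure μ]

lemma Regular.pair_gap_le (h : Regular μ X r q C) (hc : Blk μ X w 3 M c) (hc' : Blk μ X w 3 M c')
    (i j : ℤ) : |∫ ω, c i ω * c' j ω ∂μ| ≤ (4 + 4 * M) * C * gap w (i - j).natAbs := by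
  have := h.pair_le hc hc' (m := 2) (by norm_num) (by norm_num) (i := i) (j := j)
    (t := (i - j).natAbs / 2 - w) (by omega)
  rwa [gap, mul_one_div]

lemma Regular.triple_gap_le (h : Regular μ X r q C) (hc : Blk μ X w 5 M c)
    (hc' : Blk μ X w 5 M c') (hc'' : Blk μ X w 5 M c'') (i j k : ℤ) :
    |∫ ω, c i ω * c' j ω * c'' k ω ∂μ| ≤
      (4 + 6 * M) * C * (gap w (i - j).natAbs * gap w (i - k).natAbs) := by
  have hM := hc.nonneg
  have hC := h.one_le
  set s := (i - j).natAbs / 2 - w with hs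
  set t := (i - k).natAbs / 2 - w with ht
  have h1 := h.triple_le hc hc' hc'' (m := 4) (by norm_num) (by norm_num) (i := i) (j := j) (k := k)
    (t := max s t) (by
      rcases le_total s t with h | h
      · rw [max_eq_right h]
        have : |i - k| = (i - k).natAbs := (Int.natCast_natAbs _).symm
        omega
      · rw [max_eq_left h]
        have : |i - j| = (i - j).natAbs := (Int.natCast_natAbs _).symm
        omega)
  refine h1.trans ?_
  rw [gap, gap, ← hs, ← ht, one_div_mul_one_div, mul_one_div]
  have hs' : (s : ℝ) ≤ (max s t : ℕ) := by exact_mod_cast le_max_left s t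
  have ht' : (t : ℝ) ≤ (max s t : ℕ) := by exact_mod_cast le_max_right s t
  have : (1 + (s : ℝ)) ^ 2 * (1 + (t : ℝ)) ^ 2 ≤ (1 + ((max s t : ℕ) : ℝ)) ^ 4 := by
    calc _ ≤ (1 + ((max s t : ℕ) : ℝ)) ^ 2 * (1 + ((max s t : ℕ) : ℝ)) ^ 2 := by gcongr
      _ = _ := by ring
  gcongr

lemma Regular.integral_sq_sum_le (h : Regular μ X r q C) (hc : Blk μ X w 3 M c) (hw : 1 ≤ w)
    {g : ℕ} (hg : ∀ i, Growth X g (c i)) (hgr : g + g ≤ 2 * r) :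
    ∫ ω, (∑ i ∈ Finset.range N, c i ω) ^ 2 ∂μ ≤ (4 + 4 * M) * C * gapSum * (N * w) := by
  have hM := hc.nonneg
  have hC := h.one_le
  have h0 : ∀ ω, (∑ i ∈ Finset.range N, c i ω) ^ 2 =
      ∑ i ∈ Finset.range N, ∑ j ∈ Finset.range N, c i ω * c j ω := fun ω => by
    rw [sq, Finset.sum_mul_sum]
  simp only [h0]
  rw [integral_finsetSum _ fun (i : ℕ) _ =>
    (Growth.sum fun (j : ℕ) _ => (hg i).mul (hg j)).integrable h hgr]
  calc _ ≤ ∑ i ∈ Finset.range N, ∑ j ∈ Finset.range N,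
        (4 + 4 * M) * C * gap w ((i : ℤ) - j).natAbs := by
        refine Finset.sum_le_sum fun i _ => ?_
        rw [integral_finsetSum _ fun (j : ℕ) _ => ((hg i).mul (hg j)).integrable h hgr]
        exact Finset.sum_le_sum fun j _ => (le_abs_self _).trans (h.pair_gap_le hc hc _ _)
    _ ≤ ∑ i ∈ Finset.range N, (4 + 4 * M) * C * (gapSum * w) := by
        refine Finset.sum_le_sum fun i _ => ?_
        rw [← Finset.mul_sum]
        have := sum_gap_le hw N i
        gcongr
    _ = _ := by
        rw [Finset.sum_const, Finset.card_range, nsmul_eq_mul]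
        ring

lemma Regular.abs_integral_triple_sum_le (h : Regular μ X r q C) (hc : Blk μ X w 5 M c)
    (hc' : Blk μ X w 5 M c') (hc'' : Blk μ X w 5 M c'') (hw : 1 ≤ w) {g g' g'' : ℕ}
    (hg : ∀ i, Growth X g (c i)) (hg' : ∀ i, Growth X g' (c' i)) (hg'' : ∀ i, Growth X g'' (c'' i))
    (hgr : g + g' + g'' ≤ 2 * r) :
    |∫ ω, (∑ i ∈ Finset.range N, c i ω) * (∑ i ∈ Finset.range N, c' i ω) *
      (∑ i ∈ Finset.range N, c'' i ω) ∂μ| ≤ (4 + 6 * M) * C * gapSum ^ 2 * (N * (w : ℝ) ^ 2) := by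
  have hM := hc.nonneg
  have hC := h.one_le
  have h0 : ∀ ω, (∑ i ∈ Finset.range N, c i ω) * (∑ i ∈ Finset.range N, c' i ω) *
      (∑ i ∈ Finset.range N, c'' i ω) = ∑ i ∈ Finset.range N, ∑ j ∈ Finset.range N,
        ∑ k ∈ Finset.range N, c i ω * c' j ω * c'' k ω := fun ω => by
    rw [Finset.sum_mul_sum, Finset.sum_mul]
    refine Finset.sum_congr rfl fun i _ => ?_
    rw [Finset.sum_mul_sum]
  have g3 : ∀ i j k, Growth X (g + g' + g'') fun ω => c i ω * c' j ω * c'' k ω :=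
    fun i j k => ((hg i).mul (hg' j)).mul (hg'' k)
  simp only [h0]
  rw [integral_finsetSum _ fun (i : ℕ) _ => (Growth.sum fun (j : ℕ) _ =>
    Growth.sum fun (k : ℕ) _ => g3 i j k).integrable h hgr]
  have hG := gapSum_nonneg
  calc _ ≤ ∑ i ∈ Finset.range N, ∑ j ∈ Finset.range N, ∑ k ∈ Finset.range N,
        (4 + 6 * M) * C * (gap w ((i : ℤ) - j).natAbs * gap w ((i : ℤ) - k).natAbs) := by
        refine (Finset.abs_sum_le_sum_abs _ _).trans (Finset.sum_le_sum fun i _ => ?_)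
        rw [integral_finsetSum _ fun (j : ℕ) _ =>
          (Growth.sum fun (k : ℕ) _ => g3 i j k).integrable h hgr]
        refine (Finset.abs_sum_le_sum_abs _ _).trans (Finset.sum_le_sum fun j _ => ?_)
        rw [integral_finsetSum _ fun (k : ℕ) _ => (g3 i j k).integrable h hgr]
        refine (Finset.abs_sum_le_sum_abs _ _).trans (Finset.sum_le_sum fun k _ => ?_)
        exact h.triple_gap_le hc hc' hc'' i j k
    _ ≤ ∑ i ∈ Finset.range N, (4 + 6 * M) * C * ((gapSum * w) * (gapSum * w)) := by
        refine Finset.sum_le_sum fun i _ => ?_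
        have e : ∑ j ∈ Finset.range N, ∑ k ∈ Finset.range N,
            (4 + 6 * M) * C * (gap w ((i : ℤ) - j).natAbs * gap w ((i : ℤ) - k).natAbs) =
            (4 + 6 * M) * C * ((∑ j ∈ Finset.range N, gap w ((i : ℤ) - j).natAbs) *
              ∑ k ∈ Finset.range N, gap w ((i : ℤ) - k).natAbs) := by
          rw [Finset.sum_mul_sum]
          simp only [Finset.mul_sum]
        rw [e]
        have := sum_gap_le hw N i
        have := Finset.sum_nonneg fun j (_ : j ∈ Finset.range N) =>
          gap_nonneg w ((i : ℤ) - j).natAbs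
        gcongr
    _ = _ := by
        rw [Finset.sum_const, Finset.card_range, nsmul_eq_mul]
        ring

end BlockSums

section NormalizedBlocks

variable {μ : Measure Ω} {X : ℤ → Ω → Fin d → ℝ} {r : ℕ} {q C : ℝ} {N l : ℕ}

/-- Sum of a linear functional over a block, normalised by the square root of its length. -/
def nb (μ : Measure Ω) (X : ℤ → Ω → Fin d → ℝ) (l : ℕ) (φ : LinForm d) (i : ℤ) (ω : Ω) :
    ℝ :=
  (∑ t ∈ Finset.range l, lin μ X φ (i + 1 + t) ω) / √(l : ℝ)

lemma bsum_lin (hl : 1 ≤ l) (φ : LinForm d) (i : ℕ) (ω : Ω) :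
    bsum l (fun a => lin μ X φ a ω) i = √(l : ℝ) * nb μ X l φ i ω := by
  have : √(l : ℝ) ≠ 0 := by positivity
  unfold nb bsum
  field_simp

lemma qf_eq_nb (hl : 1 ≤ l) (φ ψ : LinForm d) (ω : Ω) :
    qf N l (lin μ X φ) (lin μ X ψ) ω =
      (∑ i ∈ Finset.range N, nb μ X l φ i ω * nb μ X l ψ i ω) / N := by
  rw [qf_eq]
  simp only [bsum_lin hl]
  have h0 : (0 : ℝ) < l := by positivity
  have e : ∀ i : ℕ, √(l : ℝ) * nb μ X l φ i ω * (√(l : ℝ) * nb μ X l ψ i ω) =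
      l * (nb μ X l φ i ω * nb μ X l ψ i ω) := fun i => by
    rw [mul_mul_mul_comm, Real.mul_self_sqrt h0.le]
  simp only [e, ← Finset.mul_sum]
  rw [mul_comm (N : ℝ), mul_div_mul_left _ _ h0.ne']

lemma mf_eq_nb (hl : 1 ≤ l) (φ : LinForm d) (ω : Ω) :
    mf N l (lin μ X φ) ω = (∑ i ∈ Finset.range N, nb μ X l φ i ω) / (N * √(l : ℝ)) := by
  rw [mf_eq]
  simp only [bsum_lin hl, ← Finset.mul_sum]
  have h0 : 0 < √(l : ℝ) := by positivity
  have e : (N * l : ℝ) = √(l : ℝ) * (N * √(l : ℝ)) := by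
    rw [mul_left_comm, Real.mul_self_sqrt (by positivity)]
  rw [e, mul_div_mul_left _ _ h0.ne']

lemma Regular.growth_nb (h : Regular μ X r q C) (φ : LinForm d) (i : ℤ) :
    Growth X 1 (nb μ X l φ i) :=
  (Growth.sum fun _ _ => h.growth_lin φ _).div_const _

lemma measurable_lin_sigmaOf (φ : LinForm d) {S : Set ℤ} {a : ℤ} (ha : a ∈ S) :
    Measurable[sigmaOf X S] (lin μ X φ a) := by
  have h1 : Measurable[MeasurableSpace.comap (X a) inferInstance] (lin μ X φ a) :=
    ((φ.measurable.comp (measurable_id.sub measurable_const)).comp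
      (comap_measurable (X a)) : _)
  exact h1.mono (comap_le_sigmaOf ha) le_rfl

lemma measurable_nb (φ : LinForm d) (i : ℤ) :
    Measurable[sigmaOf X (Set.Icc i (i + l))] (nb μ X l φ i) := by
  refine Measurable.div_const (Finset.measurable_fun_sum _ fun t ht => ?_) _
  have := Finset.mem_range.1 ht
  exact measurable_lin_sigmaOf φ (Set.mem_Icc.2 ⟨by omega, by omega⟩)

/-- Average of triple products of normalised block sums. -/
def tf (μ : Measure Ω) (X : ℤ → Ω → Fin d → ℝ) (N l : ℕ) (φ ψ χ : LinForm d) (ω : Ω) :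
    ℝ :=
  (∑ i ∈ Finset.range N, nb μ X l φ i ω * nb μ X l ψ i ω * nb μ X l χ i ω) / N

lemma Regular.growth_nb_mul (h : Regular μ X r q C) (φ ψ : LinForm d) (i : ℤ) :
    Growth X 2 (fun ω => nb μ X l φ i ω * nb μ X l ψ i ω) :=
  (h.growth_nb φ i).mul (h.growth_nb ψ i)

lemma Regular.growth_nb_mul_mul (h : Regular μ X r q C) (φ ψ χ : LinForm d) (i : ℤ) :
    Growth X 3 (fun ω => nb μ X l φ i ω * nb μ X l ψ i ω * nb μ X l χ i ω) :=
  (h.growth_nb_mul φ ψ i).mul (h.growth_nb χ i)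

lemma Regular.growth_tf (h : Regular μ X r q C) (φ ψ χ : LinForm d) :
    Growth X 3 (tf μ X N l φ ψ χ) :=
  (Growth.sum (s := Finset.range N) fun (i : ℕ) _ =>
    h.growth_nb_mul_mul (l := l) φ ψ χ (i : ℤ)).div_const (N : ℝ)

variable [IsProbabilityMeasure μ]

lemma Regular.exists_nb_moment_le (h : Regular μ X r q C) (B : ℝ) :
    ∃ K : ℝ, 1 ≤ K ∧ ∀ φ : LinForm d, ‖φ‖ ≤ B → ∀ l : ℕ, 1 ≤ l → ∀ i : ℤ,
      ∫ ω, nb μ X l φ i ω ^ 8 ∂μ ≤ K ∧ ∫ ω, nb μ X l φ i ω ^ 10 ∂μ ≤ K ∧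
      ∫ ω, nb μ X l φ i ω ^ (2 * r) ∂μ ≤ K * l := by
  obtain ⟨M, hM, hA⟩ := h.exists_adm_lin B
  obtain ⟨K6, h6, H6⟩ := h.exists_moment_le hM (N := 6) (by decide) (by norm_num)
  obtain ⟨K8, h8, H8⟩ := h.exists_moment_le hM (N := 8) (by decide) (by norm_num)
  obtain ⟨K, h1, H1⟩ := h.exists_moment_top_le hM
  refine ⟨K6 + K8 + K, by linarith, fun φ hφ l hl i => ?_⟩
  have hl0 : (0 : ℝ) < l := by positivity
  have key : ∀ p : ℕ, ∫ ω, nb μ X l φ i ω ^ (2 * p) ∂μ =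
      (∫ ω, (∑ t ∈ Finset.range l, lin μ X φ (i + 1 + t) ω) ^ (2 * p) ∂μ) / (l : ℝ) ^ p :=
    fun p => by
      simp only [nb, div_pow, integral_div]
      rw [pow_mul (√(l : ℝ)), Real.sq_sqrt hl0.le]
  refine ⟨?_, ?_, ?_⟩
  · have := H6 _ (hA φ hφ) (i + 1) l
    norm_num at this
    rw [show 8 = 2 * 4 by norm_num, key, div_le_iff₀ (by positivity)]
    refine this.trans ?_
    gcongr
    linarith
  · have := H8 _ (hA φ hφ) (i + 1) l
    norm_num at this
    rw [show 10 = 2 * 5 by norm_num, key, div_le_iff₀ (by positivity)]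
    refine this.trans ?_
    gcongr
    linarith
  · rw [key, div_le_iff₀ (by positivity)]
    refine (H1 _ (hA φ hφ) (i + 1) l).trans ?_
    rw [mul_assoc, ← pow_succ']
    gcongr
    linarith

lemma Blk.of_center {w : ℕ} {P M : ℝ} {f : ℤ → Ω → ℝ} (hX : ∀ i, Measurable (X i)) (hP : 1 ≤ P)
    (hm : ∀ i, Measurable[sigmaOf X (Set.Icc i (i + w))] (f i))
    (hi : ∀ i, Integrable (fun ω => |f i ω| ^ P) μ) (hb : ∀ i, ∫ ω, |f i ω| ^ P ∂μ ≤ M) :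
    Blk μ X w P (2 ^ P * (M + (1 + M) ^ P)) (fun i ω => f i ω - ∫ ω', f i ω' ∂μ) := by
  have hP0 : 0 ≤ P := by linarith
  have hm' : ∀ i, Measurable (f i) := fun i => (hm i).mono (sigmaOf_le hX _) le_rfl
  have hM : 0 ≤ M := le_trans (integral_nonneg fun ω => by positivity) (hb 0)
  have hle : ∀ i ω, |f i ω| ≤ 1 + |f i ω| ^ P := fun i ω => by
    simpa using abs_rpow_le_one_add (x := f i ω) zero_le_one hP
  have hi1 : ∀ i, Integrable (fun ω => 1 + |f i ω| ^ P) μ := fun i =>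
    (integrable_const _).add (hi i)
  have hf : ∀ i, Integrable (f i) μ := fun i =>
    (hi1 i).mono' (hm' i).aestronglyMeasurable (ae_of_all _ (hle i))
  have hE : ∀ i, |∫ ω, f i ω ∂μ| ≤ 1 + M := fun i => by
    calc _ ≤ ∫ ω, |f i ω| ∂μ := abs_integral_le_integral_abs
      _ ≤ ∫ ω, (1 + |f i ω| ^ P) ∂μ := integral_mono (hf i).abs (hi1 i) (hle i)
      _ = 1 + ∫ ω, |f i ω| ^ P ∂μ := by
          rw [integral_add (integrable_const _) (hi i)]
          simp
      _ ≤ _ := by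
          gcongr
          exact hb i
  have hpt : ∀ i ω, |f i ω - ∫ ω', f i ω' ∂μ| ^ P ≤ 2 ^ P * (|f i ω| ^ P + (1 + M) ^ P) :=
    fun i ω => by
      refine (Real.rpow_le_rpow (abs_nonneg _) (abs_sub _ _) hP0).trans ?_
      refine (add_rpow_le (abs_nonneg _) (abs_nonneg _) hP0).trans ?_
      have := Real.rpow_le_rpow (abs_nonneg _) (hE i) hP0
      gcongr
  have hi2 : ∀ i, Integrable (fun ω => 2 ^ P * (|f i ω| ^ P + (1 + M) ^ P)) μ := fun i =>
    ((hi i).add (integrable_const _)).const_mul _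
  have hi3 : ∀ i, Integrable (fun ω => |f i ω - ∫ ω', f i ω' ∂μ| ^ P) μ := fun i => by
    refine (hi2 i).mono' ?_ (ae_of_all _ fun ω => ?_)
    · exact (((hm' i).sub_const _).abs.pow_const P).aestronglyMeasurable
    · rw [Real.norm_eq_abs, abs_of_nonneg (by positivity)]
      exact hpt i ω
  refine ⟨fun i => (hm i).sub_const _, hi3, fun i => ?_, fun i => ?_⟩
  · calc _ ≤ ∫ ω, 2 ^ P * (|f i ω| ^ P + (1 + M) ^ P) ∂μ := integral_mono (hi3 i) (hi2 i) (hpt i)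
      _ = 2 ^ P * (∫ ω, |f i ω| ^ P ∂μ + (1 + M) ^ P) := by
          rw [integral_const_mul, integral_add (hi i) (integrable_const _)]
          simp
      _ ≤ _ := by
          gcongr
          exact hb i
  · rw [integral_sub (hf i) (integrable_const _)]
    simp

lemma abs_mul_mul_pow_le (x y z : ℝ) {j k : ℕ} (hk : Even k) (h : 3 * j ≤ k) :
    |x * y * z| ^ j ≤ 1 + (x ^ k + y ^ k + z ^ k) := by
  have h1 : ∀ u : ℝ, u ^ k = |u| ^ k := fun u => (hk.pow_abs u).symm
  rw [h1 x, h1 y, h1 z, abs_mul, abs_mul]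
  generalize hx : |x| = a
  generalize hy : |y| = b
  generalize hz : |z| = c
  have ha : 0 ≤ a := hx ▸ abs_nonneg x
  have hb : 0 ≤ b := hy ▸ abs_nonneg y
  have hc : 0 ≤ c := hz ▸ abs_nonneg z
  have pa : 0 ≤ a ^ k := by positivity
  have pb : 0 ≤ b ^ k := by positivity
  have pc : 0 ≤ c ^ k := by positivity
  have key : ∀ T : ℝ, 1 ≤ T → a ≤ T → b ≤ T → c ≤ T → (a * b * c) ^ j ≤ T ^ k :=
    fun T hT h1 h2 h3 => by
      calc (a * b * c) ^ j ≤ (T * T * T) ^ j := by gcongr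
        _ = T ^ (3 * j) := by rw [pow_mul]; ring
        _ ≤ T ^ k := pow_le_pow_right₀ hT h
  have := key (max 1 (max a (max b c))) (by simp) (by simp) (by simp) (by simp)
  rcases max_choice 1 (max a (max b c)) with e | e <;> rw [e] at this
  · rw [one_pow] at this
    linarith
  rcases max_choice a (max b c) with e | e <;> rw [e] at this
  · linarith
  rcases max_choice b c with e | e <;> rw [e] at this <;> linarith

lemma Blk.mono_exponent {w : ℕ} {P P' M : ℝ} {c : ℤ → Ω → ℝ} (hX : ∀ i, Measurable (X i))
    (hc : Blk μ X w P M c) (h0 : 0 ≤ P') (hP : P' ≤ P) : Blk μ X w P' (1 + M) c := by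
  have hi : ∀ i, Integrable (fun ω => 1 + |c i ω| ^ P) μ := fun i =>
    (integrable_const _).add (hc.int i)
  have hi' : ∀ i, Integrable (fun ω => |c i ω| ^ P') μ := fun i => by
    refine (hi i).mono' ((hc.measurable hX i).abs.pow_const P').aestronglyMeasurable
      (ae_of_all _ fun ω => ?_)
    rw [Real.norm_eq_abs, abs_of_nonneg (by positivity)]
    exact abs_rpow_le_one_add h0 hP
  refine ⟨hc.meas, hi', fun i => ?_, hc.mean⟩
  calc _ ≤ ∫ ω, (1 + |c i ω| ^ P) ∂μ :=
        integral_mono (hi' i) (hi i) fun ω => abs_rpow_le_one_add h0 hP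
    _ = 1 + ∫ ω, |c i ω| ^ P ∂μ := by
        rw [integral_add (integrable_const _) (hc.int i)]
        simp
    _ ≤ _ := by
        gcongr
        exact hc.bound i

lemma Blk.mono_bound {w : ℕ} {P M M' : ℝ} {c : ℤ → Ω → ℝ} (hc : Blk μ X w P M c) (h : M ≤ M') :
    Blk μ X w P M' c :=
  ⟨hc.meas, hc.int, fun i => (hc.bound i).trans h, hc.mean⟩

lemma Regular.integral_nb (h : Regular μ X r q C) (φ : LinForm d) (i : ℤ) :
    ∫ ω, nb μ X l φ i ω ∂μ = 0 := by
  have := h.six_le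
  unfold nb
  rw [integral_div, integral_finsetSum _ fun t _ => (h.growth_lin φ _).integrable h (by omega)]
  simp [h.lin_mean]

lemma Regular.exists_blk (h : Regular μ X r q C) (B : ℝ) :
    ∃ M : ℝ, 0 ≤ M ∧ ∀ l : ℕ, 1 ≤ l → ∀ φ ψ χ : LinForm d,
      ‖φ‖ ≤ B → ‖ψ‖ ≤ B → ‖χ‖ ≤ B →
      Blk μ X l 5 M (nb μ X l φ) ∧
      Blk μ X l 5 M (fun i ω => nb μ X l φ i ω * nb μ X l ψ i ω -
        ∫ ω', nb μ X l φ i ω' * nb μ X l ψ i ω' ∂μ) ∧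
      Blk μ X l 3 M (fun i ω => nb μ X l φ i ω * nb μ X l ψ i ω -
        ∫ ω', nb μ X l φ i ω' * nb μ X l ψ i ω' ∂μ) ∧
      Blk μ X l 3 M (fun i ω => nb μ X l φ i ω * nb μ X l ψ i ω * nb μ X l χ i ω -
        ∫ ω', nb μ X l φ i ω' * nb μ X l ψ i ω' * nb μ X l χ i ω' ∂μ) := by
  obtain ⟨K, hK, hm⟩ := h.exists_nb_moment_le B
  have hr := h.six_le
  have hK0 : 0 ≤ K := by linarith
  set K' := 1 + 3 * K with hK'
  have hK'0 : 0 ≤ K' := by positivity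
  have hp5 : (0 : ℝ) ≤ 2 ^ (5 : ℝ) * (K' + (1 + K') ^ (5 : ℝ)) := by positivity
  have hp3 : (0 : ℝ) ≤ 2 ^ (3 : ℝ) * (K' + (1 + K') ^ (3 : ℝ)) := by positivity
  refine ⟨1 + K' + 2 ^ (5 : ℝ) * (K' + (1 + K') ^ (5 : ℝ)) + 2 ^ (3 : ℝ) * (K' + (1 + K') ^ (3 : ℝ)),
    by linarith, fun l hl φ ψ χ hφ hψ hχ => ?_⟩
  have g := h.growth_nb (l := l)
  have i10 : ∀ (ξ : LinForm d) i, Integrable (fun ω => nb μ X l ξ i ω ^ 10) μ :=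
    fun ξ i => ((g ξ i).pow 10).integrable h (by omega)
  have key : ∀ (f : Ω → ℝ) (j : ℕ) (i : ℤ), Measurable f →
      (∀ ω, |f ω| ^ j ≤ 1 + (nb μ X l φ i ω ^ 10 + nb μ X l ψ i ω ^ 10 + nb μ X l χ i ω ^ 10)) →
      Integrable (fun ω => |f ω| ^ j) μ ∧ ∫ ω, |f ω| ^ j ∂μ ≤ K' := fun f j i hf hb => by
    have hi1 : Integrable (fun ω => nb μ X l φ i ω ^ 10 + nb μ X l ψ i ω ^ 10) μ :=
      (i10 φ i).add (i10 ψ i)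
    have hi2 : Integrable (fun ω => nb μ X l φ i ω ^ 10 + nb μ X l ψ i ω ^ 10 +
      nb μ X l χ i ω ^ 10) μ := hi1.add (i10 χ i)
    have hi3 : Integrable (fun ω => 1 + (nb μ X l φ i ω ^ 10 + nb μ X l ψ i ω ^ 10 +
      nb μ X l χ i ω ^ 10)) μ := (integrable_const _).add hi2
    have hi4 : Integrable (fun ω => |f ω| ^ j) μ := by
      refine hi3.mono' (hf.abs.pow_const j).aestronglyMeasurable (ae_of_all _ fun ω => ?_)
      rw [Real.norm_eq_abs, abs_of_nonneg (by positivity)]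
      exact hb ω
    refine ⟨hi4, (integral_mono hi4 hi3 hb).trans ?_⟩
    rw [integral_add (integrable_const _) hi2, integral_add hi1 (i10 χ i),
      integral_add (i10 φ i) (i10 ψ i)]
    have := (hm φ hφ l hl i).2.1
    have := (hm ψ hψ l hl i).2.1
    have := (hm χ hχ l hl i).2.1
    simp only [integral_const, probReal_univ, smul_eq_mul, one_mul]
    linarith
  have c10 : ∀ x : ℝ, 0 ≤ x ^ 10 := fun x => Even.pow_nonneg (by decide) x
  have m1 : ∀ ξ i, Measurable (nb μ X l ξ i) := fun ξ i => (g ξ i).meas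
  have s5 : ∀ f : Ω → ℝ, (fun ω => |f ω| ^ (5 : ℝ)) = fun ω => |f ω| ^ 5 :=
    fun f => funext fun ω => Real.rpow_ofNat _ 5
  have s3 : ∀ f : Ω → ℝ, (fun ω => |f ω| ^ (3 : ℝ)) = fun ω => |f ω| ^ 3 :=
    fun f => funext fun ω => Real.rpow_ofNat _ 3
  have k1 : ∀ i, _ := fun i => key (nb μ X l φ i) 5 i (m1 φ i) fun ω => by
    have h5 : |nb μ X l φ i ω| ^ 5 ≤ 1 + |nb μ X l φ i ω| ^ 10 := by
      have := sq_nonneg (|nb μ X l φ i ω| ^ 5 - 1)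
      have e : |nb μ X l φ i ω| ^ 10 = (|nb μ X l φ i ω| ^ 5) ^ 2 := by ring
      rw [e]
      nlinarith [sq_nonneg (|nb μ X l φ i ω| ^ 5)]
    rw [(by decide : Even 10).pow_abs] at h5
    linarith [c10 (nb μ X l ψ i ω), c10 (nb μ X l χ i ω)]
  have k2 : ∀ i, _ := fun i => key (fun ω => nb μ X l φ i ω * nb μ X l ψ i ω) 5 i
    ((m1 φ i).mul (m1 ψ i)) fun ω => by
    have h5 : |nb μ X l φ i ω * nb μ X l ψ i ω| ^ 5 ≤
        |nb μ X l φ i ω| ^ 10 + |nb μ X l ψ i ω| ^ 10 := by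
      rw [abs_mul, mul_pow]
      have e : ∀ x : ℝ, x ^ 10 = (x ^ 5) ^ 2 := fun x => by ring
      rw [e, e]
      nlinarith [sq_nonneg (|nb μ X l φ i ω| ^ 5 - |nb μ X l ψ i ω| ^ 5),
        sq_nonneg (|nb μ X l φ i ω| ^ 5 + |nb μ X l ψ i ω| ^ 5)]
    rw [(by decide : Even 10).pow_abs, (by decide : Even 10).pow_abs] at h5
    linarith [c10 (nb μ X l χ i ω)]
  have k3 : ∀ i, _ := fun i => key
    (fun ω => nb μ X l φ i ω * nb μ X l ψ i ω * nb μ X l χ i ω) 3 i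
    (((m1 φ i).mul (m1 ψ i)).mul (m1 χ i)) fun ω =>
      abs_mul_mul_pow_le _ _ _ (by decide) (by norm_num)
  have b5 : Blk μ X l 5 (2 ^ (5 : ℝ) * (K' + (1 + K') ^ (5 : ℝ)))
      (fun i ω => nb μ X l φ i ω * nb μ X l ψ i ω -
        ∫ ω', nb μ X l φ i ω' * nb μ X l ψ i ω' ∂μ) :=
    Blk.of_center h.meas (by norm_num) (fun i => (measurable_nb φ i).mul (measurable_nb ψ i))
      (fun i => by rw [s5]; exact (k2 i).1) (fun i => by rw [s5]; exact (k2 i).2)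
  refine ⟨⟨fun i => measurable_nb φ i, fun i => by rw [s5]; exact (k1 i).1, fun i => ?_,
    fun i => h.integral_nb φ i⟩, b5.mono_bound (by linarith),
    (b5.mono_exponent h.meas (by norm_num) (by norm_num)).mono_bound (by linarith), ?_⟩
  · rw [s5]
    linarith [(k1 i).2]
  · have b3 : Blk μ X l 3 (2 ^ (3 : ℝ) * (K' + (1 + K') ^ (3 : ℝ)))
      (fun i ω => nb μ X l φ i ω * nb μ X l ψ i ω * nb μ X l χ i ω -
        ∫ ω', nb μ X l φ i ω' * nb μ X l ψ i ω' * nb μ X l χ i ω' ∂μ) :=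
      Blk.of_center h.meas (by norm_num)
        (fun i => ((measurable_nb φ i).mul (measurable_nb ψ i)).mul (measurable_nb χ i))
        (fun i => by rw [s3]; exact (k3 i).1) (fun i => by rw [s3]; exact (k3 i).2)
    exact b3.mono_bound (by linarith)

lemma Regular.qf_sub_integral_eq (h : Regular μ X r q C) (hl : 1 ≤ l)
    (φ ψ : LinForm d) (ω : Ω) :
    qf N l (lin μ X φ) (lin μ X ψ) ω - ∫ ω', qf N l (lin μ X φ) (lin μ X ψ) ω' ∂μ =
      (∑ i ∈ Finset.range N, (nb μ X l φ i ω * nb μ X l ψ i ω -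
        ∫ ω', nb μ X l φ i ω' * nb μ X l ψ i ω' ∂μ)) / N := by
  have := h.six_le
  simp only [qf_eq_nb hl]
  rw [integral_div, integral_finsetSum _ fun (i : ℕ) _ =>
    (h.growth_nb_mul φ ψ (i : ℤ)).integrable h (by omega), ← sub_div, ← Finset.sum_sub_distrib]

lemma Regular.tf_sub_integral_eq (h : Regular μ X r q C)
    (φ ψ χ : LinForm d) (ω : Ω) :
    tf μ X N l φ ψ χ ω - ∫ ω', tf μ X N l φ ψ χ ω' ∂μ =
      (∑ i ∈ Finset.range N, (nb μ X l φ i ω * nb μ X l ψ i ω * nb μ X l χ i ω -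
        ∫ ω', nb μ X l φ i ω' * nb μ X l ψ i ω' * nb μ X l χ i ω' ∂μ)) / N := by
  have := h.six_le
  unfold tf
  rw [integral_div, integral_finsetSum _ fun (i : ℕ) _ =>
    (h.growth_nb_mul_mul φ ψ χ (i : ℤ)).integrable h (by omega), ← sub_div,
    ← Finset.sum_sub_distrib]

lemma Regular.exists_var_qf_le (h : Regular μ X r q C) (B : ℝ) :
    ∃ K : ℝ, 1 ≤ K ∧ ∀ φ ψ : LinForm d, ‖φ‖ ≤ B → ‖ψ‖ ≤ B →
      ∀ N l : ℕ, 1 ≤ l → 1 ≤ N → ∫ ω, (qf N l (lin μ X φ) (lin μ X ψ) ω -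
        ∫ ω', qf N l (lin μ X φ) (lin μ X ψ) ω' ∂μ) ^ 2 ∂μ ≤ K * (l / N) := by
  obtain ⟨M, hM, hb⟩ := h.exists_blk B
  have hr := h.six_le
  have hC := h.one_le
  have hg := gapSum_nonneg
  refine ⟨1 + (4 + 4 * M) * C * gapSum, le_add_of_nonneg_right (by positivity),
    fun φ ψ hφ hψ N l hl hN => ?_⟩
  have hN0 : (0 : ℝ) < N := by positivity
  simp only [h.qf_sub_integral_eq hl, div_pow, integral_div]
  rw [div_le_iff₀ (by positivity)]
  refine (h.integral_sq_sum_le (hb l hl φ ψ ψ hφ hψ hψ).2.2.1 hl (g := 2)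
    (fun i => (h.growth_nb_mul φ ψ i).sub (Growth.const 2 _)) (by omega)).trans ?_
  have e : (1 + (4 + 4 * M) * C * gapSum) * ((l : ℝ) / N) * (N : ℝ) ^ 2 =
      (1 + (4 + 4 * M) * C * gapSum) * (N * l) := by field_simp
  rw [e]
  gcongr
  linarith

lemma Regular.exists_qf_qf_mf_le (h : Regular μ X r q C) (B : ℝ) :
    ∃ K : ℝ, 1 ≤ K ∧ ∀ φ ψ φ' ψ' χ : LinForm d, ‖φ‖ ≤ B → ‖ψ‖ ≤ B → ‖φ'‖ ≤ B →
      ‖ψ'‖ ≤ B → ‖χ‖ ≤ B → ∀ N l : ℕ, 1 ≤ l → 1 ≤ N →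
      |∫ ω, (qf N l (lin μ X φ) (lin μ X ψ) ω - ∫ ω', qf N l (lin μ X φ) (lin μ X ψ) ω' ∂μ) *
        (qf N l (lin μ X φ') (lin μ X ψ') ω - ∫ ω', qf N l (lin μ X φ') (lin μ X ψ') ω' ∂μ) *
        mf N l (lin μ X χ) ω ∂μ| ≤ K * ((l : ℝ) ^ 2 / (N : ℝ) ^ 2) := by
  obtain ⟨M, hM, hb⟩ := h.exists_blk B
  have hr := h.six_le
  have hC := h.one_le
  have hg := gapSum_nonneg
  refine ⟨1 + (4 + 6 * M) * C * gapSum ^ 2, le_add_of_nonneg_right (by positivity),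
    fun φ ψ φ' ψ' χ hφ hψ hφ' hψ' hχ N l hl hN => ?_⟩
  have hN0 : (0 : ℝ) < N := by positivity
  have hl1 : 1 ≤ √(l : ℝ) := Real.one_le_sqrt.2 (by exact_mod_cast hl)
  have key := h.abs_integral_triple_sum_le (N := N) (hb l hl φ ψ ψ hφ hψ hψ).2.1
    (hb l hl φ' ψ' ψ' hφ' hψ' hψ').2.1 (hb l hl χ ψ ψ hχ hψ hψ).1 hl (g := 2) (g' := 2) (g'' := 1)
    (fun i => (h.growth_nb_mul φ ψ i).sub (Growth.const 2 _))
    (fun i => (h.growth_nb_mul φ' ψ' i).sub (Growth.const 2 _))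
    (fun i => h.growth_nb χ i) (by omega)
  simp only [h.qf_sub_integral_eq hl, mf_eq_nb hl, div_mul_div_comm, integral_div]
  rw [abs_div, div_le_iff₀ (by positivity), abs_of_pos (a := (N * N * (N * √(l : ℝ)) : ℝ))
    (by positivity)]
  refine key.trans ?_
  have e : (1 + (4 + 6 * M) * C * gapSum ^ 2) * ((l : ℝ) ^ 2 / (N : ℝ) ^ 2) *
      (N * N * (N * √(l : ℝ))) =
      (1 + (4 + 6 * M) * C * gapSum ^ 2) * (N * (l : ℝ) ^ 2) * √(l : ℝ) := by field_simp
  rw [e]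
  refine le_trans ?_ (le_mul_of_one_le_right (by positivity) hl1)
  gcongr
  linarith

lemma mf_one (x : ℤ → Ω → ℝ) (ω : Ω) :
    mf l 1 x ω = (∑ t ∈ Finset.range l, x ((0 : ℤ) + 1 + t) ω) / l := by
  rw [mf_eq]
  simp [bsum, add_comm]

lemma Regular.abs_integral_nb_mul_mul_le (h : Regular μ X r q C) {φ ψ χ : LinForm d}
    {K : ℝ} (hK : 0 ≤ K) (hd : Decays3 K (mom3 μ X φ ψ χ)) (hl : 1 ≤ l) (i : ℤ) :
    |∫ ω, nb μ X l φ i ω * nb μ X l ψ i ω * nb μ X l χ i ω ∂μ| ≤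
      2 * (K * decSum ^ 2) / √(l : ℝ) := by
  have h0 : (0 : ℝ) < l := by positivity
  have hs : 0 < √(l : ℝ) := by positivity
  have e0 : ∫ ω, nb μ X l φ i ω * nb μ X l ψ i ω * nb μ X l χ i ω ∂μ =
      ∫ ω, nb μ X l φ 0 ω * nb μ X l ψ 0 ω * nb μ X l χ 0 ω ∂μ := by
    have := h.stat.integral_eq h.meas (F := fun f =>
      (∑ t ∈ Finset.range l, φ (f ((0 : ℤ) + 1 + t) - meanVec μ X)) / √(l : ℝ) *
      ((∑ t ∈ Finset.range l, ψ (f ((0 : ℤ) + 1 + t) - meanVec μ X)) / √(l : ℝ)) *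
      ((∑ t ∈ Finset.range l, χ (f ((0 : ℤ) + 1 + t) - meanVec μ X)) / √(l : ℝ)))
      (by fun_prop) i
    have e : ∀ t : ℕ, (0 : ℤ) + 1 + t + i = i + 1 + t := fun t => by ring
    simp only [e] at this
    exact this
  have e1 : ∀ (ξ : LinForm d) ω, nb μ X l ξ 0 ω = √(l : ℝ) * mf l 1 (lin μ X ξ) ω :=
    fun ξ ω => by
      rw [mf_one, nb, mul_div_assoc', div_eq_div_iff hs.ne' h0.ne', mul_right_comm,
        Real.mul_self_sqrt h0.le, mul_comm]
  have key := h.abs_integral_mf_mul_mul_le hK hd (N := l) (l := 1) le_rfl hl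
  have e2 : ∀ ω, nb μ X l φ 0 ω * nb μ X l ψ 0 ω * nb μ X l χ 0 ω = (l * √(l : ℝ)) *
      (mf l 1 (lin μ X φ) ω * mf l 1 (lin μ X ψ) ω * mf l 1 (lin μ X χ) ω) := fun ω => by
    simp only [e1]
    linear_combination (√(l : ℝ) * mf l 1 (lin μ X φ) ω * mf l 1 (lin μ X ψ) ω *
      mf l 1 (lin μ X χ) ω) * Real.mul_self_sqrt h0.le
  rw [e0]
  simp only [e2, integral_const_mul]
  rw [abs_mul, abs_of_pos (by positivity)]
  have hle : l * √(l : ℝ) * (2 * (K * decSum ^ 2) / (l : ℝ) ^ 2) =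
      2 * (K * decSum ^ 2) / √(l : ℝ) := by
    rw [mul_div_assoc', div_eq_div_iff (by positivity) hs.ne']
    linear_combination (l * (2 * (K * decSum ^ 2))) * Real.mul_self_sqrt h0.le
  rw [← hle]
  gcongr

lemma integral_sq_eq_add {f : Ω → ℝ} {m : ℝ} (hf : Integrable f μ)
    (hf2 : Integrable (fun ω => f ω ^ 2) μ) (hm : ∫ ω, f ω ∂μ = m) :
    ∫ ω, f ω ^ 2 ∂μ = ∫ ω, (f ω - m) ^ 2 ∂μ + m ^ 2 := by
  have e : ∀ ω, (f ω - m) ^ 2 = f ω ^ 2 - (2 * m * f ω - m ^ 2) := fun ω => by ring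
  have h1 : Integrable (fun ω => 2 * m * f ω) μ := hf.const_mul _
  have h2 : Integrable (fun ω => 2 * m * f ω - m ^ 2) μ := h1.sub (integrable_const _)
  simp only [e]
  rw [integral_sub hf2 h2, integral_sub h1 (integrable_const _), integral_const_mul, hm]
  simp
  ring

lemma Regular.exists_tf_sq_le (h : Regular μ X r q C) (B : ℝ) :
    ∃ K : ℝ, 1 ≤ K ∧ ∀ φ ψ χ : LinForm d, ‖φ‖ ≤ B → ‖ψ‖ ≤ B → ‖χ‖ ≤ B →
      ∀ N l : ℕ, 1 ≤ l → 1 ≤ N →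
        ∫ ω, tf μ X N l φ ψ χ ω ^ 2 ∂μ ≤ K * (l / N + 1 / l) := by
  obtain ⟨M, hM, hb⟩ := h.exists_blk B
  obtain ⟨K, hK, -, hd, -⟩ := h.exists_decay B
  have hr := h.six_le
  have hC := h.one_le
  have hg := gapSum_nonneg
  have hds := decSum_ge_one
  refine ⟨1 + (4 + 4 * M) * C * gapSum + (2 * (K * decSum ^ 2)) ^ 2, ?_,
    fun φ ψ χ hφ hψ hχ N l hl hN => ?_⟩
  · rw [add_assoc]
    exact le_add_of_nonneg_right (by positivity)
  have hN0 : (0 : ℝ) < N := by positivity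
  have hl0 : (0 : ℝ) < l := by positivity
  have g := h.growth_tf (N := N) (l := l) φ ψ χ
  have hvar : ∫ ω, (tf μ X N l φ ψ χ ω - ∫ ω', tf μ X N l φ ψ χ ω' ∂μ) ^ 2 ∂μ ≤
      (4 + 4 * M) * C * gapSum * (l / N) := by
    simp only [h.tf_sub_integral_eq, div_pow, integral_div]
    rw [div_le_iff₀ (by positivity)]
    refine (h.integral_sq_sum_le (hb l hl φ ψ χ hφ hψ hχ).2.2.2 hl (g := 3)
      (fun i => (h.growth_nb_mul_mul φ ψ χ i).sub (Growth.const 3 _)) (by omega)).trans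
      (le_of_eq ?_)
    field_simp
  have hmean : (∫ ω', tf μ X N l φ ψ χ ω' ∂μ) ^ 2 ≤ (2 * (K * decSum ^ 2)) ^ 2 * (1 / l) := by
    have hb1 : |∫ ω', tf μ X N l φ ψ χ ω' ∂μ| ≤ 2 * (K * decSum ^ 2) / √(l : ℝ) := by
      unfold tf
      rw [integral_div, integral_finsetSum _ fun (i : ℕ) _ =>
        (h.growth_nb_mul_mul φ ψ χ (i : ℤ)).integrable h (by omega), abs_div, Nat.abs_cast,
        div_le_iff₀ hN0]
      refine (Finset.abs_sum_le_sum_abs _ _).trans ((Finset.sum_le_sum fun (i : ℕ) _ =>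
        h.abs_integral_nb_mul_mul_le (by linarith) (hd φ ψ χ hφ hψ hχ) hl (i : ℤ)).trans ?_)
      simp [mul_comm]
    rw [← sq_abs]
    refine (pow_le_pow_left₀ (abs_nonneg _) hb1 2).trans (le_of_eq ?_)
    rw [div_pow, Real.sq_sqrt hl0.le]
    ring
  rw [integral_sq_eq_add (g.integrable h (by omega)) ((g.pow 2).integrable h (by omega)) rfl]
  have p1 : 0 ≤ (l : ℝ) / N := by positivity
  have p2 : 0 ≤ 1 / (l : ℝ) := by positivity
  have p3 : 0 ≤ (4 + 4 * M) * C * gapSum * (1 / l) := by positivity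
  have p4 : 0 ≤ (2 * (K * decSum ^ 2)) ^ 2 * (l / N) := by positivity
  linarith

lemma average_pow_le (N p : ℕ) (hN : 1 ≤ N) (hp : Even p) (f : ℕ → ℝ) :
    ((∑ i ∈ Finset.range N, f i) / N) ^ p ≤ (∑ i ∈ Finset.range N, f i ^ p) / N := by
  have hN0 : (0 : ℝ) < N := by positivity
  have key := (hp.convexOn_pow (𝕜 := ℝ)).map_sum_le (t := Finset.range N)
    (w := fun _ => (1 : ℝ) / N) (p := f) (fun _ _ => by positivity)
    (by simp [hN0.ne']) (fun _ _ => Set.mem_univ _)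
  simp only [smul_eq_mul, ← Finset.mul_sum] at key
  rw [div_eq_inv_mul, div_eq_inv_mul]
  simpa using key

lemma Regular.exists_qf_four_le (h : Regular μ X r q C) (B : ℝ) :
    ∃ K : ℝ, 1 ≤ K ∧ ∀ φ ψ : LinForm d, ‖φ‖ ≤ B → ‖ψ‖ ≤ B →
      ∀ N l : ℕ, 1 ≤ l → 1 ≤ N → ∫ ω, qf N l (lin μ X φ) (lin μ X ψ) ω ^ 4 ∂μ ≤ K := by
  obtain ⟨K, hK, hm⟩ := h.exists_nb_moment_le B
  have hr := h.six_le
  refine ⟨K, hK, fun φ ψ hφ hψ N l hl hN => ?_⟩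
  have hN0 : (0 : ℝ) < N := by positivity
  have i8 : ∀ (ξ : LinForm d) (i : ℤ), Integrable (fun ω => nb μ X l ξ i ω ^ 8) μ :=
    fun ξ i => ((h.growth_nb ξ i).pow 8).integrable h (by omega)
  have i8' : ∀ i : ℤ, Integrable (fun ω => (nb μ X l φ i ω ^ 8 + nb μ X l ψ i ω ^ 8) / 2) μ :=
    fun i => ((i8 φ i).add (i8 ψ i)).div_const 2
  have hint : Integrable (fun ω => (∑ i ∈ Finset.range N,
      (nb μ X l φ i ω ^ 8 + nb μ X l ψ i ω ^ 8) / 2) / (N : ℝ)) μ :=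
    (integrable_finsetSum _ fun (i : ℕ) _ => i8' i).div_const _
  have hpt : ∀ ω, qf N l (lin μ X φ) (lin μ X ψ) ω ^ 4 ≤ (∑ i ∈ Finset.range N,
      (nb μ X l φ i ω ^ 8 + nb μ X l ψ i ω ^ 8) / 2) / N := fun ω => by
    rw [qf_eq_nb hl]
    refine (average_pow_le N 4 hN (by decide) _).trans ?_
    gcongr with i
    nlinarith [sq_nonneg (nb μ X l φ i ω ^ 4 - nb μ X l ψ i ω ^ 4)]
  refine (integral_mono (((h.growth_qf φ ψ).pow 4).integrable h (by omega)) hint hpt).trans ?_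
  rw [integral_div, integral_finsetSum _ fun (i : ℕ) _ => i8' i, div_le_iff₀ hN0]
  refine (Finset.sum_le_sum (g := fun _ => K) fun (i : ℕ) _ => ?_).trans (by simp [mul_comm])
  rw [integral_div, integral_add (i8 φ i) (i8 ψ i)]
  have := (hm φ hφ l hl i).1
  have := (hm ψ hψ l hl i).1
  linarith

end NormalizedBlocks


section Resampling

variable {ι : Type*} [Fintype ι] [Nonempty ι] {k : ℕ}

/-- The average of `x` over a finite index type. -/
def avg (x : ι → ℝ) : ℝ := (∑ i, x i) / Fintype.card ι

/-- The average over all tuples of `k` indices. -/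
def bavg (g : (Fin k → ι) → ℝ) : ℝ := (∑ f, g f) / (Fintype.card ι : ℝ) ^ k

lemma bavg_add (g g' : (Fin k → ι) → ℝ) : bavg (fun f => g f + g' f) = bavg g + bavg g' := by
  simp [bavg, Finset.sum_add_distrib, add_div]

lemma bavg_sub (g g' : (Fin k → ι) → ℝ) : bavg (fun f => g f - g' f) = bavg g - bavg g' := by
  simp [bavg, Finset.sum_sub_distrib, sub_div]

lemma bavg_const_mul (c : ℝ) (g : (Fin k → ι) → ℝ) : bavg (fun f => c * g f) = c * bavg g := by
  simp [bavg, ← Finset.mul_sum, mul_div_assoc]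

lemma bavg_sum {κ : Type*} (s : Finset κ) (g : κ → (Fin k → ι) → ℝ) :
    bavg (fun f => ∑ a ∈ s, g a f) = ∑ a ∈ s, bavg (g a) := by
  simp only [bavg]
  rw [Finset.sum_comm, Finset.sum_div]

lemma card_pos_real : (0 : ℝ) < Fintype.card ι := by exact_mod_cast Fintype.card_pos

lemma bavg_const (c : ℝ) : bavg (fun _ : Fin k → ι => c) = c := by
  have := card_pos_real (ι := ι)
  simp [bavg]

lemma bavg_mono {g g' : (Fin k → ι) → ℝ} (h : ∀ f, g f ≤ g' f) : bavg g ≤ bavg g' := by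
  unfold bavg
  gcongr with f
  exact h f

lemma abs_bavg_le (g : (Fin k → ι) → ℝ) : |bavg g| ≤ bavg fun f => |g f| := by
  unfold bavg
  rw [abs_div, abs_of_pos (pow_pos card_pos_real k)]
  gcongr
  exact Finset.abs_sum_le_sum_abs _ _

lemma bavg_nonneg {g : (Fin k → ι) → ℝ} (h : ∀ f, 0 ≤ g f) : 0 ≤ bavg g := by
  simpa [bavg_const] using bavg_mono (g := fun _ => 0) h

lemma bavg_sq_le (g : (Fin k → ι) → ℝ) : bavg g ^ 2 ≤ bavg fun f => g f ^ 2 := by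
  have h : 0 ≤ bavg fun f => (g f - bavg g) ^ 2 := bavg_nonneg fun f => sq_nonneg _
  have e : ∀ f, (g f - bavg g) ^ 2 = g f ^ 2 - 2 * bavg g * g f + bavg g ^ 2 := fun f => by ring
  simp only [e] at h
  rw [bavg_add, bavg_sub, bavg_const_mul, bavg_const] at h
  nlinarith

lemma bavg_mul_eq_zero {x : ι → ℝ} (hx : ∑ i, x i = 0) (a : Fin k) {g : (Fin k → ι) → ℝ}
    (hg : ∀ f i, g (Function.update f a i) = g f) : bavg (fun f => g f * x (f a)) = 0 := by
  unfold bavg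
  rw [div_eq_zero_iff]
  left
  rw [← Equiv.sum_comp (Equiv.funSplitAt a ι).symm, Fintype.sum_prod_type, Finset.sum_comm]
  refine Finset.sum_eq_zero fun f' _ => ?_
  have i₀ : ι := Classical.arbitrary ι
  have e : ∀ i, (Equiv.funSplitAt a ι).symm (i, f') =
      Function.update ((Equiv.funSplitAt a ι).symm (i₀, f')) a i := fun i => by
    ext b
    by_cases hb : b = a
    · subst hb
      simp [Equiv.funSplitAt, Equiv.piSplitAt]
    · simp [Equiv.funSplitAt, Equiv.piSplitAt, hb]
  have : ∀ i, g ((Equiv.funSplitAt a ι).symm (i, f')) * x ((Equiv.funSplitAt a ι).symm (i, f') a) =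
      g ((Equiv.funSplitAt a ι).symm (i₀, f')) * x i := fun i => by
    rw [e i, hg]
    simp
  simp only [this, ← Finset.mul_sum, hx, mul_zero]

lemma avg_add (x y : ι → ℝ) : avg (fun i => x i + y i) = avg x + avg y := by
  simp [avg, Finset.sum_add_distrib, add_div]

lemma avg_sub (x y : ι → ℝ) : avg (fun i => x i - y i) = avg x - avg y := by
  simp [avg, Finset.sum_sub_distrib, sub_div]

lemma avg_const_mul (c : ℝ) (x : ι → ℝ) : avg (fun i => c * x i) = c * avg x := by
  simp [avg, ← Finset.mul_sum, mul_div_assoc]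

lemma avg_const (c : ℝ) : avg (fun _ : ι => c) = c := by
  have := card_pos_real (ι := ι)
  simp [avg]

lemma avg_mono {x y : ι → ℝ} (h : ∀ i, x i ≤ y i) : avg x ≤ avg y := by
  unfold avg
  gcongr with i
  exact h i

lemma avg_nonneg {x : ι → ℝ} (h : ∀ i, 0 ≤ x i) : 0 ≤ avg x := by
  simpa [avg_const] using avg_mono (x := fun _ => 0) h

lemma sum_eq_zero_of_avg {x : ι → ℝ} (h : avg x = 0) : ∑ i, x i = 0 := by
  have := card_pos_real (ι := ι)
  rw [avg, div_eq_zero_iff] at h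
  exact h.resolve_right this.ne'

lemma bavg_apply (x : ι → ℝ) (a : Fin k) : bavg (fun f => x (f a)) = avg x := by
  have h0 : ∑ i, (x i - avg x) = 0 := sum_eq_zero_of_avg (by rw [avg_sub, avg_const, sub_self])
  have := bavg_mul_eq_zero h0 a (g := fun _ => 1) fun _ _ => rfl
  simp only [one_mul] at this
  rw [bavg_sub (fun f => x (f a)) fun _ => avg x, bavg_const] at this
  linarith

lemma bavg_sum_apply {x : ι → ℝ} (hx : avg x = 0) :
    bavg (fun f : Fin k → ι => ∑ a, x (f a)) = 0 := by
  rw [bavg_sum]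
  simp [bavg_apply, hx]

lemma bavg_mul_apply {x y : ι → ℝ} (hx : avg x = 0) (a b : Fin k) :
    bavg (fun f => x (f a) * y (f b)) = if a = b then avg (fun i => x i * y i) else 0 := by
  split_ifs with h
  · subst h
    exact bavg_apply (fun i => x i * y i) a
  · simp only [mul_comm (x _)]
    exact bavg_mul_eq_zero (sum_eq_zero_of_avg hx) a (g := fun f => y (f b)) fun f i => by
      simp [Ne.symm h]

lemma bavg_sum_mul_sum {x y : ι → ℝ} (hx : avg x = 0) :
    bavg (fun f : Fin k → ι => (∑ a, x (f a)) * ∑ a, y (f a)) = k * avg (fun i => x i * y i) := by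
  simp only [Finset.sum_mul_sum]
  rw [bavg_sum]
  simp only [bavg_sum, bavg_mul_apply hx]
  simp

lemma bavg_mul_mul_apply {x y z : ι → ℝ} (hx : avg x = 0) (hy : avg y = 0) (hz : avg z = 0)
    (a b c : Fin k) : bavg (fun f => x (f a) * y (f b) * z (f c)) =
      if a = b ∧ b = c then avg (fun i => x i * y i * z i) else 0 := by
  split_ifs with h
  · obtain ⟨rfl, rfl⟩ := h
    exact bavg_apply (fun i => x i * y i * z i) a
  · by_cases hab : a = b
    · have hbc : c ≠ b := fun e => h ⟨hab, e.symm⟩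
      subst hab
      exact bavg_mul_eq_zero (sum_eq_zero_of_avg hz) c (g := fun f => x (f a) * y (f a))
        fun f i => by simp [hbc.symm]
    · by_cases hac : a = c
      · subst hac
        have e : ∀ f : Fin k → ι, x (f a) * y (f b) * z (f a) = x (f a) * z (f a) * y (f b) :=
          fun f => by ring
        simp only [e]
        exact bavg_mul_eq_zero (sum_eq_zero_of_avg hy) b (g := fun f => x (f a) * z (f a))
          fun f i => by simp [hab]
      · have e : ∀ f : Fin k → ι, x (f a) * y (f b) * z (f c) = y (f b) * z (f c) * x (f a) :=
          fun f => by ring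
        simp only [e]
        exact bavg_mul_eq_zero (sum_eq_zero_of_avg hx) a (g := fun f => y (f b) * z (f c))
          fun f i => by simp [Ne.symm hab, Ne.symm hac]

lemma bavg_sum_mul_sum_mul_sum {x y z : ι → ℝ} (hx : avg x = 0) (hy : avg y = 0)
    (hz : avg z = 0) :
    bavg (fun f : Fin k → ι => (∑ a, x (f a)) * (∑ a, y (f a)) * ∑ a, z (f a)) =
      k * avg (fun i => x i * y i * z i) := by
  have e : ∀ f : Fin k → ι, (∑ a, x (f a)) * (∑ a, y (f a)) * ∑ a, z (f a) =
      ∑ a, ∑ b, ∑ c, x (f a) * y (f b) * z (f c) := fun f => by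
    rw [Finset.sum_mul_sum, Finset.sum_mul]
    refine Finset.sum_congr rfl fun a _ => ?_
    rw [Finset.sum_mul]
    exact Finset.sum_congr rfl fun b _ => Finset.mul_sum _ _ _
  simp only [e]
  rw [bavg_sum]
  have e2 : ∀ a : Fin k, bavg (fun f : Fin k → ι => ∑ b, ∑ c, x (f a) * y (f b) * z (f c)) =
      avg (fun i => x i * y i * z i) := fun a => by
    rw [bavg_sum]
    have e3 : ∀ b : Fin k, bavg (fun f : Fin k → ι => ∑ c, x (f a) * y (f b) * z (f c)) =
        if a = b then avg (fun i => x i * y i * z i) else 0 := fun b => by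
      rw [bavg_sum]
      simp only [bavg_mul_mul_apply hx hy hz, ite_and]
      split_ifs <;> simp
    simp [e3]
  simp [e2]

/-- Moments of sums of resampled centred values. -/
lemma bavg_sum_pow_le {x : ι → ℝ} (hx : avg x = 0) {p : ℕ} (hp : Even p) (hp2 : 2 ≤ p) :
    bavg (fun f : Fin k → ι => (∑ a, x (f a)) ^ p) ≤
      ((p : ℝ) ^ 2 * 2 ^ p * 2) ^ (p / 2) * k ^ (p / 2) * avg (fun i => x i ^ p) := by
  obtain ⟨N, rfl⟩ : ∃ N, p = N + 2 := ⟨p - 2, by omega⟩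
  have hN : Even N := by simpa [Nat.even_add] using hp
  have hdiv : (N + 2) / 2 = N / 2 + 1 := by omega
  rcases Nat.eq_zero_or_pos k with rfl | hk
  · simp [bavg, hdiv]
  have hA0 : 0 ≤ avg (fun i => x i ^ (N + 2)) := avg_nonneg fun i => hp.pow_nonneg _
  rcases hA0.eq_or_lt with h0 | hpos
  · have hz : ∀ i, x i = 0 := fun i => by
      have := (Finset.sum_eq_zero_iff_of_nonneg fun i _ => hp.pow_nonneg (x i)).1
        (sum_eq_zero_of_avg h0.symm) i (Finset.mem_univ i)
      exact pow_eq_zero_iff (by omega) |>.1 this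
    simp [hz, bavg_const, avg_const]
  set A := avg (fun i => x i ^ (N + 2)) with hA
  set s : ℝ := A ^ ((((N + 2 : ℕ) : ℝ))⁻¹) with hs
  have hs0 : 0 < s := by positivity
  have hsp : s ^ (N + 2) = A := Real.rpow_inv_natCast_pow hpos.le (by omega)
  let α := Fin k → ι
  let _ : MeasurableSpace α := ⊤
  have : MeasurableSingletonClass α := ⟨fun _ => trivial⟩
  let ν : Measure α := (PMF.uniformOfFintype α).toMeasure
  have hint : ∀ g : α → ℝ, ∫ f, g f ∂ν = bavg g := fun g => by
    rw [PMF.integral_eq_sum]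
    simp only [PMF.uniformOfFintype_apply, smul_eq_mul, bavg, ← Finset.mul_sum]
    simp [α, div_eq_inv_mul]
  let ξ : ℕ → α → ℝ := fun j f => if h : j < k then x (f ⟨j, h⟩) / s else 0
  have hLp : ∀ g : α → ℝ, MemLp g ((N + 2 : ℕ) : ENNReal) ν := fun g =>
    MemLp.of_bound (measurable_from_top.aestronglyMeasurable) (∑ f, |g f|)
      (ae_of_all _ fun f => Finset.single_le_sum (f := fun f => |g f|)
        (fun _ _ => abs_nonneg _) (Finset.mem_univ f))
  have key := moment_core (ν := ν) (ξ := ξ) (N := N) (n := k) (D := 0) (M := 1) le_rfl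
    (fun j _ => hLp _) (fun j _ => hLp _) hN (fun j hj => ?_) (fun Λ _ _ j hj => ?_)
    zero_le_one hk
  · rw [hint] at key
    have e : ∀ f : α, ∑ i ∈ Finset.range k, ξ i f = (∑ a, x (f a)) / s := fun f => by
      rw [Finset.sum_range, Finset.sum_div]
      simp [ξ]
    simp only [e, div_pow, hsp] at key
    have e2 : bavg (fun f : Fin k → ι => (∑ a, x (f a)) ^ (N + 2) / A) =
        A⁻¹ * bavg (fun f : Fin k → ι => (∑ a, x (f a)) ^ (N + 2)) := by
      rw [← bavg_const_mul]
      simp only [div_eq_inv_mul]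
    rw [e2, inv_mul_le_iff₀ hpos] at key
    refine key.trans (le_of_eq ?_)
    rw [hdiv, ← mul_pow]
    push_cast
    ring
  · rw [hint]
    simp only [ξ, hj, dif_pos, div_pow, hsp]
    rw [bavg_apply (fun i => x i ^ (N + 2) / A)]
    simp only [div_eq_inv_mul]
    rw [avg_const_mul, inv_mul_cancel₀ hpos.ne']
  · rw [hint, zero_mul]
    refine le_of_eq ?_
    simp only [ξ, hj, dif_pos]
    refine bavg_mul_eq_zero (x := fun i => x i / s) ?_ ⟨j, hj⟩
      (g := fun f => (∑ i ∈ Finset.range j, if h : i < k then x (f ⟨i, h⟩) / s else 0) ^ (N + 1))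
      fun f i => ?_
    · rw [← Finset.sum_div, sum_eq_zero_of_avg hx, zero_div]
    · refine congrArg (· ^ (N + 1)) (Finset.sum_congr rfl fun a ha => ?_)
      have := Finset.mem_range.1 ha
      split_ifs with hak
      · rw [Function.update_of_ne]
        simp [Fin.ext_iff]
        omega
      · rfl

end Resampling

section Taylor

open Metric

set_option maxSynthPendingDepth 3

/-- The second derivative of `H`, as a family of linear functionals. -/
def hessRow (H : (Fin d → ℝ) → ℝ) (m₀ : Fin d → ℝ) (p : Fin d) : LinForm d :=
  fderiv ℝ (fderiv ℝ H) m₀ (Pi.single p 1)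

/-- A coordinate functional. -/
def coordProj (p : Fin d) : LinForm d := ContinuousLinearMap.proj p

lemma hess_apply (H : (Fin d → ℝ) → ℝ) (m₀ u v : Fin d → ℝ) :
    fderiv ℝ (fderiv ℝ H) m₀ u v = ∑ p, coordProj p u * hessRow H m₀ p v := by
  conv_lhs => rw [pi_eq_sum_univ' u, map_sum]
  simp only [map_smul, sum_apply]
  rfl

lemma norm_fderiv_three {E : Type*} [NormedAddCommGroup E] [NormedSpace ℝ E] (H : E → ℝ) (x : E) :
    ‖fderiv ℝ (fderiv ℝ (fderiv ℝ H)) x‖ = ‖iteratedFDeriv ℝ 3 H x‖ := by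
  rw [← norm_iteratedFDeriv_zero (𝕜 := ℝ) (f := fderiv ℝ (fderiv ℝ (fderiv ℝ H))),
    norm_iteratedFDeriv_fderiv, norm_iteratedFDeriv_fderiv, norm_iteratedFDeriv_fderiv]

lemma hasFDerivAt_comp_const_add {E F : Type*} [NormedAddCommGroup E] [NormedSpace ℝ E]
    [NormedAddCommGroup F] [NormedSpace ℝ F] {f : E → F} {f' : E →L[ℝ] F} {m w : E}
    (h : HasFDerivAt f f' (m + w)) : HasFDerivAt (fun w => f (m + w)) f' w := by
  have h1 : HasFDerivAt (fun w : E => m + w) (ContinuousLinearMap.id ℝ E) w :=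
    (hasFDerivAt_id w).const_add m
  exact h.comp w h1

lemma exists_taylor_le {E : Type*} [NormedAddCommGroup E] [NormedSpace ℝ E] {H : E → ℝ} {a₀ : ℕ}
    {C : ℝ} (hH : ContDiff ℝ 3 H) (hC : 0 ≤ C)
    (hb : ∀ x, ‖iteratedFDeriv ℝ 3 H x‖ ≤ C * (1 + ‖x‖ ^ a₀)) (m₀ : E) :
    ∃ C' : ℝ, 0 ≤ C' ∧ ∀ z : E, |H (m₀ + z) - H m₀ - fderiv ℝ H m₀ z -
      fderiv ℝ (fderiv ℝ H) m₀ z z / 2| ≤ C' * ‖z‖ ^ 3 * (1 + ‖z‖ ^ a₀) := by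
  have h1 : ContDiff ℝ 2 (fderiv ℝ H) := hH.fderiv_right (by norm_num)
  have h2 : ContDiff ℝ 1 (fderiv ℝ (fderiv ℝ H)) := h1.fderiv_right (by norm_num)
  have d0 : Differentiable ℝ H := hH.differentiable (by norm_num)
  have d1 : Differentiable ℝ (fderiv ℝ H) := h1.differentiable (by norm_num)
  have d2 : Differentiable ℝ (fderiv ℝ (fderiv ℝ H)) := h2.differentiable (by norm_num)
  set T := fderiv ℝ (fderiv ℝ H) m₀ with hT
  have hsymm : ∀ u v, T u v = T v u := fun u v =>
    (hH.contDiffAt.isSymmSndFDerivAt (by simp; norm_num)).eq u v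
  refine ⟨C * (2 ^ a₀ * (1 + ‖m₀‖ ^ a₀)), by positivity, fun z => ?_⟩
  set ρ := ‖z‖ with hρ
  set M := C * (1 + (‖m₀‖ + ρ) ^ a₀) with hM
  have hM0 : 0 ≤ M := by positivity
  have hconv : Convex ℝ (closedBall (0 : E) ρ) := convex_closedBall _ _
  have h0 : (0 : E) ∈ closedBall (0 : E) ρ := by simp [hρ]
  have b3 : ∀ w ∈ closedBall (0 : E) ρ,
      ‖fderiv ℝ (fderiv ℝ (fderiv ℝ H)) (m₀ + w)‖ ≤ M := fun w hw => by
    rw [norm_fderiv_three]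
    refine (hb _).trans ?_
    have : ‖m₀ + w‖ ≤ ‖m₀‖ + ρ := (norm_add_le _ _).trans
      (add_le_add le_rfl (by simpa using hw))
    rw [hM]
    gcongr
  have e2 : ∀ w ∈ closedBall (0 : E) ρ,
      ‖fderiv ℝ (fderiv ℝ H) (m₀ + w) - T‖ ≤ M * ρ := fun w hw => by
    have := hconv.norm_image_sub_le_of_norm_hasFDerivWithin_le
      (f := fun w => fderiv ℝ (fderiv ℝ H) (m₀ + w))
      (f' := fun w => fderiv ℝ (fderiv ℝ (fderiv ℝ H)) (m₀ + w)) (C := M)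
      (fun w _ => (hasFDerivAt_comp_const_add (d2 (m₀ + w)).hasFDerivAt).hasFDerivWithinAt)
      b3 h0 hw
    simp only [add_zero, sub_zero] at this
    refine this.trans ?_
    gcongr
    simpa using hw
  have e1 : ∀ w ∈ closedBall (0 : E) ρ,
      ‖fderiv ℝ H (m₀ + w) - fderiv ℝ H m₀ - T w‖ ≤ M * ρ * ρ := fun w hw => by
    have := hconv.norm_image_sub_le_of_norm_hasFDerivWithin_le
      (f := fun w => fderiv ℝ H (m₀ + w) - T w)
      (f' := fun w => fderiv ℝ (fderiv ℝ H) (m₀ + w) - T) (C := M * ρ)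
      (fun w _ => ((hasFDerivAt_comp_const_add (d1 (m₀ + w)).hasFDerivAt).sub
        T.hasFDerivAt).hasFDerivWithinAt) e2 h0 hw
    simp only [add_zero, sub_zero, map_zero] at this
    rw [sub_right_comm]
    refine this.trans ?_
    gcongr
    simpa using hw
  have hz : z ∈ closedBall (0 : E) ρ := by simp [hρ]
  have e0 := hconv.norm_image_sub_le_of_norm_hasFDerivWithin_le
    (f := fun w => H (m₀ + w) - fderiv ℝ H m₀ w - T w w / 2)
    (f' := fun w => fderiv ℝ H (m₀ + w) - fderiv ℝ H m₀ - T w) (C := M * ρ * ρ)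
    (fun w _ => by
      have hq : HasFDerivAt (fun w => T w w / 2) (T w) w := by
        have hq1 := ((T.hasFDerivAt (x := w)).clm_apply (hasFDerivAt_id (𝕜 := ℝ) w)).const_mul
          (1 / 2 : ℝ)
        refine (hq1.congr_fderiv (g' := T w) ?_).congr_of_eventuallyEq (Eventually.of_forall ?_)
        · ext u
          simp [hsymm u w]
          ring
        · intro w
          simp
          ring
      exact (((hasFDerivAt_comp_const_add (d0 (m₀ + w)).hasFDerivAt).sub
        (fderiv ℝ H m₀).hasFDerivAt).sub hq).hasFDerivWithinAt) e1 h0 hz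
  simp only [add_zero, sub_zero, map_zero, zero_div] at e0
  rw [Real.norm_eq_abs] at e0
  have hle : M ≤ C * (2 ^ a₀ * (1 + ‖m₀‖ ^ a₀)) * (1 + ρ ^ a₀) := by
    rw [hM, mul_assoc]
    have p1 : (‖m₀‖ + ρ) ^ a₀ ≤ 2 ^ a₀ * (‖m₀‖ ^ a₀ + ρ ^ a₀) := by
      have := add_pow_le (norm_nonneg m₀) (norm_nonneg z) a₀
      refine this.trans ?_
      gcongr
      · norm_num
      · omega
    have p2 : (1 : ℝ) ≤ 2 ^ a₀ := one_le_pow₀ (by norm_num)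
    have p3 : 0 ≤ 2 ^ a₀ * (‖m₀‖ ^ a₀ * ρ ^ a₀) := by positivity
    gcongr
    nlinarith
  calc |H (m₀ + z) - H m₀ - fderiv ℝ H m₀ z - T z z / 2|
      = |H (m₀ + z) - fderiv ℝ H m₀ z - T z z / 2 - H m₀| := by
        congr 1
        ring
    _ ≤ M * ρ * ρ * ρ := e0
    _ = M * ρ ^ 3 := by ring
    _ ≤ C * (2 ^ a₀ * (1 + ‖m₀‖ ^ a₀)) * (1 + ρ ^ a₀) * ρ ^ 3 := by gcongr
    _ = _ := by ring

lemma CondD.exists_taylor {H : (Fin d → ℝ) → ℝ} {a₀ : ℕ} (hD : CondD H a₀) (m₀ : Fin d → ℝ) :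
    ∃ C : ℝ, 0 ≤ C ∧ ∀ z : Fin d → ℝ, |H (m₀ + z) - H m₀ - fderiv ℝ H m₀ z -
      (∑ p, coordProj p z * hessRow H m₀ p z) / 2| ≤ C * ‖z‖ ^ 3 * (1 + ‖z‖ ^ a₀) := by
  obtain ⟨hH, C, hC, hb⟩ := hD
  obtain ⟨C', h0, h⟩ := exists_taylor_le hH hC.le hb m₀
  refine ⟨C', h0, fun z => ?_⟩
  rw [← hess_apply]
  exact h z

end Taylor


section Expansion

set_option maxSynthPendingDepth 3

variable {ι : Type} [Fintype ι] [Nonempty ι] {k : ℕ}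

/-- The average of a family of vectors. -/
def mavg (v : ι → Fin d → ℝ) : Fin d → ℝ := (Fintype.card ι : ℝ)⁻¹ • ∑ i, v i

/-- The average of the centred vectors along a tuple of indices. -/
def zavg (v : ι → Fin d → ℝ) (f : Fin k → ι) : Fin d → ℝ := (k : ℝ)⁻¹ • ∑ a, (v (f a) - mavg v)

lemma map_mavg (ψ : LinForm d) (v : ι → Fin d → ℝ) :
    ψ (mavg v) = avg fun i => ψ (v i) := by
  rw [mavg, map_smul, map_sum, avg, div_eq_inv_mul, smul_eq_mul]

lemma map_zavg (ψ : LinForm d) (v : ι → Fin d → ℝ) (f : Fin k → ι) :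
    ψ (zavg v f) = (k : ℝ)⁻¹ * ∑ a, ψ (v (f a) - mavg v) := by
  rw [zavg, map_smul, map_sum, smul_eq_mul]

lemma avg_map_sub_mavg (ψ : LinForm d) (v : ι → Fin d → ℝ) :
    avg (fun i => ψ (v i - mavg v)) = 0 := by
  simp only [map_sub]
  rw [avg_sub, avg_const, map_mavg, sub_self]

lemma avg_map_sub_mul (φ ψ : LinForm d) (v : ι → Fin d → ℝ) :
    avg (fun i => φ (v i - mavg v) * ψ (v i - mavg v)) =
      avg (fun i => φ (v i) * ψ (v i)) - φ (mavg v) * ψ (mavg v) := by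
  have e : ∀ i, φ (v i - mavg v) * ψ (v i - mavg v) =
      φ (v i) * ψ (v i) - φ (mavg v) * ψ (v i) - ψ (mavg v) * φ (v i - mavg v) := fun i => by
    simp only [map_sub]
    ring
  simp only [e]
  rw [avg_sub, avg_sub, avg_const_mul, avg_const_mul, avg_map_sub_mavg, ← map_mavg]
  ring

lemma avg_map_sub_mul_mul (φ ψ χ : LinForm d) (v : ι → Fin d → ℝ) :
    avg (fun i => φ (v i - mavg v) * ψ (v i - mavg v) * χ (v i - mavg v)) =
      avg (fun i => φ (v i) * ψ (v i) * χ (v i)) -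
        φ (mavg v) * avg (fun i => ψ (v i) * χ (v i)) -
        ψ (mavg v) * avg (fun i => φ (v i) * χ (v i)) -
        χ (mavg v) * avg (fun i => φ (v i) * ψ (v i)) +
        2 * (φ (mavg v) * ψ (mavg v) * χ (mavg v)) := by
  have e : ∀ i, φ (v i - mavg v) * ψ (v i - mavg v) * χ (v i - mavg v) =
      φ (v i) * ψ (v i) * χ (v i) - φ (mavg v) * (ψ (v i) * χ (v i)) -
        ψ (mavg v) * (φ (v i) * χ (v i)) - χ (mavg v) * (φ (v i) * ψ (v i)) +
        (φ (mavg v) * ψ (mavg v) * χ (v i) + (φ (mavg v) * χ (mavg v) * ψ (v i) +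
          ψ (mavg v) * χ (mavg v) * φ (v i - mavg v))) := fun i => by
    simp only [map_sub]
    ring
  simp only [e]
  rw [avg_add, avg_add, avg_add, avg_sub, avg_sub, avg_sub, avg_const_mul, avg_const_mul,
    avg_const_mul, avg_const_mul, avg_const_mul, avg_const_mul, avg_map_sub_mavg, ← map_mavg,
    ← map_mavg]
  ring

lemma bavg_zavg (ψ : LinForm d) (v : ι → Fin d → ℝ) :
    bavg (fun f : Fin k → ι => ψ (zavg v f)) = 0 := by
  simp only [map_zavg]
  rw [bavg_const_mul, bavg_sum_apply (x := fun i => ψ (v i - mavg v)) (avg_map_sub_mavg ψ v),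
    mul_zero]

lemma bavg_zavg_mul (hk : 1 ≤ k) (φ ψ : LinForm d) (v : ι → Fin d → ℝ) :
    bavg (fun f : Fin k → ι => φ (zavg v f) * ψ (zavg v f)) =
      (k : ℝ)⁻¹ * avg (fun i => φ (v i - mavg v) * ψ (v i - mavg v)) := by
  have hk0 : (k : ℝ) ≠ 0 := by positivity
  have e : ∀ f : Fin k → ι, φ (zavg v f) * ψ (zavg v f) = ((k : ℝ)⁻¹) ^ 2 *
      ((∑ a, φ (v (f a) - mavg v)) * ∑ a, ψ (v (f a) - mavg v)) := fun f => by
    simp only [map_zavg]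
    ring
  simp only [e]
  rw [bavg_const_mul, bavg_sum_mul_sum (x := fun i => φ (v i - mavg v))
    (y := fun i => ψ (v i - mavg v)) (avg_map_sub_mavg φ v)]
  field_simp

lemma bavg_zavg_mul_mul (hk : 1 ≤ k) (φ ψ χ : LinForm d) (v : ι → Fin d → ℝ) :
    bavg (fun f : Fin k → ι => φ (zavg v f) * ψ (zavg v f) * χ (zavg v f)) =
      ((k : ℝ)⁻¹) ^ 2 *
        avg (fun i => φ (v i - mavg v) * ψ (v i - mavg v) * χ (v i - mavg v)) := by
  have hk0 : (k : ℝ) ≠ 0 := by positivity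
  have e : ∀ f : Fin k → ι, φ (zavg v f) * ψ (zavg v f) * χ (zavg v f) = ((k : ℝ)⁻¹) ^ 3 *
      ((∑ a, φ (v (f a) - mavg v)) * (∑ a, ψ (v (f a) - mavg v)) *
        ∑ a, χ (v (f a) - mavg v)) := fun f => by
    simp only [map_zavg]
    ring
  simp only [e]
  rw [bavg_const_mul, bavg_sum_mul_sum_mul_sum (x := fun i => φ (v i - mavg v))
    (y := fun i => ψ (v i - mavg v)) (z := fun i => χ (v i - mavg v))
    (avg_map_sub_mavg φ v) (avg_map_sub_mavg ψ v) (avg_map_sub_mavg χ v)]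
  field_simp

lemma bavg_sq_sub_sq (c : ℝ) {x : (Fin k → ι) → ℝ} (hx : bavg x = 0) (q : (Fin k → ι) → ℝ) :
    bavg (fun f => (c + x f + q f) ^ 2) - bavg (fun f => c + x f + q f) ^ 2 =
      bavg (fun f => x f * x f) + 2 * bavg (fun f => x f * q f) +
        (bavg (fun f => q f ^ 2) - bavg q ^ 2) := by
  have e : ∀ f, (c + x f + q f) ^ 2 = c ^ 2 + (2 * c) * x f + (2 * c) * q f + x f * x f +
      2 * (x f * q f) + q f ^ 2 := fun f => by ring
  simp only [e]
  rw [bavg_add, bavg_add, bavg_add, bavg_add, bavg_add, bavg_const_mul, bavg_const_mul,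
    bavg_const_mul, bavg_const, bavg_add, bavg_add, bavg_const, hx]
  ring

lemma pow_le_pow_add_pow {w : ℝ} (hw : 0 ≤ w) {i j n : ℕ} (hij : i ≤ j) (hjn : j ≤ n) :
    w ^ j ≤ w ^ i + w ^ n := by
  rcases le_total w 1 with h | h
  · exact (pow_le_pow_of_le_one hw h hij).trans (le_add_of_nonneg_right (by positivity))
  · exact (pow_le_pow_right₀ h hjn).trans (le_add_of_nonneg_left (by positivity))

lemma add_pow_le_two_pow {a b : ℝ} (ha : 0 ≤ a) (hb : 0 ≤ b) (p : ℕ) :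
    (a + b) ^ p ≤ 2 ^ p * (a ^ p + b ^ p) := by
  refine (add_pow_le ha hb p).trans ?_
  gcongr
  · norm_num
  · omega

lemma norm_pow_le_sum (u : Fin d → ℝ) {p : ℕ} (hp : Even p) (hp0 : p ≠ 0) :
    ‖u‖ ^ p ≤ ∑ q, coordProj q u ^ p := by
  have h0 : ∀ q, 0 ≤ coordProj q u ^ p := fun q => hp.pow_nonneg _
  rcases isEmpty_or_nonempty (Fin d) with hd | hd
  · rw [Subsingleton.elim u 0, norm_zero, zero_pow hp0]
    exact Finset.sum_nonneg fun q _ => hp.pow_nonneg _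
  · obtain ⟨q, hq⟩ := Finite.exists_max fun q => ‖u q‖
    have : ‖u‖ ≤ ‖u q‖ := (pi_norm_le_iff_of_nonneg (norm_nonneg _)).2 hq
    calc ‖u‖ ^ p ≤ ‖u q‖ ^ p := by gcongr
      _ = coordProj q u ^ p := by rw [Real.norm_eq_abs, hp.pow_abs]; rfl
      _ ≤ _ := Finset.single_le_sum (f := fun q => coordProj q u ^ p) (fun q _ => h0 q)
        (Finset.mem_univ q)

lemma exists_bavg_norm_pow_le {p : ℕ} (hp : 1 ≤ p) : ∃ C : ℝ, 0 ≤ C ∧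
    ∀ {ι : Type} [Fintype ι] [Nonempty ι] {k : ℕ} (_ : 1 ≤ k) (v : ι → Fin d → ℝ),
      bavg (fun f : Fin k → ι => (‖mavg v‖ + ‖zavg v f‖) ^ (2 * p)) ≤
        C * ∑ q, (coordProj q (mavg v) ^ (2 * p) +
          avg (fun i => coordProj q (v i) ^ (2 * p)) / (k : ℝ) ^ p) := by
  have hev : Even (2 * p) := even_two_mul p
  set c : ℝ := ((((2 * p : ℕ) : ℝ)) ^ 2 * 2 ^ (2 * p) * 2) ^ p with hc
  have hc0 : 0 ≤ c := by positivity
  refine ⟨2 ^ (2 * p) * (1 + c * 2 ^ (2 * p)), by positivity, fun {ι} _ _ {k} hk v => ?_⟩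
  have hk1 : (1 : ℝ) ≤ k := by exact_mod_cast hk
  have hk0 : (0 : ℝ) < k := by positivity
  have hA : ∀ q, bavg (fun f : Fin k → ι => coordProj q (zavg v f) ^ (2 * p)) ≤
      c * (2 ^ (2 * p) * (avg (fun i => coordProj q (v i) ^ (2 * p)) / (k : ℝ) ^ p +
        coordProj q (mavg v) ^ (2 * p))) := fun q => by
    simp only [map_zavg, mul_pow]
    rw [bavg_const_mul]
    have h1 := bavg_sum_pow_le (k := k) (avg_map_sub_mavg (coordProj q) v) hev (by omega)
    rw [Nat.mul_div_cancel_left p (by norm_num), ← hc] at h1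
    have h2 : avg (fun i => coordProj q (v i - mavg v) ^ (2 * p)) ≤ 2 ^ (2 * p) *
        (avg (fun i => coordProj q (v i) ^ (2 * p)) + coordProj q (mavg v) ^ (2 * p)) := by
      have h3 := avg_const (ι := ι) (coordProj q (mavg v) ^ (2 * p))
      calc _ ≤ avg fun i => 2 ^ (2 * p) * (coordProj q (v i) ^ (2 * p) +
            coordProj q (mavg v) ^ (2 * p)) := avg_mono fun i => by
              have h4 := abs_sub (coordProj q (v i)) (coordProj q (mavg v))
              calc _ = |coordProj q (v i - mavg v)| ^ (2 * p) := (hev.pow_abs _).symm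
                _ ≤ (|coordProj q (v i)| + |coordProj q (mavg v)|) ^ (2 * p) := by
                  rw [map_sub]
                  gcongr
                _ ≤ _ := add_pow_le_two_pow (abs_nonneg _) (abs_nonneg _) _
                _ = _ := by rw [hev.pow_abs, hev.pow_abs]
        _ = _ := by rw [avg_const_mul, avg_add, h3]
    have hm0 : 0 ≤ coordProj q (mavg v) ^ (2 * p) := hev.pow_nonneg _
    calc _ ≤ ((k : ℝ)⁻¹) ^ (2 * p) * (c * k ^ p * (2 ^ (2 * p) *
        (avg (fun i => coordProj q (v i) ^ (2 * p)) + coordProj q (mavg v) ^ (2 * p)))) := by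
          gcongr
          exact h1.trans (by gcongr)
      _ = c * (2 ^ (2 * p) * (avg (fun i => coordProj q (v i) ^ (2 * p)) / (k : ℝ) ^ p +
        coordProj q (mavg v) ^ (2 * p) / (k : ℝ) ^ p)) := by
          have : ((k : ℝ)⁻¹) ^ (2 * p) = ((k : ℝ) ^ p)⁻¹ * ((k : ℝ) ^ p)⁻¹ := by
            rw [two_mul, pow_add, inv_pow]
          rw [this]
          field_simp
      _ ≤ _ := by
          gcongr
          exact div_le_self hm0 (one_le_pow₀ hk1)
  have hB : ∀ f : Fin k → ι, (‖mavg v‖ + ‖zavg v f‖) ^ (2 * p) ≤ 2 ^ (2 * p) *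
      ∑ q, (coordProj q (mavg v) ^ (2 * p) + coordProj q (zavg v f) ^ (2 * p)) := fun f => by
    rw [Finset.sum_add_distrib]
    refine (add_pow_le_two_pow (norm_nonneg _) (norm_nonneg _) _).trans ?_
    gcongr <;> exact norm_pow_le_sum _ hev (by omega)
  refine (bavg_mono hB).trans ?_
  rw [bavg_const_mul, bavg_sum, mul_assoc, Finset.mul_sum (a := 1 + c * 2 ^ (2 * p))]
  gcongr with q
  rw [bavg_add, bavg_const]
  have h5 : 0 ≤ avg (fun i => coordProj q (v i) ^ (2 * p)) / (k : ℝ) ^ p :=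
    div_nonneg (avg_nonneg fun i => hev.pow_nonneg _) (by positivity)
  have := hA q
  linarith

set_option maxHeartbeats 1000000 in
lemma CondD.exists_expansion {H : (Fin d → ℝ) → ℝ} {a₀ : ℕ} (hD : CondD H a₀)
    (m₀ : Fin d → ℝ) : ∃ C : ℝ, 0 ≤ C ∧
    ∀ {ι : Type} [Fintype ι] [Nonempty ι] {k : ℕ} (_ : 1 ≤ k) (v : ι → Fin d → ℝ),
      |k * (bavg (fun f : Fin k → ι => H (m₀ + (mavg v + zavg v f)) ^ 2) -
          bavg (fun f : Fin k → ι => H (m₀ + (mavg v + zavg v f))) ^ 2) -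
        (avg (fun i => fderiv ℝ H m₀ (v i - mavg v) * fderiv ℝ H m₀ (v i - mavg v)) +
          ∑ p, (coordProj p (mavg v) *
              avg (fun i => fderiv ℝ H m₀ (v i - mavg v) * hessRow H m₀ p (v i - mavg v)) +
            hessRow H m₀ p (mavg v) *
              avg (fun i => fderiv ℝ H m₀ (v i - mavg v) * coordProj p (v i - mavg v)) +
            (k : ℝ)⁻¹ * avg (fun i => fderiv ℝ H m₀ (v i - mavg v) *
              coordProj p (v i - mavg v) * hessRow H m₀ p (v i - mavg v))))| ^ 2 ≤
        C * k ^ 2 * ∑ q, (coordProj q (mavg v) ^ 8 +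
          coordProj q (mavg v) ^ (2 * (6 + 2 * a₀)) +
          avg (fun i => coordProj q (v i) ^ 8) / (k : ℝ) ^ 4 +
          avg (fun i => coordProj q (v i) ^ (2 * (6 + 2 * a₀))) / (k : ℝ) ^ (6 + 2 * a₀)) := by
  obtain ⟨C, hC, hT⟩ := hD.exists_taylor m₀
  obtain ⟨C8, hC8, h8⟩ := exists_bavg_norm_pow_le (d := d) (p := 4) (by norm_num)
  obtain ⟨Cr, hCr, hr⟩ := exists_bavg_norm_pow_le (d := d) (p := 6 + 2 * a₀) (by omega)
  set φ := fderiv ℝ H m₀ with hφ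
  set b := ‖fderiv ℝ (fderiv ℝ H) m₀‖ with hb
  set D := 4 * ‖φ‖ * C + 2 * b ^ 2 + 8 * C ^ 2 with hDdef
  have hb0 : 0 ≤ b := norm_nonneg _
  have hD0 : 0 ≤ D := by positivity
  refine ⟨2 * D ^ 2 * (C8 + Cr), by positivity, fun {ι} _ _ {k} hk v => ?_⟩
  have hk0 : (k : ℝ) ≠ 0 := by positivity
  set G : Fin d → ℝ := fun p => coordProj p (mavg v) *
      avg (fun i => φ (v i - mavg v) * hessRow H m₀ p (v i - mavg v)) +
    hessRow H m₀ p (mavg v) * avg (fun i => φ (v i - mavg v) * coordProj p (v i - mavg v)) +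
    (k : ℝ)⁻¹ * avg (fun i => φ (v i - mavg v) *
      coordProj p (v i - mavg v) * hessRow H m₀ p (v i - mavg v)) with hG
  set Q : (Fin k → ι) → ℝ := fun f =>
    (∑ p, coordProj p (mavg v + zavg v f) * hessRow H m₀ p (mavg v + zavg v f)) / 2 with hQ
  set R : (Fin k → ι) → ℝ := fun f =>
    H (m₀ + (mavg v + zavg v f)) - H m₀ - φ (mavg v + zavg v f) - Q f with hR
  have e1 : ∀ f : Fin k → ι, H (m₀ + (mavg v + zavg v f)) =
      (H m₀ + φ (mavg v)) + φ (zavg v f) + (Q f + R f) := fun f => by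
    simp only [hR, map_add]
    ring
  have e2 : bavg (fun f : Fin k → ι => φ (zavg v f) * (Q f + R f)) =
      ((k : ℝ)⁻¹ * ∑ p, G p) / 2 +
        bavg (fun f : Fin k → ι => φ (zavg v f) * R f) := by
    have : ∀ f : Fin k → ι, φ (zavg v f) * (Q f + R f) = 2⁻¹ * (∑ p,
        ((coordProj p (mavg v) * hessRow H m₀ p (mavg v)) * φ (zavg v f) +
          coordProj p (mavg v) * (φ (zavg v f) * hessRow H m₀ p (zavg v f)) +
          hessRow H m₀ p (mavg v) * (φ (zavg v f) * coordProj p (zavg v f)) +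
          φ (zavg v f) * coordProj p (zavg v f) * hessRow H m₀ p (zavg v f))) +
        φ (zavg v f) * R f := fun f => by
      rw [mul_add, hQ]
      simp only [mul_div_assoc', Finset.mul_sum, map_add]
      rw [div_eq_inv_mul, Finset.mul_sum]
      congr 1
      refine Finset.sum_congr rfl fun p _ => ?_
      ring
    simp only [this]
    rw [bavg_add, bavg_const_mul, bavg_sum, div_eq_inv_mul, Finset.mul_sum (a := (k : ℝ)⁻¹)]
    congr 2
    refine Finset.sum_congr rfl fun p _ => ?_
    rw [bavg_add, bavg_add, bavg_add, bavg_const_mul, bavg_const_mul, bavg_const_mul,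
      bavg_zavg, bavg_zavg_mul hk, bavg_zavg_mul hk, bavg_zavg_mul_mul hk, hG]
    ring
  set W := 2 * bavg (fun f : Fin k → ι => φ (zavg v f) * R f) +
    (bavg (fun f => (Q f + R f) ^ 2) - bavg (fun f => Q f + R f) ^ 2) with hWdef
  refine le_of_eq_of_le (b := |k * W| ^ 2) ?_ ?_
  · simp only [e1]
    rw [bavg_sq_sub_sq _ (bavg_zavg φ v) (fun f => Q f + R f), bavg_zavg_mul hk, e2]
    congr 2
    field_simp
    ring
  have hW : ∀ f : Fin k → ι, 2 * |φ (zavg v f) * R f| + (Q f + R f) ^ 2 ≤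
      D * ((‖mavg v‖ + ‖zavg v f‖) ^ 4 + (‖mavg v‖ + ‖zavg v f‖) ^ (6 + 2 * a₀)) := fun f => by
    set w := ‖mavg v‖ + ‖zavg v f‖ with hw
    have hw0 : 0 ≤ w := by positivity
    have hZ : ‖mavg v + zavg v f‖ ≤ w := norm_add_le _ _
    have hφz : |φ (zavg v f)| ≤ ‖φ‖ * w := (φ.le_opNorm _).trans (by
      gcongr
      exact le_add_of_nonneg_left (norm_nonneg _))
    have hRw : |R f| ≤ C * w ^ 3 * (1 + w ^ a₀) := (hT _).trans (by gcongr)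
    have hQw : |Q f| ≤ b * w ^ 2 := by
      simp only [hQ]
      rw [← hess_apply, abs_div, abs_two]
      have := (fderiv ℝ (fderiv ℝ H) m₀).le_opNorm₂ (mavg v + zavg v f) (mavg v + zavg v f)
      rw [Real.norm_eq_abs] at this
      have h2 : b * ‖mavg v + zavg v f‖ * ‖mavg v + zavg v f‖ ≤ b * w * w := by gcongr
      have h3 : 0 ≤ b * w * w := by positivity
      linarith [this.trans h2]
    have p1 : w ^ (4 + a₀) ≤ w ^ 4 + w ^ (6 + 2 * a₀) :=
      pow_le_pow_add_pow hw0 (by omega) (by omega)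
    have p2 : w ^ 6 ≤ w ^ 4 + w ^ (6 + 2 * a₀) := pow_le_pow_add_pow hw0 (by omega) (by omega)
    have p3 : w ^ (6 + a₀) ≤ w ^ 4 + w ^ (6 + 2 * a₀) :=
      pow_le_pow_add_pow hw0 (by omega) (by omega)
    have p4 : 0 ≤ w ^ 4 := by positivity
    have p5 : 0 ≤ w ^ (6 + 2 * a₀) := by positivity
    set S := w ^ 4 + w ^ (6 + 2 * a₀) with hS
    have q1 : |φ (zavg v f) * R f| ≤ ‖φ‖ * C * (2 * S) := by
      rw [abs_mul]
      calc _ ≤ ‖φ‖ * w * (C * w ^ 3 * (1 + w ^ a₀)) := by gcongr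
        _ = ‖φ‖ * C * (w ^ 4 + w ^ (4 + a₀)) := by ring
        _ ≤ _ := by
          gcongr
          linarith
    have q2 : Q f ^ 2 ≤ b ^ 2 * S := by
      rw [← sq_abs]
      calc |Q f| ^ 2 ≤ (b * w ^ 2) ^ 2 := by gcongr
        _ = b ^ 2 * w ^ 4 := by ring
        _ ≤ _ := by
          gcongr
          linarith
    have q3 : R f ^ 2 ≤ C ^ 2 * (4 * S) := by
      rw [← sq_abs]
      calc |R f| ^ 2 ≤ (C * w ^ 3 * (1 + w ^ a₀)) ^ 2 := by gcongr
        _ = C ^ 2 * (w ^ 6 + 2 * w ^ (6 + a₀) + w ^ (6 + 2 * a₀)) := by ring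
        _ ≤ _ := by
          gcongr
          linarith
    have q4 : (Q f + R f) ^ 2 ≤ 2 * Q f ^ 2 + 2 * R f ^ 2 := by
      linarith [add_sq_le (a := Q f) (b := R f)]
    have q5 : D * S = 2 * (‖φ‖ * C * (2 * S)) + 2 * (b ^ 2 * S) + 2 * (C ^ 2 * (4 * S)) := by
      rw [hDdef]
      ring
    linarith
  have hE : |W| ^ 2 ≤ 2 * D ^ 2 *
      (bavg (fun f : Fin k → ι => (‖mavg v‖ + ‖zavg v f‖) ^ (2 * 4)) +
        bavg fun f : Fin k → ι => (‖mavg v‖ + ‖zavg v f‖) ^ (2 * (6 + 2 * a₀))) := by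
    refine (pow_le_pow_left₀ (abs_nonneg _) (le_trans ?_ (bavg_mono hW)) 2).trans ?_
    · rw [bavg_add (fun f => 2 * |φ (zavg v f) * R f|) fun f => (Q f + R f) ^ 2, bavg_const_mul]
      have t1 := abs_bavg_le fun f : Fin k → ι => φ (zavg v f) * R f
      have t2 := bavg_sq_le fun f : Fin k → ι => Q f + R f
      have t3 := sq_nonneg (bavg fun f : Fin k → ι => Q f + R f)
      rw [abs_le] at t1 ⊢
      constructor <;> linarith [t1.1, t1.2]
    · rw [← bavg_add, ← bavg_const_mul]
      refine (bavg_sq_le _).trans (bavg_mono fun f => ?_)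
      set w := ‖mavg v‖ + ‖zavg v f‖
      rw [mul_pow, mul_comm 2 (D ^ 2), mul_assoc, pow_mul' w 2 4, pow_mul' w 2 (6 + 2 * a₀)]
      gcongr
      exact add_sq_le
  rw [abs_mul, mul_pow, sq_abs (k : ℝ)]
  have hG := h8 hk v
  have hG' := hr hk v
  set S8 := ∑ q, (coordProj q (mavg v) ^ (2 * 4) +
    avg (fun i => coordProj q (v i) ^ (2 * 4)) / (k : ℝ) ^ 4) with hS8
  set Sr := ∑ q, (coordProj q (mavg v) ^ (2 * (6 + 2 * a₀)) +
    avg (fun i => coordProj q (v i) ^ (2 * (6 + 2 * a₀))) / (k : ℝ) ^ (6 + 2 * a₀)) with hSr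
  have hpos : ∀ p, 0 ≤ ∑ q, (coordProj q (mavg v) ^ (2 * p) +
      avg (fun i => coordProj q (v i) ^ (2 * p)) / (k : ℝ) ^ p) := fun p =>
    Finset.sum_nonneg fun q _ => add_nonneg ((even_two_mul p).pow_nonneg _)
      (div_nonneg (avg_nonneg fun i => (even_two_mul p).pow_nonneg _) (by positivity))
  have h80 : 0 ≤ S8 := hpos 4
  have hr0 : 0 ≤ Sr := hpos _
  have hsum : ∑ q, (coordProj q (mavg v) ^ 8 + coordProj q (mavg v) ^ (2 * (6 + 2 * a₀)) +
      avg (fun i => coordProj q (v i) ^ 8) / (k : ℝ) ^ 4 +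
      avg (fun i => coordProj q (v i) ^ (2 * (6 + 2 * a₀))) / (k : ℝ) ^ (6 + 2 * a₀)) =
      S8 + Sr := by
    rw [hS8, hSr, ← Finset.sum_add_distrib]
    refine Finset.sum_congr rfl fun q _ => ?_
    norm_num
    ring
  rw [hsum]
  calc _ ≤ (k : ℝ) ^ 2 * (2 * D ^ 2 * (C8 * S8 + Cr * Sr)) := by
        gcongr
        exact hE.trans (by gcongr)
    _ ≤ (k : ℝ) ^ 2 * (2 * D ^ 2 * ((C8 + Cr) * (S8 + Sr))) := by
        gcongr
        rw [add_mul, mul_add, mul_add]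
        have i1 := mul_nonneg hC8 hr0
        have i2 := mul_nonneg hCr h80
        linarith
    _ = _ := by ring

end Expansion

section Linking

variable {μ : Measure Ω} {X : ℤ → Ω → Fin d → ℝ} {H : (Fin d → ℝ) → ℝ} {N l n : ℕ}

/-- The centred block means. -/
def blockVec (μ : Measure Ω) (X : ℤ → Ω → Fin d → ℝ) (N l : ℕ) (ω : Ω)
    (i : ↥(Finset.range N)) : Fin d → ℝ :=
  (l : ℝ)⁻¹ • ∑ t ∈ Finset.range l, (X (((i : ℕ) : ℤ) + 1 + t) ω - meanVec μ X)

lemma map_blockVec (hl : 1 ≤ l) (φ : LinForm d) (ω : Ω) (i : ↥(Finset.range N)) :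
    φ (blockVec μ X N l ω i) = (√(l : ℝ))⁻¹ * nb μ X l φ (i : ℕ) ω := by
  have h0 : (0 : ℝ) < l := by positivity
  have h1 : √(l : ℝ) ≠ 0 := by positivity
  have h2 : (l : ℝ)⁻¹ = (√(l : ℝ))⁻¹ * (√(l : ℝ))⁻¹ := by
    rw [← mul_inv, Real.mul_self_sqrt h0.le]
  rw [blockVec, map_smul, map_sum, nb, smul_eq_mul, h2, div_eq_inv_mul, mul_assoc]
  rfl

lemma avg_range (F : ℕ → ℝ) :
    avg (fun i : ↥(Finset.range N) => F i) = (∑ i ∈ Finset.range N, F i) / N := by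
  rw [avg, Finset.sum_coe_sort (Finset.range N) F, Fintype.card_coe, Finset.card_range]

lemma avg_blockVec (hl : 1 ≤ l) (φ : LinForm d) (ω : Ω) :
    avg (fun i => φ (blockVec μ X N l ω i)) = mf N l (lin μ X φ) ω := by
  simp only [map_blockVec hl]
  rw [avg_range fun i => (√(l : ℝ))⁻¹ * nb μ X l φ i ω, mf_eq_nb hl, ← Finset.mul_sum]
  field_simp

lemma avg_blockVec_mul (hl : 1 ≤ l) (φ ψ : LinForm d) (ω : Ω) :
    avg (fun i => φ (blockVec μ X N l ω i) * ψ (blockVec μ X N l ω i)) =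
      (l : ℝ)⁻¹ * qf N l (lin μ X φ) (lin μ X ψ) ω := by
  have h0 : (0 : ℝ) < l := by positivity
  simp only [map_blockVec hl]
  rw [avg_range fun i => (√(l : ℝ))⁻¹ * nb μ X l φ i ω * ((√(l : ℝ))⁻¹ * nb μ X l ψ i ω),
    qf_eq_nb hl, mul_div_assoc', Finset.mul_sum]
  congr 1
  refine Finset.sum_congr rfl fun i _ => ?_
  rw [mul_mul_mul_comm, ← mul_inv, Real.mul_self_sqrt h0.le]

lemma avg_blockVec_mul_mul (hl : 1 ≤ l) (φ ψ χ : LinForm d) (ω : Ω) :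
    avg (fun i => φ (blockVec μ X N l ω i) * ψ (blockVec μ X N l ω i) *
      χ (blockVec μ X N l ω i)) = ((√(l : ℝ))⁻¹) ^ 3 * tf μ X N l φ ψ χ ω := by
  simp only [map_blockVec hl]
  rw [avg_range fun i => (√(l : ℝ))⁻¹ * nb μ X l φ i ω * ((√(l : ℝ))⁻¹ * nb μ X l ψ i ω) *
    ((√(l : ℝ))⁻¹ * nb μ X l χ i ω), tf, mul_div_assoc', Finset.mul_sum]
  congr 1
  refine Finset.sum_congr rfl fun i _ => ?_
  ring

/-- The average of powers of normalised block sums. -/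
def pwf (μ : Measure Ω) (X : ℤ → Ω → Fin d → ℝ) (N l p : ℕ) (φ : LinForm d) (ω : Ω) :
    ℝ :=
  (∑ i ∈ Finset.range N, nb μ X l φ i ω ^ p) / N

lemma avg_blockVec_pow (hl : 1 ≤ l) (φ : LinForm d) (p : ℕ) (ω : Ω) :
    avg (fun i => φ (blockVec μ X N l ω i) ^ (2 * p)) =
      pwf μ X N l (2 * p) φ ω / (l : ℝ) ^ p := by
  have h0 : (0 : ℝ) < l := by positivity
  have h1 : ((√(l : ℝ))⁻¹) ^ (2 * p) = ((l : ℝ) ^ p)⁻¹ := by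
    rw [pow_mul, inv_pow, Real.sq_sqrt h0.le, inv_pow]
  simp only [map_blockVec hl, mul_pow]
  rw [avg_range fun i => ((√(l : ℝ))⁻¹) ^ (2 * p) * nb μ X l φ i ω ^ (2 * p), pwf,
    ← Finset.mul_sum, h1]
  field_simp

/-- The empirical covariance of normalised block sums. -/
def cq (μ : Measure Ω) (X : ℤ → Ω → Fin d → ℝ) (N l : ℕ) (φ ψ : LinForm d) (ω : Ω) :
    ℝ :=
  qf N l (lin μ X φ) (lin μ X ψ) ω - l * (mf N l (lin μ X φ) ω * mf N l (lin μ X ψ) ω)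

lemma avg_cov_eq (hl : 1 ≤ l) [Nonempty ↥(Finset.range N)] (φ ψ : LinForm d) (ω : Ω) :
    avg (fun i => φ (blockVec μ X N l ω i - mavg (blockVec μ X N l ω)) *
      ψ (blockVec μ X N l ω i - mavg (blockVec μ X N l ω))) = (l : ℝ)⁻¹ * cq μ X N l φ ψ ω := by
  have h0 : (0 : ℝ) < l := by positivity
  rw [avg_map_sub_mul, avg_blockVec_mul hl, map_mavg, map_mavg, avg_blockVec hl, avg_blockVec hl,
    cq]
  field_simp

/-- The empirical third central moment of normalised block sums. -/
def ctf (μ : Measure Ω) (X : ℤ → Ω → Fin d → ℝ) (N l : ℕ) (φ ψ χ : LinForm d)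
    (ω : Ω) : ℝ :=
  ((√(l : ℝ))⁻¹) ^ 3 * tf μ X N l φ ψ χ ω -
    (l : ℝ)⁻¹ * (mf N l (lin μ X φ) ω * qf N l (lin μ X ψ) (lin μ X χ) ω) -
    (l : ℝ)⁻¹ * (mf N l (lin μ X ψ) ω * qf N l (lin μ X φ) (lin μ X χ) ω) -
    (l : ℝ)⁻¹ * (mf N l (lin μ X χ) ω * qf N l (lin μ X φ) (lin μ X ψ) ω) +
    2 * (mf N l (lin μ X φ) ω * mf N l (lin μ X ψ) ω * mf N l (lin μ X χ) ω)

lemma avg_third_eq (hl : 1 ≤ l) [Nonempty ↥(Finset.range N)] (φ ψ χ : LinForm d)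
    (ω : Ω) :
    avg (fun i => φ (blockVec μ X N l ω i - mavg (blockVec μ X N l ω)) *
      ψ (blockVec μ X N l ω i - mavg (blockVec μ X N l ω)) *
      χ (blockVec μ X N l ω i - mavg (blockVec μ X N l ω))) = ctf μ X N l φ ψ χ ω := by
  rw [avg_map_sub_mul_mul, avg_blockVec_mul_mul hl, avg_blockVec_mul hl, avg_blockVec_mul hl,
    avg_blockVec_mul hl, map_mavg, map_mavg, map_mavg, avg_blockVec hl, avg_blockVec hl,
    avg_blockVec hl, ctf]
  ring

/-- The second order correction to the estimator coming from the curvature of `H`. -/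
def lf (μ : Measure Ω) (X : ℤ → Ω → Fin d → ℝ) (H : (Fin d → ℝ) → ℝ) (N l : ℕ) (ω : Ω) : ℝ :=
  ∑ p, (mf N l (lin μ X (coordProj p)) ω *
      cq μ X N l (fderiv ℝ H (meanVec μ X)) (hessRow H (meanVec μ X) p) ω +
    mf N l (lin μ X (hessRow H (meanVec μ X) p)) ω *
      cq μ X N l (fderiv ℝ H (meanVec μ X)) (coordProj p) ω)

/-- The skewness correction to the estimator coming from the curvature of `H`. -/
def sf (μ : Measure Ω) (X : ℤ → Ω → Fin d → ℝ) (H : (Fin d → ℝ) → ℝ) (N l : ℕ) (ω : Ω) : ℝ :=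
  ∑ p, ctf μ X N l (fderiv ℝ H (meanVec μ X)) (coordProj p) (hessRow H (meanVec μ X) p) ω

lemma mean_add_mavg_add_zavg {k : ℕ} (hk : 1 ≤ k) (hl : 1 ≤ l) (ω : Ω)
    (f : Fin k → ↥(Finset.range N)) :
    (fun j => (∑ a, (∑ t ∈ Finset.range l, X (1 + ((f a : ℕ) : ℤ) + (t : ℤ)) ω j) / (l : ℝ)) / k) =
      meanVec μ X + (mavg (blockVec μ X N l ω) + zavg (blockVec μ X N l ω) f) := by
  have hk0 : (k : ℝ) ≠ 0 := by positivity
  have hl0 : (l : ℝ) ≠ 0 := by positivity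
  funext j
  have e : ∀ a, (∑ t ∈ Finset.range l, X (1 + ((f a : ℕ) : ℤ) + (t : ℤ)) ω j) / (l : ℝ) =
      blockVec μ X N l ω (f a) j + meanVec μ X j := fun a => by
    simp only [blockVec, Pi.smul_apply, Finset.sum_apply, Pi.sub_apply, Finset.sum_sub_distrib,
      Finset.sum_const, Finset.card_range, nsmul_eq_mul, smul_eq_mul, add_comm (1 : ℤ),
      Pi.mul_apply, Pi.natCast_apply]
    field_simp
    ring
  simp only [e, zavg, Pi.add_apply, Pi.smul_apply, Finset.sum_apply, Pi.sub_apply,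
    Finset.sum_add_distrib, Finset.sum_sub_distrib, Finset.sum_const, Finset.card_univ,
    Fintype.card_fin, nsmul_eq_mul, smul_eq_mul, Pi.mul_apply, Pi.natCast_apply]
  field_simp
  ring

lemma CondD.exists_sigmaHat_expansion {a₀ : ℕ} (hD : CondD H a₀) : ∃ C : ℝ, 0 ≤ C ∧
    ∀ n l : ℕ, 1 ≤ l → l ≤ n → ∀ ω, (sigmaHat X H n l ω -
      (cq μ X (n - l + 1) l (fderiv ℝ H (meanVec μ X)) (fderiv ℝ H (meanVec μ X)) ω +
        lf μ X H (n - l + 1) l ω +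
        l * ((n / l : ℕ) : ℝ)⁻¹ * sf μ X H (n - l + 1) l ω)) ^ 2 ≤
      C * l ^ 2 * ((n / l : ℕ) : ℝ) ^ 2 * ∑ p,
        (mf (n - l + 1) l (lin μ X (coordProj p)) ω ^ 8 +
          mf (n - l + 1) l (lin μ X (coordProj p)) ω ^ (2 * (6 + 2 * a₀)) +
          pwf μ X (n - l + 1) l 8 (coordProj p) ω / (l : ℝ) ^ 4 / ((n / l : ℕ) : ℝ) ^ 4 +
          pwf μ X (n - l + 1) l (2 * (6 + 2 * a₀)) (coordProj p) ω / (l : ℝ) ^ (6 + 2 * a₀) /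
            ((n / l : ℕ) : ℝ) ^ (6 + 2 * a₀)) := by
  obtain ⟨C, hC, hE⟩ := hD.exists_expansion (meanVec μ X)
  refine ⟨C, hC, fun n l hl hln ω => ?_⟩
  have hk : 1 ≤ n / l := Nat.div_pos hln (by omega)
  have hl0 : (l : ℝ) ≠ 0 := by positivity
  set k := n / l with hkdef
  set N := n - l + 1 with hN
  have : Nonempty ↥(Finset.range N) := ⟨⟨0, Finset.mem_range.2 (by omega)⟩⟩
  have h1 := hE hk (blockVec μ X N l ω)
  simp only [map_mavg, avg_blockVec hl, avg_cov_eq hl, avg_third_eq hl,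
    avg_blockVec_pow hl _ (6 + 2 * a₀)] at h1
  have e8 : ∀ p, avg (fun i => coordProj p (blockVec μ X N l ω i) ^ 8) =
      pwf μ X N l 8 (coordProj p) ω / (l : ℝ) ^ 4 := fun p => avg_blockVec_pow hl _ 4 ω
  simp only [e8] at h1
  have hs : sigmaHat X H n l ω = l * (k * (bavg (fun f : Fin k → ↥(Finset.range N) =>
        H (meanVec μ X + (mavg (blockVec μ X N l ω) + zavg (blockVec μ X N l ω) f)) ^ 2) -
      bavg (fun f : Fin k → ↥(Finset.range N) =>
        H (meanVec μ X + (mavg (blockVec μ X N l ω) + zavg (blockVec μ X N l ω) f))) ^ 2)) := by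
    simp only [← mean_add_mavg_add_zavg hk hl]
    rw [← mul_assoc]
    simp only [bavg, Fintype.card_coe]
    rfl
  rw [hs]
  rw [sq_abs] at h1
  have hlf : lf μ X H N l ω + l * (k : ℝ)⁻¹ * sf μ X H N l ω = l * ∑ p,
      (mf N l (lin μ X (coordProj p)) ω * ((l : ℝ)⁻¹ *
          cq μ X N l (fderiv ℝ H (meanVec μ X)) (hessRow H (meanVec μ X) p) ω) +
        mf N l (lin μ X (hessRow H (meanVec μ X) p)) ω * ((l : ℝ)⁻¹ *
          cq μ X N l (fderiv ℝ H (meanVec μ X)) (coordProj p) ω) +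
        (k : ℝ)⁻¹ * ctf μ X N l (fderiv ℝ H (meanVec μ X)) (coordProj p)
          (hessRow H (meanVec μ X) p) ω) := by
    rw [lf, sf, Finset.mul_sum, Finset.mul_sum, ← Finset.sum_add_distrib]
    refine Finset.sum_congr rfl fun p _ => ?_
    field_simp
  rw [add_assoc, hlf]
  have hc : cq μ X N l (fderiv ℝ H (meanVec μ X)) (fderiv ℝ H (meanVec μ X)) ω = l * ((l : ℝ)⁻¹ *
      cq μ X N l (fderiv ℝ H (meanVec μ X)) (fderiv ℝ H (meanVec μ X)) ω) := by
    field_simp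
  rw [hc, ← mul_add, ← mul_sub, mul_pow]
  calc _ ≤ (l : ℝ) ^ 2 * _ := mul_le_mul_of_nonneg_left h1 (by positivity)
    _ = _ := by ring

end Linking

section SecondMoment

variable {μ : Measure Ω} {f g : Ω → ℝ} {s t : ℝ}

/-- The second moment of `f` is finite and at most `s ^ 2`. -/
structure L2Le (μ : Measure Ω) (f : Ω → ℝ) (s : ℝ) : Prop where
  meas : AEStronglyMeasurable f μ
  int : Integrable (fun ω => f ω ^ 2) μ
  nonneg : 0 ≤ s
  le : ∫ ω, f ω ^ 2 ∂μ ≤ s ^ 2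

namespace L2Le

lemma integrable_mul (hf : L2Le μ f s) (hg : L2Le μ g t) : Integrable (fun ω => f ω * g ω) μ :=
  ((memLp_two_iff_integrable_sq hf.meas).2 hf.int).integrable_mul
    ((memLp_two_iff_integrable_sq hg.meas).2 hg.int)

lemma abs_integral_mul_le (hf : L2Le μ f s) (hg : L2Le μ g t) : |∫ ω, f ω * g ω ∂μ| ≤ s * t :=
  abs_integral_mul_le_of_sq hf.int hg.int (hf.integrable_mul hg) hf.nonneg hg.nonneg hf.le hg.le

lemma mono (hf : L2Le μ f s) (h : s ≤ t) : L2Le μ f t :=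
  ⟨hf.meas, hf.int, hf.nonneg.trans h, hf.le.trans (by have := hf.nonneg; gcongr)⟩

lemma add (hf : L2Le μ f s) (hg : L2Le μ g t) : L2Le μ (fun ω => f ω + g ω) (s + t) := by
  have e : ∀ ω, (f ω + g ω) ^ 2 = f ω ^ 2 + 2 * (f ω * g ω) + g ω ^ 2 := fun ω => by ring
  have h1 : Integrable (fun ω => 2 * (f ω * g ω)) μ := (hf.integrable_mul hg).const_mul 2
  have h2 : Integrable (fun ω => f ω ^ 2 + 2 * (f ω * g ω)) μ := hf.int.add h1
  refine ⟨hf.meas.add hg.meas, ?_, add_nonneg hf.nonneg hg.nonneg, ?_⟩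
  · simp only [e]
    exact h2.add hg.int
  · simp only [e]
    rw [integral_add h2 hg.int, integral_add hf.int h1, integral_const_mul]
    have h3 := (abs_le.1 (hf.abs_integral_mul_le hg)).2
    have h4 := hf.le
    have h5 := hg.le
    rw [add_sq]
    linarith

lemma const_mul (hf : L2Le μ f s) (c : ℝ) : L2Le μ (fun ω => c * f ω) (|c| * s) := by
  refine ⟨hf.meas.const_mul c, ?_, mul_nonneg (abs_nonneg _) hf.nonneg, ?_⟩
  · simp only [mul_pow]
    exact hf.int.const_mul _
  · simp only [mul_pow, sq_abs]
    rw [integral_const_mul]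
    exact mul_le_mul_of_nonneg_left hf.le (sq_nonneg _)

lemma sub (hf : L2Le μ f s) (hg : L2Le μ g t) : L2Le μ (fun ω => f ω - g ω) (s + t) := by
  have := hf.add (hg.const_mul (-1))
  simpa [sub_eq_add_neg] using this

lemma sum {ι : Type*} {S : Finset ι} {f : ι → Ω → ℝ} (h : ∀ i ∈ S, L2Le μ (f i) s) :
    L2Le μ (fun ω => ∑ i ∈ S, f i ω) (S.card * s) := by
  induction S using Finset.induction_on with
  | empty =>
    exact ⟨by simpa using aestronglyMeasurable_const, by simp, by simp, by simp⟩
  | insert a S ha ih =>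
    simp only [Finset.sum_insert ha, Finset.card_insert_of_notMem ha]
    refine ((h a (Finset.mem_insert_self _ _)).add
      (ih fun i hi => h i (Finset.mem_insert_of_mem hi))).mono ?_
    push_cast
    linarith

lemma of_growth [IsProbabilityMeasure μ] {X : ℤ → Ω → Fin d → ℝ} {r j : ℕ} {q C : ℝ}
    (hf : Growth X j f) (h : Regular μ X r q C) (hj : j ≤ 6) (hs : 0 ≤ s)
    (hle : ∫ ω, f ω ^ 2 ∂μ ≤ s ^ 2) : L2Le μ f s :=
  ⟨hf.meas.aestronglyMeasurable, (hf.pow 2).integrable h (by have := h.six_le; omega), hs, hle⟩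

lemma of_growth_le [IsProbabilityMeasure μ] {X : ℤ → Ω → Fin d → ℝ} {r j l i : ℕ} {q C D : ℝ}
    (hf : Growth X j f) (h : Regular μ X r q C) (hj : j ≤ 6) (hD : 1 ≤ D)
    (hle : ∫ ω, f ω ^ 2 ∂μ ≤ D / (l : ℝ) ^ i) : L2Le μ f (D / √(l : ℝ) ^ i) := by
  refine of_growth hf h hj (by positivity) (hle.trans ?_)
  rw [div_pow, ← pow_mul, mul_comm i 2, pow_mul, Real.sq_sqrt (by positivity)]
  gcongr
  nlinarith

end L2Le

/-- The block length `l` and the number `N` of blocks satisfy `l ^ 3 ≍ N`. -/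
structure Regime (c : ℝ) (N l : ℕ) : Prop where
  one_le : 1 ≤ c
  one_le_len : 1 ≤ l
  two_mul_le : 2 * l ≤ N
  cube_le : (l : ℝ) ^ 3 ≤ c * N

namespace Regime

variable {c : ℝ} {N l : ℕ}

lemma one_le_num (h : Regime c N l) : 1 ≤ N := by
  have := h.one_le_len
  have := h.two_mul_le
  omega

lemma div_le (h : Regime c N l) {i j k : ℕ} (hk : i + k = 3 * j) :
    (l : ℝ) ^ i / (N : ℝ) ^ j ≤ c ^ j / (l : ℝ) ^ k := by
  have h1 := h.one_le_len
  have h2 := h.one_le_num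
  rw [div_le_div_iff₀ (by positivity) (by positivity), ← pow_add, hk, pow_mul, ← mul_pow]
  exact pow_le_pow_left₀ (by positivity) h.cube_le j

lemma le_div (h : Regime c N l) {x K : ℝ} (hK : 0 ≤ K) {i j k : ℕ} (hk : i + k = 3 * j)
    (hx : x ≤ K * ((l : ℝ) ^ i / (N : ℝ) ^ j)) : x ≤ K * c ^ j / (l : ℝ) ^ k := by
  rw [mul_div_assoc]
  exact hx.trans (mul_le_mul_of_nonneg_left (h.div_le hk) hK)

end Regime

end SecondMoment

section Sizes

variable {μ : Measure Ω} {X : ℤ → Ω → Fin d → ℝ} {r : ℕ} {q C : ℝ} {N l : ℕ}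

lemma Regime.one_le_sqrt {c : ℝ} (h : Regime c N l) : 1 ≤ √(l : ℝ) := by
  rw [Real.one_le_sqrt]
  exact_mod_cast h.one_le_len

lemma Regime.div_sqrt_pow_le {c : ℝ} (h : Regime c N l) {D D' : ℝ} (hD : 0 ≤ D) (hD' : D ≤ D')
    {i j : ℕ} (hij : j ≤ i) : D / √(l : ℝ) ^ i ≤ D' / √(l : ℝ) ^ j := by
  have h1 := h.one_le_sqrt
  have h2 := pow_le_pow_right₀ h1 hij
  have h3 : 0 ≤ D' := hD.trans hD'
  gcongr

lemma sq_mul_le (x y : ℝ) : (x * y) ^ 2 ≤ x ^ 4 + y ^ 4 := by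
  nlinarith [sq_nonneg (x ^ 2 - y ^ 2), sq_nonneg (x ^ 2), sq_nonneg (y ^ 2)]

/-- Mean square bounds for the basic statistics, uniformly over functionals of norm at most `B`. -/
structure Sizes (μ : Measure Ω) (X : ℤ → Ω → Fin d → ℝ) (D B : ℝ) (N l : ℕ) : Prop where
  mf : ∀ φ : LinForm d, ‖φ‖ ≤ B → L2Le μ (mf N l (lin μ X φ)) (D / √(l : ℝ) ^ 3)
  mf_mul : ∀ φ ψ : LinForm d, ‖φ‖ ≤ B → ‖ψ‖ ≤ B →
    L2Le μ (fun ω => BlockLength.mf N l (lin μ X φ) ω * BlockLength.mf N l (lin μ X ψ) ω)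
      (D / √(l : ℝ) ^ 6)
  mf_mul_mul : ∀ φ ψ χ : LinForm d, ‖φ‖ ≤ B → ‖ψ‖ ≤ B → ‖χ‖ ≤ B →
    L2Le μ (fun ω => BlockLength.mf N l (lin μ X φ) ω * BlockLength.mf N l (lin μ X ψ) ω *
      BlockLength.mf N l (lin μ X χ) ω) (D / √(l : ℝ) ^ 9)
  qf : ∀ φ ψ : LinForm d, ‖φ‖ ≤ B → ‖ψ‖ ≤ B →
    L2Le μ (fun ω => qf N l (lin μ X φ) (lin μ X ψ) ω - ∑' a, ccov μ X φ ψ a)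
      (D / √(l : ℝ) ^ 2)
  mf_mul_qf : ∀ χ φ ψ : LinForm d, ‖χ‖ ≤ B → ‖φ‖ ≤ B → ‖ψ‖ ≤ B →
    L2Le μ (fun ω => BlockLength.mf N l (lin μ X χ) ω *
      (BlockLength.qf N l (lin μ X φ) (lin μ X ψ) ω - ∑' a, ccov μ X φ ψ a)) (D / √(l : ℝ) ^ 4)
  tsum_le : ∀ φ ψ : LinForm d, ‖φ‖ ≤ B → ‖ψ‖ ≤ B → |∑' a, ccov μ X φ ψ a| ≤ D
  one_le : 1 ≤ D

namespace Regular

variable [IsProbabilityMeasure μ]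

lemma exists_mf_size (h : Regular μ X r q C) (B : ℝ) {c : ℝ} (hc : 1 ≤ c) :
    ∃ D : ℝ, 1 ≤ D ∧ ∀ N l, Regime c N l → ∀ φ : LinForm d, ‖φ‖ ≤ B →
      ∀ j, 1 ≤ j → j ≤ 4 →
        ∫ ω, mf N l (lin μ X φ) ω ^ (2 * j) ∂μ ≤ D / (l : ℝ) ^ (3 * j) := by
  obtain ⟨K, hK, hm⟩ := h.exists_mf_pow_le B
  refine ⟨K * c ^ 4, one_le_mul_of_one_le_of_one_le hK (one_le_pow₀ hc),
    fun N l hR φ hφ j h1 h4 => ?_⟩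
  have hx := (hm φ hφ N l hR.one_le_len hR.one_le_num).1 j h1 (by omega)
  refine (hR.le_div (i := 0) (j := j) (k := 3 * j) (K := K) (by positivity) (by simp)
    (hx.trans_eq (by simp [div_eq_mul_inv]))).trans ?_
  have hl := hR.one_le_len
  gcongr

lemma exists_qf_size (h : Regular μ X r q C) (B : ℝ) {c : ℝ} (hc : 1 ≤ c) :
    ∃ D : ℝ, 1 ≤ D ∧ ∀ N l, Regime c N l → ∀ φ ψ : LinForm d, ‖φ‖ ≤ B → ‖ψ‖ ≤ B →
      |∑' a, ccov μ X φ ψ a| ≤ D ∧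
      ∫ ω, (qf N l (lin μ X φ) (lin μ X ψ) ω - ∑' a, ccov μ X φ ψ a) ^ 2 ∂μ ≤ D / (l : ℝ) ^ 2 ∧
      ∫ ω, (qf N l (lin μ X φ) (lin μ X ψ) ω - ∑' a, ccov μ X φ ψ a) ^ 4 ∂μ ≤ D := by
  obtain ⟨K, hK, hv⟩ := h.exists_var_qf_le B
  obtain ⟨L, hL, hd, -, -⟩ := h.exists_decay B
  obtain ⟨M, hM, h4⟩ := h.exists_qf_four_le B
  have hr := h.six_le
  have hS : (0 : ℝ) ≤ L * decSum := mul_nonneg (by linarith) (by linarith [decSum_ge_one])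
  refine ⟨(1 + L * decSum) + (K * c ^ 1 + (3 * (L * decSum)) ^ 2) +
    8 * (M + (L * decSum) ^ 4), ?_, fun N l hR φ ψ hφ hψ => ?_⟩
  · have : 0 ≤ K * c ^ 1 := by positivity
    have : 0 ≤ (3 * (L * decSum)) ^ 2 := by positivity
    have : 0 ≤ 8 * (M + (L * decSum) ^ 4) := by positivity
    linarith
  have hl := hR.one_le_len
  have hN := hR.one_le_num
  have hA := h.growth_qf (N := N) (l := l) φ ψ
  set A := qf N l (lin μ X φ) (lin μ X ψ) with hAdef
  set s := ∑' a, ccov μ X φ ψ a with hs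
  have hA1 : Integrable A μ := hA.integrable h (by omega)
  have p1 : 0 ≤ K * c ^ 1 := by positivity
  have p2 : 0 ≤ (3 * (L * decSum)) ^ 2 := by positivity
  have p3 : 0 ≤ 8 * (M + (L * decSum) ^ 4) := by positivity
  have hsb : |s| ≤ L * decSum := (hd φ ψ hφ hψ).abs_tsum_le
  refine ⟨by linarith, ?_, ?_⟩
  · have hg := hA.sub (Growth.const 2 s)
    have hm : ∫ ω, (A ω - s) ∂μ = ∫ ω, A ω ∂μ - s := by
      rw [integral_sub hA1 (integrable_const _)]
      simp
    rw [integral_sq_eq_add (hg.integrable h (by omega)) ((hg.pow 2).integrable h (by omega)) hm]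
    simp only [sub_sub_sub_cancel_right]
    have h1 := hR.le_div (i := 1) (j := 1) (k := 2) (K := K) (by positivity) (by norm_num)
      ((hv φ ψ hφ hψ N l hl hN).trans_eq (by simp))
    have h2 := h.abs_integral_qf_sub_tsum_le (hd φ ψ hφ hψ) hl hN
    have h3 : (∫ ω, A ω ∂μ - s) ^ 2 ≤ (3 * (L * decSum)) ^ 2 / (l : ℝ) ^ 2 := by
      rw [← sq_abs, ← div_pow]
      gcongr
    calc _ ≤ K * c ^ 1 / (l : ℝ) ^ 2 + (3 * (L * decSum)) ^ 2 / (l : ℝ) ^ 2 := add_le_add h1 h3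
      _ ≤ _ := by
        rw [← add_div]
        exact div_le_div_of_nonneg_right (by linarith) (by positivity)
  · have hi : Integrable (fun ω => 8 * (A ω ^ 4 + s ^ 4)) μ :=
      (((hA.pow 4).add (Growth.const _ (s ^ 4))).const_mul 8).integrable h (by omega)
    calc _ ≤ ∫ ω, 8 * (A ω ^ 4 + s ^ 4) ∂μ := by
          refine integral_mono (((hA.sub (Growth.const 2 s)).pow 4).integrable h (by omega)) hi
            fun ω => ?_
          have h7 : ∀ x y : ℝ, (x - y) ^ 4 ≤ 8 * (x ^ 4 + y ^ 4) := fun x y => by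
            nlinarith [sq_nonneg (x + y), sq_nonneg (x - y), sq_nonneg (x ^ 2 - y ^ 2),
              sq_nonneg ((x + y) ^ 2), sq_nonneg (x ^ 2 + 2 * x * y + y ^ 2 + (x - y) ^ 2),
              mul_nonneg (sq_nonneg (x + y)) (sq_nonneg (x - y))]
          exact h7 _ _
      _ = 8 * (∫ ω, A ω ^ 4 ∂μ + s ^ 4) := by
          rw [integral_const_mul, integral_add ((hA.pow 4).integrable h (by omega))
            (integrable_const _)]
          simp
      _ ≤ 8 * (M + (L * decSum) ^ 4) := by
          have h5 : s ^ 4 ≤ (L * decSum) ^ 4 := by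
            rw [← Even.pow_abs (by decide : Even 4) s]
            gcongr
          have h6 := h4 φ ψ hφ hψ N l hl hN
          linarith
      _ ≤ _ := by linarith

theorem exists_sizes (h : Regular μ X r q C) (B : ℝ) {c : ℝ} (hc : 1 ≤ c) :
    ∃ D : ℝ, ∀ N l, Regime c N l → Sizes μ X D B N l := by
  obtain ⟨D, hD, hm⟩ := h.exists_mf_size B hc
  obtain ⟨E, hE, hq⟩ := h.exists_qf_size B hc
  have hr := h.six_le
  have hi : ∀ N l φ j, j ≤ 12 → Integrable (fun ω => mf N l (lin μ X φ) ω ^ j) μ :=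
    fun N l φ j hj => ((h.growth_mf φ).pow j).integrable h (by omega)
  have hDE : 1 ≤ D * E := one_le_mul_of_one_le_of_one_le hD hE
  have hDE' : 1 ≤ D * E * E := one_le_mul_of_one_le_of_one_le hDE hE
  refine ⟨3 * D + D * E * E + E, fun N l hR => ⟨fun φ hφ => ?_, fun φ ψ hφ hψ => ?_,
    fun φ ψ χ hφ hψ hχ => ?_, fun φ ψ hφ hψ => ?_, fun χ φ ψ hχ hφ hψ => ?_,
    fun φ ψ hφ hψ => ?_, ?_⟩⟩
  · exact ((L2Le.of_growth_le (h.growth_mf φ) h (by omega) hD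
      (hm N l hR φ hφ 1 (by omega) (by omega))).mono
      (hR.div_sqrt_pow_le (by linarith) (by linarith) le_rfl))
  · refine (L2Le.of_growth_le (D := 2 * D) (i := 6) ((h.growth_mf φ).mul (h.growth_mf ψ)) h
      (by omega) (by linarith) ?_).mono (hR.div_sqrt_pow_le (by linarith) (by linarith) le_rfl)
    have i1 := hi N l φ 4 (by norm_num)
    have i2 := hi N l ψ 4 (by norm_num)
    refine (integral_mono ((((h.growth_mf φ).mul (h.growth_mf ψ)).pow 2).integrable h (by omega))
      (i1.add i2) fun ω => sq_mul_le _ _).trans ?_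
    simp only [Pi.add_apply]
    rw [integral_add i1 i2, mul_div_assoc, two_mul]
    exact add_le_add (hm N l hR φ hφ 2 (by omega) (by omega))
      (hm N l hR ψ hψ 2 (by omega) (by omega))
  · refine (L2Le.of_growth_le (D := 3 * D) (i := 9)
      (((h.growth_mf φ).mul (h.growth_mf ψ)).mul (h.growth_mf χ)) h
      (by omega) (by linarith) ?_).mono (hR.div_sqrt_pow_le (by linarith) (by linarith) le_rfl)
    have i1 := hi N l φ 6 (by norm_num)
    have i2 := hi N l ψ 6 (by norm_num)
    have i3 := hi N l χ 6 (by norm_num)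
    have i12 : Integrable (fun ω => mf N l (lin μ X φ) ω ^ 6 + mf N l (lin μ X ψ) ω ^ 6) μ :=
      i1.add i2
    refine (integral_mono
      (((((h.growth_mf φ).mul (h.growth_mf ψ)).mul (h.growth_mf χ)).pow 2).integrable h (by omega))
      (i12.add i3) fun ω => ?_).trans ?_
    · have hx : ∀ u v w : ℝ, 0 ≤ u → 0 ≤ v → 0 ≤ w → u * v * w ≤ u ^ 3 + v ^ 3 + w ^ 3 := by
        intro u v w hu hv hw
        have := add_nonneg (add_nonneg hu hv) hw
        nlinarith [mul_nonneg this (sq_nonneg (u - v)), mul_nonneg this (sq_nonneg (v - w)),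
          mul_nonneg this (sq_nonneg (u - w)), mul_nonneg (mul_nonneg hu hv) hw]
      have := hx _ _ _ (sq_nonneg (mf N l (lin μ X φ) ω)) (sq_nonneg (mf N l (lin μ X ψ) ω))
        (sq_nonneg (mf N l (lin μ X χ) ω))
      simp only [Pi.add_apply, mul_pow]
      calc _ ≤ _ := this
        _ = _ := by ring
    · simp only [Pi.add_apply]
      rw [integral_add i12 i3, integral_add i1 i2, mul_div_assoc,
        show (3 : ℝ) = 1 + 1 + 1 by norm_num, add_mul, add_mul, one_mul]
      exact add_le_add (add_le_add (hm N l hR φ hφ 3 (by omega) (by omega))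
        (hm N l hR ψ hψ 3 (by omega) (by omega))) (hm N l hR χ hχ 3 (by omega) (by omega))
  · exact (L2Le.of_growth_le ((h.growth_qf φ ψ).sub (Growth.const 2 _)) h (by omega) hE
      (hq N l hR φ ψ hφ hψ).2.1).mono (hR.div_sqrt_pow_le (by linarith) (by linarith) le_rfl)
  · have hl := hR.one_le_len
    have gm := h.growth_mf (N := N) (l := l) χ
    have gg := (h.growth_qf (N := N) (l := l) φ ψ).sub (Growth.const 2 (∑' a, ccov μ X φ ψ a))
    have m4 : L2Le μ (fun ω => mf N l (lin μ X χ) ω ^ 4) (D / (l : ℝ) ^ 6) := by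
      refine L2Le.of_growth (gm.pow 4) h (by omega) (by positivity) ?_
      simp only [← pow_mul]
      refine (hm N l hR χ hχ 4 (by omega) (by omega)).trans ?_
      rw [div_pow, ← pow_mul]
      gcongr
      nlinarith
    have g2 : L2Le μ (fun ω => (qf N l (lin μ X φ) (lin μ X ψ) ω - ∑' a, ccov μ X φ ψ a) ^ 2)
        E := by
      refine L2Le.of_growth (gg.pow 2) h (by omega) (by positivity) ?_
      simp only [← pow_mul]
      refine (hq N l hR φ ψ hφ hψ).2.2.trans ?_
      nlinarith
    have m2g : L2Le μ (fun ω => mf N l (lin μ X χ) ω ^ 2 *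
        (qf N l (lin μ X φ) (lin μ X ψ) ω - ∑' a, ccov μ X φ ψ a)) (D * E / (l : ℝ) ^ 3) := by
      refine L2Le.of_growth ((gm.pow 2).mul gg) h (by omega) (by positivity) ?_
      have := (abs_le.1 (m4.abs_integral_mul_le g2)).2
      simp only [mul_pow, ← pow_mul]
      refine this.trans ?_
      rw [div_pow, ← pow_mul, div_mul_eq_mul_div]
      gcongr
      nlinarith
    have g1 : L2Le μ (fun ω => qf N l (lin μ X φ) (lin μ X ψ) ω - ∑' a, ccov μ X φ ψ a)
        (E / (l : ℝ)) := by
      refine L2Le.of_growth gg h (by omega) (by positivity) ?_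
      refine (hq N l hR φ ψ hφ hψ).2.1.trans ?_
      rw [div_pow]
      gcongr
      nlinarith
    refine (L2Le.of_growth_le (D := D * E * E) (i := 4) (gm.mul gg) h (by omega) hDE' ?_).mono
      (hR.div_sqrt_pow_le (by linarith) (by linarith) le_rfl)
    calc _ = ∫ ω, mf N l (lin μ X χ) ω ^ 2 *
        (qf N l (lin μ X φ) (lin μ X ψ) ω - ∑' a, ccov μ X φ ψ a) *
        (qf N l (lin μ X φ) (lin μ X ψ) ω - ∑' a, ccov μ X φ ψ a) ∂μ :=
          integral_congr_ae (ae_of_all _ fun ω => by ring)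
      _ ≤ _ := (abs_le.1 (m2g.abs_integral_mul_le g1)).2
      _ = _ := by
        field_simp
  · exact (hq N l hR φ ψ hφ hψ).1.trans (by linarith)
  · linarith

end Regular

end Sizes

section Remainder

variable {μ : Measure Ω} {X : ℤ → Ω → Fin d → ℝ} {H : (Fin d → ℝ) → ℝ} {q C : ℝ} {N l n : ℕ}

lemma measurable_sigmaHat (hH : Continuous H) (hX : ∀ i, Measurable (X i)) (n l : ℕ) :
    Measurable (sigmaHat X H n l) := by
  have hX' : ∀ i j, Measurable fun ω => X i ω j := fun i j => (measurable_pi_apply j).comp (hX i)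
  have hθ : ∀ f : Fin (n / l) → ↥(Finset.range (n - l + 1)), Measurable fun ω => H fun j =>
      (∑ a, (∑ t ∈ Finset.range l, X (1 + ((f a : ℕ) : ℤ) + (t : ℤ)) ω j) / (l : ℝ)) /
        ((n / l : ℕ) : ℝ) := fun f =>
    hH.measurable.comp (measurable_pi_lambda _ fun j =>
      (Finset.measurable_fun_sum _ fun a _ =>
        (Finset.measurable_fun_sum _ fun t _ => hX' _ j).div_const _).div_const _)
  exact (((Finset.measurable_fun_sum _ fun f _ => (hθ f).pow_const 2).div_const _).sub
    (((Finset.measurable_fun_sum _ fun f _ => hθ f).div_const _).pow_const 2)).const_mul _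

variable {r : ℕ}

lemma Regular.growth_cq (h : Regular μ X r q C) (φ ψ : LinForm d) :
    Growth X 2 (cq μ X N l φ ψ) :=
  (h.growth_qf φ ψ).sub (((h.growth_mf φ).mul (h.growth_mf ψ)).const_mul _)

lemma Regular.growth_ctf (h : Regular μ X r q C) (φ ψ χ : LinForm d) :
    Growth X 3 (ctf μ X N l φ ψ χ) :=
  (((((h.growth_tf φ ψ χ).const_mul _).sub
    (((h.growth_mf φ).mul (h.growth_qf ψ χ)).const_mul _)).sub
    (((h.growth_mf ψ).mul (h.growth_qf φ χ)).const_mul _)).sub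
    (((h.growth_mf χ).mul (h.growth_qf φ ψ)).const_mul _)).add
    ((((h.growth_mf φ).mul (h.growth_mf ψ)).mul (h.growth_mf χ)).const_mul _)

lemma Regular.growth_lf (h : Regular μ X r q C) : Growth X 3 (lf μ X H N l) :=
  Growth.sum fun _ _ => ((h.growth_mf _).mul (h.growth_cq _ _)).add
    ((h.growth_mf _).mul (h.growth_cq _ _))

lemma Regular.growth_sf (h : Regular μ X r q C) : Growth X 3 (sf μ X H N l) :=
  Growth.sum fun _ _ => h.growth_ctf _ _ _

lemma Regular.growth_pwf (h : Regular μ X r q C) (p : ℕ) (φ : LinForm d) :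
    Growth X p (pwf μ X N l p φ) := by
  have : ∀ i : ℕ, Growth X p fun ω => nb μ X l φ i ω ^ p := fun i => by
    simpa using (h.growth_nb (l := l) φ i).pow p
  exact (Growth.sum fun i _ => this i).div_const _

variable [IsProbabilityMeasure μ]

lemma Regular.integral_pwf_le (h : Regular μ X r q C) {p : ℕ} (hp : p ≤ 2 * r) (hN : 1 ≤ N)
    {φ : LinForm d} {K : ℝ} (hK : ∀ i : ℤ, ∫ ω, nb μ X l φ i ω ^ p ∂μ ≤ K) :
    ∫ ω, pwf μ X N l p φ ω ∂μ ≤ K := by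
  have hg : ∀ i : ℕ, Growth X p fun ω => nb μ X l φ i ω ^ p := fun i => by
    simpa using (h.growth_nb (l := l) φ i).pow p
  have hN0 : (0 : ℝ) < N := by positivity
  unfold pwf
  rw [integral_div, integral_finsetSum _ fun (i : ℕ) _ => (hg i).integrable h hp, div_le_iff₀ hN0]
  calc _ ≤ ∑ i ∈ Finset.range N, K := Finset.sum_le_sum fun i _ => hK i
    _ = _ := by simp [mul_comm]

/-- The quotient `n / l` is comparable to the real quotient. -/
lemma le_two_mul_div (hl : 1 ≤ l) (hln : l ≤ n) :
    (n : ℝ) ≤ 2 * (l * ((n / l : ℕ) : ℝ)) ∧ l * ((n / l : ℕ) : ℝ) ≤ n := by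
  have h1 : 1 ≤ n / l := Nat.div_pos hln (by omega)
  have h2 := Nat.div_add_mod n l
  have h3 := Nat.mod_lt n (show 0 < l by omega)
  have h4 : l * 1 ≤ l * (n / l) := Nat.mul_le_mul_left l h1
  constructor
  · exact_mod_cast (by omega : n ≤ 2 * (l * (n / l)))
  · exact_mod_cast (by omega : l * (n / l) ≤ n)

theorem CondD.exists_sigmaHat_size {a₀ : ℕ} (hD : CondD H a₀)
    (h : Regular μ X (6 + 2 * a₀) q C) {c : ℝ} (hc : 1 ≤ c) :
    ∃ D : ℝ, 1 ≤ D ∧ ∀ n l, l ≤ n → Regime c (n - l + 1) l → L2Le μ (fun ω => sigmaHat X H n l ω -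
      (cq μ X (n - l + 1) l (fderiv ℝ H (meanVec μ X)) (fderiv ℝ H (meanVec μ X)) ω +
        lf μ X H (n - l + 1) l ω +
        l * ((n / l : ℕ) : ℝ)⁻¹ * sf μ X H (n - l + 1) l ω)) (D / √(l : ℝ) ^ 6) := by
  obtain ⟨E, hE, hexp⟩ := hD.exists_sigmaHat_expansion (μ := μ) (X := X)
  obtain ⟨B, hB⟩ : ∃ B : ℝ, ∀ p : Fin d, ‖coordProj p‖ ≤ B :=
    ⟨∑ p : Fin d, ‖coordProj p‖, fun p =>
      Finset.single_le_sum (fun _ _ => norm_nonneg _) (Finset.mem_univ p)⟩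
  obtain ⟨K, hK, hm⟩ := h.exists_mf_pow_le B
  obtain ⟨M, hM, hb⟩ := h.exists_nb_moment_le B
  set r := 6 + 2 * a₀ with hr
  have hd : (0 : ℝ) ≤ d := by positivity
  have hP : 0 ≤ E * (d * (8 * K + 8 * M)) * c ^ 2 := by positivity
  refine ⟨1 + E * (d * (8 * K + 8 * M)) * c ^ 2, by linarith, fun n l hln hR => ?_⟩
  have hl := hR.one_le_len
  have hN := hR.one_le_num
  set N := n - l + 1 with hNdef
  set k : ℝ := ((n / l : ℕ) : ℝ) with hk
  have hk1 : 1 ≤ k := by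
    rw [hk]
    exact_mod_cast Nat.div_pos hln (by omega)
  have hl1 : (1 : ℝ) ≤ l := by exact_mod_cast hl
  have hN0 : (0 : ℝ) < N := by positivity
  have hL1 : 1 ≤ (l : ℝ) * k := one_le_mul_of_one_le_of_one_le hl1 hk1
  obtain ⟨hn1, hn2⟩ := le_two_mul_div hl hln
  rw [← hk] at hn1 hn2
  have hNn : (N : ℝ) ≤ 2 * (l * k) := by
    refine le_trans ?_ hn1
    exact_mod_cast (by omega : N ≤ n)
  have hnN : (l : ℝ) * k ≤ 2 * N := by
    refine hn2.trans ?_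
    have := hR.two_mul_le
    exact_mod_cast (by omega : n ≤ 2 * N)
  have g1 : ∀ p : Fin d, Growth X (2 * r) fun ω => mf N l (lin μ X (coordProj p)) ω ^ 8 :=
    fun p => ((h.growth_mf _).pow 8).mono (by omega)
  have g2 : ∀ p : Fin d, Growth X (2 * r) fun ω => mf N l (lin μ X (coordProj p)) ω ^ (2 * r) :=
    fun p => ((h.growth_mf _).pow (2 * r)).mono (by omega)
  have g3 : ∀ p : Fin d, Growth X (2 * r) fun ω => pwf μ X N l 8 (coordProj p) ω / (l : ℝ) ^ 4 /
      k ^ 4 := fun p => (((h.growth_pwf 8 _).div_const _).div_const _).mono (by omega)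
  have g4 : ∀ p : Fin d, Growth X (2 * r) fun ω => pwf μ X N l (2 * r) (coordProj p) ω /
      (l : ℝ) ^ r / k ^ r := fun p => (((h.growth_pwf (2 * r) _).div_const _).div_const _)
  have gs := fun p => (((g1 p).add (g2 p)).add (g3 p)).add (g4 p)
  have hG := (Growth.sum fun (p : Fin d) (_ : p ∈ Finset.univ) => gs p).const_mul
    (E * l ^ 2 * k ^ 2)
  have hmeas : Measurable fun ω => sigmaHat X H n l ω -
      (cq μ X N l (fderiv ℝ H (meanVec μ X)) (fderiv ℝ H (meanVec μ X)) ω +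
        lf μ X H N l ω + l * k⁻¹ * sf μ X H N l ω) :=
    (measurable_sigmaHat hD.1.continuous h.meas n l).sub
      (((h.growth_cq _ _).meas.add h.growth_lf.meas).add (h.growth_sf.meas.const_mul _))
  have hint := (hG.integrable h le_rfl).mono' (hmeas.pow_const 2).aestronglyMeasurable
    (ae_of_all _ fun ω => by
      rw [Real.norm_eq_abs, abs_of_nonneg (sq_nonneg _)]
      exact hexp n l hl hln ω)
  refine ⟨hmeas.aestronglyMeasurable, hint, by positivity, ?_⟩
  calc _ ≤ _ :=
      integral_mono hint (hG.integrable h le_rfl) fun ω => hexp n l hl hln ω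
    _ ≤ E * l ^ 2 * k ^ 2 * (d * ((2 * K) / (N : ℝ) ^ 4 + (2 * M) / (l * k) ^ 4)) := by
      rw [integral_const_mul, integral_finsetSum _ fun p _ => (gs p).integrable h le_rfl]
      gcongr
      refine (Finset.sum_le_card_nsmul _ _ ((2 * K) / (N : ℝ) ^ 4 + (2 * M) / (l * k) ^ 4)
        fun p _ => ?_).trans_eq
        (by rw [Finset.card_univ, Fintype.card_fin, nsmul_eq_mul])
      rw [integral_add ((((g1 p).add (g2 p)).add (g3 p)).integrable h le_rfl)
          ((g4 p).integrable h le_rfl),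
        integral_add (((g1 p).add (g2 p)).integrable h le_rfl) ((g3 p).integrable h le_rfl),
        integral_add ((g1 p).integrable h le_rfl) ((g2 p).integrable h le_rfl),
        integral_div, integral_div, integral_div, integral_div, div_div, div_div, ← mul_pow,
        ← mul_pow]
      have i1 := (hm _ (hB p) N l hl hN).1 4 (by omega) (by omega)
      have i2 := (hm _ (hB p) N l hl hN).2
      have i3 := h.integral_pwf_le (N := N) (l := l) (p := 8) (by omega) hN
        fun i => (hb _ (hB p) l hl i).1
      have i4 := h.integral_pwf_le (N := N) (l := l) (p := 2 * r) le_rfl hN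
        fun i => (hb _ (hB p) l hl i).2.2
      have i5 : (∫ ω, pwf μ X N l (2 * r) (coordProj p) ω ∂μ) / ((l : ℝ) * k) ^ r ≤
          M / (l * k) ^ 4 := by
        rw [div_le_div_iff₀ (by positivity) (by positivity)]
        calc _ ≤ M * l * (l * k) ^ 4 := by gcongr
          _ ≤ M * (l * k) * (l * k) ^ 4 := by
            gcongr
            exact le_mul_of_one_le_right (by positivity) hk1
          _ = M * (l * k) ^ 5 := by ring
          _ ≤ _ := mul_le_mul_of_nonneg_left (pow_le_pow_right₀ hL1 (by omega)) (by positivity)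
      have i6 : (∫ ω, pwf μ X N l 8 (coordProj p) ω ∂μ) / ((l : ℝ) * k) ^ 4 ≤ M / (l * k) ^ 4 := by
        gcongr
      rw [two_mul K, two_mul M, add_div, add_div]
      linarith
    _ = E * (d * (2 * K * ((l * k) ^ 2 / (N : ℝ) ^ 4) + 2 * M * (1 / (l * k) ^ 2))) := by
      field_simp
    _ ≤ E * (d * (2 * K * (4 / (N : ℝ) ^ 2) + 2 * M * (4 / (N : ℝ) ^ 2))) := by
      have j1 : ((l : ℝ) * k) ^ 2 / (N : ℝ) ^ 4 ≤ 4 / (N : ℝ) ^ 2 := by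
        rw [div_le_div_iff₀ (by positivity) (by positivity)]
        calc _ ≤ (2 * (N : ℝ)) ^ 2 * (N : ℝ) ^ 2 := by gcongr
          _ = _ := by ring
      have j2 : 1 / ((l : ℝ) * k) ^ 2 ≤ 4 / (N : ℝ) ^ 2 := by
        rw [div_le_div_iff₀ (by positivity) (by positivity), one_mul]
        calc _ ≤ (2 * ((l : ℝ) * k)) ^ 2 := by gcongr
          _ = _ := by ring
      gcongr
    _ = E * (d * (8 * K + 8 * M)) * ((l : ℝ) ^ 0 / (N : ℝ) ^ 2) := by
      rw [pow_zero]
      ring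
    _ ≤ E * (d * (8 * K + 8 * M)) * c ^ 2 / (l : ℝ) ^ 6 :=
      hR.le_div (by positivity) (by norm_num) le_rfl
    _ ≤ (1 + E * (d * (8 * K + 8 * M)) * c ^ 2) ^ 2 / (l : ℝ) ^ 6 := by
      gcongr
      nlinarith
    _ = _ := by
      rw [div_pow, ← pow_mul, mul_comm 6 2, pow_mul √(l : ℝ), Real.sq_sqrt (by positivity)]

end Remainder

section CenteredSizes

variable {μ : Measure Ω} {X : ℤ → Ω → Fin d → ℝ} {H : (Fin d → ℝ) → ℝ} {r : ℕ} {q C B D c : ℝ}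
  {N l n : ℕ}

namespace Sizes

variable {φ ψ χ : LinForm d}

lemma len_mul (hS : Sizes μ X D B N l) (hR : Regime c N l) (hφ : ‖φ‖ ≤ B) (hψ : ‖ψ‖ ≤ B) :
    L2Le μ (fun ω => l * (BlockLength.mf N l (lin μ X φ) ω * BlockLength.mf N l (lin μ X ψ) ω))
      (D / √(l : ℝ) ^ 4) := by
  refine ((hS.mf_mul φ ψ hφ hψ).const_mul l).mono (le_of_eq ?_)
  have h1 := hR.one_le_sqrt
  have h0 : √(l : ℝ) ≠ 0 := by positivity
  have h2 : |(l : ℝ)| = √(l : ℝ) ^ 2 := by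
    rw [Real.sq_sqrt (by positivity), abs_of_nonneg (by positivity)]
  rw [h2]
  field_simp

lemma cq_sub (hS : Sizes μ X D B N l) (hR : Regime c N l) (hφ : ‖φ‖ ≤ B) (hψ : ‖ψ‖ ≤ B) :
    L2Le μ (fun ω => cq μ X N l φ ψ ω - ∑' a, ccov μ X φ ψ a) (2 * D / √(l : ℝ) ^ 2) := by
  have hD : 0 ≤ D := zero_le_one.trans hS.one_le
  have h1 := ((hS.qf φ ψ hφ hψ).sub (hS.len_mul hR hφ hψ)).mono
    (add_le_add_right (hR.div_sqrt_pow_le hD le_rfl (by norm_num : 2 ≤ 4)) _)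
  rw [← add_div, ← two_mul] at h1
  refine (funext fun ω => ?_ : (fun ω => cq μ X N l φ ψ ω - ∑' a, ccov μ X φ ψ a) = _) ▸ h1
  rw [cq]
  ring

lemma mf_mul_cq (hS : Sizes μ X D B N l) (hR : Regime c N l) (hχ : ‖χ‖ ≤ B) (hφ : ‖φ‖ ≤ B)
    (hψ : ‖ψ‖ ≤ B) :
    L2Le μ (fun ω => BlockLength.mf N l (lin μ X χ) ω *
      (cq μ X N l φ ψ ω - ∑' a, ccov μ X φ ψ a)) (2 * D / √(l : ℝ) ^ 4) := by
  have hD : 0 ≤ D := zero_le_one.trans hS.one_le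
  have h0 := hR.one_le_sqrt
  have hne : √(l : ℝ) ≠ 0 := by positivity
  have h2 : |(l : ℝ)| = √(l : ℝ) ^ 2 := by
    rw [Real.sq_sqrt (by positivity), abs_of_nonneg (by positivity)]
  have h1 := ((hS.mf_mul_qf χ φ ψ hχ hφ hψ).sub
    ((hS.mf_mul_mul χ φ ψ hχ hφ hψ).const_mul l)).mono (t := 2 * D / √(l : ℝ) ^ 4) (by
      have h3 : |(l : ℝ)| * (D / √(l : ℝ) ^ 9) ≤ D / √(l : ℝ) ^ 4 := by
        calc _ = D / √(l : ℝ) ^ 7 := by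
              rw [h2]
              field_simp
          _ ≤ _ := hR.div_sqrt_pow_le hD le_rfl (by norm_num)
      rw [two_mul, add_div]
      linarith)
  refine (funext fun ω => ?_ : (fun ω => BlockLength.mf N l (lin μ X χ) ω *
      (cq μ X N l φ ψ ω - ∑' a, ccov μ X φ ψ a)) = _) ▸ h1
  rw [cq]
  ring

lemma inv_len_mul (hS : Sizes μ X D B N l) (hR : Regime c N l) (hχ : ‖χ‖ ≤ B) (hφ : ‖φ‖ ≤ B)
    (hψ : ‖ψ‖ ≤ B) :
    L2Le μ (fun ω => (l : ℝ)⁻¹ * (BlockLength.mf N l (lin μ X χ) ω *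
      BlockLength.qf N l (lin μ X φ) (lin μ X ψ) ω)) ((D + D ^ 2) / √(l : ℝ) ^ 4) := by
  have hD1 := hS.one_le
  have hD : 0 ≤ D := zero_le_one.trans hD1
  have h0 := hR.one_le_sqrt
  have hne : √(l : ℝ) ≠ 0 := by positivity
  have h2 : |(l : ℝ)⁻¹| = (√(l : ℝ) ^ 2)⁻¹ := by
    rw [Real.sq_sqrt (by positivity), abs_of_nonneg (by positivity)]
  have h1 := (((hS.mf_mul_qf χ φ ψ hχ hφ hψ).add ((hS.mf χ hχ).const_mul
    (∑' a, ccov μ X φ ψ a))).const_mul (l : ℝ)⁻¹).mono (t := (D + D ^ 2) / √(l : ℝ) ^ 4) (by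
      have h3 := hR.div_sqrt_pow_le hD le_rfl (by norm_num : 2 ≤ 4)
      have h4 := hR.div_sqrt_pow_le hD le_rfl (by norm_num : 2 ≤ 3)
      have h5 : |∑' a, ccov μ X φ ψ a| * (D / √(l : ℝ) ^ 3) ≤ D * (D / √(l : ℝ) ^ 2) :=
        mul_le_mul (hS.tsum_le φ ψ hφ hψ) h4 (by positivity) hD
      rw [h2]
      calc _ ≤ (√(l : ℝ) ^ 2)⁻¹ * (D / √(l : ℝ) ^ 2 + D * (D / √(l : ℝ) ^ 2)) := by gcongr
        _ = _ := by field_simp)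
  refine (funext fun ω => ?_ : (fun ω => (l : ℝ)⁻¹ * (BlockLength.mf N l (lin μ X χ) ω *
      BlockLength.qf N l (lin μ X φ) (lin μ X ψ) ω)) = _) ▸ h1
  ring

end Sizes

variable [IsProbabilityMeasure μ]

lemma Regular.exists_ctf_size (h : Regular μ X r q C) (B : ℝ) (hc : 1 ≤ c) :
    ∃ D : ℝ, 1 ≤ D ∧ ∀ N l, Regime c N l → ∀ φ ψ χ : LinForm d, ‖φ‖ ≤ B → ‖ψ‖ ≤ B →
      ‖χ‖ ≤ B → L2Le μ (ctf μ X N l φ ψ χ) (D / √(l : ℝ) ^ 4) := by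
  obtain ⟨D, hS⟩ := h.exists_sizes B hc
  obtain ⟨K, hK, ht⟩ := h.exists_tf_sq_le B
  have hr := h.six_le
  have hKc : 1 ≤ K * (c + 1) := one_le_mul_of_one_le_of_one_le hK (by linarith)
  refine ⟨K * (c + 1) + 3 * (|D| + D ^ 2) + 2 * |D|, ?_, fun N l hR φ ψ χ hφ hψ hχ => ?_⟩
  · have := abs_nonneg D
    nlinarith [sq_nonneg D]
  have hs := hS N l hR
  have hl := hR.one_le_len
  have hD : 0 ≤ D := zero_le_one.trans hs.one_le
  rw [abs_of_nonneg hD]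
  have h0 := hR.one_le_sqrt
  have hne : √(l : ℝ) ≠ 0 := by positivity
  have t1 : L2Le μ (tf μ X N l φ ψ χ) (K * (c + 1) / √(l : ℝ) ^ 1) := by
    refine L2Le.of_growth_le (h.growth_tf φ ψ χ) h (by omega) hKc
      ((ht φ ψ χ hφ hψ hχ N l hl hR.one_le_num).trans ?_)
    have h1 := hR.div_le (i := 1) (j := 1) (k := 2) (by norm_num)
    simp only [pow_one] at h1 ⊢
    rw [mul_div_assoc]
    gcongr
    calc (l : ℝ) / N + 1 / l ≤ c / (l : ℝ) ^ 2 + 1 / l := by gcongr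
      _ ≤ c / (l : ℝ) + 1 / l := by
        gcongr
        exact le_self_pow₀ (by exact_mod_cast hl) (by norm_num)
      _ = _ := by rw [add_div]
  have t2 := t1.const_mul (((√(l : ℝ))⁻¹) ^ 3)
  have t3 := (((t2.sub (hs.inv_len_mul hR hφ hψ hχ)).sub (hs.inv_len_mul hR hψ hφ hχ)).sub
    (hs.inv_len_mul hR hχ hφ hψ)).add ((hs.mf_mul_mul φ ψ χ hφ hψ hχ).const_mul 2)
  refine t3.mono ?_
  have e1 : |((√(l : ℝ))⁻¹) ^ 3| * (K * (c + 1) / √(l : ℝ) ^ 1) = K * (c + 1) / √(l : ℝ) ^ 4 := by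
    rw [abs_of_nonneg (by positivity)]
    field_simp
  have e2 := hR.div_sqrt_pow_le hD le_rfl (by norm_num : 4 ≤ 9)
  rw [e1, abs_of_nonneg (by norm_num : (0 : ℝ) ≤ 2)]
  calc _ ≤ K * (c + 1) / √(l : ℝ) ^ 4 + (D + D ^ 2) / √(l : ℝ) ^ 4 +
        (D + D ^ 2) / √(l : ℝ) ^ 4 + (D + D ^ 2) / √(l : ℝ) ^ 4 + 2 * (D / √(l : ℝ) ^ 4) := by gcongr
    _ = _ := by ring

theorem CondD.exists_remainder_size {a₀ : ℕ} (hD : CondD H a₀)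
    (h : Regular μ X (6 + 2 * a₀) q C) (hc : 1 ≤ c) :
    ∃ D : ℝ, 1 ≤ D ∧ ∀ n l, l ≤ n → Regime c (n - l + 1) l → L2Le μ (fun ω => sigmaHat X H n l ω -
      (cq μ X (n - l + 1) l (fderiv ℝ H (meanVec μ X)) (fderiv ℝ H (meanVec μ X)) ω +
        lf μ X H (n - l + 1) l ω)) (D / √(l : ℝ) ^ 6) := by
  obtain ⟨B, hB⟩ : ∃ B : ℝ, ∀ p : Fin d, ‖coordProj p‖ ≤ B ∧ ‖hessRow H (meanVec μ X) p‖ ≤ B ∧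
      ‖fderiv ℝ H (meanVec μ X)‖ ≤ B := by
    have h1 := fun p : Fin d => Finset.single_le_sum (fun (p : Fin d) _ => norm_nonneg (coordProj p))
      (Finset.mem_univ p)
    have h2 := fun p => Finset.single_le_sum
      (fun (p : Fin d) _ => norm_nonneg (hessRow H (meanVec μ X) p)) (Finset.mem_univ p)
    refine ⟨∑ p : Fin d, ‖coordProj p‖ + ∑ p, ‖hessRow H (meanVec μ X) p‖ +
      ‖fderiv ℝ H (meanVec μ X)‖, fun p => ?_⟩
    have h3 := norm_nonneg (fderiv ℝ H (meanVec μ X))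
    have h4 := h1 p
    have h5 := h2 p
    have h6 := norm_nonneg (coordProj p)
    have h7 := norm_nonneg (hessRow H (meanVec μ X) p)
    exact ⟨by linarith, by linarith, by linarith⟩
  obtain ⟨D, hD1, hE⟩ := hD.exists_sigmaHat_size h hc
  obtain ⟨E, hE1, hs⟩ := h.exists_ctf_size B hc
  have hd : (0 : ℝ) ≤ d := by positivity
  have hp : 0 ≤ 2 * c * (d * E) := by positivity
  refine ⟨D + 2 * c * (d * E), by linarith, fun n l hln hR => ?_⟩
  have h1 : L2Le μ (sf μ X H (n - l + 1) l) (d * (E / √(l : ℝ) ^ 4)) := by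
    have := L2Le.sum (S := (Finset.univ : Finset (Fin d))) fun p _ =>
      hs _ _ hR (fderiv ℝ H (meanVec μ X)) (coordProj p) (hessRow H (meanVec μ X) p)
        (hB p).2.2 (hB p).1 (hB p).2.1
    rw [Finset.card_univ, Fintype.card_fin] at this
    exact this
  have h2 := (hE n l hln hR).add (h1.const_mul (l * ((n / l : ℕ) : ℝ)⁻¹))
  have hl := hR.one_le_len
  have hk : 1 ≤ n / l := Nat.div_pos hln (by omega)
  have h3 : (l : ℝ) * ((n / l : ℕ) : ℝ)⁻¹ ≤ 2 * c / √(l : ℝ) ^ 2 := by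
    have hn1 := (le_two_mul_div hl hln).1
    have h4 := hR.cube_le
    have h5 : ((n - l + 1 : ℕ) : ℝ) ≤ n := by exact_mod_cast (by omega : n - l + 1 ≤ n)
    have h0 : (0 : ℝ) < l := by positivity
    rw [Real.sq_sqrt (by positivity), ← div_eq_mul_inv, div_le_div_iff₀ (by positivity) h0]
    have h6 : c * ((n - l + 1 : ℕ) : ℝ) ≤ c * (2 * (l * ((n / l : ℕ) : ℝ))) :=
      mul_le_mul_of_nonneg_left (h5.trans hn1) (by linarith)
    refine le_of_mul_le_mul_left ?_ h0
    calc _ = (l : ℝ) ^ 3 := by ring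
      _ ≤ _ := h4.trans h6
      _ = _ := by ring
  have h5 := h2.mono (t := (D + 2 * c * (d * E)) / √(l : ℝ) ^ 6) (by
    rw [abs_of_nonneg (by positivity : 0 ≤ (l : ℝ) * ((n / l : ℕ) : ℝ)⁻¹), add_div]
    have h0 : √(l : ℝ) ≠ 0 := by positivity
    calc _ ≤ D / √(l : ℝ) ^ 6 + 2 * c / √(l : ℝ) ^ 2 * (d * (E / √(l : ℝ) ^ 4)) := by gcongr
      _ = _ := by field_simp)
  refine (funext fun ω => ?_ : (fun ω => sigmaHat X H n l ω -
      (cq μ X (n - l + 1) l (fderiv ℝ H (meanVec μ X)) (fderiv ℝ H (meanVec μ X)) ω +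
        lf μ X H (n - l + 1) l ω)) = _) ▸ h5
  ring

end CenteredSizes

section RegimeOrder

/-- `F N l` is of order `l ^ (-k)` in the regime `l ^ 3 ≤ c * N`. -/
def RegO (c : ℝ) (k : ℕ) (F : ℕ → ℕ → ℝ) : Prop :=
  ∃ D : ℝ, 0 ≤ D ∧ ∀ N l, Regime c N l → |F N l| ≤ D / (l : ℝ) ^ k

namespace RegO

variable {c : ℝ} {j k : ℕ} {F G : ℕ → ℕ → ℝ}

lemma mono (h : RegO c k F) (hjk : j ≤ k) : RegO c j F := by
  obtain ⟨D, hD, h⟩ := h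
  refine ⟨D, hD, fun N l hR => (h N l hR).trans ?_⟩
  have h1 : (1 : ℝ) ≤ l := by exact_mod_cast hR.one_le_len
  have := pow_le_pow_right₀ h1 hjk
  gcongr

lemma add (hF : RegO c k F) (hG : RegO c k G) : RegO c k fun N l => F N l + G N l := by
  obtain ⟨D, hD, hF⟩ := hF
  obtain ⟨E, hE, hG⟩ := hG
  refine ⟨D + E, by positivity, fun N l hR => ?_⟩
  rw [add_div]
  exact (abs_add_le _ _).trans (add_le_add (hF N l hR) (hG N l hR))

lemma mul (hF : RegO c j F) (hG : RegO c k G) : RegO c (j + k) fun N l => F N l * G N l := by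
  obtain ⟨D, hD, hF⟩ := hF
  obtain ⟨E, hE, hG⟩ := hG
  refine ⟨D * E, by positivity, fun N l hR => ?_⟩
  rw [abs_mul, pow_add, ← div_mul_div_comm]
  exact mul_le_mul (hF N l hR) (hG N l hR) (abs_nonneg _) (by positivity)

lemma const_mul (hF : RegO c k F) (a : ℝ) : RegO c k fun N l => a * F N l := by
  obtain ⟨D, hD, hF⟩ := hF
  refine ⟨|a| * D, by positivity, fun N l hR => ?_⟩
  rw [abs_mul, mul_div_assoc]
  exact mul_le_mul_of_nonneg_left (hF N l hR) (abs_nonneg a)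

lemma sub (hF : RegO c k F) (hG : RegO c k G) : RegO c k fun N l => F N l - G N l := by
  simpa [sub_eq_add_neg] using hF.add (hG.const_mul (-1))

lemma len_mul (hF : RegO c (k + 1) F) : RegO c k fun N l => l * F N l := by
  obtain ⟨D, hD, hF⟩ := hF
  refine ⟨D, hD, fun N l hR => ?_⟩
  have hl : (0 : ℝ) < l := by exact_mod_cast hR.one_le_len
  rw [abs_mul, abs_of_pos hl]
  calc _ ≤ l * (D / (l : ℝ) ^ (k + 1)) := mul_le_mul_of_nonneg_left (hF N l hR) hl.le
    _ = _ := by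
      field_simp
      ring

lemma sum {ι : Type*} {S : Finset ι} {F : ι → ℕ → ℕ → ℝ} (h : ∀ i ∈ S, RegO c k (F i)) :
    RegO c k fun N l => ∑ i ∈ S, F i N l := by
  induction S using Finset.induction_on with
  | empty => exact ⟨0, le_rfl, fun N l _ => by simp⟩
  | insert a S ha ih =>
    simp only [Finset.sum_insert ha]
    exact (h a (Finset.mem_insert_self _ _)).add (ih fun i hi => h i (Finset.mem_insert_of_mem hi))

lemma congr (hF : RegO c k F) (h : ∀ N l, Regime c N l → G N l = F N l) : RegO c k G := by
  obtain ⟨D, hD, hF⟩ := hF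
  exact ⟨D, hD, fun N l hR => h N l hR ▸ hF N l hR⟩

lemma of_le {K : ℝ} (hK : 0 ≤ K) {i j : ℕ} (hc : 1 ≤ c) (hk : i + k = 3 * j)
    (h : ∀ N l, Regime c N l → |F N l| ≤ K * ((l : ℝ) ^ i / (N : ℝ) ^ j)) : RegO c k F :=
  ⟨K * c ^ j, by positivity, fun N l hR => hR.le_div hK hk (h N l hR)⟩

lemma of_inv_le {K : ℝ} (hK : 0 ≤ K) (h : ∀ N l, Regime c N l → |F N l| ≤ K / (l : ℝ) ^ k) :
    RegO c k F := ⟨K, hK, h⟩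

lemma of_error {K : ℝ} (hK : 0 ≤ K) (hc : 1 ≤ c) (h : ∀ N l, Regime c N l →
    |F N l| ≤ K * (1 / (N * l) + (l : ℝ) ^ 2 / (N : ℝ) ^ 2)) : RegO c 4 F := by
  refine ⟨K * (c + c ^ 2), by positivity, fun N l hR => (h N l hR).trans ?_⟩
  have h1 := hR.div_le (i := 0) (j := 1) (k := 3) (by norm_num)
  have h2 := hR.div_le (i := 2) (j := 2) (k := 4) (by norm_num)
  simp only [pow_zero, pow_one] at h1
  have h3 : 1 / ((N : ℝ) * l) ≤ c / (l : ℝ) ^ 4 := by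
    rw [← div_div, pow_succ (l : ℝ) 3, ← div_div]
    gcongr
  rw [mul_div_assoc, add_div]
  gcongr

lemma of_integral_mul {Ω : Type*} [MeasurableSpace Ω] {μ : Measure Ω} {f g : ℕ → ℕ → Ω → ℝ}
    {D E : ℝ} (hD : 0 ≤ D) (hE : 0 ≤ E) {i j : ℕ} (hk : i + j = 2 * k)
    (hf : ∀ N l, Regime c N l → L2Le μ (f N l) (D / √(l : ℝ) ^ i))
    (hg : ∀ N l, Regime c N l → L2Le μ (g N l) (E / √(l : ℝ) ^ j)) :
    RegO c k fun N l => ∫ ω, f N l ω * g N l ω ∂μ := by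
  refine ⟨D * E, by positivity, fun N l hR =>
    ((hf N l hR).abs_integral_mul_le (hg N l hR)).trans_eq ?_⟩
  rw [div_mul_div_comm, ← pow_add, hk, pow_mul, Real.sq_sqrt (by positivity)]

end RegO

end RegimeOrder

section KeyIntegrals

variable {μ : Measure Ω} {X : ℤ → Ω → Fin d → ℝ} {r : ℕ} {q C c : ℝ}
variable {φ ψ φ' ψ' χ τ : LinForm d}

lemma integral_eq_sum_mul {k : ℕ} {g : Ω → ℝ} (a : Fin k → ℝ) (f : Fin k → Ω → ℝ)
    (hf : ∀ i, Integrable (f i) μ) (h : ∀ ω, g ω = ∑ i, a i * f i ω) :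
    ∫ ω, g ω ∂μ = ∑ i, a i * ∫ ω, f i ω ∂μ := by
  simp only [h]
  rw [integral_finsetSum _ fun (i : Fin k) _ => (hf i).const_mul (a i)]
  simp only [integral_const_mul]

variable [IsProbabilityMeasure μ]

lemma Growth.integral_cross {Q Q' m M M' : Ω → ℝ} (h : Regular μ X r q C) (hQ : Growth X 2 Q)
    (hQ' : Growth X 2 Q') (hm : Growth X 1 m) (hM : Growth X 2 M) (hM' : Growth X 2 M')
    (h0 : ∫ ω, m ω ∂μ = 0) (s s' : ℝ) :
    ∫ ω, (Q ω - M ω - s) * (m ω * (Q' ω - M' ω - s')) ∂μ =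
      ∫ ω, (Q ω - ∫ ω', Q ω' ∂μ) * (Q' ω - ∫ ω', Q' ω' ∂μ) * m ω ∂μ +
        (∫ ω, Q ω ∂μ - s) * ∫ ω, Q' ω * m ω ∂μ + (∫ ω, Q' ω ∂μ - s') * ∫ ω, Q ω * m ω ∂μ -
        ∫ ω, m ω * (Q ω - s) * M' ω ∂μ - ∫ ω, M ω * (m ω * (Q' ω - M' ω - s')) ∂μ := by
  have hr := h.six_le
  have c2 : ∀ a, Growth X 2 (fun _ => a) := Growth.const 2
  rw [integral_eq_sum_mul ![1, ∫ ω, Q ω ∂μ - s, ∫ ω, Q' ω ∂μ - s',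
    s * s' - (∫ ω, Q ω ∂μ) * ∫ ω, Q' ω ∂μ, -1, -1]
    ![fun ω => (Q ω - ∫ ω', Q ω' ∂μ) * (Q' ω - ∫ ω', Q' ω' ∂μ) * m ω, fun ω => Q' ω * m ω,
      fun ω => Q ω * m ω, m, fun ω => m ω * (Q ω - s) * M' ω,
      fun ω => M ω * (m ω * (Q' ω - M' ω - s'))]]
  · simp only [Fin.sum_univ_six, Matrix.cons_val]
    rw [h0]
    ring
  · intro i
    fin_cases i
    exacts [(((hQ.sub (c2 _)).mul (hQ'.sub (c2 _))).mul hm).integrable h (by omega),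
      (hQ'.mul hm).integrable h (by omega), (hQ.mul hm).integrable h (by omega),
      hm.integrable h (by omega), ((hm.mul (hQ.sub (c2 _))).mul hM').integrable h (by omega),
      (hM.mul (hm.mul ((hQ'.sub hM').sub (c2 _)))).integrable h (by omega)]
  · intro ω
    simp only [Fin.sum_univ_six, Matrix.cons_val]
    ring

lemma Growth.integral_sub_sub_sq {Q M : Ω → ℝ} (h : Regular μ X r q C) (hQ : Growth X 2 Q)
    (hM : Growth X 2 M) (a s : ℝ) : ∫ ω, (Q ω - a * M ω - s) ^ 2 ∂μ =
      (∫ ω, Q ω ^ 2 ∂μ - (∫ ω, Q ω ∂μ) ^ 2) + (∫ ω, Q ω ∂μ - s) ^ 2 -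
        2 * (a * (∫ ω, Q ω * M ω ∂μ - (∫ ω, Q ω ∂μ) * ∫ ω, M ω ∂μ)) -
        2 * (a * ((∫ ω, Q ω ∂μ - s) * ∫ ω, M ω ∂μ)) + a * (a * ∫ ω, M ω ^ 2 ∂μ) := by
  have hr := h.six_le
  rw [integral_eq_sum_mul ![1, -2 * s, s ^ 2, -2 * a, 2 * a * s, a ^ 2]
    ![fun ω => Q ω ^ 2, Q, fun _ => 1, fun ω => Q ω * M ω, M, fun ω => M ω ^ 2]]
  · simp only [Fin.sum_univ_six, Matrix.cons_val, integral_const, probReal_univ, smul_eq_mul]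
    ring
  · intro i
    fin_cases i
    exacts [(hQ.pow 2).integrable h (by omega), hQ.integrable h (by omega), integrable_const _,
      (hQ.mul hM).integrable h (by omega), hM.integrable h (by omega),
      (hM.pow 2).integrable h (by omega)]
  · intro ω
    simp only [Fin.sum_univ_six, Matrix.cons_val]
    ring

lemma Growth.integral_sub_sub_mul {Q M m : Ω → ℝ} (h : Regular μ X r q C) (hQ : Growth X 2 Q)
    (hM : Growth X 2 M) (hm : Growth X 1 m) (h0 : ∫ ω, m ω ∂μ = 0) (a s : ℝ) :
    ∫ ω, (Q ω - a * M ω - s) * m ω ∂μ = ∫ ω, Q ω * m ω ∂μ - a * ∫ ω, M ω * m ω ∂μ := by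
  have hr := h.six_le
  rw [integral_eq_sum_mul ![1, -a, -s] ![fun ω => Q ω * m ω, fun ω => M ω * m ω, m]]
  · simp only [Fin.sum_univ_three, Matrix.cons_val, h0]
    ring
  · intro i
    fin_cases i
    exacts [(hQ.mul hm).integrable h (by omega), (hM.mul hm).integrable h (by omega),
      hm.integrable h (by omega)]
  · intro ω
    simp only [Fin.sum_univ_three, Matrix.cons_val]
    ring

namespace Regular

lemma regO_integral_qf_sub (h : Regular μ X r q C) : RegO c 1 fun N l =>
    ∫ ω, qf N l (lin μ X φ) (lin μ X ψ) ω ∂μ - ∑' a, ccov μ X φ ψ a := by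
  obtain ⟨K, hK, h2, -, -⟩ := h.exists_decay (max ‖φ‖ ‖ψ‖)
  have h2 := h2 φ ψ (le_max_left _ _) (le_max_right _ _)
  refine RegO.of_inv_le (K := 3 * (K * decSum)) (by have := h2.mul_decSum_nonneg; positivity)
    fun N l hR => ?_
  rw [pow_one]
  exact h.abs_integral_qf_sub_tsum_le h2 hR.one_le_len hR.one_le_num

lemma regO_integral_qf_mul_mf (h : Regular μ X r q C) (hc : 1 ≤ c) : RegO c 3 fun N l =>
    ∫ ω, qf N l (lin μ X φ) (lin μ X ψ) ω * mf N l (lin μ X χ) ω ∂μ := by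
  obtain ⟨K, hK, -, h3, -⟩ := h.exists_decay (max (max ‖φ‖ ‖ψ‖) ‖χ‖)
  have h3 := h3 φ ψ χ (by simp) (by simp) (by simp)
  have hs := decSum_ge_one
  refine RegO.of_le (K := 2 * (K * decSum ^ 2)) (by positivity) hc (i := 0) (j := 1) (by norm_num)
    fun N l hR => ?_
  have := h.abs_integral_qf_mul_mf_le (by positivity) h3 hR.one_le_len
    (by have := hR.two_mul_le; omega : l ≤ N)
  simpa [div_eq_mul_inv] using this

lemma exists_nonneg_sizes (h : Regular μ X r q C) (B : ℝ) (hc : 1 ≤ c) :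
    ∃ D : ℝ, 0 ≤ D ∧ ∀ N l, Regime c N l → Sizes μ X D B N l := by
  obtain ⟨D, hS⟩ := h.exists_sizes B hc
  have hR : Regime c 2 1 := ⟨hc, le_rfl, le_rfl, by norm_num; linarith⟩
  exact ⟨D, zero_le_one.trans (hS 2 1 hR).one_le, hS⟩

lemma regO_integral_cq_mul_mf_mul_cq (h : Regular μ X r q C) (hc : 1 ≤ c) :
    RegO c 4 fun N l => ∫ ω, (cq μ X N l φ ψ ω - ∑' a, ccov μ X φ ψ a) *
      (mf N l (lin μ X χ) ω * (cq μ X N l φ' ψ' ω - ∑' a, ccov μ X φ' ψ' a)) ∂μ := by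
  obtain ⟨B, hφ, hψ, hφ', hψ', hχ⟩ :
      ∃ B, ‖φ‖ ≤ B ∧ ‖ψ‖ ≤ B ∧ ‖φ'‖ ≤ B ∧ ‖ψ'‖ ≤ B ∧ ‖χ‖ ≤ B :=
    ⟨max (max (max ‖φ‖ ‖ψ‖) (max ‖φ'‖ ‖ψ'‖)) ‖χ‖, by simp, by simp, by simp, by simp, by simp⟩
  obtain ⟨D, hD, hS⟩ := h.exists_nonneg_sizes B hc
  obtain ⟨K, hK, hq⟩ := h.exists_qf_qf_mf_le B
  have h1 : RegO c 4 fun N l =>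
      ∫ ω, (qf N l (lin μ X φ) (lin μ X ψ) ω - ∫ ω', qf N l (lin μ X φ) (lin μ X ψ) ω' ∂μ) *
        (qf N l (lin μ X φ') (lin μ X ψ') ω - ∫ ω', qf N l (lin μ X φ') (lin μ X ψ') ω' ∂μ) *
        mf N l (lin μ X χ) ω ∂μ :=
    RegO.of_le (by positivity) hc (i := 2) (j := 2) (by norm_num) fun N l hR =>
      hq φ ψ φ' ψ' χ hφ hψ hφ' hψ' hχ N l hR.one_le_len hR.one_le_num
  have h2 := (h.regO_integral_qf_sub (φ := φ) (ψ := ψ) (c := c)).mul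
    (h.regO_integral_qf_mul_mf (φ := φ') (ψ := ψ') (χ := χ) hc)
  have h3 := (h.regO_integral_qf_sub (φ := φ') (ψ := ψ') (c := c)).mul
    (h.regO_integral_qf_mul_mf (φ := φ) (ψ := ψ) (χ := χ) hc)
  have h4 := RegO.of_integral_mul (k := 4) hD hD (by norm_num)
    (fun N l hR => (hS N l hR).mf_mul_qf χ φ ψ hχ hφ hψ)
    (fun N l hR => (hS N l hR).len_mul hR hφ' hψ')
  have h5 := RegO.of_integral_mul (k := 4) hD (by positivity : 0 ≤ 2 * D) (by norm_num)
    (fun N l hR => (hS N l hR).len_mul hR hφ hψ)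
    (fun N l hR => (hS N l hR).mf_mul_cq hR hχ hφ' hψ')
  exact ((((h1.add h2).add h3).sub h4).sub h5).congr fun N l hR =>
    Growth.integral_cross h (h.growth_qf φ ψ) (h.growth_qf φ' ψ') (h.growth_mf χ)
      (((h.growth_mf φ).mul (h.growth_mf ψ)).const_mul l)
      (((h.growth_mf φ').mul (h.growth_mf ψ')).const_mul l) (h.integral_mf χ) _ _

end Regular

/-- The part of the mean squared error that does not depend on the block length. -/
def pooled (μ : Measure Ω) (X : ℤ → Ω → Fin d → ℝ) (φ τ : LinForm d) (S : Finset ℤ)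
    (w : ℝ) : ℝ :=
  ∑ a ∈ S, ∑ b ∈ S, ∑ c ∈ S, ∑ e ∈ S, w ^ 2 * cum4 μ (lin μ X φ) a b c e +
    2 * ((∑' a : ℤ, |(a : ℝ)| * ccov μ X φ φ a) *
      ∑ a ∈ S, ∑ b ∈ S, w ^ 2 * ccov μ X φ φ (b - a)) +
    2 * ∑ a ∈ S, ∑ b ∈ S, ∑ c ∈ S, w ^ 2 * mom3 μ X φ φ τ a b c +
    ∑ a ∈ S, ∑ b ∈ S, w ^ 2 * ccov μ X τ τ (b - a)

namespace Regular

lemma regO_integral_mf_sq_sub (h : Regular μ X r q C) (hc : 1 ≤ c) (φ : LinForm d) :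
    RegO c 5 fun N l => ∫ ω, mf N l (lin μ X φ) ω ^ 2 ∂μ -
      ∑ a ∈ dat N l, ∑ b ∈ dat N l, (1 / ((N + l - 1 : ℕ) : ℝ)) ^ 2 * ccov μ X φ φ (b - a) := by
  obtain ⟨K, hK, h2, -, -⟩ := h.exists_decay ‖φ‖
  have h2 := h2 φ φ le_rfl le_rfl
  refine RegO.of_le (K := 4 * (K * decSum)) (by have := h2.mul_decSum_nonneg; positivity) hc
    (i := 1) (j := 2) (by norm_num) fun N l hR => ?_
  simp only [pow_two (mf N l (lin μ X φ) _), h.integral_mf_mul, pow_one]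
  exact h2.abs_wgt_sum_sub_le hR.one_le_len (by have := hR.two_mul_le; omega)

lemma regO_integral_mf_pow (h : Regular μ X r q C) (hc : 1 ≤ c) (φ : LinForm d) {j : ℕ}
    (hj : 1 ≤ j) (hj' : j ≤ 4) :
    RegO c (3 * j) fun N l => ∫ ω, mf N l (lin μ X φ) ω ^ (2 * j) ∂μ := by
  obtain ⟨D, hD, hm⟩ := h.exists_mf_size ‖φ‖ hc
  refine RegO.of_inv_le (K := D) (by positivity) fun N l hR => ?_
  rw [abs_of_nonneg (integral_nonneg fun ω => (even_two_mul j).pow_nonneg _)]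
  exact hm N l hR φ le_rfl j hj hj'

lemma regO_leading (h : Regular μ X r q C) (hc : 1 ≤ c) (φ τ : LinForm d) :
    RegO c 4 fun N l =>
      ∫ ω, (cq μ X N l φ φ ω - ∑' a, ccov μ X φ φ a) ^ 2 ∂μ +
        2 * ∫ ω, (cq μ X N l φ φ ω - ∑' a, ccov μ X φ φ a) * mf N l (lin μ X τ) ω ∂μ +
        ∫ ω, mf N l (lin μ X τ) ω ^ 2 ∂μ -
      ((∑' a : ℤ, |(a : ℝ)| * ccov μ X φ φ a) ^ 2 / (l : ℝ) ^ 2 +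
        4 / 3 * (∑' a, ccov μ X φ φ a) ^ 2 * l / ((N + l - 1 : ℕ) : ℝ) +
        pooled μ X φ τ (dat N l) (1 / ((N + l - 1 : ℕ) : ℝ))) := by
  obtain ⟨K, hK, h2, h3, h4⟩ := h.exists_decay (max ‖φ‖ ‖τ‖)
  have h2 := h2 φ φ (le_max_left _ _) (le_max_left _ _)
  have h3 := h3 φ φ τ (le_max_left _ _) (le_max_left _ _) (le_max_right _ _)
  have h4 := h4 φ (le_max_left _ _)
  have hs := decSum_ge_one
  have hle : ∀ {N l}, Regime c N l → l ≤ N := fun hR => by have := hR.two_mul_le; omega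
  set s := ∑' a, ccov μ X φ φ a
  set b := ∑' a : ℤ, |(a : ℝ)| * ccov μ X φ φ a with hb_def
  have t1 : RegO c 4 fun N l => ∫ ω, qf N l (lin μ X φ) (lin μ X φ) ω ^ 2 ∂μ -
      (∫ ω, qf N l (lin μ X φ) (lin μ X φ) ω ∂μ) ^ 2 - (4 / 3 * s ^ 2 * l / N +
        ∑ a ∈ dat N l, ∑ b ∈ dat N l, ∑ c ∈ dat N l, ∑ e ∈ dat N l,
          (1 / ((N + l - 1 : ℕ) : ℝ)) ^ 2 * cum4 μ (lin μ X φ) a b c e) :=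
    RegO.of_error (by positivity) hc fun N l hR =>
      h.abs_var_qf_sub_le (by positivity) h2 h4 hR.one_le_len hR.two_mul_le
  have t2 : RegO c 4 fun N l => (l : ℝ) / N - l / ((N + l - 1 : ℕ) : ℝ) := by
    refine RegO.of_le zero_le_one hc (i := 2) (j := 2) (by norm_num) fun N l hR => ?_
    have hl := hR.one_le_len
    have hN := hR.one_le_num
    have hn : ((N + l - 1 : ℕ) : ℝ) = N + (l - 1) := by
      rw [Nat.cast_sub (by omega)]
      push_cast
      ring
    have hl' : (1 : ℝ) ≤ l := by exact_mod_cast hl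
    have hN' : (1 : ℝ) ≤ N := by exact_mod_cast hN
    rw [hn, div_sub_div _ _ (by positivity) (by positivity), one_mul,
      show (l : ℝ) * (N + (l - 1)) - N * l = l * (l - 1) by ring,
      abs_of_nonneg (div_nonneg (mul_nonneg (by positivity) (by linarith))
        (mul_nonneg (by positivity) (by linarith)))]
    exact div_le_div₀ (by positivity) (by nlinarith) (by positivity) (by nlinarith)
  have u : RegO c 4 fun N l => ∫ ω, qf N l (lin μ X φ) (lin μ X φ) ω ∂μ - (s - b / l) :=
    RegO.of_inv_le (by positivity) fun N l hR =>
      h.abs_integral_qf_sub_le h2 hR.one_le_len hR.one_le_num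
  have v : RegO c 1 fun _ l => 1 / (l : ℝ) := RegO.of_inv_le zero_le_one fun N l hR => by
    rw [abs_of_nonneg (by positivity), pow_one]
  have t5 : RegO c (4 + 1) fun N l => ∫ ω, qf N l (lin μ X φ) (lin μ X φ) ω *
        mf N l (lin μ X φ) ω ^ 2 ∂μ -
      (∫ ω, qf N l (lin μ X φ) (lin μ X φ) ω ∂μ) * ∫ ω, mf N l (lin μ X φ) ω ^ 2 ∂μ :=
    RegO.of_le (K := 2 * (K * decSum ^ 3) + 2 * (K * decSum) ^ 2) (by positivity) hc (i := 1)
      (j := 2) (by norm_num) fun N l hR => by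
      rw [pow_one]
      exact h.abs_cov_qf_mf_sq_le (by positivity) h2 h4 hR.one_le_len (hle hR)
  have m2 := h.regO_integral_mf_pow hc φ le_rfl (by norm_num)
  have m4 := h.regO_integral_mf_pow hc φ one_le_two (by norm_num)
  have t9 : RegO c 4 fun N l =>
      ∫ ω, qf N l (lin μ X φ) (lin μ X φ) ω * mf N l (lin μ X τ) ω ∂μ -
      ∑ a ∈ dat N l, ∑ b ∈ dat N l, ∑ c ∈ dat N l,
        (1 / ((N + l - 1 : ℕ) : ℝ)) ^ 2 * mom3 μ X φ φ τ a b c := by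
    refine RegO.of_error (K := 4 * (K * decSum ^ 2)) (by positivity) hc fun N l hR => ?_
    rw [h.integral_qf_mul_mf]
    refine (h3.abs_ker_sum_sub_le (by positivity) hR.one_le_len (hle hR)).trans ?_
    have : (l : ℝ) ≤ (l : ℝ) ^ 2 :=
      le_self_pow₀ (by exact_mod_cast hR.one_le_len) two_ne_zero
    gcongr
  have t10 : RegO c (5 + 1) fun N l => ∫ ω, mf N l (lin μ X φ) ω ^ 2 * mf N l (lin μ X τ) ω ∂μ :=
    RegO.of_le (K := 2 * (K * decSum ^ 2)) (by positivity) hc (i := 0) (j := 2) (by norm_num)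
      fun N l hR => by
        simpa [pow_two (mf N l (lin μ X φ) _), div_eq_mul_inv] using
          h.abs_integral_mf_mul_mul_le (by positivity) h3 hR.one_le_len (hle hR)
  refine (((((((((((t1.add (t2.const_mul (4 / 3 * s ^ 2))).add ((u.mul u).mono (by norm_num))).add
    (((u.mul v).mono (by norm_num)).const_mul (-2 * b))).sub (t5.len_mul.const_mul 2)).sub
    ((((u.mul m2).mono (by norm_num : 4 + 1 ≤ 4 + 3 * 1)).len_mul).const_mul 2)).add
    (((h.regO_integral_mf_sq_sub hc φ).mono (by norm_num)).const_mul (2 * b))).add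
    (m4.len_mul (k := 5)).len_mul).add (t9.const_mul 2)).sub
    ((t10.len_mul.mono (by norm_num)).const_mul 2)).add
    ((h.regO_integral_mf_sq_sub hc τ).mono (by norm_num)))).congr fun N l hR => ?_
  have hv : (l : ℝ) * (1 / l) = 1 := mul_one_div_cancel (by have := hR.one_le_len; positivity)
  have e : ∀ ω, cq μ X N l φ φ ω = qf N l (lin μ X φ) (lin μ X φ) ω -
      l * mf N l (lin μ X φ) ω ^ 2 := fun ω => by rw [cq, pow_two]
  simp only [e, pooled]
  rw [Growth.integral_sub_sub_sq h (h.growth_qf φ φ) ((h.growth_mf φ).pow 2),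
    Growth.integral_sub_sub_mul h (h.growth_qf φ φ) ((h.growth_mf φ).pow 2) (h.growth_mf τ)
      (h.integral_mf τ)]
  simp only [← pow_mul, mul_one, ← hb_def, (by norm_num : 2 * 2 = 4)]
  linear_combination (2 * b * ∫ ω, mf N l (lin μ X φ) ω ^ 2 ∂μ) * hv

end Regular

end KeyIntegrals

section ErrorExpansion

variable {μ : Measure Ω} {X : ℤ → Ω → Fin d → ℝ} {H : (Fin d → ℝ) → ℝ} {r : ℕ} {q C c : ℝ}

lemma L2Le.integral_add_sq {g T W R : Ω → ℝ} {s t u v : ℝ} (hg : L2Le μ g s) (hT : L2Le μ T t)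
    (hW : L2Le μ W u) (hR : L2Le μ R v) : ∫ ω, (g ω + T ω + W ω + R ω) ^ 2 ∂μ =
      ∫ ω, g ω ^ 2 ∂μ + 2 * ∫ ω, g ω * T ω ∂μ + ∫ ω, T ω ^ 2 ∂μ +
        (2 * ∫ ω, g ω * W ω ∂μ + 2 * ∫ ω, T ω * W ω ∂μ + ∫ ω, W ω * W ω ∂μ +
          2 * ∫ ω, (g ω + T ω + W ω) * R ω ∂μ + ∫ ω, R ω * R ω ∂μ) := by
  rw [integral_eq_sum_mul ![1, 2, 1, 2, 2, 1, 2, 1] ![fun ω => g ω ^ 2, fun ω => g ω * T ω,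
    fun ω => T ω ^ 2, fun ω => g ω * W ω, fun ω => T ω * W ω, fun ω => W ω * W ω,
    fun ω => (g ω + T ω + W ω) * R ω, fun ω => R ω * R ω]]
  · simp only [Fin.sum_univ_eight, Matrix.cons_val]
    ring
  · intro i
    fin_cases i
    exacts [hg.int, hg.integrable_mul hT, hT.int, hg.integrable_mul hW, hT.integrable_mul hW,
      hW.integrable_mul hW, ((hg.add hT).add hW).integrable_mul hR, hR.integrable_mul hR]
  · intro ω
    simp only [Fin.sum_univ_eight, Matrix.cons_val]
    ring

lemma mf_lin_sum {ι : Type*} [Fintype ι] (N l : ℕ) (s : ι → ℝ)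
    (χ : ι → LinForm d) (ω : Ω) :
    mf N l (lin μ X (∑ i, s i • χ i)) ω = ∑ i, s i * mf N l (lin μ X (χ i)) ω := by
  simp only [mf, lin, _root_.sum_apply, ContinuousLinearMap.smul_apply, smul_eq_mul,
    Finset.mul_sum]
  rw [Finset.sum_comm]
  refine Finset.sum_congr rfl fun i _ => Finset.sum_congr rfl fun a _ => ?_
  ring

variable [IsProbabilityMeasure μ]

lemma Regular.regO_integral_sq_sub {ι : Type*} [Fintype ι] (h : Regular μ X r q C) (hc : 1 ≤ c)
    (φ : LinForm d) (χ ψ : ι → LinForm d) {R : ℕ → ℕ → Ω → ℝ} {E : ℝ}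
    (hE : 0 ≤ E) (hRem : ∀ N l, Regime c N l → L2Le μ (R N l) (E / √(l : ℝ) ^ 6)) :
    RegO c 4 fun N l =>
      ∫ ω, (cq μ X N l φ φ ω - ∑' a, ccov μ X φ φ a +
        ∑ i, mf N l (lin μ X (χ i)) ω * cq μ X N l φ (ψ i) ω + R N l ω) ^ 2 ∂μ -
      (∫ ω, (cq μ X N l φ φ ω - ∑' a, ccov μ X φ φ a) ^ 2 ∂μ +
        2 * ∫ ω, (cq μ X N l φ φ ω - ∑' a, ccov μ X φ φ a) *
          mf N l (lin μ X (∑ i, (∑' a, ccov μ X φ (ψ i) a) • χ i)) ω ∂μ +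
        ∫ ω, mf N l (lin μ X (∑ i, (∑' a, ccov μ X φ (ψ i) a) • χ i)) ω ^ 2 ∂μ) := by
  set s := fun i => ∑' a, ccov μ X φ (ψ i) a with hs
  set τ := ∑ i, s i • χ i with hτ
  have hsum : ∀ i, ‖χ i‖ + ‖ψ i‖ ≤ ∑ i, (‖χ i‖ + ‖ψ i‖) := fun i =>
    Finset.single_le_sum (f := fun i => ‖χ i‖ + ‖ψ i‖) (fun i _ => by positivity)
      (Finset.mem_univ i)
  obtain ⟨B, hφ, hτB, hχ, hψ⟩ :
      ∃ B, ‖φ‖ ≤ B ∧ ‖τ‖ ≤ B ∧ (∀ i, ‖χ i‖ ≤ B) ∧ ∀ i, ‖ψ i‖ ≤ B :=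
    ⟨max (max ‖φ‖ ‖τ‖) (∑ i, (‖χ i‖ + ‖ψ i‖)), by simp, by simp,
      fun i => le_max_of_le_right (by linarith [hsum i, norm_nonneg (ψ i)]),
      fun i => le_max_of_le_right (by linarith [hsum i, norm_nonneg (χ i)])⟩
  obtain ⟨D, hD, hS⟩ := h.exists_nonneg_sizes B hc
  set W : ℕ → ℕ → Ω → ℝ := fun N l ω =>
    ∑ i, mf N l (lin μ X (χ i)) ω * (cq μ X N l φ (ψ i) ω - s i) with hW_def
  have hT := fun N l hR => (hS N l hR).mf τ hτB
  have hg := fun N l hR => (hS N l hR).cq_sub hR hφ hφ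
  have hV := fun i N l hR => (hS N l hR).mf_mul_cq hR (hχ i) hφ (hψ i)
  have hW : ∀ N l, Regime c N l → L2Le μ (W N l)
      ((Fintype.card ι : ℝ) * (2 * D) / √(l : ℝ) ^ 4) := fun N l hR => by
    rw [mul_div_assoc]
    exact L2Le.sum fun i _ => hV i N l hR
  have hD2 : 0 ≤ 2 * D := by positivity
  have hDW : 0 ≤ (Fintype.card ι : ℝ) * (2 * D) := by positivity
  have hgTW : ∀ N l, Regime c N l → L2Le μ (fun ω => cq μ X N l φ φ ω - ∑' a, ccov μ X φ φ a +
      mf N l (lin μ X τ) ω + W N l ω)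
      ((2 * D + D + (Fintype.card ι : ℝ) * (2 * D)) / √(l : ℝ) ^ 2) := fun N l hR => by
    refine (((hg N l hR).add (hT N l hR)).add (hW N l hR)).mono ?_
    rw [add_div, add_div]
    exact add_le_add (add_le_add le_rfl (hR.div_sqrt_pow_le hD le_rfl (by norm_num)))
      (hR.div_sqrt_pow_le hDW le_rfl (by norm_num))
  have t1 := RegO.sum (S := Finset.univ) fun i _ =>
    h.regO_integral_cq_mul_mf_mul_cq (φ := φ) (ψ := φ) (φ' := φ) (ψ' := ψ i) (χ := χ i) hc
  have t2 := RegO.sum (S := Finset.univ) fun i _ => RegO.of_integral_mul (k := 4) hD hD2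
    (by norm_num) (fun N l hR => (hS N l hR).mf_mul τ (χ i) hτB (hχ i))
    (fun N l hR => (hS N l hR).cq_sub hR hφ (hψ i))
  have t3 := RegO.of_integral_mul (k := 4) hDW hDW (by norm_num) hW hW
  have t4 := RegO.of_integral_mul (k := 4) (by positivity) hE (by norm_num) hgTW hRem
  have t5 := (RegO.of_integral_mul (k := 6) hE hE (by norm_num) hRem hRem).mono
    (by norm_num : 4 ≤ 6)
  refine (((((t1.const_mul 2).add (t2.const_mul 2)).add t3).add (t4.const_mul 2)).add
    t5).congr fun N l hR => ?_
  have e : ∀ ω, cq μ X N l φ φ ω - ∑' a, ccov μ X φ φ a +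
      ∑ i, mf N l (lin μ X (χ i)) ω * cq μ X N l φ (ψ i) ω + R N l ω =
      cq μ X N l φ φ ω - ∑' a, ccov μ X φ φ a + mf N l (lin μ X τ) ω + W N l ω + R N l ω :=
    fun ω => by
      have : ∑ i, mf N l (lin μ X (χ i)) ω * cq μ X N l φ (ψ i) ω =
          mf N l (lin μ X τ) ω + W N l ω := by
        rw [hτ, mf_lin_sum, hW_def, ← Finset.sum_add_distrib]
        exact Finset.sum_congr rfl fun i _ => by ring
      linarith
  simp only [e]
  rw [(hg N l hR).integral_add_sq (hT N l hR) (hW N l hR) (hRem N l hR), add_sub_cancel_left]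
  congr 4
  · rw [← integral_finsetSum _ fun (i : ι) _ => (hg N l hR).integrable_mul (hV i N l hR)]
    simp only [hW_def, Finset.mul_sum]
    rfl
  · rw [← integral_finsetSum _ fun (i : ι) _ =>
      ((hS N l hR).mf_mul τ (χ i) hτB (hχ i)).integrable_mul ((hS N l hR).cq_sub hR hφ (hψ i))]
    simp only [hW_def, Finset.mul_sum, ← mul_assoc]
    rfl

/-- Expansion of the mean squared error of the block bootstrap variance estimator. -/
theorem CondD.exists_regO_MSEfun {a₀ : ℕ} (hD : CondD H a₀)
    (h : Regular μ X (6 + 2 * a₀) q C) (hc : 1 ≤ c) :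
    ∃ p : ℕ → ℝ, RegO c 4 fun N l =>
      MSEfun μ X H (N + l - 1) l - fapprox μ X H (N + l - 1) l - p (N + l - 1) := by
  obtain ⟨E, hE, hRem⟩ := hD.exists_remainder_size h hc
  set φ := fderiv ℝ H (meanVec μ X) with hφ
  set η := fun p => hessRow H (meanVec μ X) p
  set π : Fin d → LinForm d := fun p => coordProj p
  have hs : sigInfSq μ X H = ∑' a, ccov μ X φ φ a := by simp only [sigInfSq, h.rcov_eq]; rfl
  have hb : B0 μ X H = ∑' a : ℤ, |(a : ℝ)| * ccov μ X φ φ a := by simp only [B0, h.rcov_eq]; rfl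
  have key := h.regO_integral_sq_sub hc φ (Sum.elim π η) (Sum.elim η π) (R := fun N l ω =>
      sigmaHat X H (N + l - 1) l ω - (cq μ X N l φ φ ω + lf μ X H N l ω))
    (zero_le_one.trans hE) fun N l hR => by
      have h1 := hR.one_le_len
      have h2 := hR.one_le_num
      have := hRem (N + l - 1) l (by omega)
      rw [show N + l - 1 - l + 1 = N by omega] at this
      exact this hR
  set τ := ∑ i, (∑' a, ccov μ X φ ((Sum.elim η π : Fin d ⊕ Fin d → _) i) a) •
    (Sum.elim π η : Fin d ⊕ Fin d → _) i
  refine ⟨fun n => pooled μ X φ τ (Finset.Icc 1 (n : ℤ)) (1 / (n : ℝ)),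
    (key.add (h.regO_leading hc φ τ)).congr fun N l hR => ?_⟩
  have hdat : Finset.Icc 1 ((N + l - 1 : ℕ) : ℤ) = dat N l := by
    rw [dat, Nat.cast_sub (by have := hR.one_le_len; omega)]
    push_cast
    rfl
  have e : MSEfun μ X H (N + l - 1) l = ∫ ω, (cq μ X N l φ φ ω - ∑' a, ccov μ X φ φ a +
        ∑ i, mf N l (lin μ X ((Sum.elim π η : Fin d ⊕ Fin d → _) i)) ω *
          cq μ X N l φ ((Sum.elim η π : Fin d ⊕ Fin d → _) i) ω +
        (sigmaHat X H (N + l - 1) l ω - (cq μ X N l φ φ ω + lf μ X H N l ω))) ^ 2 ∂μ := by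
    rw [MSEfun, hs]
    refine integral_congr_ae (ae_of_all _ fun ω => ?_)
    simp only [lf, Fintype.sum_sum_type, Finset.sum_add_distrib, Sum.elim_inl, Sum.elim_inr]
    ring
  beta_reduce
  rw [e, fapprox, V0, hs, hb, hdat]
  ring

end ErrorExpansion

section Argmin

/-- Near-minimality of `x` against `m` in `a / y ^ 2 + 2 * a * y / x₀ ^ 3`, whose minimizer is
`x₀`, bounds the distance from `x` to `x₀`. -/
lemma sq_sub_le_of_near_min {a x₀ x m κ D : ℝ} (ha : 0 < a) (h0 : 0 < x₀) (hx : x₀ ≤ κ * x)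
    (hx' : x ≤ κ * x₀) (hm : x₀ ≤ m) (hm' : m ≤ x₀ + 1) (hκ : 0 < κ) (hD : 0 ≤ D)
    (h : a / x ^ 2 + 2 * a * x / x₀ ^ 3 ≤
      a / m ^ 2 + 2 * a * m / x₀ ^ 3 + D / x ^ 4 + D / m ^ 4) :
    (x - x₀) ^ 2 ≤ κ ^ 2 * (3 * a + D * (κ ^ 4 + 1)) / a := by
  have hx0 : 0 < x := pos_of_mul_pos_right (h0.trans_le hx) hκ.le
  have hm0 : 0 < m := h0.trans_le hm
  have ex : ∀ y : ℝ, 0 < y → a / y ^ 2 + 2 * a * y / x₀ ^ 3 =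
      3 * a / x₀ ^ 2 + a * (y - x₀) ^ 2 * (x₀ + 2 * y) / (x₀ ^ 3 * y ^ 2) := fun y hy => by
    field_simp
    ring
  rw [ex x hx0, ex m hm0] at h
  have h1 : a * (x - x₀) ^ 2 / (κ ^ 2 * x₀ ^ 4) ≤
      a * (x - x₀) ^ 2 * (x₀ + 2 * x) / (x₀ ^ 3 * x ^ 2) := by
    calc _ = a * (x - x₀) ^ 2 * x₀ / (x₀ ^ 3 * (κ * x₀) ^ 2) := by field_simp
      _ ≤ _ := by
        gcongr
        linarith
  have h2 : a * (m - x₀) ^ 2 * (x₀ + 2 * m) / (x₀ ^ 3 * m ^ 2) ≤ 3 * a / x₀ ^ 4 := by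
    calc _ ≤ a * 1 ^ 2 * (m + 2 * m) / (x₀ ^ 3 * m ^ 2) := by
          have : 0 ≤ m - x₀ := by linarith
          gcongr
          linarith
      _ = 3 * a / (x₀ ^ 3 * m) := by field_simp; ring
      _ ≤ 3 * a / (x₀ ^ 3 * x₀) := by gcongr
      _ = _ := by ring
  have h3 : D / x ^ 4 ≤ D * κ ^ 4 / x₀ ^ 4 := by
    calc D / x ^ 4 = D * κ ^ 4 / (κ * x) ^ 4 := by field_simp
      _ ≤ _ := by gcongr
  have h4 : D / m ^ 4 ≤ D / x₀ ^ 4 := by gcongr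
  have h5 : a * (x - x₀) ^ 2 / (κ ^ 2 * x₀ ^ 4) ≤ (3 * a + D * (κ ^ 4 + 1)) / x₀ ^ 4 := by
    have : (3 * a + D * (κ ^ 4 + 1)) / x₀ ^ 4 =
      3 * a / x₀ ^ 4 + D * κ ^ 4 / x₀ ^ 4 + D / x₀ ^ 4 := by ring
    linarith
  rw [div_le_div_iff₀ (by positivity) (by positivity)] at h5
  rw [le_div_iff₀ ha]
  refine le_of_mul_le_mul_right ?_ (pow_pos h0 4)
  linarith

lemma regime_of_mem_Jset {K : ℝ} {n l : ℕ} (hK : 0 < K) (hn : 3 * K ≤ ((n : ℝ) ^ ((1 : ℝ) / 3)) ^ 2)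
    (h : l ∈ Jset K n) : Regime (2 * K ^ 3 + 1) (n - l + 1) l ∧ n - l + 1 + l - 1 = n := by
  rw [Jset, Finset.mem_filter, Finset.mem_Icc] at h
  obtain ⟨⟨h1, h2⟩, -, h3⟩ := h
  have ht : (0 : ℝ) ≤ (n : ℝ) ^ ((1 : ℝ) / 3) := by positivity
  have ht3 : ((n : ℝ) ^ ((1 : ℝ) / 3)) ^ 3 = n := by
    rw [← Real.rpow_mul_natCast (by positivity)]
    norm_num
  set t := (n : ℝ) ^ ((1 : ℝ) / 3)
  have h4 : (3 * l : ℝ) ≤ n := by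
    have := mul_le_mul_of_nonneg_right hn ht
    rw [← ht3]
    linarith
  have h5 : 3 * l ≤ n := by exact_mod_cast h4
  refine ⟨⟨by linarith [pow_pos hK 3], h1, by omega, ?_⟩, by omega⟩
  have h6 : (l : ℝ) ^ 3 ≤ K ^ 3 * n := by
    rw [← ht3, ← mul_pow]
    gcongr
  have h7 : (n : ℝ) ≤ 2 * (n - l + 1 : ℕ) := by exact_mod_cast (by omega : n ≤ 2 * (n - l + 1))
  have := mul_le_mul_of_nonneg_left h7 (pow_pos hK 3).le
  have h8 : (0 : ℝ) ≤ (n - l + 1 : ℕ) := by positivity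
  linarith

end Argmin

theorem statement_1 {Ω : Type*} [MeasurableSpace Ω] {d a₀ : ℕ}
    (μ : Measure Ω) [IsProbabilityMeasure μ]
    (X : ℤ → Ω → Fin d → ℝ) (H : (Fin d → ℝ) → ℝ)
    (hmeas : ∀ i, Measurable (X i))
    (hstat : IsStationary μ X)
    (hD : CondD H a₀)
    (hM : CondM μ X (6 + 2 * a₀))
    (hS : CondS μ X H)
    (hσ : SigLimit μ X H)
    (K : ℝ) (hK : 0 < K ∧ K⁻¹ < C0 μ X H ∧ C0 μ X H < K)
    (ℓopt : ℕ → ℕ)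
    (hopt : ∀ n, (Jset K n).Nonempty → IsArgminOn (MSEfun μ X H n) (Jset K n) (ℓopt n))
 :
    ∃ C : ℝ, 0 < C ∧ ∀ᶠ n : ℕ in atTop,
      |(ℓopt n : ℝ) - C0 μ X H * (n : ℝ) ^ ((1 : ℝ) / 3)| /
          (C0 μ X H * (n : ℝ) ^ ((1 : ℝ) / 3))
        ≤ C * (n : ℝ) ^ (-(1 : ℝ) / 3) := by
  obtain ⟨hK0, hK1, hK2⟩ := hK
  obtain ⟨hB, hV⟩ := hS
  obtain ⟨q, C, hR⟩ := hM.exists_regular hmeas hstat (by omega)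
  obtain ⟨p, D, hD0, hp⟩ := hD.exists_regO_MSEfun hR
    (show (1 : ℝ) ≤ 2 * K ^ 3 + 1 by linarith [pow_pos hK0 3])
  have ha : 0 < B0 μ X H ^ 2 := by positivity
  have hC3 : C0 μ X H ^ 3 = 2 * B0 μ X H ^ 2 / V0 μ X H := by
    rw [C0, ← Real.rpow_mul_natCast (by positivity)]
    norm_num
  have hC : 0 < C0 μ X H := (inv_pos.2 hK0).trans hK1
  set a := B0 μ X H ^ 2 with hadef
  set c₀ := C0 μ X H with hcdef
  set E := (K ^ 2) ^ 2 * (3 * a + D * ((K ^ 2) ^ 4 + 1)) / a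
  refine ⟨(√E + 1) / c₀, by positivity, ?_⟩
  have hlim : Tendsto (fun n : ℕ => (n : ℝ) ^ ((1 : ℝ) / 3)) atTop atTop :=
    (tendsto_rpow_atTop (by norm_num)).comp tendsto_natCast_atTop_atTop
  filter_upwards [hlim.eventually_ge_atTop (3 * K), hlim.eventually_ge_atTop 1,
    hlim.eventually_ge_atTop (1 / (K - c₀))] with n hn1 hn2 hn3
  have ht3 : ((n : ℝ) ^ ((1 : ℝ) / 3)) ^ 3 = n := by
    rw [← Real.rpow_mul_natCast (by positivity)]
    norm_num
  have hneg : (n : ℝ) ^ (-(1 : ℝ) / 3) = ((n : ℝ) ^ ((1 : ℝ) / 3))⁻¹ := by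
    rw [← Real.rpow_neg (by positivity), neg_div]
  have hJ : ∀ l, l ∈ Jset K n ↔ (1 ≤ l ∧ l ≤ n) ∧ K⁻¹ * (n : ℝ) ^ ((1 : ℝ) / 3) ≤ (l : ℝ) ∧
      (l : ℝ) ≤ K * (n : ℝ) ^ ((1 : ℝ) / 3) := fun l => by
    rw [Jset, Finset.mem_filter, Finset.mem_Icc]
  have hmse := fun l (hl : l ∈ Jset K n) => by
    obtain ⟨h1, h2⟩ := regime_of_mem_Jset hK0
      (hn1.trans (le_self_pow₀ hn2 (by norm_num))) hl
    have := hp _ _ h1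
    simp only [h2] at this
    exact abs_le.1 this
  rw [hneg]
  set t := (n : ℝ) ^ ((1 : ℝ) / 3)
  have ht : 0 < t := by linarith
  have hx0 : 0 < c₀ * t := by positivity
  have hf : ∀ l : ℕ, fapprox μ X H n l = a / (l : ℝ) ^ 2 + 2 * a * l / (c₀ * t) ^ 3 := fun l => by
    rw [fapprox, mul_pow, hC3, ht3, ← hadef]
    have : (n : ℝ) ≠ 0 := by rw [← ht3]; positivity
    field_simp
  have hm1 := Nat.le_ceil (c₀ * t)
  have hm2 := (Nat.ceil_lt_add_one hx0.le).le
  have hmJ : ⌈c₀ * t⌉₊ ∈ Jset K n := by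
    have h1 : (⌈c₀ * t⌉₊ : ℝ) ≤ K * t := by
      rw [div_le_iff₀ (by linarith)] at hn3
      linarith
    refine (hJ _).2 ⟨⟨Nat.ceil_pos.2 hx0, ?_⟩, ?_, h1⟩
    · have : K * t ≤ t ^ 3 := by
        have h2 : K ≤ t ^ 2 := by nlinarith
        calc K * t ≤ t ^ 2 * t := by gcongr
          _ = _ := by ring
      exact_mod_cast h1.trans (this.trans_eq ht3)
    · exact le_trans (by gcongr) hm1
  obtain ⟨hl, hmin⟩ := hopt n ⟨_, hmJ⟩
  have hE := sq_sub_le_of_near_min (x := ℓopt n) (κ := K ^ 2) (D := D) ha hx0 (by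
      have h1 := mul_le_mul_of_nonneg_left ((hJ _).1 hl).2.1 (sq_nonneg K)
      refine le_trans ?_ h1
      rw [← mul_assoc, sq, mul_assoc K K, mul_inv_cancel₀ hK0.ne', mul_one]
      gcongr) (by
      refine ((hJ _).1 hl).2.2.trans ?_
      have : 1 ≤ K * c₀ := by
        rw [← mul_inv_cancel₀ hK0.ne']
        gcongr
      have h2 := mul_le_mul_of_nonneg_left this (mul_pos hK0 ht).le
      linarith) hm1 hm2 (by positivity) hD0 (by
      have h1 := (hmse _ hl).1
      have h2 := (hmse _ hmJ).2
      have h3 := hmin _ hmJ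
      rw [← hf, ← hf]
      linarith)
  rw [div_le_iff₀ hx0]
  calc |(ℓopt n : ℝ) - c₀ * t| ≤ √E := Real.abs_le_sqrt hE
    _ ≤ √E + 1 := by linarith
    _ = _ := by field_simp

end BlockLength
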